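/- Let (u_p)_{p>1} be a family of low energy nodal solutions of (P_p) and fix ϱ ∈ (0, ϱ₀/2]. Then for any given small δ > 0 and i = 1,2: ∫_{B_{ϱ/ε_{i,p}}(0)} |1 + v_{i,p}(z)/p|^p dz = 8π − 24π/p + O(1/p^{2−δ}), ∫_{B_{ϱ/ε_{i,p}}(0)} log|z| · |1 + v_{i,p}(z)/p|^p dz = 12π log 2 + O(1/p), and ∫_{B_{ϱ/ε_{i,p}}(0)} |1 + v_{i,p}(z)/p|^{p+1} dz = 8π − 40π/p + O(1/p^{2−δ}). -/

import Mathlib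

open Real MeasureTheory Metric Filter Topology Bornology

noncomputable section

abbrev E2 : Type := EuclideanSpace ℝ (Fin 2)

/-- Laplacian of `u : ℝ² → ℝ` via coordinate second derivatives. -/
def lap (u : E2 → ℝ) (x : E2) : ℝ :=
  ∑ i : Fin 2,
    fderiv ℝ (fun y => fderiv ℝ u y (EuclideanSpace.single i 1)) x (EuclideanSpace.single i 1)

/-- `u` is a (classical) solution of the Lane–Emden problem `(P_p)` on `Ω`. -/
def IsSolution (Ω : Set E2) (p : ℝ) (u : E2 → ℝ) : Prop :=
  ContDiffOn ℝ 2 u Ω ∧ ContinuousOn u (closure Ω) ∧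
    (∀ x ∈ Ω, -lap u x = |u x| ^ (p - 1) * u x) ∧
    (∀ x ∈ frontier Ω, u x = 0)

/-- `u` is a nodal (sign-changing) function on `Ω`. -/
def IsNodal (Ω : Set E2) (u : E2 → ℝ) : Prop :=
  (∃ x ∈ Ω, 0 < u x) ∧ (∃ x ∈ Ω, u x < 0)

/-- The Green function of `-Δ` on `Ω` with Dirichlet boundary conditions, together with
its regular part `H`, so that `G(x,y) = -(1/2π) log|x-y| + H(x,y)`. -/
structure GreenData (Ω : Set E2) where
  G : E2 → E2 → ℝ
  H : E2 → E2 → ℝ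
  decomp : ∀ x y, G x y = -(1 / (2 * π)) * Real.log ‖x - y‖ + H x y
  bdry : ∀ x ∈ Ω, ∀ y ∈ frontier Ω, G x y = 0
  symm : ∀ x y, G x y = G y x
  smoothH : ContDiffOn ℝ (⊤ : ℕ∞) (fun q : E2 × E2 => H q.1 q.2) (Ω ×ˢ Ω)
  contH : ∀ x ∈ Ω, ContinuousOn (H x) (closure Ω)
  harmH : ∀ x ∈ Ω, ∀ y ∈ Ω, lap (H x) y = 0

/-- The Kirchhoff–Routh type function `Ψ(a₁,a₂) = 2G(a₁,a₂) − R(a₁) − R(a₂)`. -/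
def KR {Ω : Set E2} (gd : GreenData Ω) (q : E2 × E2) : ℝ :=
  2 * gd.G q.1 q.2 - gd.H q.1 q.1 - gd.H q.2 q.2

/-- `q` is a non-degenerate critical point of `F`. -/
def NondegCrit (F : E2 × E2 → ℝ) (q : E2 × E2) : Prop :=
  fderiv ℝ F q = 0 ∧
    ∀ v : E2 × E2, (∀ w : E2 × E2, fderiv ℝ (fun r => fderiv ℝ F r) q v w = 0) → v = 0

/-- Convergence in `C²_loc(S)`: uniform convergence of all derivatives of order `≤ 2`
on compact subsets of `S`. -/
def TendstoC2LocOn (S : Set E2) (F : ℕ → E2 → ℝ) (g : E2 → ℝ) : Prop :=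
  ∀ K : Set E2, K ⊆ S → IsCompact K → ∀ k : ℕ, k ≤ 2 →
    TendstoUniformlyOn (fun n x => iteratedFDeriv ℝ k (F n) x)
      (fun x => iteratedFDeriv ℝ k g x) atTop K

/-- `‖u⁺‖_∞` on `closure Ω`. -/
def supPos (Ω : Set E2) (u : E2 → ℝ) : ℝ := sSup ((fun x => max (u x) 0) '' closure Ω)

/-- `‖u⁻‖_∞` on `closure Ω`. -/
def supNeg (Ω : Set E2) (u : E2 → ℝ) : ℝ := sSup ((fun x => max (-u x) 0) '' closure Ω)

/-- The energy functional `J_p`. -/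
def energy (Ω : Set E2) (p : ℝ) (u : E2 → ℝ) : ℝ :=
  (1 / 2) * (∫ x in Ω, ‖fderiv ℝ u x‖ ^ 2) - (1 / (p + 1)) * ∫ x in Ω, |u x| ^ (p + 1)

/-- The standard bubble `U(z) = −2 log(1 + |z|²/8)`. -/
def Ustd (z : E2) : ℝ := -2 * Real.log (1 + ‖z‖ ^ 2 / 8)

/-- Unit vector at angle `θ`. -/
def circDir (θ : ℝ) : E2 :=
  EuclideanSpace.single 0 (Real.cos θ) + EuclideanSpace.single 1 (Real.sin θ)

/-- Surface integral over the circle `∂B_r(c)`; the integrand may depend on the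
outer unit normal (first argument) and on the point (second argument). -/
def surfInt (c : E2) (r : ℝ) (F : E2 → E2 → ℝ) : ℝ :=
  ∫ θ in (0:ℝ)..(2 * π), r * F (circDir θ) (c + r • circDir θ)

/-- Inner product of gradients `⟨∇f, ∇g⟩`. -/
def gradInner (f g : E2 → ℝ) (x : E2) : ℝ :=
  ∑ j : Fin 2, fderiv ℝ f x (EuclideanSpace.single j 1) *
    fderiv ℝ g x (EuclideanSpace.single j 1)

/-- The quadratic form `P_i` (centred at `c`, radius `r`). -/
def Pform (c : E2) (r : ℝ) (f g : E2 → ℝ) : ℝ :=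
  -2 * r * surfInt c r (fun ν x => fderiv ℝ f x ν * fderiv ℝ g x ν) +
    r * surfInt c r (fun _ x => gradInner f g x)

/-- The quadratic form `Q_{ij}` (centred at `c`, radius `r`). -/
def Qform (c : E2) (r : ℝ) (j : Fin 2) (f g : E2 → ℝ) : ℝ :=
  surfInt c r (fun ν x =>
    -(fderiv ℝ f x (EuclideanSpace.single j 1)) * fderiv ℝ g x ν -
      fderiv ℝ f x ν * fderiv ℝ g x (EuclideanSpace.single j 1) +
      gradInner f g x * ν j)


noncomputable section

/-- complex `∂_z` derivative -/
def dz (g : ℂ → ℂ) (z : ℂ) : ℂ := (fderiv ℝ g z 1 - Complex.I * fderiv ℝ g z Complex.I) / 2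

/-- complex `∂_{z̄}` derivative -/
def db (g : ℂ → ℂ) (z : ℂ) : ℂ := (fderiv ℝ g z 1 + Complex.I * fderiv ℝ g z Complex.I) / 2

lemma fderiv_eq_dz_db (g : ℂ → ℂ) (z e : ℂ) :
    fderiv ℝ g z e = dz g z * e + db g z * (starRingEnd ℂ) e := by
  have h : e = e.re • (1:ℂ) + e.im • Complex.I := by
    simp [Complex.re_add_im]
  have h2 : fderiv ℝ g z e = e.re • fderiv ℝ g z 1 + e.im • fderiv ℝ g z Complex.I := by
    conv_lhs => rw [h]
    rw [map_add, map_smul, map_smul]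
  rw [h2]
  have h3 : (starRingEnd ℂ) e = (e.re : ℂ) - e.im * Complex.I := by
    apply Complex.ext <;> simp
  have h4 : e = (e.re : ℂ) + e.im * Complex.I := (Complex.re_add_im e).symm
  rw [h3]
  conv_rhs => rw [h4]
  simp only [dz, db, Complex.add_re, Complex.add_im, Complex.ofReal_re, Complex.ofReal_im,
    Complex.mul_re, Complex.mul_im, Complex.I_re, Complex.I_im, Complex.real_smul]
  ring_nf
  simp only [Complex.I_sq]
  ring_nf

lemma db_polar (g : ℂ → ℂ) (z e : ℂ) :
    db g z * (starRingEnd ℂ) e = (fderiv ℝ g z e + Complex.I * fderiv ℝ g z (Complex.I * e)) / 2 := by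
  rw [fderiv_eq_dz_db g z e, fderiv_eq_dz_db g z (Complex.I * e)]
  simp only [map_mul, Complex.conj_I]
  ring_nf
  simp only [Complex.I_sq]
  ring_nf

/-- unit vector -/
def cis (θ : ℝ) : ℂ := Complex.exp (θ * Complex.I)

lemma cis_hasDeriv (θ : ℝ) : HasDerivAt cis (Complex.I * cis θ) θ := by
  unfold cis
  have h1 : HasDerivAt (fun t : ℝ => (t : ℂ) * Complex.I) Complex.I θ := by
    simpa using (Complex.ofRealCLM.hasDerivAt (x := θ)).mul_const Complex.I
  simpa [mul_comm] using h1.cexp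

lemma cis_cont : Continuous cis := by unfold cis; fun_prop

lemma cis_norm (θ : ℝ) : ‖cis θ‖ = 1 := by simp [cis, Complex.norm_exp_ofReal_mul_I]

lemma cis_ne (θ : ℝ) : cis θ ≠ 0 := Complex.exp_ne_zero _

lemma cis_conj (θ : ℝ) : (starRingEnd ℂ) (cis θ) = (cis θ)⁻¹ := by
  rw [Complex.inv_def, Complex.normSq_eq_norm_sq, cis_norm]; simp

lemma polar_integrable (H : ℝ × ℝ → ℂ) (hH : Continuous H) (S : ℝ) (hS : ∀ q : ℝ × ℝ, S < q.1 → H q = 0) :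
    IntegrableOn H (Set.Ioi 0 ×ˢ Set.Ioo (-π) π) := by
  have h1 : IntegrableOn H (Set.Icc 0 S ×ˢ Set.Icc (-π) π) :=
    hH.continuousOn.integrableOn_compact (isCompact_Icc.prod isCompact_Icc)
  refine h1.of_forall_sdiff_eq_zero ?_ ?_
  · exact (measurableSet_Ioi.prod measurableSet_Ioo)
  · rintro ⟨r, t⟩ ⟨⟨h2, h3⟩, h4⟩
    apply hS
    by_contra hc
    simp only [not_lt] at hc
    exact h4 ⟨⟨le_of_lt h2, hc⟩, ⟨h3.1.le, h3.2.le⟩⟩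

lemma pompeiu_zero (g : ℂ → ℂ) (hg : ContDiff ℝ 1 g) (hc : HasCompactSupport g) :
    ∫ y, db g y / y = - π * g 0 := by
  obtain ⟨S, hS⟩ : ∃ S : ℝ, ∀ y : ℂ, S < ‖y‖ → g y = 0 ∧ fderiv ℝ g y = 0 := by
    obtain ⟨S, hS⟩ := hc.isCompact.isBounded.exists_norm_le
    refine ⟨S, fun y hy => ?_⟩
    have : y ∉ tsupport g := fun h => absurd (hS y h) (not_le.mpr hy)
    refine ⟨image_eq_zero_of_notMem_tsupport this, ?_⟩
    exact image_eq_zero_of_notMem_tsupport (fun h => this (tsupport_fderiv_subset ℝ h))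
  have hcf : Continuous (fderiv ℝ g) := hg.continuous_fderiv (by norm_num)
  have hdiff : Differentiable ℝ g := hg.differentiable (by norm_num)
  set H1 : ℝ × ℝ → ℂ := fun q => fderiv ℝ g (q.1 * cis q.2) (cis q.2) with hH1
  set H2 : ℝ × ℝ → ℂ := fun q => fderiv ℝ g (q.1 * cis q.2) (Complex.I * cis q.2) with hH2
  have cc : Continuous (fun q : ℝ × ℝ => cis q.2) := cis_cont.comp continuous_snd
  have cp : Continuous (fun q : ℝ × ℝ => (q.1 : ℂ) * cis q.2) :=
    (Complex.continuous_ofReal.comp continuous_fst).mul cc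
  have hS0 : ∀ q : ℝ × ℝ, max S 0 < q.1 → fderiv ℝ g (q.1 * cis q.2) = 0 := by
    intro q hq
    refine (hS _ ?_).2
    rw [norm_mul, cis_norm, Complex.norm_real, mul_one]
    exact lt_of_lt_of_le (lt_of_le_of_lt (le_max_left _ _) hq) (le_abs_self _)
  have i1 := polar_integrable H1 ((hcf.comp cp).clm_apply cc) (max S 0)
    (fun q hq => by simp [hH1, hS0 q hq])
  have i2 := polar_integrable H2 ((hcf.comp cp).clm_apply (continuous_const.mul cc)) (max S 0)
    (fun q hq => by simp [hH2, hS0 q hq])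
  rw [← Complex.integral_comp_polarCoord_symm, polarCoord_target]
  have e1 : ∫ q in Set.Ioi (0:ℝ) ×ˢ Set.Ioo (-π) π, q.1 • (db g (Complex.polarCoord.symm q) / Complex.polarCoord.symm q)
      = ∫ q in Set.Ioi (0:ℝ) ×ˢ Set.Ioo (-π) π, (H1 q / 2 + Complex.I * (H2 q / 2)) := by
    apply setIntegral_congr_fun (measurableSet_Ioi.prod measurableSet_Ioo)
    rintro ⟨r, t⟩ ⟨hr, ht⟩
    have hr' : (r:ℂ) ≠ 0 := by
      simp only [Set.mem_Ioi] at hr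
      exact_mod_cast hr.ne'
    have hs : Complex.polarCoord.symm (r, t) = r * cis t := by
      rw [Complex.polarCoord_symm_apply, cis, Complex.exp_mul_I]
      simp
    simp only [hs, hH1, hH2]
    have := db_polar g (r * cis t) (cis t)
    rw [cis_conj] at this
    have h5 : r • (db g (↑r * cis t) / (↑r * cis t)) = db g (↑r * cis t) * (cis t)⁻¹ := by
      rw [Complex.real_smul]
      field_simp
    rw [h5, this]; ring
  rw [e1, integral_add (i1.div_const 2) ((i2.div_const 2).const_mul _)]
  rw [integral_const_mul, integral_div, integral_div]
  have r2 : ∫ q in Set.Ioi (0:ℝ) ×ˢ Set.Ioo (-π) π, H2 q = 0 := by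
    rw [Measure.volume_eq_prod] at i2 ⊢
    rw [setIntegral_prod _ i2]
    apply setIntegral_eq_zero_of_forall_eq_zero
    intro r hr
    have hr' : (r:ℂ) ≠ 0 := by
      simp only [Set.mem_Ioi] at hr
      exact_mod_cast hr.ne'
    rw [← integral_Ioc_eq_integral_Ioo, ← intervalIntegral.integral_of_le (by linarith [pi_pos])]
    have : ∫ t in (-π)..π, (r:ℂ) * H2 (r, t) = g (r * cis π) - g (r * cis (-π)) := by
      apply intervalIntegral.integral_eq_sub_of_hasDerivAt (f := fun t => g (r * cis t))
      · intro t _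
        have h1 := (hdiff (r * cis t)).hasFDerivAt.comp_hasDerivAt t ((cis_hasDeriv t).const_mul (r:ℂ))
        have h2 : (r:ℂ) * H2 (r, t) = fderiv ℝ g (r * cis t) ((r:ℂ) * (Complex.I * cis t)) := by
          change (r:ℂ) * fderiv ℝ g (r*cis t) (Complex.I*cis t) = _
          rw [← Complex.real_smul (x:=r) (z:=Complex.I*cis t), map_smul, Complex.real_smul]
        rw [h2]
        exact h1
      · apply Continuous.intervalIntegrable
        have : Continuous (fun t : ℝ => (r, t)) := by fun_prop
        exact continuous_const.mul (((hcf.comp cp).clm_apply (continuous_const.mul cc)).comp this)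
    have e : cis π = cis (-π) := by
      simp [cis, Complex.exp_neg]
    rw [e, sub_self, intervalIntegral.integral_const_mul] at this
    exact (mul_eq_zero.mp this).resolve_left hr'
  have r1 : ∫ q in Set.Ioi (0:ℝ) ×ˢ Set.Ioo (-π) π, H1 q = - (2 * π) * g 0 := by
    rw [Measure.volume_eq_prod] at i1 ⊢
    rw [← setIntegral_prod_swap]
    rw [setIntegral_prod (fun z : ℝ × ℝ => H1 z.swap) i1.swap]
    have : ∀ t ∈ Set.Ioo (-π) π, ∫ r in Set.Ioi (0:ℝ), H1 (Prod.swap (t, r)) = - g 0 := by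
      intro t _
      have hd : ∀ r : ℝ, HasDerivAt (fun r : ℝ => g (r * cis t)) (H1 (r, t)) r := by
        intro r
        have h0 : HasDerivAt (fun r : ℝ => (r:ℂ) * cis t) (cis t) r := by
          simpa using (Complex.ofRealCLM.hasDerivAt (x := r)).mul_const (cis t)
        exact (hdiff (r * cis t)).hasFDerivAt.comp_hasDerivAt r h0
      have := integral_Ioi_of_hasDerivAt_of_tendsto' (a := (0:ℝ)) (m := (0:ℂ)) (fun r _ => hd r) ?_ ?_
      · simpa using this
      · have h1 : IntegrableOn (fun r => H1 (r, t)) (Set.Icc 0 (max S 0)) := by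
          apply Continuous.integrableOn_Icc
          have : Continuous (fun r : ℝ => (r, t)) := by fun_prop
          exact (((hcf.comp cp).clm_apply cc)).comp this
        refine h1.of_forall_sdiff_eq_zero measurableSet_Ioi ?_
        rintro r ⟨h2, h4⟩
        have : max S 0 < r := by
          by_contra hc
          exact h4 ⟨le_of_lt h2, not_lt.mp hc⟩
        simp [hH1, hS0 (r, t) this]
      · apply tendsto_const_nhds.congr'
        filter_upwards [eventually_gt_atTop (max S 0)] with r hr
        refine ((hS _ ?_).1).symm
        rw [norm_mul, cis_norm, Complex.norm_real, mul_one]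
        exact lt_of_lt_of_le (lt_of_le_of_lt (le_max_left _ _) hr) (le_abs_self _)
    rw [setIntegral_congr_fun measurableSet_Ioo this]
    simp [Complex.real_smul]
    have : (max (π + π) 0 : ℝ) = 2 * π := by rw [max_eq_left (by linarith [pi_pos])]; ring
    simp [two_mul, pi_pos.le]
  rw [r1, r2]; ring

lemma fderiv_comp_const_add (g : ℂ → ℂ) (z y : ℂ) :
    fderiv ℝ (fun ζ => g (z + ζ)) y = fderiv ℝ g (z + y) := by
  exact fderiv_comp_add_left z

/-- Cauchy–Pompeiu formula. -/
lemma pompeiu (g : ℂ → ℂ) (hg : ContDiff ℝ 1 g) (hc : HasCompactSupport g) (z : ℂ) :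
    ∫ y, db g y / (z - y) = π * g z := by
  have h1 : ContDiff ℝ 1 (fun ζ => g (z + ζ)) := hg.comp (by fun_prop)
  have h2 : HasCompactSupport (fun ζ => g (z + ζ)) :=
    hc.comp_homeomorph (Homeomorph.addLeft z)
  have := pompeiu_zero _ h1 h2
  have h3 : ∀ y, db (fun ζ => g (z + ζ)) y = db g (z + y) := by
    intro y; simp only [db, fderiv_comp_const_add]
  simp only [h3, add_zero] at this
  have h4 : ∫ y, db g y / (z - y) = ∫ y, db g (z + y) / (z - (z + y)) :=
    (integral_add_left_eq_self (μ := volume) (fun y => db g y / (z - y)) z).symm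
  rw [h4]
  have h5 : ∀ y, db g (z + y) / (z - (z + y)) = - (db g (z + y) / y) := by
    intro y
    rw [sub_add_cancel_left, div_neg]
  simp only [h5]
  rw [integral_neg, this]; ring
end

noncomputable section

/-- the real-linear map `e ↦ a e + b ē` -/
def wL (a b : ℂ) : ℂ →L[ℝ] ℂ :=
  a • (ContinuousLinearMap.id ℝ ℂ) + b • (Complex.conjCLE : ℂ →L[ℝ] ℂ)

@[simp] lemma wL_apply (a b e : ℂ) : wL a b e = a * e + b * (starRingEnd ℂ) e := by
  simp [wL]

/-- Wirtinger derivatives -/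
def HasW (g : ℂ → ℂ) (a b z : ℂ) : Prop := HasFDerivAt (𝕜 := ℝ) g (wL a b) z

lemma HasW.mk' {g : ℂ → ℂ} {a b z : ℂ} {L : ℂ →L[ℝ] ℂ} (h : HasFDerivAt g L z)
    (hL : ∀ e, L e = a * e + b * (starRingEnd ℂ) e) : HasW g a b z := by
  have h1 : L = wL a b := by
    apply ContinuousLinearMap.ext
    intro e
    rw [hL, wL_apply]
  rw [h1] at h
  exact h

lemma HasW.dz_eq {g : ℂ → ℂ} {a b z : ℂ} (h : HasW g a b z) : dz g z = a := by
  unfold dz; rw [HasFDerivAt.fderiv h]; simp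
  linear_combination (-1/2 : ℂ) * (a - b) * Complex.I_sq

lemma HasW.db_eq {g : ℂ → ℂ} {a b z : ℂ} (h : HasW g a b z) : db g z = b := by
  unfold db; rw [HasFDerivAt.fderiv h]; simp
  linear_combination (1/2 : ℂ) * (a - b) * Complex.I_sq

lemma hasW_of_differentiableAt {g : ℂ → ℂ} {z : ℂ} (h : DifferentiableAt ℝ g z) :
    HasW g (dz g z) (db g z) z := by
  unfold HasW
  have : wL (dz g z) (db g z) = fderiv ℝ g z := by
    ext1 <;> simp [fderiv_eq_dz_db g z]
  rw [this]; exact h.hasFDerivAt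

lemma HasW.differentiableAt {g : ℂ → ℂ} {a b z : ℂ} (h : HasW g a b z) : DifferentiableAt ℝ g z :=
  HasFDerivAt.differentiableAt h

lemma HasW.continuousAt {g : ℂ → ℂ} {a b z : ℂ} (h : HasW g a b z) : ContinuousAt g z :=
  HasFDerivAt.continuousAt h

lemma HasW.add {g k : ℂ → ℂ} {a b c d z : ℂ} (h : HasW g a b z) (h' : HasW k c d z) :
    HasW (fun y => g y + k y) (a + c) (b + d) z := by
  exact HasW.mk' (HasFDerivAt.add h h') (fun e => by simp; ring)

lemma HasW.const_mul {g : ℂ → ℂ} {a b z : ℂ} (c : ℂ) (h : HasW g a b z) :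
    HasW (fun y => c * g y) (c * a) (c * b) z := by
  exact HasW.mk' (HasFDerivAt.const_mul h c) (fun e => by simp; ring)

lemma HasW.neg {g : ℂ → ℂ} {a b z : ℂ} (h : HasW g a b z) :
    HasW (fun y => - g y) (-a) (-b) z := by
  simpa using h.const_mul (-1)

lemma HasW.sub {g k : ℂ → ℂ} {a b c d z : ℂ} (h : HasW g a b z) (h' : HasW k c d z) :
    HasW (fun y => g y - k y) (a - c) (b - d) z := by
  simpa [sub_eq_add_neg] using h.add h'.neg

lemma HasW.mul {g k : ℂ → ℂ} {a b c d z : ℂ} (h : HasW g a b z) (h' : HasW k c d z) :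
    HasW (fun y => g y * k y) (a * k z + g z * c) (b * k z + g z * d) z := by
  exact HasW.mk' (HasFDerivAt.mul h h') (fun e => by simp; ring)

lemma HasW.conj {g : ℂ → ℂ} {a b z : ℂ} (h : HasW g a b z) :
    HasW (fun y => (starRingEnd ℂ) (g y)) ((starRingEnd ℂ) b) ((starRingEnd ℂ) a) z := by
  exact HasW.mk' ((Complex.conjCLE : ℂ →L[ℝ] ℂ).hasFDerivAt.comp z h) (fun e => by simp; ring)

lemma HasW.congr_ev {g k : ℂ → ℂ} {a b z : ℂ} (h : HasW g a b z) (h' : k =ᶠ[𝓝 z] g) :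
    HasW k a b z := HasFDerivAt.congr_of_eventuallyEq h h'

lemma hasW_const (c z : ℂ) : HasW (fun _ => c) 0 0 z := by
  exact HasW.mk' (hasFDerivAt_const (𝕜 := ℝ) c z) (fun e => by simp)

lemma hasW_id (z : ℂ) : HasW (fun y => y) 1 0 z := by
  exact HasW.mk' (hasFDerivAt_id (𝕜 := ℝ) z) (fun e => by simp)

lemma hasW_of_hasDerivAt {h : ℂ → ℂ} {h' z : ℂ} (hh : HasDerivAt h h' z) : HasW h h' 0 z := by
  exact HasW.mk' (hh.hasFDerivAt.restrictScalars ℝ) (fun e => by simp [mul_comm])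

lemma HasW.hasDerivAt {h : ℂ → ℂ} {a z : ℂ} (hh : HasW h a 0 z) : HasDerivAt h a z := by
  rw [hasDerivAt_iff_isLittleO]
  have := HasFDerivAt.isLittleO hh
  simpa [mul_comm] using this

/-- along a line -/
lemma HasW.line {g : ℂ → ℂ} {a b x e : ℂ} {t : ℝ} (h : HasW g a b (x + t * e)) :
    HasDerivAt (fun s : ℝ => g (x + s * e)) (a * e + b * (starRingEnd ℂ) e) t := by
  have h0 : HasDerivAt (fun r : ℝ => x + (r:ℂ) * e) e t := by
    simpa using ((Complex.ofRealCLM.hasDerivAt (x := t)).mul_const e).const_add x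
  have h1 : HasFDerivAt g (wL a b) (x + t * e) := h
  have h2 := h1.comp_hasDerivAt t h0
  rw [wL_apply] at h2
  exact h2

/-- derivative of a real function: `v_z = a` -/
def HasR (v : ℂ → ℝ) (a z : ℂ) : Prop := HasW (fun y => (v y : ℂ)) a ((starRingEnd ℂ) a) z

lemma HasR.of_differentiableAt {v : ℂ → ℝ} {z : ℂ} (h : DifferentiableAt ℝ v z) :
    HasR v (dz (fun y => (v y : ℂ)) z) z := by
  have h1 : HasFDerivAt (𝕜 := ℝ) (fun y => (v y : ℂ)) (Complex.ofRealCLM.comp (fderiv ℝ v z)) z :=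
    Complex.ofRealCLM.hasFDerivAt.comp z h.hasFDerivAt
  have h2 := hasW_of_differentiableAt h1.differentiableAt
  unfold HasR
  convert h2 using 1
  unfold dz db
  rw [h1.fderiv]
  simp [Complex.conj_ofNat]

lemma HasR.hasFDerivAt {v : ℂ → ℝ} {a z : ℂ} (h : HasR v a z) :
    HasFDerivAt v (Complex.reCLM.comp (wL a ((starRingEnd ℂ) a))) z := by
  have := Complex.reCLM.hasFDerivAt.comp z h
  exact this

lemma HasR.comp {v : ℂ → ℝ} {a z : ℂ} (h : HasR v a z) {φ : ℝ → ℝ} {φ' : ℝ}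
    (hφ : HasDerivAt φ φ' (v z)) : HasR (fun y => φ (v y)) (φ' * a) z := by
  have h1 := (hφ.comp_hasFDerivAt z h.hasFDerivAt)
  have h2 := Complex.ofRealCLM.hasFDerivAt.comp z h1
  refine HasW.mk' h2 (fun e => ?_)
  apply Complex.ext <;> simp <;> ring

lemma HasR.line {v : ℂ → ℝ} {a x e : ℂ} {t : ℝ} (h : HasR v a (x + t * e)) :
    HasDerivAt (fun s : ℝ => v (x + s * e)) (2 * (a * e).re) t := by
  have h0 : HasDerivAt (fun r : ℝ => x + (r:ℂ) * e) e t := by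
    simpa using ((Complex.ofRealCLM.hasDerivAt (x := t)).mul_const e).const_add x
  have := h.hasFDerivAt.comp_hasDerivAt t h0
  have h3 : (Complex.reCLM.comp (wL a ((starRingEnd ℂ) a))) e = 2 * (a * e).re := by
    simp; ring
  rw [h3] at this
  exact this

lemma HasR.continuousAt {v : ℂ → ℝ} {a z : ℂ} (h : HasR v a z) : ContinuousAt v z :=
  h.hasFDerivAt.continuousAt

/-- Cauchy transform -/
def CT (g : ℂ → ℂ) (z : ℂ) : ℂ := ∫ y, g y / (z - y)

lemma locInt_inv : LocallyIntegrable (fun y : ℂ => y⁻¹) := by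
  apply locallyIntegrable_of_norm_le_rpow (C := 1) (α := 1)
  · simp
  · filter_upwards with y
    rw [Real.rpow_neg_one]; simp
  · exact (measurable_inv).aestronglyMeasurable
  · simp

open scoped Convolution in
lemma CT_eq_conv (g : ℂ → ℂ) : CT g = (fun y : ℂ => y⁻¹) ⋆[ContinuousLinearMap.mul ℝ ℂ, volume] g := by
  ext z
  unfold CT
  rw [convolution_def]
  rw [← integral_sub_left_eq_self _ _ z]
  apply integral_congr_ae
  filter_upwards with y
  simp [div_eq_mul_inv, mul_comm]

lemma CT_hasW (g : ℂ → ℂ) (hg : ContDiff ℝ 1 g) (hc : HasCompactSupport g) (z : ℂ) :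
    HasW (CT g) (CT (dz g) z) (π * g z) z := by
  have h1 := hc.hasFDerivAt_convolution_right (ContinuousLinearMap.mul ℝ ℂ) locInt_inv hg z
  rw [← CT_eq_conv] at h1
  have hcf : HasCompactSupport (fderiv ℝ g) := hc.fderiv ℝ
  have hcont : Continuous (fderiv ℝ g) := hg.continuous_fderiv (by norm_num)
  have key : ∀ e : ℂ, fderiv ℝ (CT g) z e = CT (fun y => fderiv ℝ g y e) z := by
    intro e
    rw [h1.fderiv, CT_eq_conv, convolution_def, convolution_def]
    have hi := hcf.convolutionExists_right ((ContinuousLinearMap.mul ℝ ℂ).precompR ℂ) locInt_inv hcont z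
    rw [ContinuousLinearMap.integral_apply hi]
    rfl
  have h2 := hasW_of_differentiableAt h1.differentiableAt
  have hIntg : ∀ e : ℂ, Integrable (fun y => fderiv ℝ g y e / (z - y)) := by
    intro e
    have hc1 : HasCompactSupport (fun y => fderiv ℝ g y e) := hcf.mono (fun y hy h => hy (by simp [h]))
    have hcont1 : Continuous (fun y => fderiv ℝ g y e) := hcont.clm_apply continuous_const
    have hi := hc1.convolutionExists_right (ContinuousLinearMap.mul ℝ ℂ) locInt_inv hcont1 z
    unfold ConvolutionExistsAt at hi
    rw [← integrable_comp_sub_left _ z] at hi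
    refine hi.congr ?_
    filter_upwards with y
    simp [div_eq_mul_inv, mul_comm]
  have h3 : dz (CT g) z = CT (dz g) z := by
    unfold dz
    rw [key, key]
    unfold CT
    rw [← integral_const_mul, ← integral_sub (hIntg _) ((hIntg _).const_mul _), ← integral_div]
    congr 1; ext y; ring
  have h4 : db (CT g) z = CT (db g) z := by
    unfold db
    rw [key, key]
    unfold CT
    rw [← integral_const_mul, ← integral_add (hIntg _) ((hIntg _).const_mul _), ← integral_div]
    congr 1; ext y; ring
  rw [h3, h4] at h2
  have h5 := pompeiu g hg hc z
  unfold CT at h2 ⊢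
  rwa [h5] at h2

lemma CT_integrable (g : ℂ → ℂ) (hg : Continuous g) (hc : HasCompactSupport g) (z : ℂ) :
    Integrable (fun y => g y / (z - y)) := by
  have hi := hc.convolutionExists_right (ContinuousLinearMap.mul ℝ ℂ) locInt_inv hg z
  unfold ConvolutionExistsAt at hi
  rw [← integrable_comp_sub_left _ z] at hi
  refine hi.congr ?_
  filter_upwards with y
  simp [div_eq_mul_inv, mul_comm]

lemma dz_contDiff {g : ℂ → ℂ} {n : ℕ} (hg : ContDiff ℝ (n+1) g) : ContDiff ℝ n (dz g) := by
  have h1 : ContDiff ℝ n (fderiv ℝ g) := hg.fderiv_right (by norm_cast)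
  unfold dz
  fun_prop

lemma dz_compact {g : ℂ → ℂ} (hc : HasCompactSupport g) : HasCompactSupport (dz g) := by
  have hcf : HasCompactSupport (fderiv ℝ g) := hc.fderiv ℝ
  exact hcf.mono (fun y hy h => hy (by simp [dz, h]))

lemma db_contDiff {g : ℂ → ℂ} {n : ℕ} (hg : ContDiff ℝ (n+1) g) : ContDiff ℝ n (db g) := by
  have h1 : ContDiff ℝ n (fderiv ℝ g) := hg.fderiv_right (by norm_cast)
  unfold db
  fun_prop

lemma db_compact {g : ℂ → ℂ} (hc : HasCompactSupport g) : HasCompactSupport (db g) := by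
  have hcf : HasCompactSupport (fderiv ℝ g) := hc.fderiv ℝ
  exact hcf.mono (fun y hy h => hy (by simp [db, h]))

end

noncomputable section

lemma integral_fderiv_zero (g : ℂ → ℂ) (hg : ContDiff ℝ 1 g) (hc : HasCompactSupport g) (e : ℂ) :
    ∫ y, fderiv ℝ g y e = 0 := by
  have hcont : Continuous (fderiv ℝ g) := hg.continuous_fderiv (by norm_num)
  have hcf : HasCompactSupport (fderiv ℝ g) := hc.fderiv ℝ
  have hcont1 : Continuous (fun y => fderiv ℝ g y e) := hcont.clm_apply continuous_const
  have hc1 : HasCompactSupport (fun y => fderiv ℝ g y e) := hcf.mono (fun y hy h => hy (by simp [h]))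
  have hi := hcont1.integrable_of_hasCompactSupport hc1 (μ := volume)
  have := integral_mul_fderiv_eq_neg_fderiv_mul_of_integrable (μ := (volume : Measure ℂ)) (f := fun _ : ℂ => (1:ℂ)) (g := g) (v := e)
    (by simp) (by simpa using hi)
    (by simpa using hg.continuous.integrable_of_hasCompactSupport hc)
    (fun x _ => by fun_prop) (fun x _ => (hg.differentiable (by norm_num)) x)
  simpa using this

lemma integral_dz_zero (g : ℂ → ℂ) (hg : ContDiff ℝ 1 g) (hc : HasCompactSupport g) :
    ∫ y, dz g y = 0 := by
  have hcont : Continuous (fderiv ℝ g) := hg.continuous_fderiv (by norm_num)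
  have hcf : HasCompactSupport (fderiv ℝ g) := hc.fderiv ℝ
  have hi : ∀ e, Integrable (fun y => fderiv ℝ g y e) := by
    intro e
    have hcont1 : Continuous (fun y => fderiv ℝ g y e) := hcont.clm_apply continuous_const
    have hc1 : HasCompactSupport (fun y => fderiv ℝ g y e) := hcf.mono (fun y hy h => hy (by simp [h]))
    exact hcont1.integrable_of_hasCompactSupport hc1 (μ := volume)
  unfold dz
  rw [integral_div, integral_sub (hi _) ((hi _).const_mul _), integral_const_mul,
    integral_fderiv_zero g hg hc, integral_fderiv_zero g hg hc]
  simp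

lemma integral_db_zero (g : ℂ → ℂ) (hg : ContDiff ℝ 1 g) (hc : HasCompactSupport g) :
    ∫ y, db g y = 0 := by
  have hcont : Continuous (fderiv ℝ g) := hg.continuous_fderiv (by norm_num)
  have hcf : HasCompactSupport (fderiv ℝ g) := hc.fderiv ℝ
  have hi : ∀ e, Integrable (fun y => fderiv ℝ g y e) := by
    intro e
    have hcont1 : Continuous (fun y => fderiv ℝ g y e) := hcont.clm_apply continuous_const
    have hc1 : HasCompactSupport (fun y => fderiv ℝ g y e) := hcf.mono (fun y hy h => hy (by simp [h]))
    exact hcont1.integrable_of_hasCompactSupport hc1 (μ := volume)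
  unfold db
  rw [integral_div, integral_add (hi _) ((hi _).const_mul _), integral_const_mul,
    integral_fderiv_zero g hg hc, integral_fderiv_zero g hg hc]
  simp

lemma radial_integral (F : ℝ → ℝ) : ∫ z : ℂ, F ‖z‖ = 2 * π * ∫ r in Set.Ioi (0:ℝ), r * F r := by
  rw [integral_fun_norm_addHaar volume F]
  simp [Measure.real, Complex.volume_ball]
  ring

lemma radial_integrable {F : ℝ → ℝ} :
    Integrable (fun z : ℂ => F ‖z‖) ↔ IntegrableOn (fun r => r * F r) (Set.Ioi 0) := by
  rw [integrable_fun_norm_addHaar volume (f := F)]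
  simp

/-- truncated kernel -/
def kerT (s : ℝ) (y : ℂ) : ℝ := (ball (0:ℂ) s).indicator (fun y => ‖y‖⁻¹) y

lemma kerT_eq (s : ℝ) (y : ℂ) : kerT s y = (Set.Iio s).indicator (fun r => r⁻¹) ‖y‖ := by
  simp [kerT, Set.indicator]

lemma kerT_nonneg (s : ℝ) (y : ℂ) : 0 ≤ kerT s y := by
  unfold kerT; apply Set.indicator_nonneg; intro y _; positivity

lemma kerT_aux (s : ℝ) : Set.EqOn (fun r => r * (Set.Iio s).indicator (fun r => r⁻¹) r)
    ((Set.Iio s).indicator (fun _ => (1:ℝ))) (Set.Ioi 0) := by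
  intro r hr
  have : r ≠ 0 := (ne_of_gt hr)
  by_cases h : r < s <;> simp [h, this]

lemma kerT_integrable (s : ℝ) : Integrable (kerT s) := by
  have : kerT s = fun y => (Set.Iio s).indicator (fun r => r⁻¹) ‖y‖ := by ext y; exact kerT_eq s y
  rw [this, radial_integrable, integrableOn_congr_fun (kerT_aux s) measurableSet_Ioi,
    IntegrableOn, integrable_indicator_iff measurableSet_Iio, IntegrableOn, Measure.restrict_restrict measurableSet_Iio]
  rw [Set.Iio_inter_Ioi]
  simp

lemma kerT_integral {s : ℝ} (hs : 0 ≤ s) : ∫ y, kerT s y = 2 * π * s := by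
  simp_rw [kerT_eq]
  rw [radial_integral, setIntegral_congr_fun measurableSet_Ioi (kerT_aux s),
    setIntegral_indicator measurableSet_Iio, Set.Ioi_inter_Iio]
  simp [hs]

lemma inv_le_kerT {s : ℝ} (hs : 0 < s) (y : ℂ) : ‖y‖⁻¹ ≤ kerT s y + s⁻¹ := by
  by_cases h : ‖y‖ < s
  · have : kerT s y = ‖y‖⁻¹ := by simp [kerT, h]
    rw [this]; have := inv_pos.mpr hs; linarith
  · have := kerT_nonneg s y
    have h2 : ‖y‖⁻¹ ≤ s⁻¹ := inv_anti₀ hs (not_lt.mp h)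
    linarith

lemma kern_pt {ρ : ℂ → ℝ} (h0 : ∀ y, 0 ≤ ρ y) (h1 : ∀ y, ρ y ≤ 1) (z y : ℂ) :
    ρ y / ‖z - y‖ ≤ kerT 1 (z - y) + ρ y := by
  have := inv_le_kerT one_pos (z - y)
  rw [div_eq_mul_inv]
  have h2 := kerT_nonneg 1 (z - y)
  calc ρ y * ‖z - y‖⁻¹ ≤ ρ y * (kerT 1 (z-y) + 1⁻¹) := mul_le_mul_of_nonneg_left this (h0 y)
    _ = ρ y * kerT 1 (z - y) + ρ y := by ring
    _ ≤ 1 * kerT 1 (z - y) + ρ y := by gcongr; exact h1 y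
    _ = _ := by ring

lemma kern_integrable {ρ : ℂ → ℝ} (hm : Integrable ρ) (h0 : ∀ y, 0 ≤ ρ y) (h1 : ∀ y, ρ y ≤ 1) (z : ℂ) :
    Integrable (fun y => ρ y / ‖z - y‖) := by
  refine (((kerT_integrable 1).comp_sub_left z).add hm).mono' ?_ ?_
  · have : AEStronglyMeasurable (fun y : ℂ => ‖z - y‖) volume := by fun_prop
    exact hm.aestronglyMeasurable.div₀ this
  · filter_upwards with y
    rw [Real.norm_of_nonneg (div_nonneg (h0 y) (norm_nonneg _))]
    exact kern_pt h0 h1 z y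

lemma kern_le {ρ : ℂ → ℝ} (hm : Integrable ρ) (h0 : ∀ y, 0 ≤ ρ y) (h1 : ∀ y, ρ y ≤ 1) (z : ℂ) :
    ∫ y, ρ y / ‖z - y‖ ≤ 2 * π + ∫ y, ρ y := by
  have h2 := ((kerT_integrable 1).comp_sub_left z)
  calc _ ≤ ∫ y, (kerT 1 (z - y) + ρ y) :=
        integral_mono (kern_integrable hm h0 h1 z) (h2.add hm) (fun y => kern_pt h0 h1 z y)
    _ = _ := by
        rw [integral_add h2 hm, integral_sub_left_eq_self (kerT 1) volume z, kerT_integral zero_le_one]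
        ring

lemma int_w (r : ℝ) (hr : 2 < r) : Integrable (fun y : ℂ => (1 + ‖y‖) ^ (-r)) := by
  apply integrable_one_add_norm
  simpa using hr

lemma w_pos (y : ℂ) : 0 < 1 + ‖y‖ := by positivity
lemma w_one (y : ℂ) : 1 ≤ 1 + ‖y‖ := by linarith [norm_nonneg y]

/-- weighted kernel bound -/
lemma w3_pt (z y : ℂ) : (1 + ‖z‖) * ((1 + ‖y‖) ^ (-(3:ℝ)) * ‖z - y‖⁻¹) ≤
    kerT 1 (z - y) + 2 * (1 + ‖y‖) ^ (-(3:ℝ)) + 8 * (1 + ‖z - y‖) ^ (-(3:ℝ)) := by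
  have e : ∀ x : ℝ, x ^ (-(3:ℝ)) = (x ^ 3)⁻¹ := by
    intro x; rw [show (-(3:ℝ)) = ((-3 : ℤ) : ℝ) by norm_num, Real.rpow_intCast, zpow_neg]; norm_cast
  simp only [e]
  set w := 1 + ‖y‖ with hw
  have hw1 : 1 ≤ w := w_one y
  have hw3 : 0 < (w ^ 3)⁻¹ := by positivity
  set t := ‖z - y‖ with ht
  have ht0 : 0 ≤ t := norm_nonneg _
  have hk := kerT_nonneg 1 (z - y)
  rcases ht0.eq_or_lt with h | h
  · rw [← h]; simp only [inv_zero, mul_zero]; positivity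
  have h1 : 1 + ‖z‖ ≤ w + t := by
    have := norm_add_le (z - y) y
    rw [sub_add_cancel] at this; linarith
  have h2 : (1 + ‖z‖) * ((w ^ 3)⁻¹ * t⁻¹) ≤ (w ^ 2)⁻¹ * t⁻¹ + (w ^ 3)⁻¹ := by
    calc _ ≤ (w + t) * ((w ^ 3)⁻¹ * t⁻¹) := by gcongr
      _ = _ := by field_simp
  have h3 : (w ^ 2)⁻¹ * t⁻¹ ≤ kerT 1 (z - y) + (w ^ 3)⁻¹ + 8 * ((1 + t) ^ 3)⁻¹ := by
    have h8 : 0 < ((1 + t) ^ 3)⁻¹ := by positivity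
    by_cases h4 : t < 1
    · have : kerT 1 (z - y) = t⁻¹ := by simp [kerT, ← ht, h4]
      rw [this]
      have : (w ^ 2)⁻¹ * t⁻¹ ≤ 1 * t⁻¹ := by
        gcongr
        exact inv_le_one_of_one_le₀ (one_le_pow₀ hw1)
      linarith
    · push Not at h4
      rcases le_total w t with h5 | h5
      · have : (w ^ 2)⁻¹ * t⁻¹ ≤ (w ^ 2)⁻¹ * w⁻¹ := by gcongr
        have e2 : (w ^ 2)⁻¹ * w⁻¹ = (w ^ 3)⁻¹ := by rw [← mul_inv]; ring
        linarith
      · have : (w ^ 2)⁻¹ * t⁻¹ ≤ (t ^ 2)⁻¹ * t⁻¹ := by gcongr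
        have e2 : (t ^ 2)⁻¹ * t⁻¹ = (t ^ 3)⁻¹ := by rw [← mul_inv]; ring
        have : (t ^ 3)⁻¹ ≤ 8 * ((1 + t) ^ 3)⁻¹ := by
          have : (1 + t) ^ 3 ≤ (2 * t) ^ 3 := by gcongr; linarith
          rw [← div_eq_mul_inv, le_div_iff₀ (by positivity), inv_mul_le_iff₀ (by positivity)]
          nlinarith
        linarith
  linarith

/-- constant -/
def C3 : ℝ := 2 * π + 10 * ∫ y : ℂ, (1 + ‖y‖) ^ (-(3:ℝ))

lemma C3_pos : 0 < C3 := by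
  unfold C3
  have : 0 ≤ ∫ y : ℂ, (1 + ‖y‖) ^ (-(3:ℝ)) := integral_nonneg (fun y => by positivity)
  positivity

lemma w3_integrable (z : ℂ) : Integrable (fun y : ℂ => (1 + ‖y‖) ^ (-(3:ℝ)) * ‖z - y‖⁻¹) := by
  have h3 := int_w 3 (by norm_num)
  refine ((((kerT_integrable 1).comp_sub_left z).add (h3.const_mul 2)).add
    ((h3.comp_sub_left z).const_mul 8)).mono' ?_ ?_
  · apply Measurable.aestronglyMeasurable; fun_prop
  · filter_upwards with y
    rw [Real.norm_of_nonneg (by positivity)]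
    refine le_trans ?_ (w3_pt z y)
    exact le_mul_of_one_le_left (by positivity) (w_one z)

lemma w3_le (z : ℂ) : ∫ y : ℂ, (1 + ‖y‖) ^ (-(3:ℝ)) * ‖z - y‖⁻¹ ≤ C3 / (1 + ‖z‖) := by
  have h3 := int_w 3 (by norm_num)
  rw [le_div_iff₀ (w_pos z), mul_comm, ← integral_const_mul]
  have i1 := (kerT_integrable 1).comp_sub_left z
  have i2 := h3.const_mul 2
  have i3 := (h3.comp_sub_left z).const_mul 8
  have i12 : Integrable (fun x : ℂ => kerT 1 (z - x) + 2 * (1 + ‖x‖) ^ (-(3:ℝ))) := i1.add i2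
  refine (integral_mono ((w3_integrable z).const_mul _) (i12.add i3) (w3_pt z)).trans ?_
  simp only [Pi.add_apply]
  rw [integral_add i12 i3, integral_add i1 i2, integral_const_mul, integral_const_mul,
    integral_sub_left_eq_self (kerT 1) volume z,
    integral_sub_left_eq_self (fun y : ℂ => (1 + ‖y‖) ^ (-(3:ℝ))) volume z, kerT_integral zero_le_one]
  unfold C3; linarith

/-- bound for `CT` of a function with cubic decay -/
lemma CT_le_of_decay {g : ℂ → ℂ} {K : ℝ} (hg : ∀ y, ‖g y‖ ≤ K * (1 + ‖y‖) ^ (-(3:ℝ))) (z : ℂ) :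
    ‖CT g z‖ ≤ K * (C3 / (1 + ‖z‖)) := by
  unfold CT
  have hK : 0 ≤ K := by
    have := (norm_nonneg _).trans (hg 0); simpa using this
  calc _ ≤ ∫ y, K * ((1 + ‖y‖) ^ (-(3:ℝ)) * ‖z - y‖⁻¹) := by
        apply norm_integral_le_of_norm_le ((w3_integrable z).const_mul K)
        filter_upwards with y
        rw [norm_div, div_eq_mul_inv, ← mul_assoc]
        gcongr
        exact hg y
    _ ≤ _ := by
        rw [integral_const_mul]; gcongr; exact w3_le z

lemma CT_le {ρ : ℂ → ℝ} (hm : Integrable ρ) (h0 : ∀ y, 0 ≤ ρ y) (h1 : ∀ y, ρ y ≤ 1) (z : ℂ) :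
    ‖CT (fun y => (ρ y : ℂ)) z‖ ≤ ∫ y, ρ y / ‖z - y‖ := by
  unfold CT
  apply norm_integral_le_of_norm_le (kern_integrable hm h0 h1 z)
  filter_upwards with y
  rw [norm_div, Complex.norm_real, Real.norm_of_nonneg (h0 y)]

end

noncomputable section

lemma abs_log_le (t : ℝ) (ht : 0 ≤ t) : |Real.log t| ≤ t + t⁻¹ := by
  rcases ht.eq_or_lt with h | h
  · rw [← h]; simp
  have h1 := Real.log_le_sub_one_of_pos h
  have h2 := Real.log_le_sub_one_of_pos (inv_pos.mpr h)
  rw [Real.log_inv] at h2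
  have := inv_pos.mpr h
  rw [abs_le]; constructor <;> linarith

lemma log_norm_hasDeriv (c w : ℂ) (t : ℝ) (h : c + t * w ≠ 0) :
    HasDerivAt (fun s : ℝ => Real.log ‖c + s * w‖) ((w / (c + t * w)).re) t := by
  have h0 : HasDerivAt (fun r : ℝ => c + (r:ℂ) * w) w t := by
    simpa using ((Complex.ofRealCLM.hasDerivAt (x := t)).mul_const w).const_add c
  have h1 := h0.norm_sq
  have h2 : ‖c + t * w‖ ^ 2 ≠ 0 := by positivity
  have h3 := (h1.log h2).const_mul (1/2)
  have e : (fun s : ℝ => Real.log ‖c + s * w‖) = fun s : ℝ => 1/2 * Real.log (‖c + s * w‖ ^ 2) := by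
    ext s; rw [Real.log_pow]; push_cast; ring
  rw [e]
  have e2 : 1/2 * (2 * inner ℝ (c + t * w) w / ‖c + t * w‖ ^ 2) = (w / (c + t * w)).re := by
    rw [Complex.inner, Complex.div_re, ← Complex.normSq_eq_norm_sq]
    simp
    ring
  rw [← e2]
  exact h3

lemma line_null (x w : ℂ) : ∀ᵐ y : ℂ, ∀ t : ℝ, x + t * w - y ≠ 0 := by
  have h1 : (volume : Measure ℂ) (Submodule.span ℝ {w} : Set ℂ) = 0 := by
    apply Measure.addHaar_submodule
    intro h
    have h2 := finrank_span_le_card (R := ℝ) ({w} : Set ℂ)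
    rw [h] at h2
    simp at h2
  have h3 : (volume : Measure ℂ) ((fun y => y - x) ⁻¹' (Submodule.span ℝ {w} : Set ℂ)) = 0 := by
    have := measure_preimage_add_right (volume : Measure ℂ) (-x) (Submodule.span ℝ {w} : Set ℂ)
    simp only [← sub_eq_add_neg] at this
    rw [this, h1]
  refine measure_mono_null ?_ h3
  intro y hy
  simp only [Set.mem_compl_iff, Set.mem_ofPred_eq, not_forall, not_not] at hy
  obtain ⟨t, ht⟩ := hy
  simp only [Set.mem_preimage, SetLike.mem_coe]
  rw [Submodule.mem_span_singleton]
  refine ⟨t, ?_⟩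
  rw [Complex.real_smul]
  linear_combination ht

lemma logker_integrable {ρ : ℂ → ℝ} (hρ : Continuous ρ) (hc : HasCompactSupport ρ) (x : ℂ) :
    Integrable (fun y => ρ y * Real.log ‖x - y‖) := by
  have hcc : HasCompactSupport (fun y => (ρ y : ℂ)) := hc.mono (fun y hy h => hy (by simp [h]))
  have h1 := (CT_integrable (fun y => (ρ y : ℂ)) (by fun_prop) hcc x).norm
  have h2 : Integrable (fun y => ρ y * ‖x - y‖) :=
    (by fun_prop : Continuous (fun y => ρ y * ‖x - y‖)).integrable_of_hasCompactSupport
      (hc.mul_right)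
  refine (h1.add h2.norm).mono' ?_ ?_
  · apply Measurable.aestronglyMeasurable
    have := hρ.measurable
    fun_prop
  · filter_upwards with y
    simp only [norm_mul, Pi.add_apply, norm_div, Complex.norm_real, norm_norm]
    have := abs_log_le ‖x - y‖ (norm_nonneg _)
    rw [Real.norm_eq_abs (Real.log _)]
    calc _ ≤ ‖ρ y‖ * (‖x - y‖ + ‖x - y‖⁻¹) := by gcongr
      _ = _ := by ring

lemma CT_line_log {ρ : ℂ → ℝ} (hρ : Continuous ρ) (hc : HasCompactSupport ρ) (x w : ℂ) :
    ∫ t in (0:ℝ)..1, (w * CT (fun y => (ρ y : ℂ)) (x + t * w)).re =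
      ∫ y, ρ y * (Real.log ‖x + w - y‖ - Real.log ‖x - y‖) := by
  have hcc : HasCompactSupport (fun y => (ρ y : ℂ)) := hc.mono (fun y hy h => hy (by simp [h]))
  obtain ⟨K, hK⟩ := hρ.bounded_above_of_compact_support hc
  set K' := max K 1 with hK'
  have hK0 : 0 < K' := lt_of_lt_of_le one_pos (le_max_right _ _)
  have hKb : ∀ y, |ρ y| ≤ K' := fun y => (hK y).trans (le_max_left _ _)
  set F : ℝ → ℂ → ℝ := fun t y => ρ y * (w / (x + t * w - y)).re with hF
  have hmeas : AEStronglyMeasurable (Function.uncurry F) ((volume.restrict (Set.Ioc (0:ℝ) 1)).prod volume) := by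
    apply Measurable.aestronglyMeasurable
    have := hρ.measurable
    simp only [hF, Function.uncurry_def]
    apply Measurable.mul
    · fun_prop
    · apply Complex.measurable_re.comp
      apply Measurable.div <;> fun_prop
  have hsl : ∀ t : ℝ, Integrable (F t) := by
    intro t
    have := ((CT_integrable _ (by fun_prop) hcc (x + t * w)).const_mul w).re
    refine this.congr ?_
    filter_upwards with y
    simp only [hF, RCLike.re_eq_complex_re]
    rw [show w * ((ρ y : ℂ) / (x + t * w - y)) = (ρ y : ℂ) * (w / (x + t * w - y)) by ring,
      Complex.re_ofReal_mul]
  have hρi : Integrable ρ := hρ.integrable_of_hasCompactSupport hc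
  have hbd : ∀ t : ℝ, ∫ y, ‖F t y‖ ≤ ‖w‖ * K' * (2 * π + ∫ y, |ρ y| / K') := by
    intro t
    have h1 : Integrable (fun y => |ρ y| / K') := hρi.norm.div_const K'
    have h2 := kern_le h1 (fun y => by positivity) (fun y => (div_le_one hK0).mpr (hKb y)) (x + t * w)
    have h3 := kern_integrable h1 (fun y => by positivity) (fun y => (div_le_one hK0).mpr (hKb y)) (x + t * w)
    calc _ ≤ ∫ y, ‖w‖ * K' * (|ρ y| / K' / ‖x + t * w - y‖) := by
          apply integral_mono (hsl t).norm (h3.const_mul _)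
          intro y
          simp only [hF, norm_mul, Real.norm_eq_abs]
          have := Complex.abs_re_le_norm (w / (x + t * w - y))
          rw [norm_div] at this
          calc _ ≤ |ρ y| * (‖w‖ / ‖x + t * w - y‖) := by gcongr
            _ = _ := by field_simp
      _ ≤ _ := by rw [integral_const_mul]; gcongr
  have hIntg : Integrable (Function.uncurry F) ((volume.restrict (Set.Ioc (0:ℝ) 1)).prod volume) := by
    rw [integrable_prod_iff hmeas]
    refine ⟨Eventually.of_forall (fun t => hsl t), ?_⟩
    refine (integrable_const (‖w‖ * K' * (2 * π + ∫ y, |ρ y| / K'))).mono' ?_ ?_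
    · exact hmeas.norm.integral_prod_right'
    · filter_upwards with t
      rw [Real.norm_of_nonneg (integral_nonneg (fun y => norm_nonneg _))]
      exact hbd t
  have h1 : ∀ t : ℝ, (w * CT (fun y => (ρ y : ℂ)) (x + t * w)).re = ∫ y, F t y := by
    intro t
    unfold CT
    rw [← integral_const_mul]
    have := integral_re ((CT_integrable _ (by fun_prop : Continuous (fun y => (ρ y : ℂ))) hcc (x + t * w)).const_mul w)
    simp only [RCLike.re_eq_complex_re] at this
    rw [← this]
    apply integral_congr_ae
    filter_upwards with y
    simp only [hF]
    rw [show w * ((ρ y : ℂ) / (x + t * w - y)) = (ρ y : ℂ) * (w / (x + t * w - y)) by ring,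
      Complex.re_ofReal_mul]
  simp_rw [h1]
  rw [intervalIntegral.integral_of_le zero_le_one, integral_integral_swap hIntg]
  apply integral_congr_ae
  filter_upwards [line_null x w] with y hy
  simp only [hF]
  rw [integral_const_mul, ← intervalIntegral.integral_of_le zero_le_one]
  congr 1
  have hd : ∀ t : ℝ, HasDerivAt (fun s : ℝ => Real.log ‖(x - y) + s * w‖) ((w / ((x - y) + t * w)).re) t := by
    intro t
    apply log_norm_hasDeriv
    have := hy t
    intro h; apply this; linear_combination h
  have := intervalIntegral.integral_eq_sub_of_hasDerivAt (a := 0) (b := 1) (fun t _ => hd t) ?_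
  · simp only [Complex.ofReal_one, one_mul, Complex.ofReal_zero, zero_mul, add_zero] at this
    rw [show x + w - y = x - y + w by ring, ← this]
    congr 1; ext t
    rw [show x + t * w - y = x - y + t * w by ring]
  · apply Continuous.intervalIntegrable
    apply Complex.continuous_re.comp
    apply Continuous.div continuous_const (by fun_prop)
    intro t
    have := hy t
    intro h; apply this; linear_combination h

/-- Newtonian potential representation. -/
lemma log_rep {g : ℂ → ℝ} (hg : ContDiff ℝ 2 g) (hgc : HasCompactSupport g) {ρ : ℂ → ℝ} (hρ : Continuous ρ)
    (hc : HasCompactSupport ρ) (hr : ∀ z, 4 * db (dz (fun y => (g y : ℂ))) z = ρ z) (x : ℂ) :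
    2 * π * g x = ∫ y, ρ y * Real.log ‖x - y‖ := by
  have hgC : ContDiff ℝ 2 (fun y => (g y : ℂ)) := Complex.ofRealCLM.contDiff.comp hg
  have hgcC : HasCompactSupport (fun y => (g y : ℂ)) := hgc.mono (fun y hy h => hy (by simp [h]))
  have hd1 : ContDiff ℝ 1 (dz (fun y => (g y : ℂ))) := dz_contDiff (n := 1) (by norm_cast)
  have hd1c := dz_compact hgcC
  have hCT : ∀ z, CT (fun y => (ρ y : ℂ)) z = 4 * (π * dz (fun y => (g y : ℂ)) z) := by
    intro z
    rw [← pompeiu _ hd1 hd1c z]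
    unfold CT
    rw [← integral_const_mul]
    simp_rw [← hr]
    congr 1; ext y; ring
  have hR : ∀ z, HasR g (dz (fun y => (g y : ℂ)) z) z := fun z =>
    HasR.of_differentiableAt (hg.differentiable (by norm_num) z)
  have hftc : ∀ w : ℂ, 2 * π * (g (x + w) - g x) = ∫ y, ρ y * (Real.log ‖x + w - y‖ - Real.log ‖x - y‖) := by
    intro w
    rw [← CT_line_log hρ hc]
    have h1 := intervalIntegral.integral_eq_sub_of_hasDerivAt (a := 0) (b := 1)
      (fun t _ => (hR (x + t * w)).line) ?_
    · simp only [Complex.ofReal_one, one_mul, Complex.ofReal_zero, zero_mul, add_zero] at h1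
      rw [← h1, ← intervalIntegral.integral_const_mul]
      congr 1; ext t
      rw [hCT]
      simp
      ring
    · apply Continuous.intervalIntegrable
      have := hd1.continuous
      fun_prop
  have hρ0 : ∫ y, ρ y = 0 := by
    have h1 : ∫ y, (ρ y : ℂ) = 0 := by
      simp_rw [← hr]
      rw [integral_const_mul, integral_db_zero _ hd1 hd1c, mul_zero]
    rw [integral_complex_ofReal] at h1
    exact_mod_cast h1
  have hρi : Integrable ρ := hρ.integrable_of_hasCompactSupport hc
  obtain ⟨S, hS⟩ := hc.isCompact.isBounded.exists_norm_le
  obtain ⟨S', hS'⟩ := hgc.isCompact.isBounded.exists_norm_le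
  set T := |S| + ‖x‖ with hT
  have key : ∀ᶠ n : ℕ in atTop, |2 * π * g x - ∫ y, ρ y * Real.log ‖x - y‖| ≤ (2 * T * ∫ y, |ρ y|) / n := by
    filter_upwards [eventually_gt_atTop 0, eventually_ge_atTop (⌈2 * T⌉₊), eventually_gt_atTop (⌈S' + ‖x‖⌉₊)] with n hn0 hn1 hn2
    have hn0' : (0:ℝ) < n := by exact_mod_cast hn0
    have hn1' : 2 * T ≤ n := (Nat.le_ceil _).trans (by exact_mod_cast hn1)
    have hn2' : S' + ‖x‖ < n := (Nat.le_ceil _).trans_lt (by exact_mod_cast hn2)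
    have hg0 : g (x + n) = 0 := by
      apply image_eq_zero_of_notMem_tsupport
      intro h
      have h1 := hS' _ h
      have h2 : ‖(n:ℂ)‖ ≤ ‖x + n‖ + ‖x‖ := by
        calc ‖(n:ℂ)‖ = ‖(x + n) - x‖ := by congr 1; ring
          _ ≤ _ := norm_sub_le _ _
      simp at h2
      linarith
    have h3 := hftc n
    rw [hg0] at h3
    have i1 := logker_integrable hρ hc (x + n)
    have i2 := logker_integrable hρ hc x
    simp_rw [mul_sub (ρ _)] at h3
    rw [integral_sub i1 i2] at h3
    have h4 : 2 * π * g x - ∫ y, ρ y * Real.log ‖x - y‖ = - ∫ y, ρ y * Real.log ‖x + n - y‖ := by linarith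
    rw [h4, abs_neg]
    have h5 : ∫ y, ρ y * Real.log ‖x + n - y‖ = ∫ y, ρ y * (Real.log ‖x + n - y‖ - Real.log n) := by
      simp_rw [mul_sub (ρ _)]
      rw [integral_sub i1 (hρi.mul_const _), integral_mul_const, hρ0]; ring
    rw [h5, mul_div_assoc, mul_comm, ← Real.norm_eq_abs]
    have h6 : (∫ y, |ρ y|) / n * (2 * T) = ∫ y, |ρ y| * (2 * T / n) := by
      rw [integral_mul_const]; ring
    rw [mul_comm, mul_comm (2 * T), h6]
    apply norm_integral_le_of_norm_le (hρi.norm.mul_const _)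
    filter_upwards with y
    rw [norm_mul, Real.norm_eq_abs (ρ y)]
    by_cases hy : y ∈ tsupport ρ
    swap
    · rw [image_eq_zero_of_notMem_tsupport hy]; simp
    gcongr
    have hyS : ‖x - y‖ ≤ T := by
      have := hS y hy
      have := norm_sub_le x y
      have := le_abs_self S
      linarith
    have h7 : |‖x + n - y‖ - n| ≤ T := by
      have := abs_norm_sub_norm_le (x + n - y) (n:ℂ)
      simp only [Complex.norm_natCast] at this
      refine this.trans ?_
      rw [show x + (n:ℂ) - y - n = x - y by ring]; exact hyS
    rw [abs_le] at h7
    set r := ‖x + n - y‖ with hr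
    have hrp : n / 2 ≤ r := by linarith
    have hrp0 : 0 < r := by linarith
    rw [← Real.log_div hrp0.ne' hn0'.ne', Real.norm_eq_abs, abs_le]
    have l1 := Real.log_le_sub_one_of_pos (div_pos hrp0 hn0')
    have l2 := Real.log_le_sub_one_of_pos (div_pos hn0' hrp0)
    rw [← inv_div, Real.log_inv] at l2
    have hT0 : 0 ≤ T := by positivity
    constructor
    · have : n / r - 1 ≤ 2 * T / n := by
        have h8 : n / r - 1 = (n - r) / r := by field_simp
        rw [h8, div_le_div_iff₀ hrp0 hn0']
        have : (n - r) * n ≤ T * n := by nlinarith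
        nlinarith
      rw [inv_div] at l2
      linarith
    · have : r / n - 1 ≤ 2 * T / n := by
        rw [div_sub_one hn0'.ne']; gcongr; linarith
      linarith
  have hlim : Tendsto (fun n : ℕ => (2 * T * ∫ y, |ρ y|) / n) atTop (𝓝 0) :=
    tendsto_const_div_atTop_nhds_zero_nat _
  have := ge_of_tendsto hlim key
  have := abs_eq_zero.mp (le_antisymm this (abs_nonneg _))
  linarith
end

noncomputable section

/-- the rescaled package at a fixed index -/
structure Pk (B p R : ℝ) (v : ℂ → ℝ) (vz hh : ℂ → ℂ) (ρ : ℂ → ℝ) : Prop where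
  hB : 1 ≤ B
  hp : 20 ≤ p
  hR : p ^ 10 ≤ R
  hv : ∀ z ∈ ball (0:ℂ) R, HasR v (vz z) z
  vzC : ContDiffOn ℝ 1 vz (ball (0:ℂ) R)
  v0 : v 0 = 0
  vle : ∀ z ∈ ball (0:ℂ) R, v z ≤ 0
  vpos : ∀ z ∈ ball (0:ℂ) R, 0 < 1 + v z / p
  rep : ∀ z ∈ ball (0:ℂ) R, vz z = hh z - 1 / (4 * π) * CT (fun y => (ρ y : ℂ)) z
  hol : DifferentiableOn ℂ hh (ball (0:ℂ) R)
  hhB : ∀ z ∈ ball (0:ℂ) R, ‖hh z‖ ≤ B / R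
  ρC : ContDiff ℝ 2 ρ
  ρc : HasCompactSupport ρ
  ρ0 : ∀ y, 0 ≤ ρ y
  ρ1 : ∀ y, ρ y ≤ 1
  ρv : ∀ z ∈ ball (0:ℂ) R, ρ z = (1 + v z / p) ^ p
  ρd : ∀ y, R ≤ ‖y‖ → ρ y ≤ (1 + ‖y‖) ^ (-(4:ℝ))
  ρzd : ∀ y, R ≤ ‖y‖ → ‖dz (fun y => (ρ y : ℂ)) y‖ ≤ (1 + ‖y‖) ^ (-(3:ℝ))
  mass : ∫ y, ρ y ≤ 8 * π + 1 / 10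

/-- primitive -/
def FF (p : ℝ) (ρ : ℂ → ℝ) (y : ℂ) : ℝ := p / (p + 1) * ρ y ^ (1 + 1 / p)

namespace Pk
variable {B p R : ℝ} {v : ℂ → ℝ} {vz hh : ℂ → ℂ} {ρ : ℂ → ℝ}

lemma p0 (h : Pk B p R v vz hh ρ) : 0 < p := by linarith [h.hp]
lemma R0 (h : Pk B p R v vz hh ρ) : 1 ≤ R := by
  have h1 : (1:ℝ) ≤ p ^ 10 := one_le_pow₀ (by linarith [h.hp])
  linarith [h.hR]
lemma ρi (h : Pk B p R v vz hh ρ) : Integrable ρ := h.ρC.continuous.integrable_of_hasCompactSupport h.ρc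
lemma mpos (h : Pk B p R v vz hh ρ) : 0 ≤ ∫ y, ρ y := integral_nonneg h.ρ0
lemma ρcC (h : Pk B p R v vz hh ρ) : HasCompactSupport (fun y => (ρ y : ℂ)) :=
  h.ρc.mono (fun y hy h => hy (by simp [h]))
lemma ρCC (h : Pk B p R v vz hh ρ) : ContDiff ℝ 2 (fun y => (ρ y : ℂ)) :=
  Complex.ofRealCLM.contDiff.comp h.ρC

lemma ρz (h : Pk B p R v vz hh ρ) {z : ℂ} (hz : z ∈ ball (0:ℂ) R) :
    dz (fun y => (ρ y : ℂ)) z = ((1 + v z / p) ^ (p - 1) : ℝ) * vz z := by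
  have hp := h.p0
  have h1 : HasDerivAt (fun t : ℝ => (1 + t / p) ^ p) ((1 + v z / p) ^ (p - 1)) (v z) := by
    have := (((hasDerivAt_id (v z)).div_const p).const_add 1).rpow_const (p := p) (Or.inl (h.vpos z hz).ne')
    have e : 1 / p * p * (1 + v z / p) ^ (p - 1) = (1 + v z / p) ^ (p - 1) := by field_simp
    simp only [id] at this
    rw [e] at this
    exact this
  have h2 := (h.hv z hz).comp h1
  have h3 : HasW (fun y => (ρ y : ℂ)) (((1 + v z / p) ^ (p - 1) : ℝ) * vz z) ((starRingEnd ℂ) (((1 + v z / p) ^ (p - 1) : ℝ) * vz z)) z := by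
    refine HasW.congr_ev h2 ?_
    filter_upwards [isOpen_ball.mem_nhds hz] with y hy
    rw [h.ρv y hy]
  exact h3.dz_eq

lemma FFz (h : Pk B p R v vz hh ρ) (z : ℂ) :
    HasR (FF p ρ) ((ρ z ^ (1 / p) : ℝ) * dz (fun y => (ρ y : ℂ)) z) z := by
  have hp := h.p0
  have h0 := HasR.of_differentiableAt (h.ρC.differentiable (by norm_num) z)
  have h1 : HasDerivAt (fun t : ℝ => p / (p + 1) * t ^ (1 + 1 / p)) (ρ z ^ (1 / p)) (ρ z) := by
    have := (Real.hasDerivAt_rpow_const (x := ρ z) (p := 1 + 1 / p) (Or.inr (by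
      have : 0 < 1 / p := by positivity
      linarith))).const_mul (p / (p + 1))
    have e : p / (p + 1) * ((1 + 1 / p) * ρ z ^ (1 + 1 / p - 1)) = ρ z ^ (1 / p) := by
      rw [show 1 + 1 / p - 1 = 1 / p by ring]; field_simp
    rwa [e] at this
  exact h0.comp h1

lemma ρroot (h : Pk B p R v vz hh ρ) {z : ℂ} (hz : z ∈ ball (0:ℂ) R) :
    ρ z ^ (1 / p) = 1 + v z / p := by
  have hp := h.p0
  rw [h.ρv z hz, ← Real.rpow_mul (h.vpos z hz).le, mul_one_div_cancel hp.ne', Real.rpow_one]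

lemma FFz' (h : Pk B p R v vz hh ρ) {z : ℂ} (hz : z ∈ ball (0:ℂ) R) :
    dz (fun y => (FF p ρ y : ℂ)) z = ρ z * vz z := by
  have h1 := (h.FFz z)
  unfold HasR at h1
  rw [h1.dz_eq, h.ρz hz, h.ρroot hz, h.ρv z hz, ← mul_assoc, ← Complex.ofReal_mul]
  congr 2
  rw [mul_comm, ← Real.rpow_add_one (h.vpos z hz).ne', sub_add_cancel]

lemma FFC (h : Pk B p R v vz hh ρ) : ContDiff ℝ 1 (FF p ρ) := by
  have hp := h.p0
  unfold FF
  have h2 : ContDiff ℝ 1 (fun t : ℝ => t ^ (1 + 1 / p)) := by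
    have := Real.contDiff_rpow_const_of_le (n := 1) (p := 1 + 1 / p) (by
      have : 0 < 1 / p := by positivity
      push_cast; linarith)
    exact_mod_cast this
  exact contDiff_const.mul (h2.comp (h.ρC.of_le (by norm_num)))

lemma prodInt (h : Pk B p R v vz hh ρ) {Φ : ℂ → ℂ} (hΦ : Continuous Φ) {T : ℝ} (hT : ∀ z, ‖Φ z‖ ≤ T) :
    Integrable (fun q : ℂ × ℂ => Φ q.1 * ρ q.1 * (ρ q.2 / (q.1 - q.2))) (volume.prod volume) := by
  have hmeas : AEStronglyMeasurable (fun q : ℂ × ℂ => Φ q.1 * ρ q.1 * (ρ q.2 / (q.1 - q.2))) (volume.prod volume) := by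
    apply Measurable.aestronglyMeasurable
    have := h.ρC.continuous.measurable
    have := hΦ.measurable
    have h1 : Measurable (fun q : ℂ × ℂ => q.1 - q.2) := by fun_prop
    have h2 : Measurable (fun q : ℂ × ℂ => (ρ q.2 : ℂ)) := by fun_prop
    have h3 : Measurable (fun q : ℂ × ℂ => Φ q.1 * (ρ q.1 : ℂ)) := by fun_prop
    exact h3.mul (h2.div h1)
  have hT0 : 0 ≤ T := (norm_nonneg _).trans (hT 0)
  rw [integrable_prod_iff hmeas]
  refine ⟨Eventually.of_forall (fun z => ?_), ?_⟩
  · exact (CT_integrable _ h.ρCC.continuous h.ρcC z).const_mul (Φ z * ρ z)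
  · refine (h.ρi.const_mul (T * (2 * π + ∫ y, ρ y))).mono' hmeas.norm.integral_prod_right' ?_
    filter_upwards with z
    rw [Real.norm_of_nonneg (integral_nonneg (fun y => norm_nonneg _))]
    simp only [norm_mul, norm_div, Complex.norm_real]
    rw [integral_const_mul]
    have h1 := kern_le h.ρi h.ρ0 h.ρ1 z
    simp only [Real.norm_of_nonneg (h.ρ0 _)]
    have := h.ρ0 z
    have := hT z
    have : 0 ≤ ∫ y, ρ y / ‖z - y‖ := integral_nonneg (fun y => div_nonneg (h.ρ0 y) (norm_nonneg _))
    calc _ ≤ T * ρ z * (2 * π + ∫ y, ρ y) := by gcongr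
      _ = _ := by ring

/-- Pohozaev identity -/
lemma poh (h : Pk B p R v vz hh ρ) {Φ : ℂ → ℂ} (hΦ : ContDiff ℝ 1 Φ) (hΦc : HasCompactSupport Φ)
    (hΦs : ∀ z, R ≤ ‖z‖ → Φ z = 0) {T : ℝ} (hT : ∀ z, ‖Φ z‖ ≤ T) :
    ‖1 / (8 * π) * (∫ q : ℂ × ℂ, (ρ q.1 * ρ q.2 * ((Φ q.1 - Φ q.2) / (q.1 - q.2)) : ℂ))
      - ∫ y, dz Φ y * FF p ρ y‖ ≤ T * (B / R) * ∫ y, ρ y := by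
  have hT0 : 0 ≤ T := (norm_nonneg _).trans (hT 0)
  have hR := h.R0
  have hF1 : ContDiff ℝ 1 (fun y => (FF p ρ y : ℂ)) := Complex.ofRealCLM.contDiff.comp h.FFC
  have h1 := integral_dz_zero (fun y => Φ y * FF p ρ y) (hΦ.mul hF1) (hΦc.mul_right)
  have h2 : ∀ y, dz (fun y => Φ y * FF p ρ y) y = dz Φ y * FF p ρ y + Φ y * (ρ y * (hh y - 1 / (4 * π) * CT (fun y => (ρ y : ℂ)) y)) := by
    intro y
    have a1 := hasW_of_differentiableAt (hΦ.differentiable (by norm_num) y)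
    have a2 := hasW_of_differentiableAt (hF1.differentiable (by norm_num) y)
    rw [(a1.mul a2).dz_eq]
    congr 1
    by_cases hy : ‖y‖ < R
    · have hy' : y ∈ ball (0:ℂ) R := by simpa using hy
      rw [h.FFz' hy', h.rep y hy']
    · rw [hΦs y (not_lt.mp hy)]; simp
  have i1 : Integrable (fun y => dz Φ y * FF p ρ y) := by
    have c1 : Continuous (dz Φ) := (dz_contDiff (n := 0) (by simpa using hΦ)).continuous
    exact (c1.mul hF1.continuous).integrable_of_hasCompactSupport ((dz_compact hΦc).mul_right)
  have pI := h.prodInt hΦ.continuous hT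
  have i2 : Integrable (fun y => Φ y * ρ y * CT (fun y => (ρ y : ℂ)) y) := by
    have := pI.integral_prod_left
    refine this.congr ?_
    filter_upwards with z
    exact integral_const_mul (Φ z * ρ z) (fun y : ℂ => (ρ y : ℂ) / (z - y))
  have i3 : Integrable (fun y => Φ y * ρ y * hh y) := by
    refine (h.ρi.const_mul (T * (B / R))).mono' ?_ ?_
    · have e : (fun y => Φ y * ρ y * hh y) = (ball (0:ℂ) R).indicator (fun y => Φ y * ρ y * hh y) := by
        ext y
        by_cases hy : ‖y‖ < R
        · simp [hy]
        · rw [Set.indicator_of_notMem (by simpa using hy), hΦs y (not_lt.mp hy)]; simp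
      rw [e, aestronglyMeasurable_indicator_iff measurableSet_ball]
      apply ContinuousOn.aestronglyMeasurable _ measurableSet_ball
      exact ((hΦ.continuous.mul h.ρCC.continuous).continuousOn).mul h.hol.continuousOn
    · filter_upwards with y
      by_cases hy : ‖y‖ < R
      · rw [norm_mul, norm_mul, Complex.norm_real, Real.norm_of_nonneg (h.ρ0 y)]
        have := h.hhB y (by simpa using hy)
        have := hT y
        have := h.ρ0 y
        calc _ ≤ T * ρ y * (B / R) := by gcongr
          _ = _ := by ring
      · rw [hΦs y (not_lt.mp hy)]; simp
        have := h.ρ0 y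
        have := h.hB
        positivity
  have h3 : ∫ y, Φ y * ρ y * CT (fun y => (ρ y : ℂ)) y = ∫ q : ℂ × ℂ, Φ q.1 * ρ q.1 * (ρ q.2 / (q.1 - q.2)) := by
    rw [Measure.volume_eq_prod, integral_prod _ pI]
    congr 1; ext z
    exact (integral_const_mul (Φ z * ρ z) (fun y : ℂ => (ρ y : ℂ) / (z - y))).symm
  have h4 : ∫ q : ℂ × ℂ, (ρ q.1 * ρ q.2 * ((Φ q.1 - Φ q.2) / (q.1 - q.2)) : ℂ) =
      2 * ∫ y, Φ y * ρ y * CT (fun y => (ρ y : ℂ)) y := by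
    rw [h3, two_mul]
    have sw : ∫ q : ℂ × ℂ, Φ q.1 * ρ q.1 * (ρ q.2 / (q.1 - q.2)) =
      ∫ q : ℂ × ℂ, Φ q.2 * ρ q.2 * (ρ q.1 / (q.2 - q.1)) := by
      rw [Measure.volume_eq_prod, ← integral_prod_swap]; rfl
    have pI2 : Integrable (fun q : ℂ × ℂ => Φ q.2 * ρ q.2 * (ρ q.1 / (q.2 - q.1))) (volume.prod volume) := pI.swap
    conv_rhs => rw [sw]
    conv_rhs => arg 1; rw [← sw]
    rw [Measure.volume_eq_prod, ← integral_add pI pI2]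
    congr 1; ext q
    by_cases hq : q.1 - q.2 = 0
    · have : q.2 - q.1 = 0 := by linear_combination -hq
      simp [hq, this]
    · have : q.2 - q.1 ≠ 0 := fun h => hq (by linear_combination -h)
      rw [show q.2 - q.1 = -(q.1 - q.2) by ring] at *
      field_simp
      ring
  have h5 : (0:ℂ) = (∫ y, dz Φ y * FF p ρ y) + (∫ y, Φ y * ρ y * hh y) - 1 / (4 * π) * ∫ y, Φ y * ρ y * CT (fun y => (ρ y : ℂ)) y := by
    have i4 : Integrable (fun y => dz Φ y * FF p ρ y + Φ y * ρ y * hh y) := i1.add i3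
    rw [← integral_const_mul, ← integral_add i1 i3, ← integral_sub i4 (i2.const_mul _), ← h1]
    congr 1; ext y
    rw [h2]; ring
  have h6 : 1 / (8 * π) * (∫ q : ℂ × ℂ, (ρ q.1 * ρ q.2 * ((Φ q.1 - Φ q.2) / (q.1 - q.2)) : ℂ))
      - (∫ y, dz Φ y * FF p ρ y) = ∫ y, Φ y * ρ y * hh y := by
    rw [h4]
    have hpi : (π:ℂ) ≠ 0 := by exact_mod_cast Real.pi_ne_zero
    linear_combination (exp := 1) h5
  rw [h6, ← integral_const_mul]
  apply norm_integral_le_of_norm_le (h.ρi.const_mul (T * (B / R)))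
  filter_upwards with y
  by_cases hy : ‖y‖ < R
  · rw [norm_mul, norm_mul, Complex.norm_real, Real.norm_of_nonneg (h.ρ0 y)]
    have := h.hhB y (by simpa using hy)
    have := hT y
    have := h.ρ0 y
    calc _ ≤ T * ρ y * (B / R) := by gcongr
      _ = _ := by ring
  · rw [hΦs y (not_lt.mp hy)]; simp
    have := h.ρ0 y
    have := h.hB
    positivity

end Pk
end

noncomputable section

def thB : ContDiffBump (0:ℂ) := ⟨1, 2, by norm_num, by norm_num⟩

def Ph (L : ℝ) (z : ℂ) : ℂ := (thB (z / L) : ℂ) * z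

lemma Ph_eq {L : ℝ} (hL : 0 < L) (z : ℂ) : Ph L z = L * Ph 1 (z / L) := by
  unfold Ph
  have : (L:ℂ) ≠ 0 := by exact_mod_cast hL.ne'
  simp
  field_simp

lemma norm_div_L {L : ℝ} (hL : 0 < L) (z : ℂ) : ‖z / (L:ℂ)‖ = ‖z‖ / L := by
  rw [norm_div, Complex.norm_real, Real.norm_of_nonneg hL.le]

lemma th_contDiff (L : ℝ) : ContDiff ℝ 2 (fun z : ℂ => thB (z / L)) := by
  have : ContDiff ℝ 2 (fun z : ℂ => z / (L:ℂ)) := contDiff_id.div_const _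
  exact thB.contDiff.comp this

lemma Ph_contDiff (L : ℝ) : ContDiff ℝ 1 (Ph L) := by
  have h1 : ContDiff ℝ 1 (fun z : ℂ => (thB (z / L) : ℂ)) :=
    Complex.ofRealCLM.contDiff.comp ((th_contDiff L).of_le (by norm_num))
  exact h1.mul contDiff_id

lemma th_one {L : ℝ} (hL : 0 < L) {z : ℂ} (hz : ‖z‖ ≤ L) : thB (z / (L:ℂ)) = 1 := by
  apply thB.one_of_mem_closedBall
  rw [mem_closedBall_zero_iff, norm_div_L hL]
  exact (div_le_one hL).mpr hz

lemma th_zero {L : ℝ} (hL : 0 < L) {z : ℂ} (hz : 2 * L ≤ ‖z‖) : thB (z / (L:ℂ)) = 0 := by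
  apply thB.zero_of_le_dist
  rw [dist_zero_right, norm_div_L hL]
  exact (le_div_iff₀ hL).mpr hz

lemma Ph_id {L : ℝ} (hL : 0 < L) {z : ℂ} (hz : ‖z‖ ≤ L) : Ph L z = z := by
  unfold Ph; rw [th_one hL hz]; simp

lemma Ph_zero {L : ℝ} (hL : 0 < L) {z : ℂ} (hz : 2 * L ≤ ‖z‖) : Ph L z = 0 := by
  unfold Ph; rw [th_zero hL hz]; simp

lemma hasCompactSupport_of_norm {E : Type*} [Zero E] {f : ℂ → E} {T : ℝ} (h : ∀ z, T ≤ ‖z‖ → f z = 0) : HasCompactSupport f := by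
  apply HasCompactSupport.intro (isCompact_closedBall (0:ℂ) T)
  intro z hz
  apply h
  simp at hz
  exact hz.le

lemma Ph_compact {L : ℝ} (hL : 0 < L) : HasCompactSupport (Ph L) :=
  hasCompactSupport_of_norm (fun _ hz => Ph_zero hL hz)

lemma Ph_bound {L : ℝ} (hL : 0 < L) (z : ℂ) : ‖Ph L z‖ ≤ 2 * L := by
  by_cases hz : 2 * L ≤ ‖z‖
  · rw [Ph_zero hL hz]; simp; exact hL.le
  · unfold Ph
    rw [norm_mul, Complex.norm_real, Real.norm_of_nonneg thB.nonneg]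
    have := thB.le_one (x := z / L)
    have := thB.nonneg (x := z / L)
    calc _ ≤ 1 * ‖z‖ := by gcongr
      _ ≤ _ := by linarith

lemma exists_CΦ : ∃ C : ℝ, 1 ≤ C ∧ ∀ L : ℝ, 0 < L → ∀ z y, ‖Ph L z - Ph L y‖ ≤ C * ‖z - y‖ := by
  obtain ⟨C, hC⟩ := (Ph_contDiff 1).lipschitzWith_of_hasCompactSupport (Ph_compact one_pos) (by norm_num)
  refine ⟨max C 1, le_max_right _ _, fun L hL z y => ?_⟩
  rw [Ph_eq hL z, Ph_eq hL y, ← mul_sub, norm_mul, Complex.norm_real, Real.norm_of_nonneg hL.le]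
  have h1 := hC.norm_sub_le (z / L) (y / L)
  rw [← sub_div, norm_div_L hL] at h1
  calc _ ≤ L * (C * (‖z - y‖ / L)) := by gcongr
    _ = C * ‖z - y‖ := by field_simp
    _ ≤ _ := by gcongr; exact le_max_left _ _

def CΦ : ℝ := exists_CΦ.choose
lemma CΦ_one : 1 ≤ CΦ := exists_CΦ.choose_spec.1
lemma Ph_lip {L : ℝ} (hL : 0 < L) (z y : ℂ) : ‖Ph L z - Ph L y‖ ≤ CΦ * ‖z - y‖ := exists_CΦ.choose_spec.2 L hL z y

lemma norm_dz_le (g : ℂ → ℂ) (z : ℂ) : ‖dz g z‖ ≤ ‖fderiv ℝ g z‖ := by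
  unfold dz
  have h1 := (fderiv ℝ g z).le_opNorm 1
  have h2 := (fderiv ℝ g z).le_opNorm Complex.I
  simp only [norm_one, Complex.norm_I, mul_one] at h1 h2
  rw [norm_div]
  have h3 := norm_sub_le (fderiv ℝ g z 1) (Complex.I * fderiv ℝ g z Complex.I)
  rw [norm_mul, Complex.norm_I, one_mul] at h3
  simp
  linarith

lemma norm_db_le (g : ℂ → ℂ) (z : ℂ) : ‖db g z‖ ≤ ‖fderiv ℝ g z‖ := by
  unfold db
  have h1 := (fderiv ℝ g z).le_opNorm 1
  have h2 := (fderiv ℝ g z).le_opNorm Complex.I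
  simp only [norm_one, Complex.norm_I, mul_one] at h1 h2
  rw [norm_div]
  have h3 := norm_add_le (fderiv ℝ g z 1) (Complex.I * fderiv ℝ g z Complex.I)
  rw [norm_mul, Complex.norm_I, one_mul] at h3
  simp
  linarith

lemma Ph_dz_bound {L : ℝ} (hL : 0 < L) (z : ℂ) : ‖dz (Ph L) z‖ ≤ CΦ := by
  have h0 := CΦ_one
  refine (norm_dz_le _ _).trans ?_
  refine norm_fderiv_le_of_lip' (𝕜 := ℝ) (by linarith) ?_
  filter_upwards with y
  exact Ph_lip hL y z

lemma Ph_dz_one {L : ℝ} (hL : 0 < L) {z : ℂ} (hz : ‖z‖ < L) : dz (Ph L) z = 1 := by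
  refine ((hasW_id z).congr_ev ?_).dz_eq
  filter_upwards [isOpen_ball.mem_nhds (show z ∈ ball (0:ℂ) L by simpa using hz)] with y hy
  exact Ph_id hL (by simpa using (mem_ball_zero_iff.mp hy).le)

lemma Ph_dz_zero {L : ℝ} (hL : 0 < L) {z : ℂ} (hz : 2 * L < ‖z‖) : dz (Ph L) z = 0 := by
  refine ((hasW_const 0 z).congr_ev ?_).dz_eq
  have : IsOpen {y : ℂ | 2 * L < ‖y‖} := isOpen_lt continuous_const continuous_norm
  filter_upwards [this.mem_nhds hz] with y hy
  exact Ph_zero hL (le_of_lt hy)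

lemma diag_null : ∀ᵐ q : ℂ × ℂ, q.1 ≠ q.2 := by
  rw [Measure.volume_eq_prod]
  have hm : MeasurableSet {q : ℂ × ℂ | q.1 = q.2} := measurableSet_eq_fun measurable_fst measurable_snd
  have : (volume.prod volume) {q : ℂ × ℂ | q.1 = q.2} = 0 := by
    rw [Measure.measure_prod_null hm]
    filter_upwards with x
    have : Prod.mk x ⁻¹' {q : ℂ × ℂ | q.1 = q.2} = {x} := by ext y; simp [eq_comm]
    rw [this]; simp
  rw [ae_iff]
  simpa using this

namespace Pk
variable {B p R : ℝ} {v : ℂ → ℝ} {vz hh : ℂ → ℂ} {ρ : ℂ → ℝ}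

lemma FF0 (h : Pk B p R v vz hh ρ) (y : ℂ) : 0 ≤ FF p ρ y := by
  unfold FF; have := h.p0; have := h.ρ0 y; positivity

lemma FF_le (h : Pk B p R v vz hh ρ) (y : ℂ) : FF p ρ y ≤ ρ y := by
  unfold FF; have hp := h.p0; have := h.ρ0 y
  have h1 : p / (p + 1) ≤ 1 := by rw [div_le_one (by linarith)]; linarith
  have h2 : ρ y ^ (1 + 1 / p) ≤ ρ y ^ (1:ℝ) := by
    have : 0 ≤ 1 / p := by positivity
    exact Real.rpow_le_rpow_of_exponent_ge' (h.ρ0 y) (h.ρ1 y) (by norm_num) (by linarith)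
  rw [Real.rpow_one] at h2
  calc _ ≤ 1 * ρ y := by gcongr
    _ = _ := one_mul _

lemma FFi (h : Pk B p R v vz hh ρ) : Integrable (FF p ρ) := by
  refine h.ρi.mono' h.FFC.continuous.aestronglyMeasurable ?_
  filter_upwards with y
  rw [Real.norm_of_nonneg (h.FF0 y)]; exact h.FF_le y

lemma pohG (h : Pk B p R v vz hh ρ) {L κ : ℝ} (hL : 0 < L) (hLR : 2 * L ≤ R) (hκ : 0 ≤ κ) {S A : Set ℂ}
    (hS : MeasurableSet S) (hA : MeasurableSet A)
    (hK : ∀ z y, z ∉ A → y ∉ A → z ≠ y →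
      ‖(Ph L z - Ph L y) / (z - y) - S.indicator (fun _ => (1:ℂ)) z * S.indicator (fun _ => (1:ℂ)) y‖ ≤ κ)
    (hD : ∀ y, y ∉ A → dz (Ph L) y = S.indicator (fun _ => (1:ℂ)) y) :
    |1 / (8 * π) * (∫ y in S, ρ y) ^ 2 - ∫ y in S, FF p ρ y| ≤
      2 * L * (B / R) * (∫ y, ρ y) + (1 / (8 * π)) * (2 * (CΦ + 1) * (∫ y, ρ y) * (∫ y in A, ρ y) + κ * (∫ y, ρ y) ^ 2)
        + (CΦ + 1) * ∫ y in A, ρ y := by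
  have h0 := h.poh (Ph_contDiff L) (Ph_compact hL) (fun z hz => Ph_zero hL (hLR.trans hz)) (Ph_bound hL)
  have hC := CΦ_one
  set m := ∫ y, ρ y with hm
  set a := ∫ y in S, ρ y with ha
  set b := ∫ y in A, ρ y with hb
  have hKb : ∀ q : ℂ × ℂ, ‖(Ph L q.1 - Ph L q.2) / (q.1 - q.2)‖ ≤ CΦ := by
    intro q
    rw [norm_div]
    exact div_le_of_le_mul₀ (norm_nonneg _) (by linarith) (Ph_lip hL _ _)
  have ind1 : ∀ (S : Set ℂ) (z : ℂ), ‖S.indicator (fun _ => (1:ℂ)) z‖ ≤ 1 := by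
    intro S z; by_cases hz : z ∈ S <;> simp [hz]
  have iρ := h.ρi
  have iS : Integrable (S.indicator ρ) := iρ.indicator hS
  have iA : Integrable (A.indicator ρ) := iρ.indicator hA
  have aS : ∫ y, S.indicator ρ y = a := integral_indicator hS
  have aA : ∫ y, A.indicator ρ y = b := integral_indicator hA
  have hA0 : ∀ y, 0 ≤ A.indicator ρ y := fun y => Set.indicator_nonneg (fun y _ => h.ρ0 y) y
  -- product part
  have i1 : Integrable (fun q : ℂ × ℂ => ((ρ q.1 * ρ q.2 : ℝ) : ℂ)) := by
    rw [Measure.volume_eq_prod]; exact (iρ.mul_prod iρ).ofReal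
  have i2 : Integrable (fun q : ℂ × ℂ => (ρ q.1 * ρ q.2 * ((Ph L q.1 - Ph L q.2) / (q.1 - q.2)) : ℂ)) := by
    have hmeas : Measurable (fun q : ℂ × ℂ => (Ph L q.1 - Ph L q.2) / (q.1 - q.2)) := by
      have := (Ph_contDiff L).continuous.measurable
      have h1 : Measurable (fun q : ℂ × ℂ => q.1 - q.2) := by fun_prop
      have h2 : Measurable (fun q : ℂ × ℂ => Ph L q.1 - Ph L q.2) := by fun_prop
      exact h2.div h1
    have := i1.mul_bdd (c := CΦ) hmeas.aestronglyMeasurable (Eventually.of_forall hKb)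
    refine this.congr ?_
    filter_upwards with q
    push_cast; rfl
  have i3 : Integrable (fun q : ℂ × ℂ => ((S.indicator ρ q.1 * S.indicator ρ q.2 : ℝ) : ℂ)) := by
    rw [Measure.volume_eq_prod]; exact (iS.mul_prod iS).ofReal
  have e3 : ∫ q : ℂ × ℂ, ((S.indicator ρ q.1 * S.indicator ρ q.2 : ℝ) : ℂ) = ((a ^ 2 : ℝ) : ℂ) := by
    rw [integral_complex_ofReal, Measure.volume_eq_prod, integral_prod_mul, aS, sq]
  have i4 : Integrable (fun q : ℂ × ℂ => (CΦ + 1) * (A.indicator ρ q.1 * ρ q.2 + ρ q.1 * A.indicator ρ q.2) + κ * (ρ q.1 * ρ q.2)) := by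
    rw [Measure.volume_eq_prod]
    exact (((iA.mul_prod iρ).add (iρ.mul_prod iA)).const_mul _).add ((iρ.mul_prod iρ).const_mul _)
  have e4 : ∫ q : ℂ × ℂ, ((CΦ + 1) * (A.indicator ρ q.1 * ρ q.2 + ρ q.1 * A.indicator ρ q.2) + κ * (ρ q.1 * ρ q.2)) =
      2 * (CΦ + 1) * m * b + κ * m ^ 2 := by
    rw [Measure.volume_eq_prod]
    have j1 := iA.mul_prod iρ
    have j2 := iρ.mul_prod iA
    have j3 := iρ.mul_prod iρ
    have j4 : Integrable (fun q : ℂ × ℂ => (CΦ + 1) * (A.indicator ρ q.1 * ρ q.2 + ρ q.1 * A.indicator ρ q.2)) (volume.prod volume) :=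
      (j1.add j2).const_mul _
    rw [integral_add j4 (j3.const_mul _), integral_const_mul, integral_const_mul, integral_add j1 j2,
      integral_prod_mul, integral_prod_mul, integral_prod_mul, aA]
    ring
  have P : ‖(∫ q : ℂ × ℂ, (ρ q.1 * ρ q.2 * ((Ph L q.1 - Ph L q.2) / (q.1 - q.2)) : ℂ)) - ((a ^ 2 : ℝ) : ℂ)‖ ≤
      2 * (CΦ + 1) * m * b + κ * m ^ 2 := by
    rw [← e3, ← e4, ← integral_sub i2 i3]
    apply norm_integral_le_of_norm_le i4
    filter_upwards [diag_null] with q hq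
    have e5 : (ρ q.1 * ρ q.2 * ((Ph L q.1 - Ph L q.2) / (q.1 - q.2)) : ℂ) - ((S.indicator ρ q.1 * S.indicator ρ q.2 : ℝ) : ℂ) =
      ((ρ q.1 * ρ q.2 : ℝ) : ℂ) * ((Ph L q.1 - Ph L q.2) / (q.1 - q.2) - S.indicator (fun _ => (1:ℂ)) q.1 * S.indicator (fun _ => (1:ℂ)) q.2) := by
      by_cases h1 : q.1 ∈ S <;> by_cases h2 : q.2 ∈ S <;> simp [h1, h2] <;> ring
    rw [e5, norm_mul, Complex.norm_real, Real.norm_of_nonneg (mul_nonneg (h.ρ0 _) (h.ρ0 _))]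
    have r1 := h.ρ0 q.1
    have r2 := h.ρ0 q.2
    have r3 := hA0 q.1
    have r4 := hA0 q.2
    by_cases hA' : q.1 ∈ A ∨ q.2 ∈ A
    · have k1 : ‖(Ph L q.1 - Ph L q.2) / (q.1 - q.2) - S.indicator (fun _ => (1:ℂ)) q.1 * S.indicator (fun _ => (1:ℂ)) q.2‖ ≤ CΦ + 1 := by
        refine (norm_sub_le _ _).trans (add_le_add (hKb q) ?_)
        rw [norm_mul]
        exact mul_le_one₀ (ind1 _ _) (norm_nonneg _) (ind1 _ _)
      have k2 : ρ q.1 * ρ q.2 ≤ A.indicator ρ q.1 * ρ q.2 + ρ q.1 * A.indicator ρ q.2 := by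
        rcases hA' with hA' | hA'
        · have : A.indicator ρ q.1 = ρ q.1 := by simp [hA']
          rw [this]; have := mul_nonneg r1 r4; linarith
        · have : A.indicator ρ q.2 = ρ q.2 := by simp [hA']
          rw [this]; have := mul_nonneg r3 r2; linarith
      calc _ ≤ (A.indicator ρ q.1 * ρ q.2 + ρ q.1 * A.indicator ρ q.2) * (CΦ + 1) := by gcongr
        _ ≤ _ := by have : 0 ≤ κ * (ρ q.1 * ρ q.2) := by positivity
                    linarith
    · push Not at hA'
      have k1 := hK q.1 q.2 hA'.1 hA'.2 hq
      calc _ ≤ ρ q.1 * ρ q.2 * κ := by gcongr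
        _ ≤ _ := by have : 0 ≤ (CΦ + 1) * (A.indicator ρ q.1 * ρ q.2 + ρ q.1 * A.indicator ρ q.2) := by positivity
                    linarith
  -- dz part
  have iF := h.FFi
  have j1 : Integrable (fun y => dz (Ph L) y * FF p ρ y) := by
    have c1 : Continuous (dz (Ph L)) := (dz_contDiff (n := 0) (by simpa using Ph_contDiff L)).continuous
    exact iF.ofReal.bdd_mul (c := CΦ) c1.aestronglyMeasurable (Eventually.of_forall (fun y => Ph_dz_bound hL y))
  have j2 : Integrable (fun y => ((S.indicator (FF p ρ) y : ℝ) : ℂ)) := (iF.indicator hS).ofReal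
  have Q : ‖(∫ y, dz (Ph L) y * FF p ρ y) - ((∫ y in S, FF p ρ y : ℝ) : ℂ)‖ ≤ (CΦ + 1) * b := by
    rw [← integral_indicator hS, ← integral_complex_ofReal, ← integral_sub j1 j2, ← aA, ← integral_const_mul]
    apply norm_integral_le_of_norm_le (iA.const_mul _)
    filter_upwards with y
    have e5 : dz (Ph L) y * FF p ρ y - ((S.indicator (FF p ρ) y : ℝ) : ℂ) = FF p ρ y * (dz (Ph L) y - S.indicator (fun _ => (1:ℂ)) y) := by
      by_cases h1 : y ∈ S <;> simp [h1] <;> ring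
    rw [e5, norm_mul, Complex.norm_real, Real.norm_of_nonneg (h.FF0 y)]
    by_cases hy : y ∈ A
    · have : A.indicator ρ y = ρ y := by simp [hy]
      rw [this, mul_comm]
      have k1 : ‖dz (Ph L) y - S.indicator (fun _ => (1:ℂ)) y‖ ≤ CΦ + 1 :=
        (norm_sub_le _ _).trans (add_le_add (Ph_dz_bound hL y) (ind1 _ _))
      have := h.FF_le y
      have := h.FF0 y
      gcongr
    · rw [hD y hy]; simp [hy]
  have hpi : (0:ℝ) ≤ 1 / (8 * π) := by positivity
  have fin : ((1 / (8 * π) * a ^ 2 - ∫ y in S, FF p ρ y : ℝ) : ℂ) =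
     (1 / (8 * π) * (∫ q : ℂ × ℂ, (ρ q.1 * ρ q.2 * ((Ph L q.1 - Ph L q.2) / (q.1 - q.2)) : ℂ)) - ∫ y, dz (Ph L) y * FF p ρ y)
     - ((1 / (8 * π) : ℝ) : ℂ) * ((∫ q : ℂ × ℂ, (ρ q.1 * ρ q.2 * ((Ph L q.1 - Ph L q.2) / (q.1 - q.2)) : ℂ)) - ((a ^ 2 : ℝ) : ℂ))
     + ((∫ y, dz (Ph L) y * FF p ρ y) - ((∫ y in S, FF p ρ y : ℝ) : ℂ)) := by
    push_cast; ring
  rw [← Real.norm_eq_abs, ← Complex.norm_real, fin]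
  refine (norm_add_le _ _).trans (add_le_add ((norm_sub_le _ _).trans (add_le_add h0 ?_)) Q)
  rw [norm_mul, Complex.norm_real, Real.norm_of_nonneg hpi]
  gcongr

end Pk
end

noncomputable section

lemma HasW.mvt {g : ℂ → ℂ} {a b : ℂ → ℂ} {z : ℂ} {k : ℝ}
    (h : ∀ y, ‖y‖ ≤ ‖z‖ → HasW g (a y) (b y) y) (hk : ∀ y, ‖y‖ ≤ ‖z‖ → ‖a y‖ + ‖b y‖ ≤ k) :
    ‖g z - g 0‖ ≤ k * ‖z‖ := by
  have := Convex.norm_image_sub_le_of_norm_hasFDerivWithin_le (𝕜 := ℝ) (f := g) (f' := fun y => wL (a y) (b y))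
    (s := closedBall (0:ℂ) ‖z‖) (x := 0) (y := z) (C := k) (fun y hy => (h y (by simpa using hy)).hasFDerivWithinAt) ?_
    (convex_closedBall _ _) (by simp) (by simp)
  · simpa using this
  · intro y hy
    have hy' : ‖y‖ ≤ ‖z‖ := by simpa using hy
    refine ContinuousLinearMap.opNorm_le_bound _ ((add_nonneg (norm_nonneg _) (norm_nonneg _)).trans (hk y hy')) (fun e => ?_)
    rw [wL_apply]
    refine (norm_add_le _ _).trans ?_
    rw [norm_mul, norm_mul, RCLike.norm_conj, ← add_mul]
    exact mul_le_mul_of_nonneg_right (hk y hy') (norm_nonneg _)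

lemma HasR.mvt {g : ℂ → ℝ} {a : ℂ → ℂ} {z : ℂ} {k : ℝ}
    (h : ∀ y, ‖y‖ ≤ ‖z‖ → HasR g (a y) y) (hk : ∀ y, ‖y‖ ≤ ‖z‖ → ‖a y‖ ≤ k) :
    |g z - g 0| ≤ 2 * k * ‖z‖ := by
  have := HasW.mvt (g := fun y => (g y : ℂ)) (b := fun y => (starRingEnd ℂ) (a y)) (k := 2 * k) h
    (fun y hy => by rw [RCLike.norm_conj]; have := hk y hy; linarith)
  simp only [← Complex.ofReal_sub, Complex.norm_real, Real.norm_eq_abs] at this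
  exact this

lemma log_one_add_ge {x : ℝ} (h1 : -(1/2) ≤ x) (h2 : x ≤ 0) : x - 2 * x ^ 2 ≤ Real.log (1 + x) := by
  have := Real.abs_log_sub_add_sum_range_le (x := -x) (by rw [abs_lt]; constructor <;> linarith) 1
  simp at this
  rw [abs_of_nonpos h2] at this
  have h3 : x ^ 2 / (1 + x) ≤ 2 * x ^ 2 := by
    rw [div_le_iff₀ (by linarith)]; nlinarith [sq_nonneg x]
  rw [abs_le] at this
  have h4 : (1 : ℝ) - (-x) = 1 + x := by ring
  have := this.1
  simp only [sub_neg_eq_add] at this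
  linarith

lemma rpow_one_add_le {v p : ℝ} (hp : 0 < p) (h : 0 < 1 + v / p) {q : ℝ} (hq : 0 ≤ q) :
    (1 + v / p) ^ q ≤ Real.exp (v * (q / p)) := by
  rw [Real.rpow_def_of_pos h]
  apply Real.exp_le_exp.mpr
  have := Real.log_le_sub_one_of_pos h
  calc _ ≤ (v / p) * q := by gcongr; linarith
    _ = _ := by ring

lemma rpow_one_add_ge {v p : ℝ} (hp : 0 < p) (h1 : -(p / 2) ≤ v) (h2 : v ≤ 0) :
    Real.exp (v - 2 * v ^ 2 / p) ≤ (1 + v / p) ^ p := by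
  have h3 : -(1/2) ≤ v / p := by rw [le_div_iff₀ hp]; linarith
  have h4 : v / p ≤ 0 := div_nonpos_of_nonpos_of_nonneg h2 hp.le
  rw [Real.rpow_def_of_pos (by linarith)]
  apply Real.exp_le_exp.mpr
  have := log_one_add_ge h3 h4
  calc v - 2 * v ^ 2 / p = (v / p - 2 * (v / p) ^ 2) * p := by field_simp
    _ ≤ _ := by gcongr

namespace Pk
variable {B p R : ℝ} {v : ℂ → ℝ} {vz hh : ℂ → ℂ} {ρ : ℂ → ℝ}

lemma m26 (h : Pk B p R v vz hh ρ) : ∫ y, ρ y ≤ 26 := by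
  have := h.mass; have := Real.pi_lt_d2; linarith

lemma vz_bd (h : Pk B p R v vz hh ρ) {z : ℂ} (hz : z ∈ ball (0:ℂ) R) : ‖vz z‖ ≤ B + 3 := by
  rw [h.rep z hz]
  have h1 := h.hhB z hz
  have h2 : B / R ≤ B := div_le_self (by linarith [h.hB]) h.R0
  have h3 := (CT_le h.ρi h.ρ0 h.ρ1 z).trans (kern_le h.ρi h.ρ0 h.ρ1 z)
  have h4 := h.mass
  refine (norm_sub_le _ _).trans (add_le_add (h1.trans h2) ?_)
  rw [norm_mul]
  have : ‖(1 / (4 * π) : ℂ)‖ = 1 / (4 * π) := by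
    rw [norm_div, norm_mul, Complex.norm_real, Real.norm_of_nonneg pi_pos.le]; simp
  rw [this, div_mul_eq_mul_div, div_le_iff₀ (by positivity)]
  have := Real.pi_gt_three
  linarith

lemma v_bd (h : Pk B p R v vz hh ρ) {z : ℂ} (hz : z ∈ ball (0:ℂ) R) : |v z| ≤ 2 * (B + 3) * ‖z‖ := by
  have hz' : ‖z‖ < R := by simpa using hz
  have := HasR.mvt (g := v) (a := vz) (z := z) (k := B + 3) (fun y hy => h.hv y (by simpa using hy.trans_lt hz'))
    (fun y hy => h.vz_bd (by simpa using hy.trans_lt hz'))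
  rwa [h.v0, sub_zero] at this

lemma ball_mass (h : Pk B p R v vz hh ρ) (hp : 4 * (B + 3) ≤ p) {s : ℝ} (hs : 1 ≤ s) :
    π * Real.exp (-(4 * (B + 3))) ≤ ∫ y in ball (0:ℂ) s, ρ y := by
  have h1 : ∫ y in ball (0:ℂ) 1, Real.exp (-(4 * (B + 3))) ≤ ∫ y in ball (0:ℂ) 1, ρ y := by
    apply setIntegral_mono_on (by simp [Complex.volume_ball]) h.ρi.integrableOn measurableSet_ball
    intro y hy
    have hy1 : ‖y‖ < 1 := by simpa using hy
    have hyR : y ∈ ball (0:ℂ) R := by simp; linarith [h.R0]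
    rw [h.ρv y hyR]
    have hv := h.v_bd hyR
    have hv0 := h.vle y hyR
    have hB := h.hB
    have hp0 := h.p0
    have hv2 : |v y| ≤ 2 * (B + 3) := hv.trans (by nlinarith)
    rw [abs_of_nonpos hv0] at hv2
    refine le_trans (Real.exp_le_exp.mpr ?_) (rpow_one_add_ge hp0 (by linarith) hv0)
    have : 2 * v y ^ 2 / p ≤ - v y := by
      rw [div_le_iff₀ hp0]; nlinarith
    linarith
  have h2 : ∫ y in ball (0:ℂ) 1, ρ y ≤ ∫ y in ball (0:ℂ) s, ρ y :=
    setIntegral_mono_set h.ρi.integrableOn (Eventually.of_forall h.ρ0) (ball_subset_ball hs).eventuallyLE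
  refine le_trans ?_ (h1.trans h2)
  simp [Measure.real, Complex.volume_ball]

lemma FF_close (h : Pk B p R v vz hh ρ) {s : ℝ} (hs : 0 ≤ s) (hsR : s ≤ R) :
    |(∫ y in ball (0:ℂ) s, FF p ρ y) - ∫ y in ball (0:ℂ) s, ρ y| ≤ 26 * (1 + 2 * (B + 3) * s) / p := by
  have hp := h.p0
  have hB := h.hB
  rw [← integral_sub h.FFi.integrableOn h.ρi.integrableOn, ← Real.norm_eq_abs]
  have h1 : ∀ y ∈ ball (0:ℂ) s, ‖FF p ρ y - ρ y‖ ≤ (1 + 2 * (B + 3) * s) / p * ρ y := by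
    intro y hy
    have hy1 : ‖y‖ < s := by simpa using hy
    have hyR : y ∈ ball (0:ℂ) R := by simp; linarith
    have hv := h.v_bd hyR
    have hv0 := h.vle y hyR
    have e1 : FF p ρ y = p / (p + 1) * (ρ y * (1 + v y / p)) := by
      unfold FF
      rw [← h.ρroot hyR]
      have : 0 < ρ y := by rw [h.ρv y hyR]; exact Real.rpow_pos_of_pos (h.vpos y hyR) _
      rw [Real.rpow_add this, Real.rpow_one]
    have e2 : FF p ρ y - ρ y = -(ρ y * ((1 - v y) / (p + 1))) := by
      rw [e1]; field_simp; ring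
    rw [e2, norm_neg, norm_mul, Real.norm_of_nonneg (h.ρ0 y), mul_comm]
    have := h.ρ0 y
    gcongr
    rw [abs_of_nonpos hv0] at hv
    rw [Real.norm_of_nonneg (by apply div_nonneg <;> linarith)]
    have : 2 * (B + 3) * ‖y‖ ≤ 2 * (B + 3) * s := by gcongr
    gcongr <;> linarith
  calc _ ≤ ∫ y in ball (0:ℂ) s, (1 + 2 * (B + 3) * s) / p * ρ y := by
        apply norm_integral_le_of_norm_le (h.ρi.const_mul _).integrableOn
        exact (ae_restrict_iff' measurableSet_ball).mpr (Eventually.of_forall h1)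
    _ ≤ ∫ y, (1 + 2 * (B + 3) * s) / p * ρ y := by
        apply setIntegral_le_integral (h.ρi.const_mul _)
        filter_upwards with y
        have := h.ρ0 y
        simp only [Pi.zero_apply]
        positivity
    _ ≤ _ := by
        rw [integral_const_mul]
        have := h.m26
        calc _ ≤ (1 + 2 * (B + 3) * s) / p * 26 := by gcongr
          _ = _ := by ring

end Pk

set_option maxHeartbeats 1000000 in
lemma tight (B κ : ℝ) (hB : 1 ≤ B) (hκ : 0 < κ) : ∃ K P0 : ℝ, 1 ≤ K ∧ 0 < P0 ∧ ∀ (p R : ℝ) (v : ℂ → ℝ) (vz hh : ℂ → ℂ) (ρ : ℂ → ℝ),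
    Pk B p R v vz hh ρ → P0 ≤ p → K ≤ R ∧ 8 * π - κ ≤ ∫ y in ball (0:ℂ) K, ρ y := by
  set c0 := π * Real.exp (-(4 * (B + 3))) with hc0
  have hc0p : 0 < c0 := by positivity
  set e1 := κ * c0 / (8 * π) with he1
  have he1p : 0 < e1 := by positivity
  set Λ := max 1 (120 / e1) with hΛ
  have hΛ1 : 1 ≤ Λ := le_max_left _ _
  have hΛ2 : 30 / Λ ≤ e1 / 4 := by
    have : 120 / e1 ≤ Λ := le_max_right _ _
    rw [div_le_iff₀ he1p] at this
    rw [div_le_iff₀ (by linarith)]; linarith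
  have hC := CΦ_one
  obtain ⟨N, hN⟩ := exists_nat_gt (416 * (CΦ + 1) / e1)
  have hN0 : (0:ℝ) < N := lt_of_le_of_lt (by positivity) hN
  have hN2 : 4 * (CΦ + 1) * (26 / N) ≤ e1 / 4 := by
    rw [div_lt_iff₀ he1p] at hN
    rw [mul_div_assoc', div_le_iff₀ hN0]; linarith
  set T := (3 * Λ) ^ N with hT
  have hT1 : 1 ≤ T := one_le_pow₀ (by linarith)
  set P0 := max (max (208 * T * B / e1) (104 * (1 + 2 * (B + 3) * T) / e1)) (max (2 * T) (4 * (B + 3))) with hP0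
  refine ⟨T, P0, hT1, lt_of_lt_of_le (by linarith : 0 < 2 * T) ((le_max_left _ _).trans (le_max_right _ _)), ?_⟩
  intro p R v vz hh ρ h hpP
  have hp1 : 208 * T * B / e1 ≤ p := ((le_max_left _ _).trans (le_max_left _ _)).trans hpP
  have hp2 : 104 * (1 + 2 * (B + 3) * T) / e1 ≤ p := ((le_max_right _ _).trans (le_max_left _ _)).trans hpP
  have hp3 : 2 * T ≤ p := ((le_max_left _ _).trans (le_max_right _ _)).trans hpP
  have hp4 : 4 * (B + 3) ≤ p := ((le_max_right _ _).trans (le_max_right _ _)).trans hpP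
  have hp0 := h.p0
  have hpR : p ≤ R := le_trans (by
    calc p = p ^ 1 := (pow_one p).symm
      _ ≤ p ^ 10 := pow_le_pow_right₀ (by linarith [h.hp]) (by norm_num)) h.hR
  have hTR : T ≤ R := by linarith
  refine ⟨hTR, ?_⟩
  set M : ℝ → ℝ := fun s => ∫ y in ball (0:ℂ) s, ρ y with hM
  set s : ℕ → ℝ := fun j => (3 * Λ) ^ j with hs
  have hs1 : ∀ j, 1 ≤ s j := fun j => one_le_pow₀ (by linarith)
  have hsT : ∀ j ≤ N, s j ≤ T := fun j hj => pow_le_pow_right₀ (by linarith) hj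
  obtain ⟨j, hj, hjb⟩ : ∃ j < N, M (s (j+1)) - M (s j) ≤ 26 / N := by
    by_contra! hcon
    have h1 : ∑ j ∈ Finset.range N, (26 / N : ℝ) < ∑ j ∈ Finset.range N, (M (s (j+1)) - M (s j)) := by
      apply Finset.sum_lt_sum_of_nonempty
      · simp; rintro rfl; simp at hN0
      · intro j hj; exact hcon j (by simpa using hj)
    rw [Finset.sum_range_sub (fun j => M (s j))] at h1
    simp only [Finset.sum_const, Finset.card_range, nsmul_eq_mul] at h1
    rw [mul_div_cancel₀ _ hN0.ne'] at h1
    have h2 : M (s N) ≤ 26 := (setIntegral_le_integral h.ρi (Eventually.of_forall h.ρ0)).trans h.m26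
    have h3 : 0 ≤ M (s 0) := integral_nonneg h.ρ0
    linarith
  set r := s j with hr
  have hr1 : 1 ≤ r := hs1 j
  have hsj : s (j+1) = 3 * Λ * r := by simp only [hr, hs]; rw [pow_succ]; ring
  have hrT : 3 * Λ * r ≤ T := by rw [← hsj]; exact hsT (j+1) hj
  have hΛr : r ≤ Λ * r := le_mul_of_one_le_left (by linarith) hΛ1
  set A : Set ℂ := {y | r ≤ ‖y‖ ∧ ‖y‖ ≤ 2 * (Λ * r)} with hA
  have hAm : MeasurableSet A :=
    (measurableSet_le measurable_const measurable_norm).inter (measurableSet_le measurable_norm measurable_const)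
  have hb : ∫ y in A, ρ y ≤ 26 / N := by
    refine le_trans ?_ hjb
    have e : M (s (j+1)) - M r = ∫ y in ball (0:ℂ) (s (j+1)) \ ball 0 r, ρ y := by
      rw [setIntegral_sdiff measurableSet_ball h.ρi.integrableOn]
      apply ball_subset_ball; rw [hsj]; nlinarith
    rw [e]
    apply setIntegral_mono_set h.ρi.integrableOn (Eventually.of_forall h.ρ0)
    refine LE.le.eventuallyLE ?_
    intro y hy
    simp only [hA, Set.mem_ofPred_eq] at hy
    simp only [Set.mem_sdiff, mem_ball_zero_iff, not_lt]
    refine ⟨?_, hy.1⟩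
    rw [hsj]; nlinarith [hy.2]
  have hmain := h.pohG (L := Λ * r) (κ := 1 / Λ) (S := ball 0 r) (A := A) (by positivity) (by nlinarith) (by positivity) measurableSet_ball hAm ?_ ?_
  rotate_left
  · intro z y hz hy hzy
    have hL : 0 < Λ * r := by positivity
    have key : ∀ z y : ℂ, ‖z‖ < r → 2 * (Λ * r) < ‖y‖ → ‖z / (z - y)‖ ≤ 1 / Λ := by
      intro z y hz hy
      have h1 : Λ * r ≤ ‖z - y‖ := by
        have := norm_sub_norm_le y z
        rw [norm_sub_rev] at this
        linarith
      rw [norm_div]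
      calc _ ≤ r / (Λ * r) := by gcongr
        _ = _ := by field_simp
    simp only [hA, Set.mem_ofPred_eq, not_and_or, not_le] at hz hy
    have hr0 : 0 ≤ 1 / Λ := by positivity
    have hsub : z - y ≠ 0 := sub_ne_zero.mpr hzy
    rcases hz with hz | hz <;> rcases hy with hy | hy
    · rw [Ph_id hL (by linarith), Ph_id hL (by linarith)]
      simp only [Set.indicator, mem_ball_zero_iff, hz, hy, if_true]
      rw [div_self hsub]; simpa using hr0
    · rw [Ph_id hL (by linarith), Ph_zero hL hy.le]
      have : ¬ ‖y‖ < r := by linarith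
      simp only [Set.indicator, mem_ball_zero_iff, this, if_false]
      simpa using key z y hz hy
    · rw [Ph_id (z := y) hL (by linarith), Ph_zero (z := z) hL hz.le]
      have : ¬ ‖z‖ < r := by linarith
      simp only [Set.indicator, mem_ball_zero_iff, this, if_false]
      have := key y z hy hz
      rw [norm_div, norm_sub_rev] at this
      simpa using this
    · rw [Ph_zero hL hy.le, Ph_zero hL hz.le]
      have : ¬ ‖z‖ < r := by linarith
      simp only [Set.indicator, mem_ball_zero_iff, this, if_false]
      simpa using hr0
  · intro y hy
    have hL : 0 < Λ * r := by positivity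
    simp only [hA, Set.mem_ofPred_eq, not_and_or, not_le] at hy
    rcases hy with hy | hy
    · rw [Ph_dz_one hL (by linarith)]
      simp [Set.indicator, hy]
    · rw [Ph_dz_zero hL hy]
      have : ¬ ‖y‖ < r := by linarith
      simp [Set.indicator, this]
  have hFc := h.FF_close (s := r) (by linarith) (by nlinarith)
  set a := ∫ y in ball (0:ℂ) r, ρ y with ha
  have ha0 : c0 ≤ a := h.ball_mass hp4 hr1
  set b := ∫ y in A, ρ y with hbb
  have hb0 : 0 ≤ b := integral_nonneg h.ρ0
  set m := ∫ y, ρ y with hm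
  have hm0 : 0 ≤ m := h.mpos
  have hm26 : m ≤ 26 := h.m26
  have hLT : Λ * r ≤ T := by nlinarith
  have hrT' : r ≤ T := by linarith
  have hB0 : 0 ≤ B := by linarith
  have hR0 : 0 < R := by linarith
  have hT0 : 0 < T := by linarith
  have hΛ0 : 0 < Λ := by linarith
  clear_value a b m r T Λ
  have E1 : 2 * (Λ * r) * (B / R) * m ≤ e1 / 4 := by
    calc _ ≤ 2 * T * (B / p) * 26 := by gcongr
      _ = 52 * T * B / p := by ring
      _ ≤ e1 / 4 := by
        rw [div_le_iff₀ he1p] at hp1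
        rw [div_le_iff₀ hp0]; linarith
  have E2 : 26 * (1 + 2 * (B + 3) * r) / p ≤ e1 / 4 := by
    rw [div_le_iff₀ he1p] at hp2
    rw [div_le_iff₀ hp0]
    have : 2 * (B + 3) * r ≤ 2 * (B + 3) * T := by gcongr
    linarith
  have hpi3 := Real.pi_gt_three
  have E3 : 1 / (8 * π) * (2 * (CΦ + 1) * m * b + 1 / Λ * m ^ 2) + (CΦ + 1) * b ≤ e1 / 4 + e1 / 4 := by
    have q1 : 1 / (8 * π) ≤ 1 / 24 := by gcongr; linarith
    have q2 : 2 * (CΦ + 1) * m * b ≤ 52 * (CΦ + 1) * b := by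
      have : 0 ≤ (CΦ + 1) * b := by positivity
      nlinarith
    have q3 : 1 / Λ * m ^ 2 ≤ 1 / Λ * 676 := by gcongr; nlinarith
    calc _ ≤ 1 / 24 * (52 * (CΦ + 1) * b + 1 / Λ * 676) + (CΦ + 1) * b := by gcongr
      _ ≤ 4 * (CΦ + 1) * b + 30 / Λ := by
        have : 0 ≤ (CΦ + 1) * b := by positivity
        have : 0 < 1 / Λ := by positivity
        rw [show 30 / Λ = 30 * (1 / Λ) by ring]
        linarith
      _ ≤ 4 * (CΦ + 1) * (26 / N) + 30 / Λ := by gcongr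
      _ ≤ _ := by linarith
  have fin : |1 / (8 * π) * a ^ 2 - a| ≤ e1 := by
    rw [abs_le] at hmain hFc ⊢
    constructor <;> linarith [hmain.1, hmain.2, hFc.1, hFc.2]
  have : 8 * π - κ ≤ a := by
    rw [abs_le] at fin
    have f1 := fin.1
    by_contra! hcon
    have f2 : 1 / (8 * π) * a ^ 2 - a = - (a * (8 * π - a) / (8 * π)) := by field_simp; ring
    rw [f2] at f1
    have f3 : c0 * κ < a * (8 * π - a) := by
      have : κ < 8 * π - a := by linarith
      calc c0 * κ < c0 * (8 * π - a) := by gcongr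
        _ ≤ _ := by gcongr; linarith
    have f4 : e1 < a * (8 * π - a) / (8 * π) := by
      rw [he1]; apply div_lt_div_of_pos_right _ (by positivity); linarith
    linarith
  refine this.trans ?_
  rw [ha]
  exact setIntegral_mono_set h.ρi.integrableOn (Eventually.of_forall h.ρ0) (ball_subset_ball hrT').eventuallyLE

end

noncomputable section

namespace Pk
variable {B p R : ℝ} {v : ℂ → ℝ} {vz hh : ℂ → ℂ} {ρ : ℂ → ℝ}

lemma CTcont (h : Pk B p R v vz hh ρ) : Continuous (CT (fun y => (ρ y : ℂ))) := by
  rw [continuous_iff_continuousAt]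
  intro z
  exact (CT_hasW _ (h.ρCC.of_le (by norm_num)) h.ρcC z).continuousAt

lemma v_rep (h : Pk B p R v vz hh ρ) {z : ℂ} (hz : z ∈ ball (0:ℂ) R) :
    |v z + 1 / (2 * π) * ∫ y, ρ y * (Real.log ‖z - y‖ - Real.log ‖y‖)| ≤ 2 * B := by
  have hR := h.R0
  have hB := h.hB
  have hz' : ‖z‖ < R := by simpa using hz
  have hmem : ∀ t ∈ Set.uIcc (0:ℝ) 1, (0:ℂ) + (t:ℂ) * z ∈ ball (0:ℂ) R := by
    intro t ht
    rw [Set.uIcc_of_le zero_le_one] at ht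
    simp only [zero_add, mem_ball_zero_iff, norm_mul, Complex.norm_real, Real.norm_eq_abs, abs_of_nonneg ht.1]
    nlinarith [ht.2, norm_nonneg z]
  have hline : ContinuousOn (fun t : ℝ => (0:ℂ) + (t:ℂ) * z) (Set.uIcc 0 1) := by fun_prop
  have hvc : ContinuousOn (fun t : ℝ => vz ((0:ℂ) + (t:ℂ) * z)) (Set.uIcc 0 1) :=
    h.vzC.continuousOn.comp hline hmem
  have hhc : ContinuousOn (fun t : ℝ => hh ((0:ℂ) + (t:ℂ) * z)) (Set.uIcc 0 1) :=
    h.hol.continuousOn.comp hline hmem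
  have h1 := intervalIntegral.integral_eq_sub_of_hasDerivAt (a := 0) (b := 1)
      (f := fun s : ℝ => v ((0:ℂ) + (s:ℂ) * z))
      (fun t ht => (h.hv _ (hmem t ht)).line) (by
        apply ContinuousOn.intervalIntegrable
        exact continuousOn_const.mul (Complex.continuous_re.comp_continuousOn (hvc.mul continuousOn_const)))
  simp only [Complex.ofReal_one, one_mul, Complex.ofReal_zero, zero_mul, zero_add, h.v0, sub_zero] at h1
  have h2 := CT_line_log h.ρC.continuous h.ρc 0 z
  simp only [zero_add, zero_sub, norm_neg] at h2
  have hCTc : Continuous (fun t : ℝ => CT (fun y => (ρ y : ℂ)) ((t:ℂ) * z)) := h.CTcont.comp (by fun_prop)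
  simp only [zero_add] at hhc hvc hmem
  have h3 : ∫ t in (0:ℝ)..1, 2 * (vz (t * z) * z).re =
      (∫ t in (0:ℝ)..1, 2 * (hh (t * z) * z).re) - ∫ t in (0:ℝ)..1, 1 / (2 * π) * (z * CT (fun y => (ρ y : ℂ)) (t * z)).re := by
    rw [← intervalIntegral.integral_sub]
    · apply intervalIntegral.integral_congr
      intro t ht
      simp only
      rw [h.rep _ (hmem t ht)]
      have e : (1 / (4 * (π:ℂ))) = ((1 / (4 * π) : ℝ) : ℂ) := by push_cast; rfl
      rw [e, sub_mul, Complex.sub_re, mul_assoc, Complex.re_ofReal_mul, mul_comm (CT _ _) z]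
      field_simp
      ring
    · apply ContinuousOn.intervalIntegrable
      exact continuousOn_const.mul (Complex.continuous_re.comp_continuousOn (hhc.mul continuousOn_const))
    · apply Continuous.intervalIntegrable
      have := Complex.continuous_re
      fun_prop
  rw [intervalIntegral.integral_const_mul (1 / (2 * π)), h2] at h3
  have h4 : |∫ t in (0:ℝ)..1, 2 * (hh (t * z) * z).re| ≤ 2 * B * |(1:ℝ) - 0| := by
    rw [← Real.norm_eq_abs (∫ t in (0:ℝ)..1, 2 * (hh (t * z) * z).re)]
    apply intervalIntegral.norm_integral_le_of_norm_le_const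
    intro t ht
    have ht' : t ∈ Set.uIcc (0:ℝ) 1 := Set.uIoc_subset_uIcc ht
    rw [norm_mul, Real.norm_of_nonneg (by norm_num : (0:ℝ) ≤ 2)]
    gcongr
    refine (Complex.abs_re_le_norm _).trans ?_
    rw [norm_mul]
    calc _ ≤ B / R * R := by
          gcongr
          exact h.hhB _ (hmem t ht')
      _ = B := by field_simp
  have h5 : v z + 1 / (2 * π) * ∫ y, ρ y * (Real.log ‖z - y‖ - Real.log ‖y‖) = ∫ t in (0:ℝ)..1, 2 * (hh (t * z) * z).re := by
    rw [← h1, h3]; ring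
  rw [h5]
  simpa using h4

lemma logdiff_int (h : Pk B p R v vz hh ρ) (z : ℂ) :
    Integrable (fun y => ρ y * (Real.log ‖z - y‖ - Real.log ‖y‖)) := by
  have h1 := logker_integrable h.ρC.continuous h.ρc z
  have h2 := logker_integrable h.ρC.continuous h.ρc 0
  simp only [zero_sub, norm_neg] at h2
  have := h1.sub h2
  refine this.congr (Eventually.of_forall fun y => ?_)
  simp only [Pi.sub_apply]; ring

end Pk

lemma log_diff_le {a b c : ℝ} (ha : 0 < a) (hb : 0 < b) (hc : 0 ≤ c) (hab : a ≤ b + c) :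
    Real.log a - Real.log b ≤ Real.log (1 + c) + b⁻¹ := by
  rw [← Real.log_div ha.ne' hb.ne']
  have h1 : a / b ≤ (1 + c) * (1 + b⁻¹) := by
    rw [div_le_iff₀ hb]
    have : (1 + c) * (1 + b⁻¹) * b = (1 + c) * (b + 1) := by field_simp
    rw [this]; nlinarith
  have h2 : 0 < b⁻¹ := by positivity
  calc _ ≤ Real.log ((1 + c) * (1 + b⁻¹)) := Real.log_le_log (by positivity) h1
    _ = Real.log (1 + c) + Real.log (1 + b⁻¹) := Real.log_mul (by positivity) (by positivity)
    _ ≤ _ := by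
      have := Real.log_le_sub_one_of_pos (x := 1 + b⁻¹) (by positivity)
      linarith

lemma ae_ne (z : ℂ) : ∀ᵐ y : ℂ, y ≠ z := by
  simp [ae_iff]

namespace Pk
variable {B p R : ℝ} {v : ℂ → ℝ} {vz hh : ℂ → ℂ} {ρ : ℂ → ℝ}

lemma I_le (h : Pk B p R v vz hh ρ) (z : ℂ) :
    ∫ y, ρ y * (Real.log ‖z - y‖ - Real.log ‖y‖) ≤ (∫ y, ρ y) * Real.log (1 + ‖z‖) + (2 * π + ∫ y, ρ y) := by
  have hk := kern_integrable h.ρi h.ρ0 h.ρ1 0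
  have hk2 := kern_le h.ρi h.ρ0 h.ρ1 0
  have hk3 : Integrable (fun y => ρ y * Real.log (1 + ‖z‖)) := h.ρi.mul_const _
  calc _ ≤ ∫ y, (ρ y * Real.log (1 + ‖z‖) + ρ y / ‖0 - y‖) := by
        apply integral_mono_ae (h.logdiff_int z) (hk3.add hk)
        filter_upwards [ae_ne z, ae_ne 0] with y hy1 hy2
        simp only [Pi.add_apply]
        rw [zero_sub, norm_neg, div_eq_mul_inv, ← mul_add]
        apply mul_le_mul_of_nonneg_left _ (h.ρ0 y)
        apply log_diff_le (by simpa [sub_eq_zero] using hy1.symm) (by simpa using hy2) (norm_nonneg z)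
        rw [add_comm]; exact norm_sub_le z y
    _ ≤ _ := by
        rw [integral_add hk3 hk, integral_mul_const]
        linarith

lemma I_ge (h : Pk B p R v vz hh ρ) {z : ℂ} {K : ℝ} (hK : 1 ≤ K) (hz : 2 * K ≤ ‖z‖) :
    (∫ y in ball (0:ℂ) K, ρ y) * (2 * Real.log (1 + ‖z‖) - Real.log (4 * K)) - (∫ y, ρ y) * Real.log (1 + ‖z‖) - (2 * π + ∫ y, ρ y)
    ≤ ∫ y, ρ y * (Real.log ‖z - y‖ - Real.log ‖y‖) := by
  have hk := kern_integrable h.ρi h.ρ0 h.ρ1 z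
  have hk2 := kern_le h.ρi h.ρ0 h.ρ1 z
  set a := 2 * Real.log (1 + ‖z‖) - Real.log (4 * K) with ha
  have hk3 : Integrable (fun y => ρ y * Real.log (1 + ‖z‖)) := h.ρi.mul_const _
  have hk4 : Integrable (fun y => (ball (0:ℂ) K).indicator (fun y => ρ y * a) y) := (h.ρi.mul_const a).indicator measurableSet_ball
  have hk5 : Integrable (fun y => (ball (0:ℂ) K).indicator (fun y => ρ y * a) y - ρ y * Real.log (1 + ‖z‖)) := hk4.sub hk3
  calc _ ≤ ∫ y, ((ball (0:ℂ) K).indicator (fun y => ρ y * a) y - ρ y * Real.log (1 + ‖z‖) - ρ y / ‖z - y‖) := by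
        rw [integral_sub hk5 hk, integral_sub hk4 hk3, integral_mul_const, integral_indicator measurableSet_ball, integral_mul_const]
        linarith
    _ ≤ _ := by
        apply integral_mono_ae (hk5.sub hk) (h.logdiff_int z)
        filter_upwards [ae_ne z, ae_ne 0] with y hy1 hy2
        simp only [Pi.sub_apply]
        have hyp : 0 < ‖y‖ := by simpa using hy2
        have hzy : 0 < ‖z - y‖ := by simpa [sub_eq_zero] using hy1.symm
        have h0 := h.ρ0 y
        by_cases hyK : y ∈ ball (0:ℂ) K
        · have hyK' : ‖y‖ < K := by simpa using hyK
          rw [Set.indicator_of_mem hyK, ← mul_sub]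
          have h1 : (1 + ‖z‖) / 4 ≤ ‖z - y‖ := by
            have := norm_sub_norm_le z y
            linarith
          have h2 : Real.log (1 + ‖z‖) - Real.log 4 ≤ Real.log ‖z - y‖ := by
            rw [← Real.log_div (by positivity) (by positivity)]
            exact Real.log_le_log (by positivity) h1
          have h3 : Real.log ‖y‖ ≤ Real.log K := Real.log_le_log hyp hyK'.le
          have h4 : Real.log (4 * K) = Real.log 4 + Real.log K := Real.log_mul (by norm_num) (by positivity)
          have h5 : ρ y * (a - Real.log (1 + ‖z‖)) ≤ ρ y * (Real.log ‖z - y‖ - Real.log ‖y‖) := by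
            apply mul_le_mul_of_nonneg_left _ h0
            rw [ha]; linarith
          have : 0 ≤ ρ y / ‖z - y‖ := by positivity
          linarith
        · rw [Set.indicator_of_notMem hyK]
          have := log_diff_le (a := ‖y‖) (b := ‖z - y‖) (c := ‖z‖) hyp hzy (norm_nonneg z) (by
            have := norm_sub_norm_le y z
            rw [norm_sub_rev] at this; linarith)
          rw [div_eq_mul_inv]
          nlinarith

end Pk

lemma decay0 (B : ℝ) (hB : 1 ≤ B) : ∃ C P0 : ℝ, 0 < C ∧ 0 < P0 ∧ ∀ (p R : ℝ) (v : ℂ → ℝ) (vz hh : ℂ → ℂ) (ρ : ℂ → ℝ),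
    Pk B p R v vz hh ρ → P0 ≤ p → ∀ z ∈ ball (0:ℂ) R,
      v z ≤ C - 15 / 4 * Real.log (1 + ‖z‖) ∧ - v z ≤ C + 17 / 4 * Real.log (1 + ‖z‖) := by
  obtain ⟨K, P0, hK, hP0, H⟩ := tight B (1/10) hB (by norm_num)
  have hl4 : 0 ≤ Real.log (4 * K) := Real.log_nonneg (by linarith)
  have hl2 : 0 ≤ Real.log (1 + 2 * K) := Real.log_nonneg (by linarith)
  refine ⟨2 * B + 5 * Real.log (4 * K) + 6 + 15 / 4 * Real.log (1 + 2 * K), P0, by positivity, hP0, ?_⟩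
  intro p R v vz hh ρ h hp z hz
  obtain ⟨hKR, hmass⟩ := H p R v vz hh ρ h hp
  have hrep := abs_le.mp (h.v_rep hz)
  have hI := h.I_le z
  set I := ∫ y, ρ y * (Real.log ‖z - y‖ - Real.log ‖y‖) with hIdef
  set m := ∫ y, ρ y with hm
  have hm1 := h.mass
  have hm0 := h.mpos
  have hpi := Real.pi_gt_three
  have hpi0 := Real.pi_pos
  set ℓ := Real.log (1 + ‖z‖) with hℓ
  have hℓ0 : 0 ≤ ℓ := Real.log_nonneg (by linarith [norm_nonneg z])
  have e : 1 / (2 * π) * I = I / (2 * π) := by ring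
  rw [e] at hrep
  constructor
  · by_cases hzK : 2 * K ≤ ‖z‖
    · have hJ := h.I_ge hK hzK
      set a := ∫ y in ball (0:ℂ) K, ρ y with ha
      have ham : a ≤ m := setIntegral_le_integral h.ρi (Eventually.of_forall h.ρ0)
      have h1 : (15 / 2 * π) * ℓ - 10 * π * Real.log (4 * K) - 11 * π ≤ I := by
        have q1 : (8 * π - 3 / 10) * ℓ ≤ (2 * a - m) * ℓ := by
          apply mul_le_mul_of_nonneg_right _ hℓ0
          have : ∫ y, ρ y = m := rfl
          linarith
        have q2 : a * Real.log (4 * K) ≤ 10 * π * Real.log (4 * K) := by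
          apply mul_le_mul_of_nonneg_right _ hl4
          have : ∫ y, ρ y = m := rfl
          linarith
        have q3 : (15 / 2 * π) * ℓ ≤ (8 * π - 3 / 10) * ℓ := by
          apply mul_le_mul_of_nonneg_right _ hℓ0; linarith
        have : ∫ y, ρ y = m := rfl
        rw [mul_sub] at hJ
        rw [sub_mul] at q1
        linarith
      have h2 : 15 / 4 * ℓ - 5 * Real.log (4 * K) - 11 / 2 ≤ I / (2 * π) := by
        rw [le_div_iff₀ (by positivity)]; linarith
      linarith [hrep.2]
    · push Not at hzK
      have := h.vle z hz
      have : ℓ ≤ Real.log (1 + 2 * K) := Real.log_le_log (by linarith [norm_nonneg z]) (by linarith)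
      linarith
  · have h2 : I / (2 * π) ≤ 17 / 4 * ℓ + 6 := by
      rw [div_le_iff₀ (by positivity)]
      have q1 : m * ℓ ≤ 17 / 2 * π * ℓ := by
        apply mul_le_mul_of_nonneg_right _ hℓ0; linarith
      linarith
    linarith [hrep.1]

end

noncomputable section

/-- decay facts -/
structure Dc (C p R : ℝ) (v : ℂ → ℝ) (vz : ℂ → ℂ) (ρ : ℂ → ℝ) : Prop where
  C1 : 1 ≤ C
  ev : ∀ z ∈ ball (0:ℂ) R, Real.exp (v z) ≤ C * (1 + ‖z‖) ^ (-(15/4:ℝ))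
  lo : ∀ z ∈ ball (0:ℂ) R, - v z ≤ C + 17 / 4 * Real.log (1 + ‖z‖)
  ρd : ∀ y, ρ y ≤ C * (1 + ‖y‖) ^ (-(15/4:ℝ))
  ft : ∀ z ∈ ball (0:ℂ) R, (1 + v z / p) ^ (p - 1) ≤ C * (1 + ‖z‖) ^ (-(7/2:ℝ))
  vz : ∀ z ∈ ball (0:ℂ) R, ‖vz z‖ ≤ C / (1 + ‖z‖)
  ρz : ∀ y, ‖dz (fun y => (ρ y : ℂ)) y‖ ≤ C * (1 + ‖y‖) ^ (-(3:ℝ))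
  CTz : ∀ z, ‖CT (dz (fun y => (ρ y : ℂ))) z‖ ≤ C / (1 + ‖z‖)

lemma exp_w {c a : ℝ} (z : ℂ) : Real.exp (c - a * Real.log (1 + ‖z‖)) = Real.exp c * (1 + ‖z‖) ^ (-a) := by
  rw [Real.rpow_def_of_pos (w_pos z), ← Real.exp_add]; congr 1; ring

lemma w_mono (z : ℂ) {a b : ℝ} (hab : a ≤ b) : (1 + ‖z‖) ^ a ≤ (1 + ‖z‖) ^ b :=
  Real.rpow_le_rpow_of_exponent_le (w_one z) hab

lemma decay (B : ℝ) (hB : 1 ≤ B) : ∃ C P0 : ℝ, 1 ≤ C ∧ 0 < P0 ∧ ∀ (p R : ℝ) (v : ℂ → ℝ) (vz hh : ℂ → ℂ) (ρ : ℂ → ℝ),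
    Pk B p R v vz hh ρ → P0 ≤ p → Dc C p R v vz ρ := by
  obtain ⟨C0, P0, hC0, hP0, H⟩ := decay0 B hB
  set E := Real.exp C0 with hE
  have hE1 : 1 ≤ E := Real.one_le_exp hC0.le
  have hC3 := C3_pos
  set D := 2 * B + E * C3 with hD
  have hD1 : 1 ≤ D := by nlinarith
  set C := C0 + E + D + E * D + 1 + (E * D + 1) * C3 with hC
  have hED : 0 < E * D := by positivity
  have hEDC : 0 < (E * D + 1) * C3 := by positivity
  refine ⟨C, P0, by linarith, hP0, ?_⟩
  intro p R v vz hh ρ h hp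
  have H := H p R v vz hh ρ h hp
  have hEC : E ≤ C := by linarith
  have hp0 := h.p0
  have h20 := h.hp
  have hev : ∀ z ∈ ball (0:ℂ) R, Real.exp (v z) ≤ E * (1 + ‖z‖) ^ (-(15/4:ℝ)) := by
    intro z hz
    rw [hE, ← exp_w]
    exact Real.exp_le_exp.mpr (H z hz).1
  have hρd : ∀ y, ρ y ≤ E * (1 + ‖y‖) ^ (-(15/4:ℝ)) := by
    intro y
    by_cases hy : y ∈ ball (0:ℂ) R
    · rw [h.ρv y hy]
      refine le_trans ?_ (hev y hy)
      have := rpow_one_add_le hp0 (h.vpos y hy) hp0.le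
      rwa [div_self hp0.ne', mul_one] at this
    · have hy' : R ≤ ‖y‖ := by simpa using hy
      refine (h.ρd y hy').trans ((w_mono y (by norm_num : (-(4:ℝ)) ≤ -(15/4:ℝ))).trans ?_)
      exact le_mul_of_one_le_left (Real.rpow_nonneg (w_pos y).le _) hE1
  have hft : ∀ z ∈ ball (0:ℂ) R, (1 + v z / p) ^ (p - 1) ≤ E * (1 + ‖z‖) ^ (-(7/2:ℝ)) := by
    intro z hz
    refine (rpow_one_add_le hp0 (h.vpos z hz) (by linarith)).trans ?_
    rw [hE, ← exp_w]
    apply Real.exp_le_exp.mpr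
    have hs1 : (p - 1) / p ≤ 1 := by rw [div_le_one hp0]; linarith
    have hs2 : 19 / 20 ≤ (p - 1) / p := by rw [le_div_iff₀ hp0]; linarith
    have hl : 0 ≤ Real.log (1 + ‖z‖) := Real.log_nonneg (w_one z)
    set s := (p - 1) / p
    have := mul_le_mul_of_nonneg_right (H z hz).1 (by linarith : 0 ≤ s)
    refine this.trans ?_
    nlinarith
  have hvz : ∀ z ∈ ball (0:ℂ) R, ‖vz z‖ ≤ D / (1 + ‖z‖) := by
    intro z hz
    have hz' : ‖z‖ < R := by simpa using hz
    have hR := h.R0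
    have hw := w_pos z
    rw [h.rep z hz]
    refine (norm_sub_le _ _).trans ?_
    rw [norm_mul]
    have q1 : ‖hh z‖ ≤ 2 * B / (1 + ‖z‖) := by
      refine (h.hhB z hz).trans ?_
      rw [div_le_div_iff₀ (by linarith) hw]
      nlinarith
    have q2 : ‖CT (fun y => (ρ y : ℂ)) z‖ ≤ E * (C3 / (1 + ‖z‖)) := by
      apply CT_le_of_decay
      intro y
      rw [Complex.norm_real, Real.norm_of_nonneg (h.ρ0 y)]
      refine (hρd y).trans ?_
      gcongr E * ?_
      exact w_mono y (by norm_num)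
    have q3 : ‖(1 / (4 * π) : ℂ)‖ ≤ 1 := by
      have : (1 / (4 * π) : ℂ) = ((1 / (4 * π) : ℝ) : ℂ) := by push_cast; rfl
      rw [this, Complex.norm_real, Real.norm_of_nonneg (by positivity)]
      rw [div_le_one (by positivity)]; linarith [Real.pi_gt_three]
    calc _ ≤ 2 * B / (1 + ‖z‖) + 1 * (E * (C3 / (1 + ‖z‖))) := by gcongr
      _ = _ := by rw [hD]; ring
  have hρz : ∀ y, ‖dz (fun y => (ρ y : ℂ)) y‖ ≤ (E * D + 1) * (1 + ‖y‖) ^ (-(3:ℝ)) := by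
    intro y
    have hw3 : 0 ≤ (1 + ‖y‖) ^ (-(3:ℝ)) := Real.rpow_nonneg (w_pos y).le _
    by_cases hy : y ∈ ball (0:ℂ) R
    · rw [h.ρz hy, norm_mul, Complex.norm_real, Real.norm_of_nonneg (Real.rpow_nonneg (h.vpos y hy).le _)]
      calc _ ≤ (E * (1 + ‖y‖) ^ (-(7/2:ℝ))) * D := by
            gcongr
            · exact hft y hy
            · exact (hvz y hy).trans (div_le_self (by linarith) (w_one y))
        _ ≤ (E * (1 + ‖y‖) ^ (-(3:ℝ))) * D := by
            gcongr ?_ * D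
            gcongr E * ?_
            exact w_mono y (by norm_num)
        _ ≤ _ := by nlinarith
    · have hy' : R ≤ ‖y‖ := by simpa using hy
      refine (h.ρzd y hy').trans ?_
      nlinarith
  have hwn : ∀ (z : ℂ) (a : ℝ), 0 ≤ (1 + ‖z‖) ^ a := fun z a => Real.rpow_nonneg (w_pos z).le _
  refine ⟨by linarith, ?_, ?_, ?_, ?_, ?_, ?_, ?_⟩
  · intro z hz; exact (hev z hz).trans (mul_le_mul_of_nonneg_right hEC (hwn _ _))
  · intro z hz; linarith [(H z hz).2]
  · intro z; exact (hρd z).trans (mul_le_mul_of_nonneg_right hEC (hwn _ _))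
  · intro z hz; exact (hft z hz).trans (mul_le_mul_of_nonneg_right hEC (hwn _ _))
  · intro z hz; exact (hvz z hz).trans (by have := w_pos z; gcongr; linarith)
  · intro z; exact (hρz z).trans (mul_le_mul_of_nonneg_right (by linarith) (hwn _ _))
  · intro z
    refine (CT_le_of_decay hρz z).trans ?_
    rw [mul_div_assoc']
    have := w_pos z
    gcongr
    linarith

end

noncomputable section

lemma deriv_bound {hh : ℂ → ℂ} {R b : ℝ} (hR : 0 < R) (hol : DifferentiableOn ℂ hh (ball (0:ℂ) R))
    (hb : ∀ z ∈ ball (0:ℂ) R, ‖hh z‖ ≤ b) {z : ℂ} (hz : ‖z‖ ≤ R / 2) : ‖deriv hh z‖ ≤ b / (R / 4) := by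
  have hsub : closedBall z (R / 4) ⊆ ball (0:ℂ) R := by
    intro y hy
    simp only [mem_closedBall, dist_eq_norm] at hy
    simp only [mem_ball_zero_iff]
    have := norm_sub_norm_le y z
    linarith
  apply Complex.norm_deriv_le_of_forall_mem_sphere_norm_le (by positivity)
  · have h1 : closure (ball z (R / 4)) ⊆ ball (0:ℂ) R := closure_ball_subset_closedBall.trans hsub
    exact (hol.mono h1).diffContOnCl
  · intro y hy
    exact hb y (hsub (sphere_subset_closedBall hy))

lemma log_le_w (z : ℂ) : Real.log (1 + ‖z‖) ≤ 1 + ‖z‖ := by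
  have := Real.log_le_sub_one_of_pos (w_pos z)
  linarith

/-- second derivative facts -/
structure Ee (C p R : ℝ) (vz vzz : ℂ → ℂ) (ρ : ℂ → ℝ) : Prop where
  C1 : 1 ≤ C
  hW : ∀ z ∈ ball (0:ℂ) R, HasW vz (vzz z) (-((ρ z : ℝ) : ℂ) / 4) z
  et : ∀ z : ℂ, ‖z‖ ≤ p ^ 2 → ‖vzz z - vz z ^ 2 / 2‖ ≤ C / (p * (1 + ‖z‖))

lemma ft_mul {B p R : ℝ} {v : ℂ → ℝ} {vz hh : ℂ → ℂ} {ρ : ℂ → ℝ} (h : Pk B p R v vz hh ρ) {z : ℂ} (hz : z ∈ ball (0:ℂ) R) :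
    ρ z = (1 + v z / p) ^ (p - 1) * (1 + v z / p) := by
  rw [h.ρv z hz]
  have := h.vpos z hz
  nth_rewrite 3 [← Real.rpow_one (1 + v z / p)]
  rw [← Real.rpow_add this]; congr 1; ring

lemma eta (B C0 : ℝ) (hB : 1 ≤ B) (hC0 : 1 ≤ C0) : ∃ C : ℝ, 1 ≤ C ∧ ∀ (p R : ℝ) (v : ℂ → ℝ) (vz hh : ℂ → ℂ) (ρ : ℂ → ℝ),
    Pk B p R v vz hh ρ → Dc C0 p R v vz ρ → ∃ vzz, Ee C p R vz vzz ρ := by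
  have hC3 := C3_pos
  set C1 := C0 ^ 2 * (C0 + 5) with hC1
  have hC1p : 0 < C1 := by positivity
  set C2 := 8 * B + C0 + C0 ^ 2 with hC2
  have hC2p : 0 < C2 := by positivity
  set C4 := C2 + C1 * C3 with hC4
  have hC4p : 0 < C4 := by positivity
  refine ⟨2 * C4 + C1 * C3 + 1, by nlinarith [mul_pos hC1p hC3], ?_⟩
  intro p R v vz hh ρ h d
  have hp0 := h.p0
  have hp := h.hp
  have hR := h.hR
  have hR0 : 0 < R := by linarith [h.R0]
  set dρ := dz (fun y => (ρ y : ℂ)) with hdρ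
  have hdρC : ContDiff ℝ 1 dρ := dz_contDiff (n := 1) (by simpa using (h.ρCC.of_le (by norm_num)))
  have hdρc : HasCompactSupport dρ := dz_compact h.ρcC
  set k : ℂ := 1 / (4 * π) with hk
  have hpi : (π : ℂ) ≠ 0 := by simp [Real.pi_ne_zero]
  have hkn : ‖k‖ ≤ 1 := by
    have : k = ((1 / (4 * π) : ℝ) : ℂ) := by rw [hk]; push_cast; rfl
    rw [this, Complex.norm_real, Real.norm_of_nonneg (by positivity)]
    rw [div_le_one (by positivity)]; linarith [Real.pi_gt_three]
  have hkpi : k * π = 1 / 4 := by rw [hk]; field_simp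
  set vzz : ℂ → ℂ := fun z => deriv hh z - k * CT dρ z with hvzz
  have hhd : ∀ z ∈ ball (0:ℂ) R, HasDerivAt hh (deriv hh z) z := fun z hz =>
    (h.hol.differentiableAt (isOpen_ball.mem_nhds hz)).hasDerivAt
  have hhd2 : ∀ z ∈ ball (0:ℂ) R, HasDerivAt (deriv hh) (deriv (deriv hh) z) z := fun z hz =>
    ((h.hol.deriv isOpen_ball).differentiableAt (isOpen_ball.mem_nhds hz)).hasDerivAt
  have hW : ∀ z ∈ ball (0:ℂ) R, HasW vz (vzz z) (-((ρ z : ℝ) : ℂ) / 4) z := by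
    intro z hz
    have h1 := (hasW_of_hasDerivAt (hhd z hz)).sub ((CT_hasW _ (h.ρCC.of_le (by norm_num)) h.ρcC z).const_mul k)
    have h2 : HasW vz (deriv hh z - k * CT dρ z) (0 - k * (π * (ρ z : ℂ))) z := by
      refine h1.congr_ev ?_
      filter_upwards [isOpen_ball.mem_nhds hz] with y hy
      rw [h.rep y hy]
    have e : (0 - k * (π * (ρ z : ℂ))) = -((ρ z : ℝ) : ℂ) / 4 := by
      rw [← mul_assoc, hkpi]; ring
    rwa [e] at h2
  have hWW : ∀ z ∈ ball (0:ℂ) R, HasW vzz (deriv (deriv hh) z - k * CT (dz dρ) z) (- dρ z / 4) z := by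
    intro z hz
    have h1 := (hasW_of_hasDerivAt (hhd2 z hz)).sub ((CT_hasW _ hdρC hdρc z).const_mul k)
    have e : (0 - k * (π * dρ z)) = - dρ z / 4 := by
      rw [← mul_assoc, hkpi]; ring
    rwa [e] at h1
  have hp1 : 1 ≤ p := by linarith
  refine ⟨vzz, by nlinarith [mul_pos hC1p hC3], hW, ?_⟩
  -- cutoff
  set L := p ^ 4 with hL
  have hL0 : 0 < L := by positivity
  have hLR : 8 * L ≤ R := by
    refine le_trans ?_ hR
    have : p ^ 10 = p ^ 4 * p ^ 6 := by ring
    rw [this, hL, mul_comm]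
    gcongr
    calc (8:ℝ) ≤ p := by linarith
      _ = p ^ 1 := (pow_one p).symm
      _ ≤ p ^ 6 := pow_le_pow_right₀ hp1 (by norm_num)
  set g : ℂ → ℂ := fun z => (ρ z * vz z - dρ z) / 4 with hg
  have hgC : ContDiffOn ℝ 1 g (ball (0:ℂ) R) := by
    have a1 : ContDiffOn ℝ 1 (fun y => (ρ y : ℂ)) (ball (0:ℂ) R) := (h.ρCC.of_le (by norm_num)).contDiffOn
    exact ((a1.mul h.vzC).sub hdρC.contDiffOn).div_const 4
  have hgb : ∀ z ∈ ball (0:ℂ) R, ‖g z‖ ≤ C1 / p * (1 + ‖z‖) ^ (-(3:ℝ)) := by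
    intro z hz
    have hw := w_pos z
    have e : g z = ((1 + v z / p) ^ (p - 1) : ℝ) * vz z * ((v z / p : ℝ) : ℂ) / 4 := by
      rw [hg, hdρ]
      simp only
      rw [h.ρz hz, ft_mul h hz]; push_cast; ring
    have hvn := h.vle z hz
    have hv1 : |v z| ≤ (C0 + 5) * (1 + ‖z‖) := by
      rw [abs_of_nonpos hvn]
      have := d.lo z hz
      have := log_le_w z
      nlinarith [w_one z]
    rw [e, norm_div, norm_mul, norm_mul, Complex.norm_real, Complex.norm_real, Real.norm_of_nonneg (Real.rpow_nonneg (h.vpos z hz).le _), Real.norm_eq_abs, abs_div, abs_of_pos hp0]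
    have hft := d.ft z hz
    have hvz := d.vz z hz
    calc _ ≤ (C0 * (1 + ‖z‖) ^ (-(7/2:ℝ))) * (C0 / (1 + ‖z‖)) * (((C0 + 5) * (1 + ‖z‖)) / p) / 1 := by
          gcongr
          simp
      _ = C1 / p * (1 + ‖z‖) ^ (-(7/2:ℝ)) := by rw [hC1]; field_simp
      _ ≤ _ := by gcongr C1 / p * ?_; exact w_mono z (by norm_num)
  set G : ℂ → ℂ := fun z => (thB (z / L) : ℂ) * g z with hG
  have hG0 : ∀ z : ℂ, 2 * L ≤ ‖z‖ → G z = 0 := by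
    intro z hz; simp only [hG]; rw [th_zero hL0 hz]; simp
  have hGC : ContDiff ℝ 1 G := by
    rw [contDiff_iff_contDiffAt]
    intro z
    by_cases hz : z ∈ ball (0:ℂ) R
    · have a1 : ContDiffAt ℝ 1 g z := hgC.contDiffAt (isOpen_ball.mem_nhds hz)
      have a2 : ContDiff ℝ 1 (fun z : ℂ => (thB (z / L) : ℂ)) := Complex.ofRealCLM.contDiff.comp ((th_contDiff L).of_le (by norm_num))
      exact a2.contDiffAt.mul a1
    · have hz' : R ≤ ‖z‖ := by simpa using hz
      have : G =ᶠ[𝓝 z] fun _ => 0 := by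
        have : {y : ℂ | 2 * L < ‖y‖} ∈ 𝓝 z := (isOpen_lt continuous_const continuous_norm).mem_nhds (by simp; linarith)
        filter_upwards [this] with y hy
        exact hG0 y (le_of_lt hy)
      exact contDiffAt_const.congr_of_eventuallyEq this
  have hGc : HasCompactSupport G := hasCompactSupport_of_norm hG0
  have hGb : ∀ z, ‖G z‖ ≤ C1 / p * (1 + ‖z‖) ^ (-(3:ℝ)) := by
    intro z
    by_cases hz : 2 * L ≤ ‖z‖
    · rw [hG0 z hz, norm_zero]; have := w_pos z; positivity
    · have hzR : z ∈ ball (0:ℂ) R := by simp; linarith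
      refine le_trans ?_ (hgb z hzR)
      simp only [hG]
      rw [norm_mul, Complex.norm_real, Real.norm_of_nonneg thB.nonneg]
      exact mul_le_of_le_one_left (norm_nonneg _) thB.le_one
  have hCG := CT_le_of_decay hGb
  set η : ℂ → ℂ := fun z => vzz z - vz z ^ 2 / 2 with hη
  set κ : ℂ → ℂ := fun z => η z - (π:ℂ)⁻¹ * CT G z with hκ
  have hκW : ∀ z, ‖z‖ ≤ L → ∃ a, HasDerivAt κ a z := by
    intro z hz
    have hzR : z ∈ ball (0:ℂ) R := by simp; linarith
    have w1 := hW z hzR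
    have w2 := ((hWW z hzR).sub ((w1.mul w1).const_mul (1/2))).sub ((CT_hasW _ hGC hGc z).const_mul (π:ℂ)⁻¹)
    have w3 : HasW κ _ _ z := w2.congr_ev (Eventually.of_forall fun y => by simp only [hκ, hη]; ring)
    have e : (- dρ z / 4 - 1 / 2 * (-((ρ z : ℝ) : ℂ) / 4 * vz z + vz z * (-((ρ z : ℝ) : ℂ) / 4)) - (π:ℂ)⁻¹ * (π * G z)) = 0 := by
      simp only [hG, hg]
      rw [th_one hL0 hz]; push_cast; field_simp; ring
    rw [e] at w3
    exact ⟨_, w3.hasDerivAt⟩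
  have hηb : ∀ z, ‖z‖ ≤ L → ‖η z‖ ≤ C2 / (1 + ‖z‖) := by
    intro z hz
    have hw := w_pos z
    have hzR : z ∈ ball (0:ℂ) R := by simp; linarith
    simp only [hη, hvzz]
    have a1 : ‖deriv hh z‖ ≤ 8 * B / (1 + ‖z‖) := by
      refine (deriv_bound hR0 h.hol h.hhB (by linarith)).trans ?_
      rw [div_div_eq_mul_div, div_le_div_iff₀ (by positivity) hw]
      have : (1 + ‖z‖) ≤ 2 * R := by linarith [h.R0]
      have hR1 := h.R0
      have : B / R * 4 * (1 + ‖z‖) ≤ B / R * 4 * (2 * R) := by gcongr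
      have e : B / R * 4 * (2 * R) = 8 * B := by field_simp; ring
      nlinarith
    have a2 : ‖k * CT dρ z‖ ≤ C0 / (1 + ‖z‖) := by
      rw [norm_mul]
      have := d.CTz z
      calc _ ≤ 1 * (C0 / (1 + ‖z‖)) := by gcongr
        _ = _ := one_mul _
    have a3 : ‖vz z ^ 2 / 2‖ ≤ C0 ^ 2 / (1 + ‖z‖) := by
      rw [norm_div, norm_pow]
      have hvz := d.vz z hzR
      calc _ ≤ (C0 / (1 + ‖z‖)) ^ 2 / 1 := by gcongr; simp
        _ = C0 ^ 2 / (1 + ‖z‖) * (1 / (1 + ‖z‖)) := by field_simp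
        _ ≤ C0 ^ 2 / (1 + ‖z‖) * 1 := by
          gcongr; rw [div_le_one hw]; exact w_one z
        _ = _ := mul_one _
    calc _ ≤ ‖deriv hh z‖ + ‖k * CT dρ z‖ + ‖vz z ^ 2 / 2‖ :=
          (norm_sub_le _ _).trans (by gcongr; exact norm_sub_le _ _)
      _ ≤ 8 * B / (1 + ‖z‖) + C0 / (1 + ‖z‖) + C0 ^ 2 / (1 + ‖z‖) := by gcongr
      _ = _ := by rw [hC2]; ring
  have hCTb : ∀ z, ‖(π:ℂ)⁻¹ * CT G z‖ ≤ C1 * C3 / (p * (1 + ‖z‖)) := by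
    intro z
    have hw := w_pos z
    rw [norm_mul, norm_inv, Complex.norm_real, Real.norm_of_nonneg Real.pi_pos.le]
    calc _ ≤ 1 * (C1 / p * (C3 / (1 + ‖z‖))) := by
          gcongr
          · exact inv_le_one_of_one_le₀ (by linarith [Real.pi_gt_three])
          · exact hCG z
      _ = _ := by field_simp
  have hκb : ∀ z : ℂ, ‖z‖ ≤ L / 2 → ‖κ z‖ ≤ 2 * C4 / L := by
    intro z hz
    apply Complex.norm_le_of_forall_mem_frontier_norm_le (U := ball (0:ℂ) (L/2)) isBounded_ball
    · apply DifferentiableOn.diffContOnCl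
      intro y hy
      rw [closure_ball _ (by positivity)] at hy
      have hy : ‖y‖ ≤ L / 2 := by simpa using hy
      obtain ⟨a, ha⟩ := hκW y (by linarith)
      exact ha.differentiableAt.differentiableWithinAt
    · intro y hy
      rw [frontier_ball _ (by positivity)] at hy
      have hy : ‖y‖ = L / 2 := by simpa using hy
      have b1 := hηb y (by linarith)
      have b2 := hCTb y
      have hw := w_pos y
      calc _ ≤ ‖η y‖ + ‖(π:ℂ)⁻¹ * CT G y‖ := norm_sub_le _ _
        _ ≤ C2 / (1 + ‖y‖) + C1 * C3 / (1 * (1 + ‖y‖)) := by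
            refine add_le_add b1 (b2.trans ?_)
            gcongr
        _ = C4 / (1 + ‖y‖) := by rw [hC4]; ring
        _ ≤ C4 / (L / 2) := by gcongr; linarith
        _ = _ := by field_simp
    · rw [closure_ball _ (by positivity)]; simpa using hz
  intro z hz
  have hw := w_pos z
  have hpp : p ^ 2 ≤ L / 2 := by
    have q : 400 ≤ p ^ 2 := by nlinarith
    rw [hL, show p ^ 4 = p ^ 2 * p ^ 2 by ring]; nlinarith
  have b1 := hκb z (hz.trans hpp)
  have b2 := hCTb z
  have e : vzz z - vz z ^ 2 / 2 = κ z + (π:ℂ)⁻¹ * CT G z := by simp only [hκ, hη]; ring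
  rw [e]
  have hpw : p * (1 + ‖z‖) ≤ L := by
    have : p * (1 + ‖z‖) ≤ p * (1 + p ^ 2) := by gcongr
    refine this.trans ?_
    have q : 1 + p ^ 2 ≤ p ^ 3 := by nlinarith [mul_pos hp0 hp0]
    rw [hL, show p ^ 4 = p * p ^ 3 by ring]; gcongr
  calc _ ≤ ‖κ z‖ + ‖(π:ℂ)⁻¹ * CT G z‖ := norm_add_le _ _
    _ ≤ 2 * C4 / (p * (1 + ‖z‖)) + C1 * C3 / (p * (1 + ‖z‖)) := by
        refine add_le_add (b1.trans ?_) b2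
        gcongr
    _ ≤ _ := by rw [← add_div]; apply div_le_div_of_nonneg_right _ (by positivity); linarith

end

noncomputable section

lemma HasW.congr_val {g : ℂ → ℂ} {a b a' b' z : ℂ} (h : HasW g a b z) (ha : a = a') (hb : b = b') : HasW g a' b' z := by
  subst ha hb; exact h

lemma HasR.congr_val {g : ℂ → ℝ} {a a' z : ℂ} (h : HasR g a z) (ha : a = a') : HasR g a' z := by
  subst ha; exact h

lemma HasR.zero_of_max {v : ℂ → ℝ} {a z : ℂ} (h : HasR v a z) (hm : IsLocalMax v z) : a = 0 := by
  have h1 := hm.hasFDerivAt_eq_zero h.hasFDerivAt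
  have h2 := DFunLike.congr_fun h1 ((starRingEnd ℂ) a)
  simp only [ContinuousLinearMap.comp_apply, wL_apply, Complex.reCLM_apply, zero_apply, Complex.conj_conj] at h2
  rw [Complex.mul_conj, mul_comm, Complex.mul_conj, ← Complex.ofReal_add, Complex.ofReal_re] at h2
  have : Complex.normSq a = 0 := by linarith [Complex.normSq_nonneg a]
  exact Complex.normSq_eq_zero.mp this

lemma hasR_normSq (z : ℂ) : HasR (fun y => ‖y‖ ^ 2) ((starRingEnd ℂ) z) z := by
  have h1 := (hasW_id (z := z)).mul (hasW_id (z := z)).conj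
  have h2 : HasW (fun y => ((‖y‖ ^ 2 : ℝ) : ℂ)) _ _ z := h1.congr_ev (Eventually.of_forall fun y => by
    push_cast; rw [Complex.mul_conj, Complex.normSq_eq_norm_sq]; push_cast; rfl)
  exact HasW.congr_val h2 (by simp) (by simp)

lemma psi_est (B C0 C1 : ℝ) (hB : 1 ≤ B) (hC0 : 1 ≤ C0) (hC1 : 1 ≤ C1) : ∃ C : ℝ, 1 ≤ C ∧ ∀ (p R : ℝ) (v : ℂ → ℝ) (vz hh vzz : ℂ → ℂ) (ρ : ℂ → ℝ),
    Pk B p R v vz hh ρ → Dc C0 p R v vz ρ → Ee C1 p R vz vzz ρ → ∀ z : ℂ, ‖z‖ ≤ p ^ 2 →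
      |Real.exp (- v z / 2) - (1 + ‖z‖ ^ 2 / 8)| ≤ C / p * (1 + ‖z‖) ^ (25/8:ℝ) := by
  set E := Real.exp (C0 / 2) with hE
  have hE1 : 1 ≤ E := Real.one_le_exp (by linarith)
  set K1 := E * (C0 ^ 2 * (C0 + 5) + C1 * C0) with hK1
  have hK1p : 0 < K1 := by positivity
  set K2 := C1 * E + 2 * K1 with hK2
  have hK2p : 0 < K2 := by positivity
  refine ⟨2 * K2 + 1, by linarith, ?_⟩
  intro p R v vz hh vzz ρ h d e z hz
  have hp0 := h.p0
  have hp := h.hp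
  have hpR : p ^ 2 < R := by
    refine lt_of_lt_of_le ?_ h.hR
    exact pow_lt_pow_right₀ (by linarith) (by norm_num)
  have hmem : ∀ y : ℂ, ‖y‖ ≤ p ^ 2 → y ∈ ball (0:ℂ) R := fun y hy => by simp; linarith
  have h0mem : (0:ℂ) ∈ ball (0:ℂ) R := hmem 0 (by simp; positivity)
  have hvz0 : vz 0 = 0 := by
    apply (h.hv 0 h0mem).zero_of_max
    filter_upwards [isOpen_ball.mem_nhds h0mem] with y hy
    rw [h.v0]; exact h.vle y hy
  have hρ0 : ρ 0 = 1 := by rw [h.ρv 0 h0mem, h.v0]; simp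
  set ψ : ℂ → ℝ := fun y => Real.exp (- v y / 2) with hψ
  have hψp : ∀ y, 0 < ψ y := fun y => Real.exp_pos _
  have hψR : ∀ y ∈ ball (0:ℂ) R, HasR ψ (-(1/2) * ψ y * vz y) y := by
    intro y hy
    have h1 : HasDerivAt (fun t : ℝ => Real.exp (- t / 2)) (-(1/2) * ψ y) (v y) := by
      have := (((hasDerivAt_id (v y)).neg).div_const 2).exp
      have e : Real.exp (- v y / 2) * (-1 / 2) = -(1/2) * ψ y := by rw [hψ]; ring
      simp only [id, Pi.neg_apply] at this
      rw [e] at this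
      exact this
    refine ((h.hv y hy).comp h1).congr_val ?_
    push_cast; ring
  have hψb : ∀ y : ℂ, ‖y‖ ≤ p ^ 2 → ψ y ≤ E * (1 + ‖y‖) ^ (17/8:ℝ) := by
    intro y hy
    have := d.lo y (hmem y hy)
    have e := exp_w (c := C0 / 2) (a := -(17/8)) y
    rw [neg_neg] at e
    rw [hE, ← e]
    apply Real.exp_le_exp.mpr; linarith
  set s : ℂ → ℝ := fun y => ψ y * (ρ y / 8 + ‖vz y‖ ^ 2 / 4) with hs
  have hsR : ∀ y ∈ ball (0:ℂ) R, HasR s (ψ y * (vz y * (((1 + v y / p) ^ (p - 1) * (- v y / p) : ℝ) : ℂ) / 8 + (starRingEnd ℂ) (vz y) * (vzz y - vz y ^ 2 / 2) / 4)) y := by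
    intro y hy
    have w1 : HasW (fun y => (ψ y : ℂ)) _ _ y := hψR y hy
    have w2 := e.hW y hy
    have w3 : HasR ρ (dz (fun y => (ρ y : ℂ)) y) y := HasR.of_differentiableAt (h.ρC.differentiable (by norm_num) y)
    have w3' : HasW (fun y => (ρ y : ℂ)) _ _ y := w3
    have w4 := w1.mul ((w3'.const_mul (1/8)).add ((w2.mul w2.conj).const_mul (1/4)))
    have w5 : HasW (fun y => (s y : ℂ)) _ _ y := w4.congr_ev (Eventually.of_forall fun y => by
      simp only [hs]; push_cast; rw [Complex.mul_conj, Complex.normSq_eq_norm_sq]; push_cast; ring)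
    have hρz := h.ρz hy
    have hfm := ft_mul h hy
    set f := (1 + v y / p) ^ (p - 1) with hf
    refine w5.congr_val ?_ ?_
    · rw [hρz, hfm]; simp only [Complex.conj_ofReal, map_neg, map_div₀, map_ofNat]; push_cast
      ring
    · rw [hρz, hfm]; simp only [Complex.conj_ofReal, map_neg, map_div₀, map_ofNat, map_mul, map_add, map_sub, map_pow, map_one, Complex.conj_conj]; push_cast
      ring
  have hη := e.et
  have hwm : ∀ (a : ℝ) (y x : ℂ), 0 ≤ a → ‖y‖ ≤ ‖x‖ → (1 + ‖y‖) ^ a ≤ (1 + ‖x‖) ^ a := by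
    intro a y x ha hyx
    exact Real.rpow_le_rpow (w_pos y).le (by linarith) ha
  have hsz : ∀ y : ℂ, ‖y‖ ≤ p ^ 2 → ‖ψ y * (vz y * (((1 + v y / p) ^ (p - 1) * (- v y / p) : ℝ) : ℂ) / 8 + (starRingEnd ℂ) (vz y) * (vzz y - vz y ^ 2 / 2) / 4)‖ ≤ K1 / p * (1 + ‖y‖) ^ (1/8:ℝ) := by
    intro y hy
    have hyR := hmem y hy
    have hw := w_pos y
    have a1 := hψb y hy
    have a2 := d.vz y hyR
    have a3 := d.ft y hyR
    have a4 := hη y hy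
    have hvn := h.vle y hyR
    have a5 : -v y ≤ (C0 + 5) * (1 + ‖y‖) := by
      have := d.lo y hyR
      have := log_le_w y
      nlinarith [w_one y]
    have b1 : ‖vz y * (((1 + v y / p) ^ (p - 1) * (- v y / p) : ℝ) : ℂ) / 8‖ ≤ C0 ^ 2 * (C0 + 5) / p * (1 + ‖y‖) ^ (-(2:ℝ)) := by
      rw [norm_div, norm_mul, Complex.norm_real, Real.norm_of_nonneg (mul_nonneg (Real.rpow_nonneg (h.vpos y hyR).le _) (div_nonneg (by linarith) hp0.le))]
      calc _ ≤ C0 / (1 + ‖y‖) * (C0 * (1 + ‖y‖) ^ (-(7/2:ℝ)) * ((C0 + 5) * (1 + ‖y‖) / p)) / 1 := by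
            gcongr
            all_goals first
              | exact mul_nonneg (Real.rpow_nonneg (h.vpos y hyR).le _) (div_nonneg (by linarith) hp0.le)
              | exact div_nonneg (by linarith) hp0.le
              | simp
        _ = C0 ^ 2 * (C0 + 5) / p * (1 + ‖y‖) ^ (-(7/2:ℝ)) := by field_simp
        _ ≤ _ := by gcongr _ * ?_; exact w_mono y (by norm_num)
    have b2 : ‖(starRingEnd ℂ) (vz y) * (vzz y - vz y ^ 2 / 2) / 4‖ ≤ C1 * C0 / p * (1 + ‖y‖) ^ (-(2:ℝ)) := by
      rw [norm_div, norm_mul, Complex.norm_conj]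
      calc _ ≤ C0 / (1 + ‖y‖) * (C1 / (p * (1 + ‖y‖))) / 1 := by
            gcongr
            simp
        _ = _ := by
            rw [Real.rpow_neg hw.le]; norm_cast; field_simp
    rw [norm_mul, Complex.norm_real, Real.norm_of_nonneg (hψp y).le]
    calc _ ≤ (E * (1 + ‖y‖) ^ (17/8:ℝ)) * (C0 ^ 2 * (C0 + 5) / p * (1 + ‖y‖) ^ (-(2:ℝ)) + C1 * C0 / p * (1 + ‖y‖) ^ (-(2:ℝ))) := by
          gcongr
          exact (norm_add_le _ _).trans (add_le_add b1 b2)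
      _ = K1 / p * ((1 + ‖y‖) ^ (17/8:ℝ) * (1 + ‖y‖) ^ (-(2:ℝ))) := by rw [hK1]; ring
      _ = _ := by rw [← Real.rpow_add hw]; norm_num
  have hw1 : ∀ (y : ℂ) (a : ℝ), (1 + ‖y‖) ^ a * ‖y‖ ≤ (1 + ‖y‖) ^ (a + 1) := by
    intro y a
    rw [Real.rpow_add_one (w_pos y).ne']
    have := Real.rpow_nonneg (w_pos y).le a
    gcongr; linarith
  have S1 : ∀ y : ℂ, ‖y‖ ≤ p ^ 2 → |s y - 1 / 8| ≤ 2 * K1 / p * (1 + ‖y‖) ^ (9/8:ℝ) := by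
    intro y hy
    have := HasR.mvt (z := y) (k := K1 / p * (1 + ‖y‖) ^ (1/8:ℝ)) (fun x hx => hsR x (hmem x (hx.trans hy))) (fun x hx => (hsz x (hx.trans hy)).trans (by
      gcongr _ * ?_
      exact hwm _ _ _ (by norm_num) hx))
    have e0 : s 0 = 1 / 8 := by simp [hs, hψ, h.v0, hρ0, hvz0]
    rw [e0] at this
    refine this.trans ?_
    calc _ = 2 * K1 / p * ((1 + ‖y‖) ^ (1/8:ℝ) * ‖y‖) := by ring
      _ ≤ 2 * K1 / p * ((1 + ‖y‖) ^ (1/8 + 1:ℝ)) := by gcongr _ * ?_; exact hw1 y _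
      _ = _ := by norm_num
  -- second step
  set G : ℂ → ℂ := fun y => -(1/2) * ψ y * vz y - (1/8) * (starRingEnd ℂ) y with hG
  have hGW : ∀ y ∈ ball (0:ℂ) R, HasW G (-(1/2) * (vzz y - vz y ^ 2 / 2) * ψ y) ((s y - 1 / 8 : ℝ) : ℂ) y := by
    intro y hy
    have w1 : HasW (fun y => (ψ y : ℂ)) _ _ y := hψR y hy
    have w2 := e.hW y hy
    have w3 := ((w1.mul w2).const_mul (-(1/2))).sub ((hasW_id (z := y)).conj.const_mul (1/8))
    have w4 : HasW G _ _ y := w3.congr_ev (Eventually.of_forall fun y => by simp only [hG]; ring)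
    refine w4.congr_val ?_ ?_
    · simp; ring
    · simp only [hs, map_mul, map_neg, map_div₀, map_ofNat, map_one, Complex.conj_ofReal]
      push_cast
      rw [show ((‖vz y‖ : ℂ)) ^ 2 = vz y * (starRingEnd ℂ) (vz y) by
        rw [Complex.mul_conj, Complex.normSq_eq_norm_sq]; push_cast; rfl]
      ring
  have S2 : ∀ y : ℂ, ‖y‖ ≤ p ^ 2 → ‖G y‖ ≤ K2 / p * (1 + ‖y‖) ^ (17/8:ℝ) := by
    intro y hy
    have := HasW.mvt (z := y) (k := K2 / p * (1 + ‖y‖) ^ (9/8:ℝ)) (fun x hx => hGW x (hmem x (hx.trans hy))) (fun x hx => by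
      have hx' := hx.trans hy
      have hw := w_pos x
      have a1 := S1 x hx'
      have a2 := hη x hx'
      have a3 := hψb x hx'
      have b1 : ‖-(1/2) * (vzz x - vz x ^ 2 / 2) * ψ x‖ ≤ C1 * E / p * (1 + ‖x‖) ^ (9/8:ℝ) := by
        rw [norm_mul, norm_mul, Complex.norm_real, Real.norm_of_nonneg (hψp x).le]
        calc _ ≤ 1 * (C1 / (p * (1 + ‖x‖))) * (E * (1 + ‖x‖) ^ (17/8:ℝ)) := by
              gcongr
              norm_num
          _ = C1 * E / p * ((1 + ‖x‖) ^ (17/8:ℝ) / (1 + ‖x‖)) := by field_simp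
          _ = _ := by
            rw [← Real.rpow_sub_one hw.ne']; norm_num
      rw [Complex.norm_real, Real.norm_eq_abs]
      calc _ ≤ C1 * E / p * (1 + ‖x‖) ^ (9/8:ℝ) + 2 * K1 / p * (1 + ‖x‖) ^ (9/8:ℝ) := add_le_add b1 a1
        _ = K2 / p * (1 + ‖x‖) ^ (9/8:ℝ) := by rw [hK2]; ring
        _ ≤ _ := by gcongr _ * ?_; exact hwm _ _ _ (by norm_num) hx)
    have e0 : G 0 = 0 := by simp [hG, hvz0]
    rw [e0, sub_zero] at this
    refine this.trans ?_
    calc _ = K2 / p * ((1 + ‖y‖) ^ (9/8:ℝ) * ‖y‖) := by ring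
      _ ≤ K2 / p * ((1 + ‖y‖) ^ (9/8 + 1:ℝ)) := by gcongr _ * ?_; exact hw1 y _
      _ = _ := by norm_num
  have hHR : ∀ y ∈ ball (0:ℂ) R, HasR (fun y => ψ y - (1 + ‖y‖ ^ 2 / 8)) (G y) y := by
    intro y hy
    have w1 : HasW (fun y => (ψ y : ℂ)) _ _ y := hψR y hy
    have w2 : HasW (fun y => ((‖y‖ ^ 2 : ℝ) : ℂ)) _ _ y := hasR_normSq y
    have w3 := w1.sub ((hasW_const (z := y) (c := 1)).add (w2.const_mul (1/8)))
    have w4 : HasW (fun y => ((ψ y - (1 + ‖y‖ ^ 2 / 8) : ℝ) : ℂ)) _ _ y := w3.congr_ev (Eventually.of_forall fun y => by push_cast; ring)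
    refine w4.congr_val ?_ ?_
    · simp [hG]
    · simp only [hG, map_sub, map_mul, map_neg, map_div₀, map_one, map_ofNat, Complex.conj_conj, Complex.conj_ofReal]; ring
  have := HasR.mvt (z := z) (k := K2 / p * (1 + ‖z‖) ^ (17/8:ℝ)) (fun x hx => hHR x (hmem x (hx.trans hz))) (fun x hx => (S2 x (hx.trans hz)).trans (by
      gcongr _ * ?_
      exact hwm _ _ _ (by norm_num) hx))
  have e0 : ψ 0 - (1 + ‖(0:ℂ)‖ ^ 2 / 8) = 0 := by simp [hψ, h.v0]
  rw [e0, sub_zero] at this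
  refine this.trans ?_
  have hw := w_pos z
  calc _ = 2 * K2 / p * ((1 + ‖z‖) ^ (17/8:ℝ) * ‖z‖) := by ring
    _ ≤ 2 * K2 / p * ((1 + ‖z‖) ^ (17/8 + 1:ℝ)) := by gcongr _ * ?_; exact hw1 z _
    _ ≤ _ := by
      rw [show (17/8 + 1:ℝ) = 25/8 by norm_num]
      gcongr; linarith

end

noncomputable section

def UU (z : ℂ) : ℝ := -2 * Real.log (1 + ‖z‖ ^ 2 / 8)
def eU (z : ℂ) : ℝ := (1 + ‖z‖ ^ 2 / 8)⁻¹ ^ 2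

lemma s_pos (z : ℂ) : 0 < 1 + ‖z‖ ^ 2 / 8 := by positivity

lemma eU_eq (z : ℂ) : eU z = Real.exp (UU z) := by
  unfold eU UU
  rw [show -2 * Real.log (1 + ‖z‖ ^ 2 / 8) = (-Real.log (1 + ‖z‖ ^ 2 / 8)) + (-Real.log (1 + ‖z‖ ^ 2 / 8)) by ring, Real.exp_add, Real.exp_neg, Real.exp_log (s_pos z), sq]

lemma eU_pos (z : ℂ) : 0 < eU z := by rw [eU_eq]; exact Real.exp_pos _

lemma s_ge (z : ℂ) : (1 + ‖z‖) ^ 2 / 16 ≤ 1 + ‖z‖ ^ 2 / 8 := by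
  nlinarith [sq_nonneg (‖z‖ - 1), norm_nonneg z]

lemma eU_le (z : ℂ) : eU z ≤ 256 * (1 + ‖z‖) ^ (-(4:ℝ)) := by
  have hw := w_pos z
  have h1 := s_ge z
  have h2 : (1 + ‖z‖) ^ (-(4:ℝ)) = ((1 + ‖z‖) ^ 4)⁻¹ := by
    rw [Real.rpow_neg hw.le]; norm_cast
  rw [h2]; unfold eU
  calc _ ≤ (((1 + ‖z‖) ^ 2 / 16)⁻¹) ^ 2 := by
        gcongr
    _ = _ := by field_simp; norm_num

lemma log_w_le (z : ℂ) : Real.log (1 + ‖z‖) ≤ 4 * (1 + ‖z‖) ^ (1/4:ℝ) := by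
  have := Real.log_le_rpow_div (x := 1 + ‖z‖) (w_pos z).le (ε := 1/4) (by norm_num)
  linarith

lemma UU_abs (z : ℂ) : |UU z| ≤ 16 * (1 + ‖z‖) ^ (1/4:ℝ) := by
  unfold UU
  have h0 : 0 ≤ Real.log (1 + ‖z‖ ^ 2 / 8) := Real.log_nonneg (by have := sq_nonneg ‖z‖; linarith)
  have h1 : Real.log (1 + ‖z‖ ^ 2 / 8) ≤ 2 * Real.log (1 + ‖z‖) := by
    rw [← Real.log_rpow (w_pos z)]
    apply Real.log_le_log (s_pos z)
    norm_cast
    nlinarith [norm_nonneg z]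
  rw [abs_mul, abs_of_nonneg h0]
  norm_num
  linarith [log_w_le z]

lemma abs_exp_sub {a b M : ℝ} (ha : Real.exp a ≤ M) (hb : Real.exp b ≤ M) : |Real.exp a - Real.exp b| ≤ M * |a - b| := by
  have key : ∀ a b : ℝ, Real.exp a ≤ M → b ≤ a → |Real.exp a - Real.exp b| ≤ M * |a - b| := by
    intro a b ha hab
    rw [abs_of_nonneg (by linarith [Real.exp_le_exp.mpr hab]), abs_of_nonneg (by linarith)]
    have h1 : Real.exp b = Real.exp a * Real.exp (b - a) := by rw [← Real.exp_add]; congr 1; ring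
    have h2 := Real.add_one_le_exp (b - a)
    have h3 := Real.exp_pos a
    rw [h1]
    nlinarith
  rcases le_total b a with h | h
  · exact key a b ha h
  · rw [abs_sub_comm, abs_sub_comm a]; exact key b a hb h

lemma abs_log_sub {a b c : ℝ} (hc : 0 < c) (ha : c ≤ a) (hb : c ≤ b) : |Real.log a - Real.log b| ≤ |a - b| / c := by
  have key : ∀ a b : ℝ, c ≤ b → b ≤ a → |Real.log a - Real.log b| ≤ |a - b| / c := by
    intro a b hb hab
    have hb0 : 0 < b := by linarith
    have ha0 : 0 < a := by linarith
    rw [abs_of_nonneg (by linarith [Real.log_le_log hb0 hab]), abs_of_nonneg (by linarith), ← Real.log_div ha0.ne' hb0.ne']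
    have h1 := Real.log_le_sub_one_of_pos (x := a / b) (by positivity)
    refine h1.trans ?_
    calc a / b - 1 = (a - b) / b := by field_simp
      _ ≤ _ := by gcongr
  rcases le_total b a with h | h
  · exact key a b hb h
  · rw [abs_sub_comm, abs_sub_comm a]; exact key b a ha h

/-- pointwise comparisons -/
structure Cm (C p : ℝ) (ρ : ℂ → ℝ) : Prop where
  C1 : 1 ≤ C
  c1 : ∀ z, |ρ z - eU z| ≤ C / p * (1 + ‖z‖) ^ (-(5/2:ℝ))
  c2 : ∀ z, |p * (ρ z ^ (1 + 1 / p) - ρ z) - UU z * eU z| ≤ C / p * (1 + ‖z‖) ^ (-(9/4:ℝ))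
  c3 : ∀ z, ρ z ≤ C * (1 + ‖z‖) ^ (-(15/4:ℝ))

lemma Pk.comb {B p R : ℝ} {v : ℂ → ℝ} {vz hh : ℂ → ℂ} {ρ : ℂ → ℝ} (h : Pk B p R v vz hh ρ) {z : ℂ} (hz : z ∈ ball (0:ℂ) R) :
    p * (ρ z ^ (1 + 1 / p) - ρ z) = ρ z * v z := by
  have hp := h.p0
  have : 0 < ρ z := by rw [h.ρv z hz]; exact Real.rpow_pos_of_pos (h.vpos z hz) _
  rw [Real.rpow_add this, Real.rpow_one, h.ρroot hz]; field_simp; ring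

lemma Pk.exp_sub {B p R : ℝ} {v : ℂ → ℝ} {vz hh : ℂ → ℂ} {ρ : ℂ → ℝ} (h : Pk B p R v vz hh ρ) {z : ℂ} (hz : z ∈ ball (0:ℂ) R) :
    |Real.exp (v z) - ρ z| ≤ 2 * Real.exp (v z) * v z ^ 2 / p := by
  have hp := h.p0
  have h20 := h.hp
  have he := Real.exp_pos (v z)
  have h1 : ρ z ≤ Real.exp (v z) := by
    rw [h.ρv z hz]
    have := rpow_one_add_le hp (h.vpos z hz) hp.le
    rwa [div_self hp.ne', mul_one] at this
  rw [abs_of_nonneg (by linarith)]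
  have h0 := h.ρ0 z
  by_cases hc : -(p/2) ≤ v z
  · have h2 := rpow_one_add_ge hp hc (h.vle z hz)
    rw [← h.ρv z hz] at h2
    have h3 : Real.exp (v z - 2 * v z ^ 2 / p) = Real.exp (v z) * Real.exp (-(2 * v z ^ 2 / p)) := by
      rw [← Real.exp_add]; congr 1
    have h4 := Real.add_one_le_exp (-(2 * v z ^ 2 / p))
    rw [h3] at h2
    have : Real.exp (v z) * (-(2 * v z ^ 2 / p) + 1) ≤ ρ z := le_trans (by gcongr) h2
    have e : 2 * Real.exp (v z) * v z ^ 2 / p = Real.exp (v z) * (2 * v z ^ 2 / p) := by ring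
    rw [e]; linarith
  · push Not at hc
    have : Real.exp (v z) ≤ 2 * Real.exp (v z) * v z ^ 2 / p := by
      rw [le_div_iff₀ hp]
      have : p ≤ 2 * v z ^ 2 := by nlinarith
      nlinarith
    linarith

lemma cmp_est (B C0 K : ℝ) (hB : 1 ≤ B) (hC0 : 1 ≤ C0) (hK : 1 ≤ K) : ∃ C : ℝ, ∀ (p R : ℝ) (v : ℂ → ℝ) (vz hh : ℂ → ℂ) (ρ : ℂ → ℝ),
    Pk B p R v vz hh ρ → Dc C0 p R v vz ρ → (∀ z : ℂ, ‖z‖ ≤ p ^ 2 →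
      |Real.exp (- v z / 2) - (1 + ‖z‖ ^ 2 / 8)| ≤ K / p * (1 + ‖z‖) ^ (25/8:ℝ)) → Cm C p ρ := by
  set D := C0 + 17 with hD
  set M := C0 + 256 with hM
  set K1 := 32 * C0 * K with hK1
  set K2 := M * K1 + 2 * C0 * D ^ 2 + M with hK2
  set K3 := K2 * D + 256 * K1 + C0 * D + 1 + 4096 with hK3
  have hDp : 0 < D := by positivity
  have hMp : 0 < M := by positivity
  have hK1p : 0 < K1 := by positivity
  have hK2p : 0 < K2 := by positivity
  have hK3p : 0 < K3 := by positivity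
  refine ⟨C0 + K2 + K3, ?_⟩
  intro p R v vz hh ρ h d hψ
  have hp0 := h.p0
  have hp := h.hp
  have hp2R : p ^ 2 < R := by
    refine lt_of_lt_of_le ?_ h.hR
    exact pow_lt_pow_right₀ (by linarith) (by norm_num)
  have hmem : ∀ y : ℂ, ‖y‖ ≤ p ^ 2 → y ∈ ball (0:ℂ) R := fun y hy => by simp; linarith
  have hwn : ∀ (z : ℂ) (a : ℝ), 0 < (1 + ‖z‖) ^ a := fun z a => Real.rpow_pos_of_pos (w_pos z) _
  have hwa : ∀ (z : ℂ) (a b : ℝ), (1 + ‖z‖) ^ a * (1 + ‖z‖) ^ b = (1 + ‖z‖) ^ (a + b) := fun z a b => (Real.rpow_add (w_pos z) _ _).symm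
  -- far weights
  have far : ∀ z : ℂ, p ^ 2 < ‖z‖ → ∀ a : ℝ, (1 + ‖z‖) ^ a ≤ 1 / p * (1 + ‖z‖) ^ (a + 1/2) := by
    intro z hz a
    rw [← hwa]
    have h1 : p ≤ (1 + ‖z‖) ^ (1/2:ℝ) := by
      rw [← Real.sqrt_eq_rpow]
      apply Real.le_sqrt_of_sq_le; linarith
    rw [one_div, inv_mul_eq_div, le_div_iff₀ hp0]
    have := hwn z a
    gcongr
  have hv : ∀ z ∈ ball (0:ℂ) R, |v z| ≤ D * (1 + ‖z‖) ^ (1/4:ℝ) := by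
    intro z hz
    rw [abs_of_nonpos (h.vle z hz)]
    have h1 := d.lo z hz
    have h2 := log_w_le z
    have h3 : 1 ≤ (1 + ‖z‖) ^ (1/4:ℝ) := Real.one_le_rpow (w_one z) (by norm_num)
    rw [hD]; nlinarith
  have hevM : ∀ z ∈ ball (0:ℂ) R, Real.exp (v z) ≤ M * (1 + ‖z‖) ^ (-(15/4:ℝ)) := by
    intro z hz
    refine (d.ev z hz).trans ?_
    have := hwn z (-(15/4:ℝ))
    gcongr; linarith
  have heUM : ∀ z, eU z ≤ M * (1 + ‖z‖) ^ (-(15/4:ℝ)) := by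
    intro z
    refine (eU_le z).trans ?_
    have := hwn z (-(15/4:ℝ))
    gcongr 
    · linarith
    · exact w_one z
    · norm_num
  have hvU : ∀ z : ℂ, ‖z‖ ≤ p ^ 2 → |v z - UU z| ≤ K1 / p * (1 + ‖z‖) ^ (5/4:ℝ) := by
    intro z hz
    have hzR := hmem z hz
    have hw := w_pos z
    set c := (1 + ‖z‖) ^ (15/8:ℝ) / (16 * C0) with hc
    have hcp : 0 < c := by have := hwn z (15/8); positivity
    have e2 : ((1 + ‖z‖) ^ (15/8:ℝ)) ^ 2 = (1 + ‖z‖) ^ (15/4:ℝ) := by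
      rw [← Real.rpow_natCast, ← Real.rpow_mul hw.le]; norm_num
    have h1 : c ≤ Real.exp (- v z / 2) := by
      apply le_of_sq_le_sq _ (Real.exp_pos _).le
      have e1 : Real.exp (- v z / 2) ^ 2 = (Real.exp (v z))⁻¹ := by
        rw [sq, ← Real.exp_add, ← Real.exp_neg]; congr 1; ring
      rw [e1, hc, div_pow, e2]
      have h3 := d.ev z hzR
      have h4 : (C0 * (1 + ‖z‖) ^ (-(15/4:ℝ)))⁻¹ ≤ (Real.exp (v z))⁻¹ := by gcongr
      refine le_trans ?_ h4
      rw [mul_inv, Real.rpow_neg hw.le, inv_inv, div_eq_inv_mul]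
      have := hwn z (15/4)
      gcongr
      nlinarith
    have h2 : c ≤ 1 + ‖z‖ ^ 2 / 8 := by
      refine le_trans ?_ (s_ge z)
      have : (1 + ‖z‖) ^ (15/8:ℝ) ≤ (1 + ‖z‖) ^ 2 := by
        have := w_mono z (by norm_num : (15/8:ℝ) ≤ 2)
        norm_cast at this ⊢
      rw [hc]
      gcongr
      linarith
    have h3 := abs_log_sub hcp h1 h2
    rw [Real.log_exp] at h3
    have e : v z - UU z = -2 * (- v z / 2 - Real.log (1 + ‖z‖ ^ 2 / 8)) := by unfold UU; ring
    rw [e, abs_mul, abs_neg, abs_two]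
    calc _ ≤ 2 * ((K / p * (1 + ‖z‖) ^ (25/8:ℝ)) / c) := by
          gcongr
          exact h3.trans (by gcongr; exact hψ z hz)
      _ = K1 / p * ((1 + ‖z‖) ^ (25/8:ℝ) / (1 + ‖z‖) ^ (15/8:ℝ)) := by
          rw [hc, hK1]; field_simp; norm_num
      _ = _ := by rw [← Real.rpow_sub hw]; norm_num
  have c1 : ∀ z, |ρ z - eU z| ≤ K2 / p * (1 + ‖z‖) ^ (-(5/2:ℝ)) := by
    intro z
    have hw := w_pos z
    by_cases hz : ‖z‖ ≤ p ^ 2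
    · have hzR := hmem z hz
      have a1 := h.exp_sub hzR
      have a2 := abs_exp_sub (hevM z hzR) (by rw [← eU_eq]; exact heUM z)
      rw [← eU_eq] at a2
      have b1 : 2 * Real.exp (v z) * v z ^ 2 / p ≤ 2 * C0 * D ^ 2 / p * (1 + ‖z‖) ^ (-(5/2:ℝ)) := by
        have q1 := d.ev z hzR
        have q2 := hv z hzR
        have q3 : v z ^ 2 ≤ (D * (1 + ‖z‖) ^ (1/4:ℝ)) ^ 2 := by rw [← sq_abs]; gcongr
        calc _ ≤ 2 * (C0 * (1 + ‖z‖) ^ (-(15/4:ℝ))) * (D * (1 + ‖z‖) ^ (1/4:ℝ)) ^ 2 / p := by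
              have := hwn z (-(15/4:ℝ))
              gcongr
          _ = 2 * C0 * D ^ 2 / p * ((1 + ‖z‖) ^ (-(15/4:ℝ)) * (1 + ‖z‖) ^ (1/4:ℝ) * (1 + ‖z‖) ^ (1/4:ℝ)) := by ring
          _ ≤ _ := by
            rw [hwa, hwa]
            gcongr _ * ?_
            exact w_mono z (by norm_num)
      have b2 : M * (1 + ‖z‖) ^ (-(15/4:ℝ)) * |v z - UU z| ≤ M * K1 / p * (1 + ‖z‖) ^ (-(5/2:ℝ)) := by
        have := hwn z (-(15/4:ℝ))
        calc _ ≤ M * (1 + ‖z‖) ^ (-(15/4:ℝ)) * (K1 / p * (1 + ‖z‖) ^ (5/4:ℝ)) := by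
              gcongr; exact hvU z hz
          _ = M * K1 / p * ((1 + ‖z‖) ^ (-(15/4:ℝ)) * (1 + ‖z‖) ^ (5/4:ℝ)) := by ring
          _ = _ := by rw [hwa]; norm_num
      have t : |ρ z - eU z| ≤ |Real.exp (v z) - ρ z| + |Real.exp (v z) - eU z| := by
        have := abs_sub_le (ρ z) (Real.exp (v z)) (eU z)
        rw [abs_sub_comm (ρ z) (Real.exp (v z))] at this
        exact this
      have hM0 : 0 ≤ M / p * (1 + ‖z‖) ^ (-(5/2:ℝ)) := by have := hwn z (-(5/2:ℝ)); positivity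
      calc _ ≤ 2 * C0 * D ^ 2 / p * (1 + ‖z‖) ^ (-(5/2:ℝ)) + M * K1 / p * (1 + ‖z‖) ^ (-(5/2:ℝ)) + M / p * (1 + ‖z‖) ^ (-(5/2:ℝ)) := by linarith
        _ = _ := by rw [hK2]; ring
    · push Not at hz
      have a1 : ρ z ≤ M * (1 + ‖z‖) ^ (-(15/4:ℝ)) := by
        refine (d.ρd z).trans ?_
        have := hwn z (-(15/4:ℝ))
        gcongr; linarith
      have a2 := heUM z
      have a3 := h.ρ0 z
      have a4 := eU_pos z
      have a5 : |ρ z - eU z| ≤ M * (1 + ‖z‖) ^ (-(15/4:ℝ)) := by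
        rw [abs_le]; constructor <;> linarith
      calc _ ≤ M * (1 / p * (1 + ‖z‖) ^ (-(15/4:ℝ) + 1/2)) := a5.trans (by gcongr M * ?_; exact far z hz _)
        _ ≤ M * (1 / p * (1 + ‖z‖) ^ (-(5/2:ℝ))) := by
            gcongr M * (1 / p * ?_); exact w_mono z (by norm_num)
        _ = M / p * (1 + ‖z‖) ^ (-(5/2:ℝ)) := by ring
        _ ≤ _ := by
            have := hwn z (-(5/2:ℝ))
            gcongr
            have : 0 < M * K1 := by positivity
            have : 0 < 2 * C0 * D ^ 2 := by positivity
            linarith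
  have c2 : ∀ z, |p * (ρ z ^ (1 + 1 / p) - ρ z) - UU z * eU z| ≤ K3 / p * (1 + ‖z‖) ^ (-(9/4:ℝ)) := by
    intro z
    have hw := w_pos z
    have hw94 := hwn z (-(9/4:ℝ))
    by_cases hz : ‖z‖ ≤ p ^ 2
    · have hzR := hmem z hz
      rw [h.comb hzR]
      have e : ρ z * v z - UU z * eU z = (ρ z - eU z) * v z + eU z * (v z - UU z) := by ring
      rw [e]
      have b1 : |(ρ z - eU z) * v z| ≤ K2 * D / p * (1 + ‖z‖) ^ (-(9/4:ℝ)) := by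
        rw [abs_mul]
        calc _ ≤ (K2 / p * (1 + ‖z‖) ^ (-(5/2:ℝ))) * (D * (1 + ‖z‖) ^ (1/4:ℝ)) := by
              gcongr
              · exact c1 z
              · exact hv z hzR
          _ = K2 * D / p * ((1 + ‖z‖) ^ (-(5/2:ℝ)) * (1 + ‖z‖) ^ (1/4:ℝ)) := by ring
          _ = _ := by rw [hwa]; norm_num
      have b2 : |eU z * (v z - UU z)| ≤ 256 * K1 / p * (1 + ‖z‖) ^ (-(9/4:ℝ)) := by
        rw [abs_mul, abs_of_pos (eU_pos z)]
        calc _ ≤ (256 * (1 + ‖z‖) ^ (-(4:ℝ))) * (K1 / p * (1 + ‖z‖) ^ (5/4:ℝ)) := by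
              gcongr
              · exact eU_le z
              · exact hvU z hz
          _ = 256 * K1 / p * ((1 + ‖z‖) ^ (-(4:ℝ)) * (1 + ‖z‖) ^ (5/4:ℝ)) := by ring
          _ ≤ _ := by rw [hwa]; gcongr _ * ?_; exact w_mono z (by norm_num)
      calc _ ≤ K2 * D / p * (1 + ‖z‖) ^ (-(9/4:ℝ)) + 256 * K1 / p * (1 + ‖z‖) ^ (-(9/4:ℝ)) := (abs_add_le _ _).trans (add_le_add b1 b2)
        _ = (K2 * D + 256 * K1) / p * (1 + ‖z‖) ^ (-(9/4:ℝ)) := by ring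
        _ ≤ _ := by
          gcongr
          have : 0 < C0 * D := by positivity
          rw [hK3]; linarith
    · push Not at hz
      have b2 : |UU z * eU z| ≤ 4096 / p * (1 + ‖z‖) ^ (-(9/4:ℝ)) := by
        rw [abs_mul, abs_of_pos (eU_pos z)]
        calc _ ≤ (16 * (1 + ‖z‖) ^ (1/4:ℝ)) * (256 * (1 + ‖z‖) ^ (-(4:ℝ))) := by
              gcongr
              · exact (eU_pos z).le
              · exact UU_abs z
              · exact eU_le z
          _ = 4096 * ((1 + ‖z‖) ^ (1/4:ℝ) * (1 + ‖z‖) ^ (-(4:ℝ))) := by ring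
          _ ≤ 4096 * (1 / p * (1 + ‖z‖) ^ (1/4 + -(4:ℝ) + 1/2)) := by rw [hwa]; gcongr 4096 * ?_; exact far z hz _
          _ ≤ 4096 * (1 / p * (1 + ‖z‖) ^ (-(9/4:ℝ))) := by gcongr 4096 * (1 / p * ?_); exact w_mono z (by norm_num)
          _ = _ := by ring
      have b1 : |p * (ρ z ^ (1 + 1 / p) - ρ z)| ≤ (C0 * D + 1) / p * (1 + ‖z‖) ^ (-(9/4:ℝ)) := by
        by_cases hzR : z ∈ ball (0:ℂ) R
        · rw [h.comb hzR, abs_mul, abs_of_nonneg (h.ρ0 z)]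
          calc _ ≤ (C0 * (1 + ‖z‖) ^ (-(15/4:ℝ))) * (D * (1 + ‖z‖) ^ (1/4:ℝ)) := by
                have := h.ρ0 z
                have := hwn z (-(15/4:ℝ))
                gcongr
                · exact d.ρd z
                · exact hv z hzR
            _ = C0 * D * ((1 + ‖z‖) ^ (-(15/4:ℝ)) * (1 + ‖z‖) ^ (1/4:ℝ)) := by ring
            _ ≤ C0 * D * (1 / p * (1 + ‖z‖) ^ (-(15/4:ℝ) + 1/4 + 1/2)) := by rw [hwa]; gcongr _ * ?_; exact far z hz _
            _ ≤ C0 * D * (1 / p * (1 + ‖z‖) ^ (-(9/4:ℝ))) := by gcongr _ * (1 / p * ?_); exact w_mono z (by norm_num)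
            _ = C0 * D / p * (1 + ‖z‖) ^ (-(9/4:ℝ)) := by ring
            _ ≤ _ := by gcongr; linarith
        · have hzR' : R ≤ ‖z‖ := by simpa using hzR
          have q0 := h.ρ0 z
          have q1 := h.ρd z hzR'
          have q2 : ρ z ^ (1 + 1 / p) ≤ ρ z := by
            have : 0 < 1 / p := by positivity
            have := Real.rpow_le_rpow_of_exponent_ge' q0 (h.ρ1 z) zero_le_one (by linarith : 1 ≤ 1 + 1 / p)
            rwa [Real.rpow_one] at this
          have q3 : 0 ≤ ρ z ^ (1 + 1 / p) := Real.rpow_nonneg q0 _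
          rw [abs_mul, abs_of_pos hp0]
          have q4 : |ρ z ^ (1 + 1 / p) - ρ z| ≤ (1 + ‖z‖) ^ (-(4:ℝ)) := by rw [abs_le]; constructor <;> linarith
          calc _ ≤ p * (1 + ‖z‖) ^ (-(4:ℝ)) := by gcongr
            _ ≤ p * (1 / p * (1 / p * (1 + ‖z‖) ^ (-(4:ℝ) + 1/2 + 1/2))) := by
                gcongr p * ?_
                refine (far z hz _).trans ?_
                gcongr 1 / p * ?_
                exact far z hz _
            _ = 1 / p * (1 + ‖z‖) ^ (-(4:ℝ) + 1/2 + 1/2) := by field_simp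
            _ ≤ 1 / p * (1 + ‖z‖) ^ (-(9/4:ℝ)) := by gcongr 1 / p * ?_; exact w_mono z (by norm_num)
            _ ≤ _ := by
              gcongr
              have : 0 < C0 * D := by positivity
              linarith
      calc _ ≤ (C0 * D + 1) / p * (1 + ‖z‖) ^ (-(9/4:ℝ)) + 4096 / p * (1 + ‖z‖) ^ (-(9/4:ℝ)) := (abs_sub _ _).trans (add_le_add b1 b2)
        _ = (C0 * D + 1 + 4096) / p * (1 + ‖z‖) ^ (-(9/4:ℝ)) := by ring
        _ ≤ _ := by
          gcongr
          have : 0 < K2 * D := by positivity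
          rw [hK3]; linarith
  refine ⟨by linarith, fun z => (c1 z).trans ?_, fun z => (c2 z).trans ?_, fun z => (d.ρd z).trans ?_⟩
  · have := hwn z (-(5/2:ℝ)); gcongr; linarith
  · have := hwn z (-(9/4:ℝ)); gcongr; linarith
  · have := hwn z (-(15/4:ℝ)); gcongr; linarith

end

noncomputable section

lemma ss_pos (r : ℝ) : 0 < 1 + r ^ 2 / 8 := by positivity

lemma ss_deriv (r : ℝ) : HasDerivAt (fun r : ℝ => 1 + r ^ 2 / 8) (r / 4) r := by
  have := (((hasDerivAt_id r).pow 2).div_const 8).const_add 1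
  simp only [id] at this
  refine this.congr_deriv ?_
  norm_num; try ring

lemma ss_tendsto : Tendsto (fun r : ℝ => 1 + r ^ 2 / 8) atTop atTop :=
  tendsto_atTop_add_const_left _ _ ((tendsto_pow_atTop two_ne_zero).atTop_div_const (by norm_num))

lemma logr_div : Tendsto (fun r : ℝ => Real.log r / r) atTop (𝓝 0) := by
  have := Real.isLittleO_log_id_atTop.tendsto_div_nhds_zero
  simpa using this

lemma eU_integrable : Integrable eU := by
  refine ((int_w 4 (by norm_num)).const_mul 256).mono' ?_ (ae_of_all _ (fun z => ?_))
  · unfold eU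
    apply Continuous.aestronglyMeasurable
    exact (Continuous.inv₀ (by fun_prop) (fun z => (s_pos z).ne')).pow 2
  · rw [Real.norm_of_nonneg (eU_pos z).le]; exact eU_le z

lemma w_mul (z : ℂ) (a b : ℝ) : (1 + ‖z‖) ^ a * (1 + ‖z‖) ^ b = (1 + ‖z‖) ^ (a + b) :=
  (Real.rpow_add (w_pos z) a b).symm

lemma UeU_integrable : Integrable (fun z => UU z * eU z) := by
  refine ((int_w (15/4) (by norm_num)).const_mul (16 * 256)).mono' ?_ (ae_of_all _ (fun z => ?_))
  · unfold eU UU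
    apply Continuous.aestronglyMeasurable
    exact (continuous_const.mul (Continuous.log (by fun_prop) (fun z => (s_pos z).ne'))).mul
      ((Continuous.inv₀ (by fun_prop) (fun z => (s_pos z).ne')).pow 2)
  · rw [norm_mul, Real.norm_eq_abs, Real.norm_eq_abs, abs_of_pos (eU_pos z)]
    have h1 := UU_abs z
    have h2 := eU_le z
    have h3 := eU_pos z
    have h4 := abs_nonneg (UU z)
    calc _ ≤ (16 * (1 + ‖z‖) ^ (1/4:ℝ)) * (256 * (1 + ‖z‖) ^ (-(4:ℝ))) := by gcongr
      _ = (16 * 256) * ((1 + ‖z‖) ^ (1/4:ℝ) * (1 + ‖z‖) ^ (-(4:ℝ))) := by ring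
      _ = _ := by rw [w_mul]; norm_num

lemma log_abs_w (z : ℂ) : |Real.log ‖z‖| ≤ 1 / ‖z‖ + 4 * (1 + ‖z‖) ^ (1/4:ℝ) := by
  have hw := log_w_le z
  have h4 : 0 ≤ 4 * (1 + ‖z‖) ^ (1/4:ℝ) := by have := w_pos z; positivity
  rcases eq_or_ne z 0 with rfl | hz
  · simp
  have hz : 0 < ‖z‖ := norm_pos_iff.mpr hz
  rw [abs_le]; constructor
  · have := Real.one_sub_inv_le_log_of_pos hz
    rw [one_div]; linarith
  · have : Real.log ‖z‖ ≤ Real.log (1 + ‖z‖) := Real.log_le_log hz (by linarith)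
    have : 0 ≤ 1 / ‖z‖ := by positivity
    linarith

lemma log_w_int : Integrable (fun z : ℂ => |Real.log ‖z‖| * (1 + ‖z‖) ^ (-(5/2:ℝ))) := by
  have h1 := kern_integrable (int_w (5/2) (by norm_num)) (fun y => (by have := w_pos y; positivity))
    (fun y => Real.rpow_le_one_of_one_le_of_nonpos (w_one y) (by norm_num)) 0
  have h2 := (int_w (9/4) (by norm_num)).const_mul 4
  refine (h1.add h2).mono' ?_ (ae_of_all _ (fun z => ?_))
  · apply Measurable.aestronglyMeasurable; fun_prop
  · have := w_pos z
    rw [Real.norm_of_nonneg (by positivity)]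
    simp only [Pi.add_apply, zero_sub, norm_neg]
    calc _ ≤ (1 / ‖z‖ + 4 * (1 + ‖z‖) ^ (1/4:ℝ)) * (1 + ‖z‖) ^ (-(5/2:ℝ)) := by gcongr; exact log_abs_w z
      _ = (1 + ‖z‖) ^ (-(5/2:ℝ)) / ‖z‖ + 4 * ((1 + ‖z‖) ^ (1/4:ℝ) * (1 + ‖z‖) ^ (-(5/2:ℝ))) := by ring
      _ = _ := by rw [w_mul]; norm_num

lemma logmul_int {f : ℂ → ℝ} (hf : AEStronglyMeasurable f volume) (K : ℝ) (h : ∀ z, |f z| ≤ K * (1 + ‖z‖) ^ (-(5/2:ℝ))) :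
    Integrable (fun z => Real.log ‖z‖ * f z) := by
  refine (log_w_int.const_mul K).mono' ?_ (ae_of_all _ (fun z => ?_))
  · exact (Measurable.aestronglyMeasurable (by fun_prop)).mul hf
  · rw [norm_mul, Real.norm_eq_abs, Real.norm_eq_abs]
    have := h z
    calc _ ≤ |Real.log ‖z‖| * (K * (1 + ‖z‖) ^ (-(5/2:ℝ))) := by gcongr
      _ = _ := by ring

lemma leU_integrable : Integrable (fun z => Real.log ‖z‖ * eU z) := by
  refine logmul_int eU_integrable.1 256 (fun z => ?_)
  rw [abs_of_pos (eU_pos z)]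
  refine (eU_le z).trans ?_
  gcongr
  · exact w_one z
  · norm_num

lemma int_eU : ∫ z, eU z = 8 * π := by
  have hi := (radial_integrable (F := fun r => (1 + r ^ 2 / 8)⁻¹ ^ 2)).1 eU_integrable
  have h := radial_integral (fun r => (1 + r ^ 2 / 8)⁻¹ ^ 2)
  rw [show (∫ z, eU z) = ∫ z : ℂ, (fun r => (1 + r ^ 2 / 8)⁻¹ ^ 2) ‖z‖ from rfl, h]
  have hd : ∀ x ∈ Set.Ici (0:ℝ), HasDerivAt (fun r : ℝ => -4 * (1 + r ^ 2 / 8)⁻¹) (x * (1 + x ^ 2 / 8)⁻¹ ^ 2) x := by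
    intro x _
    have := ((ss_deriv x).inv (ss_pos x).ne').const_mul (-4)
    refine this.congr_deriv ?_
    have := ss_pos x
    field_simp
  have ht : Tendsto (fun r : ℝ => -4 * (1 + r ^ 2 / 8)⁻¹) atTop (𝓝 (-4 * 0)) :=
    ss_tendsto.inv_tendsto_atTop.const_mul _
  rw [integral_Ioi_of_hasDerivAt_of_tendsto' hd hi ht]
  norm_num; ring

lemma int_UeU : ∫ z, UU z * eU z = -16 * π := by
  have hi := (radial_integrable (F := fun r => -2 * Real.log (1 + r ^ 2 / 8) * (1 + r ^ 2 / 8)⁻¹ ^ 2)).1 UeU_integrable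
  have h := radial_integral (fun r => -2 * Real.log (1 + r ^ 2 / 8) * (1 + r ^ 2 / 8)⁻¹ ^ 2)
  rw [show (∫ z, UU z * eU z) = ∫ z : ℂ, (fun r => -2 * Real.log (1 + r ^ 2 / 8) * (1 + r ^ 2 / 8)⁻¹ ^ 2) ‖z‖ from rfl, h]
  have hd : ∀ x ∈ Set.Ici (0:ℝ), HasDerivAt (fun r : ℝ => 8 * (Real.log (1 + r ^ 2 / 8) / (1 + r ^ 2 / 8) + (1 + r ^ 2 / 8)⁻¹)) (x * (-2 * Real.log (1 + x ^ 2 / 8) * (1 + x ^ 2 / 8)⁻¹ ^ 2)) x := by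
    intro x _
    have s0 := ss_pos x
    have := ((((ss_deriv x).log s0.ne').div (ss_deriv x) s0.ne').add ((ss_deriv x).inv s0.ne')).const_mul 8
    refine this.congr_deriv ?_
    field_simp
    ring
  have ht : Tendsto (fun r : ℝ => 8 * (Real.log (1 + r ^ 2 / 8) / (1 + r ^ 2 / 8) + (1 + r ^ 2 / 8)⁻¹)) atTop (𝓝 (8 * (0 + 0))) :=
    ((logr_div.comp ss_tendsto).add ss_tendsto.inv_tendsto_atTop).const_mul _
  rw [integral_Ioi_of_hasDerivAt_of_tendsto' hd hi ht]
  norm_num; ring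

lemma int_leU : ∫ z, Real.log ‖z‖ * eU z = 12 * π * Real.log 2 := by
  have hi := (radial_integrable (F := fun r => Real.log r * (1 + r ^ 2 / 8)⁻¹ ^ 2)).1 leU_integrable
  have h := radial_integral (fun r => Real.log r * (1 + r ^ 2 / 8)⁻¹ ^ 2)
  rw [show (∫ z, Real.log ‖z‖ * eU z) = ∫ z : ℂ, (fun r => Real.log r * (1 + r ^ 2 / 8)⁻¹ ^ 2) ‖z‖ from rfl, h]
  have hc : Continuous (fun r : ℝ => 4 * (r * Real.log r) * (r / 8) * (1 + r ^ 2 / 8)⁻¹ - 2 * Real.log (1 + r ^ 2 / 8)) := by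
    have h1 := Real.continuous_mul_log
    have h2 : Continuous (fun r : ℝ => (1 + r ^ 2 / 8)⁻¹) := Continuous.inv₀ (by fun_prop) (fun r => (ss_pos r).ne')
    have h3 : Continuous (fun r : ℝ => Real.log (1 + r ^ 2 / 8)) := Continuous.log (by fun_prop) (fun r => (ss_pos r).ne')
    exact (((continuous_const.mul h1).mul (by fun_prop)).mul h2).sub (continuous_const.mul h3)
  have hd : ∀ x ∈ Set.Ioi (0:ℝ), HasDerivAt (fun r : ℝ => 4 * (r * Real.log r) * (r / 8) * (1 + r ^ 2 / 8)⁻¹ - 2 * Real.log (1 + r ^ 2 / 8)) (x * (Real.log x * (1 + x ^ 2 / 8)⁻¹ ^ 2)) x := by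
    intro x hx
    have s0 := ss_pos x
    have hx0 : x ≠ 0 := (ne_of_gt hx)
    have := ((((Real.hasDerivAt_mul_log hx0).const_mul 4).mul ((hasDerivAt_id x).div_const 8)).mul ((ss_deriv x).inv s0.ne')).sub
      (((ss_deriv x).log s0.ne').const_mul 2)
    refine this.congr_deriv ?_
    simp only [id, Pi.inv_apply, Pi.mul_apply]
    field_simp
    ring
  have ht : Tendsto (fun r : ℝ => 4 * (r * Real.log r) * (r / 8) * (1 + r ^ 2 / 8)⁻¹ - 2 * Real.log (1 + r ^ 2 / 8)) atTop (𝓝 (-2 * Real.log (1/8) - 4 * 0)) := by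
    have h1 : Tendsto (fun r : ℝ => Real.log r / (1 + r ^ 2 / 8)) atTop (𝓝 0) := by
      have h8 : Tendsto (fun r : ℝ => 8 * (Real.log r / r)) atTop (𝓝 (8 * 0)) := logr_div.const_mul 8
      rw [mul_zero] at h8
      refine squeeze_zero' ?_ ?_ h8
      · filter_upwards [eventually_ge_atTop 1] with r hr
        have := Real.log_nonneg hr
        have := ss_pos r
        positivity
      · filter_upwards [eventually_ge_atTop 1] with r hr
        have := Real.log_nonneg hr
        have hs : r / 8 ≤ 1 + r ^ 2 / 8 := by nlinarith
        calc _ ≤ Real.log r / (r / 8) := by gcongr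
          _ = _ := by ring
    have h2 : Tendsto (fun r : ℝ => -2 * Real.log (r⁻¹ ^ 2 + 1 / 8)) atTop (𝓝 (-2 * Real.log (0 ^ 2 + 1/8))) :=
      ((((tendsto_inv_atTop_zero (𝕜 := ℝ)).pow 2).add_const _).log (by norm_num)).const_mul _
    rw [zero_pow two_ne_zero, zero_add] at h2
    refine (h2.sub (h1.const_mul 4)).congr' ?_
    filter_upwards [eventually_gt_atTop 0] with r hr
    have e : r⁻¹ ^ 2 + 1 / 8 = (1 + r ^ 2 / 8) / r ^ 2 := by field_simp
    have s0 := ss_pos r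
    rw [e, Real.log_div s0.ne' (by positivity), Real.log_pow]
    field_simp
    push_cast
    ring
  rw [integral_Ioi_of_hasDerivAt_of_tendsto hc.continuousWithinAt hd hi ht]
  have e : Real.log (1/8) = -3 * Real.log 2 := by
    rw [one_div, Real.log_inv, show (8:ℝ) = 2 ^ 3 by norm_num, Real.log_pow]; push_cast; ring
  rw [e]
  norm_num; ring

/-- integrated comparisons -/
lemma cm_int : ∃ K : ℝ, 1 ≤ K ∧ ∀ (C p : ℝ) (ρ : ℂ → ℝ), 0 < p → Continuous ρ → Integrable ρ → (∀ y, 0 ≤ ρ y) → (∀ y, ρ y ≤ 1) → Cm C p ρ →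
    |(∫ y, ρ y) - 8 * π| ≤ K * C / p ∧ |(∫ y, Real.log ‖y‖ * ρ y) - 12 * π * Real.log 2| ≤ K * C / p ∧
    |(∫ y, p * (ρ y ^ (1 + 1 / p) - ρ y)) + 16 * π| ≤ K * C / p ∧ Integrable (fun y => Real.log ‖y‖ * ρ y) := by
  have i1 := int_w (5/2) (by norm_num)
  have i2 := int_w (9/4) (by norm_num)
  have n1 : 0 ≤ ∫ y : ℂ, (1 + ‖y‖) ^ (-(5/2:ℝ)) := integral_nonneg (fun y => by have := w_pos y; positivity)
  have n2 : 0 ≤ ∫ y : ℂ, (1 + ‖y‖) ^ (-(9/4:ℝ)) := integral_nonneg (fun y => by have := w_pos y; positivity)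
  have n3 : 0 ≤ ∫ y : ℂ, |Real.log ‖y‖| * (1 + ‖y‖) ^ (-(5/2:ℝ)) := integral_nonneg (fun y => by have := w_pos y; positivity)
  refine ⟨1 + (∫ y : ℂ, (1 + ‖y‖) ^ (-(5/2:ℝ))) + (∫ y : ℂ, (1 + ‖y‖) ^ (-(9/4:ℝ))) + ∫ y : ℂ, |Real.log ‖y‖| * (1 + ‖y‖) ^ (-(5/2:ℝ)), by linarith, ?_⟩
  intro C p ρ hp hc hi h0 h1 h
  have hC : 0 < C := by linarith [h.C1]
  set a1 := ∫ y : ℂ, (1 + ‖y‖) ^ (-(5/2:ℝ)) with ha1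
  set a2 := ∫ y : ℂ, (1 + ‖y‖) ^ (-(9/4:ℝ)) with ha2
  set a3 := ∫ y : ℂ, |Real.log ‖y‖| * (1 + ‖y‖) ^ (-(5/2:ℝ)) with ha3
  have hl : Integrable (fun y => Real.log ‖y‖ * ρ y) := by
    refine logmul_int hc.aestronglyMeasurable C (fun z => ?_)
    rw [abs_of_nonneg (h0 z)]
    refine (h.c3 z).trans ?_
    exact mul_le_mul_of_nonneg_left (Real.rpow_le_rpow_of_exponent_le (w_one z) (by norm_num)) hC.le
  have hN : Integrable (fun y => p * (ρ y ^ (1 + 1 / p) - ρ y)) := by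
    refine Integrable.const_mul (Integrable.sub ?_ hi) p
    refine hi.mono' ?_ (ae_of_all _ (fun z => ?_))
    · exact (hc.rpow_const (fun x => Or.inr (by positivity))).aestronglyMeasurable
    · rw [Real.norm_of_nonneg (Real.rpow_nonneg (h0 z) _)]
      calc _ ≤ ρ z ^ (1:ℝ) := by
            apply Real.rpow_le_rpow_of_exponent_ge' (h0 z) (h1 z) (by norm_num)
            have : 0 < 1 / p := by positivity
            linarith
        _ = _ := Real.rpow_one _
  have fin : ∀ a, 0 ≤ a → a ≤ 1 + a1 + a2 + a3 → C / p * a ≤ (1 + a1 + a2 + a3) * C / p := by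
    intro a ha hb
    rw [mul_div_assoc, mul_comm]
    gcongr
  refine ⟨?_, ?_, ?_, hl⟩
  · rw [← int_eU, ← integral_sub hi eU_integrable]
    rw [← Real.norm_eq_abs]
    refine (norm_integral_le_of_norm_le (i1.const_mul (C / p)) (ae_of_all _ (fun z => by rw [Real.norm_eq_abs]; exact h.c1 z))).trans ?_
    rw [integral_const_mul]
    exact fin _ n1 (by linarith)
  · rw [← int_leU, ← integral_sub hl leU_integrable]
    rw [← Real.norm_eq_abs]
    refine (norm_integral_le_of_norm_le (log_w_int.const_mul (C / p)) (ae_of_all _ (fun z => ?_))).trans ?_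
    · rw [← mul_sub, norm_mul, Real.norm_eq_abs, Real.norm_eq_abs]
      have := h.c1 z
      calc _ ≤ |Real.log ‖z‖| * (C / p * (1 + ‖z‖) ^ (-(5/2:ℝ))) := by gcongr
        _ = _ := by ring
    · rw [integral_const_mul]
      exact fin _ n3 (by linarith)
  · rw [show (∫ y, p * (ρ y ^ (1 + 1 / p) - ρ y)) + 16 * π = (∫ y, p * (ρ y ^ (1 + 1 / p) - ρ y)) - (-16 * π) by ring, ← int_UeU, ← integral_sub hN UeU_integrable]
    rw [← Real.norm_eq_abs]
    refine (norm_integral_le_of_norm_le (i2.const_mul (C / p)) (ae_of_all _ (fun z => by rw [Real.norm_eq_abs]; exact h.c2 z))).trans ?_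
    rw [integral_const_mul]
    exact fin _ n2 (by linarith)

end

noncomputable section

lemma Pk.Fsum {B p R : ℝ} {v : ℂ → ℝ} {vz hh : ℂ → ℂ} {ρ : ℂ → ℝ} (h : Pk B p R v vz hh ρ) {L b : ℝ} (hL : 0 < L) (hLR : 2 * L ≤ R)
    (hb : ∫ y in (ball (0:ℂ) L)ᶜ, ρ y ≤ b) :
    |1 / (8 * π) * (∫ y, ρ y) ^ 2 - ∫ y, FF p ρ y| ≤ 60 * L * B / R + 100 * (CΦ + 1) * b := by
  have h0 := h.pohG (S := ball (0:ℂ) L) (A := (ball (0:ℂ) L)ᶜ) (κ := 0) hL hLR le_rfl measurableSet_ball measurableSet_ball.compl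
    (by
      intro z y hz hy hzy
      rw [Set.mem_compl_iff, not_not] at hz hy
      have hz' : ‖z‖ < L := by simpa using hz
      have hy' : ‖y‖ < L := by simpa using hy
      rw [Ph_id hL hz'.le, Ph_id hL hy'.le, div_self (sub_ne_zero.mpr hzy)]
      simp [hz', hy'])
    (by
      intro y hy
      rw [Set.mem_compl_iff, not_not] at hy
      have hy' : ‖y‖ < L := by simpa using hy
      rw [Ph_dz_one hL hy']
      simp [hy'])
  have hC := CΦ_one
  have hB := h.hB
  have hR := h.R0
  have e1 : (∫ y in ball (0:ℂ) L, ρ y) + ∫ y in (ball (0:ℂ) L)ᶜ, ρ y = ∫ y, ρ y := integral_add_compl measurableSet_ball h.ρi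
  have e2 : (∫ y in ball (0:ℂ) L, FF p ρ y) + ∫ y in (ball (0:ℂ) L)ᶜ, FF p ρ y = ∫ y, FF p ρ y := integral_add_compl measurableSet_ball h.FFi
  have hF0 : 0 ≤ ∫ y in (ball (0:ℂ) L)ᶜ, FF p ρ y := integral_nonneg (fun y => h.FF0 y)
  have hFb : ∫ y in (ball (0:ℂ) L)ᶜ, FF p ρ y ≤ ∫ y in (ball (0:ℂ) L)ᶜ, ρ y :=
    setIntegral_mono h.FFi.integrableOn h.ρi.integrableOn (fun y => h.FF_le y)
  have hb0 : 0 ≤ ∫ y in (ball (0:ℂ) L)ᶜ, ρ y := integral_nonneg (fun y => h.ρ0 y)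
  have ha0 : 0 ≤ ∫ y in (ball (0:ℂ) L), ρ y := integral_nonneg (fun y => h.ρ0 y)
  have hm := h.mass
  have hm26 : ∫ y, ρ y ≤ 26 := by linarith [Real.pi_lt_d2]
  set m := ∫ y, ρ y
  set a := ∫ y in ball (0:ℂ) L, ρ y
  set b' := ∫ y in (ball (0:ℂ) L)ᶜ, ρ y
  set F := ∫ y, FF p ρ y
  set Fa := ∫ y in ball (0:ℂ) L, FF p ρ y
  set Fb := ∫ y in (ball (0:ℂ) L)ᶜ, FF p ρ y
  have hpi := Real.pi_gt_three
  have h8 : 1 / (8 * π) ≤ 1 / 24 := by apply one_div_le_one_div_of_le <;> linarith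
  have h80 : 0 < 1 / (8 * π) := by positivity
  set k := 1 / (8 * π)
  have hma : 0 ≤ k * m ^ 2 - k * a ^ 2 ∧ k * m ^ 2 - k * a ^ 2 ≤ 3 * b' := by
    have e : k * m ^ 2 - k * a ^ 2 = k * (b' * (m + a)) := by rw [← e1]; ring
    rw [e]
    have : 0 ≤ b' * (m + a) := by apply mul_nonneg hb0; linarith
    refine ⟨by positivity, ?_⟩
    calc k * (b' * (m + a)) ≤ 1 / 24 * (b' * 52) := by gcongr; linarith
      _ ≤ _ := by linarith
  have t1 : 2 * L * (B / R) * m ≤ 60 * L * B / R := by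
    have : 2 * L * (B / R) * m ≤ 2 * L * (B / R) * 26 := by gcongr
    have h2 : 60 * L * B / R = 2 * L * (B / R) * 30 := by ring
    have : 0 ≤ L * (B / R) := by positivity
    rw [h2]; linarith
  have t2 : k * (2 * (CΦ + 1) * m * b' + 0 * m ^ 2) ≤ 3 * (CΦ + 1) * b' := by
    calc _ ≤ 1 / 24 * (2 * (CΦ + 1) * 26 * b' + 0 * m ^ 2) := by gcongr; nlinarith [mul_nonneg h.mpos hb0, mul_nonneg (mul_nonneg (show 0 ≤ CΦ + 1 by linarith) h.mpos) hb0]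
      _ ≤ _ := by nlinarith [mul_nonneg (show 0 ≤ CΦ + 1 by linarith) hb0]
  have t3 : 100 * (CΦ + 1) * b' ≤ 100 * (CΦ + 1) * b := by gcongr
  have t4 : 0 ≤ (CΦ + 1) * b' := mul_nonneg (by linarith) hb0
  have t5 : b' ≤ (CΦ + 1) * b' := by nlinarith
  rw [abs_le] at h0 ⊢
  constructor <;> linarith [h0.1, h0.2, hma.1, hma.2]

lemma alg_final {p m N K : ℝ} (hp : 20 ≤ p) (hK : 1 ≤ K) (h1 : |m - 8 * π| ≤ K / p) (h2 : |p * (N - m) + 16 * π| ≤ K / p)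
    (h3 : |1 / (8 * π) * m ^ 2 - p / (p + 1) * N| ≤ K / p ^ 2) :
    |m - (8 * π - 24 * π / p)| ≤ (4 * K + K ^ 2 + 200) / p ^ 2 ∧ |N - (8 * π - 40 * π / p)| ≤ (5 * K + K ^ 2 + 200) / p ^ 2 := by
  have hp0 : 0 < p := by linarith
  have hpi := Real.pi_pos
  have hpi3 := Real.pi_gt_three
  have hpi4 := Real.pi_lt_d2
  obtain ⟨e0, he0⟩ : ∃ e0, e0 = p * (m - 8 * π) := ⟨_, rfl⟩
  obtain ⟨e1, he1⟩ : ∃ e1, e1 = p * (p * (N - m) + 16 * π) := ⟨_, rfl⟩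
  obtain ⟨e2, he2⟩ : ∃ e2, e2 = p ^ 2 * (1 / (8 * π) * m ^ 2 - p / (p + 1) * N) := ⟨_, rfl⟩
  have b0 : |e0| ≤ K := by
    rw [he0, abs_mul, abs_of_pos hp0]; calc _ ≤ p * (K / p) := by gcongr
      _ = K := by field_simp
  have b1 : |e1| ≤ K := by
    rw [he1, abs_mul, abs_of_pos hp0]; calc _ ≤ p * (K / p) := by gcongr
      _ = K := by field_simp
  have b2 : |e2| ≤ K := by
    rw [he2, abs_mul, abs_of_pos (by positivity)]; calc _ ≤ p ^ 2 * (K / p ^ 2) := by gcongr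
      _ = K := by field_simp
  have em : m = 8 * π + e0 / p := by rw [he0]; field_simp; ring
  have eN : N = m - 16 * π / p + e1 / p ^ 2 := by rw [he1]; field_simp; ring
  -- main relation
  have rel : (p + 2) * e0 = -24 * π * p + e1 + (p + 1) / p * e2 - (p + 1) / (8 * π * p) * e0 ^ 2 := by
    rw [eN, em] at he2
    field_simp at he2 ⊢
    linear_combination -he2
  have key : |e0 + 24 * π| ≤ (4 * K + K ^ 2 + 200) / p := by
    have e : e0 + 24 * π = (48 * π + e1 + (p + 1) / p * e2 - (p + 1) / (8 * π * p) * e0 ^ 2) / (p + 2) := by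
      field_simp; field_simp at rel; linear_combination rel
    rw [e, abs_div, abs_of_pos (show 0 < p + 2 by linarith)]
    have c1 : |(p + 1) / p * e2| ≤ 2 * K := by
      rw [abs_mul, abs_of_pos (by positivity)]
      have : (p + 1) / p ≤ 2 := by rw [div_le_iff₀ hp0]; linarith
      gcongr
    have c2 : |(p + 1) / (8 * π * p) * e0 ^ 2| ≤ K ^ 2 := by
      rw [abs_mul, abs_of_pos (by positivity), abs_pow]
      have : (p + 1) / (8 * π * p) ≤ 1 := by rw [div_le_one (by positivity)]; nlinarith
      calc _ ≤ 1 * K ^ 2 := by gcongr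
        _ = _ := one_mul _
    have : |48 * π + e1 + (p + 1) / p * e2 - (p + 1) / (8 * π * p) * e0 ^ 2| ≤ 4 * K + K ^ 2 + 200 := by
      rw [abs_le] at *
      constructor <;> linarith [c1.1, c1.2, c2.1, c2.2, b1.1, b1.2]
    gcongr
    linarith
  have r1 : |m - (8 * π - 24 * π / p)| ≤ (4 * K + K ^ 2 + 200) / p ^ 2 := by
    have : m - (8 * π - 24 * π / p) = (e0 + 24 * π) / p := by rw [em]; ring
    rw [this, abs_div, abs_of_pos hp0]
    calc _ ≤ (4 * K + K ^ 2 + 200) / p / p := by gcongr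
      _ = _ := by rw [div_div, ← sq]
  refine ⟨r1, ?_⟩
  have : N - (8 * π - 40 * π / p) = (m - (8 * π - 24 * π / p)) + e1 / p ^ 2 := by rw [eN]; ring
  rw [this]
  refine (abs_add_le _ _).trans ?_
  have : |e1 / p ^ 2| ≤ K / p ^ 2 := by rw [abs_div, abs_of_pos (show 0 < p ^ 2 by positivity)]; gcongr
  calc _ ≤ (4 * K + K ^ 2 + 200) / p ^ 2 + K / p ^ 2 := add_le_add r1 this
    _ = _ := by ring

/-- core theorem for packages -/
theorem core (B : ℝ) (hB : 1 ≤ B) : ∃ C P0 : ℝ, 1 ≤ C ∧ 0 < P0 ∧ ∀ (p R : ℝ) (v : ℂ → ℝ) (vz hh : ℂ → ℂ) (ρ : ℂ → ℝ),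
    Pk B p R v vz hh ρ → P0 ≤ p →
    |(∫ y, ρ y) - (8 * π - 24 * π / p)| ≤ C / p ^ 2 ∧ |(∫ y, Real.log ‖y‖ * ρ y) - 12 * π * Real.log 2| ≤ C / p ∧
    |(∫ y, ρ y ^ (1 + 1 / p)) - (8 * π - 40 * π / p)| ≤ C / p ^ 2 ∧ Integrable (fun y => Real.log ‖y‖ * ρ y) := by
  obtain ⟨C0, P0, hC0, hP0, H0⟩ := decay B hB
  obtain ⟨C1, hC1, H1⟩ := eta B C0 hB hC0
  obtain ⟨C2, hC2, H2⟩ := psi_est B C0 C1 hB hC0 hC1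
  obtain ⟨C4, H4⟩ := cmp_est B C0 C2 hB hC0 hC2
  obtain ⟨K, hK, H5⟩ := cm_int
  have hCf := CΦ_one
  set W := ∫ y : ℂ, (1 + ‖y‖) ^ (-(11/4:ℝ)) with hW
  have hW0 : 0 ≤ W := integral_nonneg (fun y => by have := w_pos y; positivity)
  set D := max C4 1 with hD
  have hD1 : 1 ≤ D := le_max_right _ _
  set K' := K * D + 60 * B + 100 * (CΦ + 1) * (D * W) with hK'
  have hK1 : 1 ≤ K' := by
    have : 0 ≤ 100 * (CΦ + 1) * (D * W) := by positivity
    nlinarith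
  refine ⟨5 * K' + K' ^ 2 + 200, P0, by nlinarith, hP0, ?_⟩
  intro p R v vz hh ρ h hp
  have hp0 := h.p0
  have h20 := h.hp
  have d := H0 p R v vz hh ρ h hp
  obtain ⟨vzz, hE⟩ := H1 p R v vz hh ρ h d
  have hc := H4 p R v vz hh ρ h d (H2 p R v vz hh vzz ρ h d hE)
  have hCD : C4 = D := by rw [hD, max_eq_left hc.C1]
  rw [hCD] at hc
  obtain ⟨g1, g2, g3, g4⟩ := H5 D p ρ hp0 h.ρC.continuous h.ρi h.ρ0 h.ρ1 hc
  have hKK : K * D / p ≤ K' / p := by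
    have : 0 ≤ 100 * (CΦ + 1) * (D * W) := by positivity
    gcongr; rw [hK']; nlinarith
  have hFN : ∫ y, FF p ρ y = p / (p + 1) * ∫ y, ρ y ^ (1 + 1 / p) := by
    unfold FF; rw [integral_const_mul]
  have hNi : Integrable (fun y => ρ y ^ (1 + 1 / p)) := by
    have := h.FFi.const_mul ((p + 1) / p)
    refine this.congr (ae_of_all _ (fun y => ?_))
    unfold FF; field_simp
  have e3 : ∫ y, p * (ρ y ^ (1 + 1 / p) - ρ y) = p * ((∫ y, ρ y ^ (1 + 1 / p)) - ∫ y, ρ y) := by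
    rw [integral_const_mul, integral_sub hNi h.ρi]
  rw [e3] at g3
  have hL : (0:ℝ) < p ^ 4 := by positivity
  have hLR : 2 * p ^ 4 ≤ R := by
    refine le_trans ?_ h.hR
    have : (2:ℝ) ≤ p ^ 6 := by
      calc (2:ℝ) ≤ 2 ^ 6 := by norm_num
        _ ≤ p ^ 6 := by gcongr; linarith
    calc 2 * p ^ 4 ≤ p ^ 6 * p ^ 4 := by gcongr
      _ = p ^ 10 := by ring
  have hb : ∫ y in (ball (0:ℂ) (p ^ 4))ᶜ, ρ y ≤ D * W / p ^ 4 := by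
    have i := (int_w (11/4) (by norm_num)).const_mul (D / p ^ 4)
    calc _ ≤ ∫ y in (ball (0:ℂ) (p ^ 4))ᶜ, D / p ^ 4 * (1 + ‖y‖) ^ (-(11/4:ℝ)) := by
          apply setIntegral_mono_on h.ρi.integrableOn i.integrableOn measurableSet_ball.compl
          intro y hy
          have hy' : p ^ 4 ≤ ‖y‖ := by simpa using hy
          have hw := w_pos y
          refine (hc.c3 y).trans ?_
          have : (1 + ‖y‖) ^ (-(15/4:ℝ)) = (1 + ‖y‖)⁻¹ * (1 + ‖y‖) ^ (-(11/4:ℝ)) := by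
            rw [← Real.rpow_neg_one, w_mul]; norm_num
          rw [this]
          have e5 : D / p ^ 4 * (1 + ‖y‖) ^ (-(11/4:ℝ)) = D * ((p ^ 4)⁻¹ * (1 + ‖y‖) ^ (-(11/4:ℝ))) := by ring
          rw [e5]
          gcongr
          linarith
      _ ≤ ∫ y, D / p ^ 4 * (1 + ‖y‖) ^ (-(11/4:ℝ)) :=
          setIntegral_le_integral i (ae_of_all _ (fun y => by have := w_pos y; positivity))
      _ = _ := by rw [integral_const_mul]; ring
  have g5 := h.Fsum hL hLR hb
  have g6 : |1 / (8 * π) * (∫ y, ρ y) ^ 2 - p / (p + 1) * ∫ y, ρ y ^ (1 + 1 / p)| ≤ K' / p ^ 2 := by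
    rw [hFN] at g5
    refine g5.trans ?_
    have q1 : 60 * p ^ 4 * B / R ≤ 60 * B / p ^ 2 := by
      rw [div_le_div_iff₀ (by linarith [h.R0]) (by positivity)]
      have : p ^ 6 ≤ R := le_trans (pow_le_pow_right₀ (by linarith) (by norm_num)) h.hR
      nlinarith [mul_le_mul_of_nonneg_left this (show 0 ≤ 60 * B by linarith)]
    have q2 : 100 * (CΦ + 1) * (D * W / p ^ 4) ≤ 100 * (CΦ + 1) * (D * W) / p ^ 2 := by
      rw [← mul_div_assoc]
      have : p ^ 2 ≤ p ^ 4 := pow_le_pow_right₀ (by linarith) (by norm_num)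
      gcongr
    have q3 : 0 ≤ K * D / p ^ 2 := by positivity
    have : K' / p ^ 2 = K * D / p ^ 2 + 60 * B / p ^ 2 + 100 * (CΦ + 1) * (D * W) / p ^ 2 := by rw [hK']; ring
    rw [this]; linarith
  obtain ⟨f1, f2⟩ := alg_final h20 hK1 (g1.trans hKK) (g3.trans hKK) g6
  refine ⟨f1.trans ?_, g2.trans (hKK.trans ?_), f2, g4⟩
  · gcongr; linarith
  · gcongr; nlinarith

end

noncomputable section

/-- solution data in the complex plane, extended by zero -/
structure Sl (Ω : Set ℂ) (d p : ℝ) (u : ℂ → ℝ) : Prop where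
  hΩ : IsOpen Ω
  hd : Ω ⊆ ball 0 (d / 2)
  d1 : 1 ≤ d
  hp : 20 ≤ p
  uC : ContDiffOn ℝ 2 u Ω
  uc : Continuous u
  u0 : ∀ x, x ∉ Ω → u x = 0
  eq : ∀ x ∈ Ω, 4 * db (dz (fun y => (u y : ℂ))) x = -((|u x| ^ (p - 1) * u x : ℝ) : ℂ)

def fp (u : ℂ → ℝ) (x : ℂ) : ℝ := max (u x) 0
def hp' (p : ℝ) (u : ℂ → ℝ) (x : ℂ) : ℝ := fp u x ^ p

def psiT (t s : ℝ) : ℝ := Real.smoothTransition ((s - t) / t)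
def PhiT (t s : ℝ) : ℝ := ∫ σ in (0:ℝ)..s, psiT t σ

lemma psiT_contDiff (t : ℝ) : ContDiff ℝ 1 (psiT t) := by
  unfold psiT
  exact (Real.smoothTransition.contDiff (n := 1)).comp (by fun_prop)

lemma PhiT_deriv (t s : ℝ) : HasDerivAt (PhiT t) (psiT t s) s :=
  intervalIntegral.integral_hasDerivAt_right ((psiT_contDiff t).continuous.intervalIntegrable _ _)
    ((psiT_contDiff t).continuous.stronglyMeasurableAtFilter _ _) (psiT_contDiff t).continuous.continuousAt

lemma PhiT_contDiff (t : ℝ) : ContDiff ℝ 2 (PhiT t) := by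
  rw [show (2 : WithTop ℕ∞) = 1 + 1 by norm_num, contDiff_succ_iff_deriv]
  refine ⟨fun s => (PhiT_deriv t s).differentiableAt, by simp, ?_⟩
  rw [show deriv (PhiT t) = psiT t from funext (fun s => (PhiT_deriv t s).deriv)]
  exact psiT_contDiff t

lemma psiT_zero {t s : ℝ} (ht : 0 < t) (hs : s ≤ t) : psiT t s = 0 := by
  unfold psiT
  exact Real.smoothTransition.zero_of_nonpos (div_nonpos_of_nonpos_of_nonneg (by linarith) ht.le)

lemma psiT_one {t s : ℝ} (ht : 0 < t) (hs : 2 * t ≤ s) : psiT t s = 1 := by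
  unfold psiT
  apply Real.smoothTransition.one_of_one_le
  rw [le_div_iff₀ ht]; linarith

lemma psiT_nonneg (t s : ℝ) : 0 ≤ psiT t s := Real.smoothTransition.nonneg _
lemma psiT_le_one (t s : ℝ) : psiT t s ≤ 1 := Real.smoothTransition.le_one _

lemma psiT_deriv_nonneg {t : ℝ} (ht : 0 < t) (s : ℝ) : 0 ≤ deriv (psiT t) s := by
  apply Monotone.deriv_nonneg
  intro a b hab
  unfold psiT
  apply Real.smoothTransition.monotone
  gcongr

lemma PhiT_zero {t s : ℝ} (ht : 0 < t) (hs : s ≤ t) : PhiT t s = 0 := by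
  unfold PhiT
  rw [intervalIntegral.integral_congr (g := fun _ => 0)]
  · simp
  · intro σ hσ
    apply psiT_zero ht
    have := hσ.2
    rcases le_total s 0 with h | h
    · rw [max_eq_left h] at this; linarith
    · rw [max_eq_right h] at this; linarith

lemma PhiT_ge {t s : ℝ} (ht : 0 < t) : s - 2 * t ≤ PhiT t s := by
  have hc := (psiT_contDiff t).continuous
  rcases le_total s t with h | h
  · rw [PhiT_zero ht h]; linarith
  have h0 : 0 ≤ PhiT t s := intervalIntegral.integral_nonneg (by linarith) (fun σ _ => psiT_nonneg t σ)
  rcases le_total s (2 * t) with h' | h'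
  · linarith
  unfold PhiT
  rw [← intervalIntegral.integral_add_adjacent_intervals (hc.intervalIntegrable 0 (2 * t)) (hc.intervalIntegrable (2 * t) s)]
  have h1 : 0 ≤ ∫ σ in (0:ℝ)..(2 * t), psiT t σ := intervalIntegral.integral_nonneg (by linarith) (fun σ _ => psiT_nonneg t σ)
  have h2 : ∫ σ in (2 * t)..s, psiT t σ = ∫ σ in (2 * t)..s, (1:ℝ) := by
    apply intervalIntegral.integral_congr
    intro σ hσ
    rw [Set.uIcc_of_le h'] at hσ
    exact psiT_one ht hσ.1
  rw [h2, intervalIntegral.integral_const, smul_eq_mul, mul_one]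
  linarith

namespace Sl
variable {Ω : Set ℂ} {d p : ℝ} {u : ℂ → ℝ}

lemma p0 (h : Sl Ω d p u) : 0 < p := by linarith [h.hp]
lemma fp0 (u : ℂ → ℝ) (x : ℂ) : 0 ≤ fp u x := le_max_right _ _
lemma hp0 (p : ℝ) (u : ℂ → ℝ) (x : ℂ) : 0 ≤ hp' p u x := Real.rpow_nonneg (fp0 u x) _
lemma fpc (h : Sl Ω d p u) : Continuous (fp u) := h.uc.max continuous_const
lemma hpc (h : Sl Ω d p u) : Continuous (hp' p u) := h.fpc.rpow_const (fun _ => Or.inr h.p0.le)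
lemma fp_out (h : Sl Ω d p u) {x : ℂ} (hx : x ∉ Ω) : fp u x = 0 := by unfold fp; rw [h.u0 x hx]; simp
lemma hp_out (h : Sl Ω d p u) {x : ℂ} (hx : x ∉ Ω) : hp' p u x = 0 := by
  unfold hp'; rw [h.fp_out hx]; exact Real.zero_rpow h.p0.ne'
lemma out_cs (h : Sl Ω d p u) {E : Type*} [Zero E] {f : ℂ → E} (hf : ∀ x, x ∉ Ω → f x = 0) : HasCompactSupport f :=
  hasCompactSupport_of_norm (T := d / 2) (fun z hz => hf z (fun hz' => by
    have := h.hd hz'; rw [mem_ball_zero_iff] at this; linarith))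
lemma hpcs (h : Sl Ω d p u) : HasCompactSupport (hp' p u) := h.out_cs (fun _ hx => h.hp_out hx)
lemma hpi (h : Sl Ω d p u) : Integrable (hp' p u) := h.hpc.integrable_of_hasCompactSupport h.hpcs

lemma uR (h : Sl Ω d p u) {x : ℂ} (hx : x ∈ Ω) : HasR u (dz (fun y => (u y : ℂ)) x) x :=
  HasR.of_differentiableAt (((h.uC.contDiffAt (h.hΩ.mem_nhds hx))).differentiableAt (by norm_num))

lemma uzC (h : Sl Ω d p u) {x : ℂ} (hx : x ∈ Ω) : ContDiffAt ℝ 1 (dz (fun y => (u y : ℂ))) x := by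
  have h1 : ContDiffAt ℝ 2 (fun y => (u y : ℂ)) x :=
    Complex.ofRealCLM.contDiff.contDiffAt.comp x (h.uC.contDiffAt (h.hΩ.mem_nhds hx))
  have h2 : ContDiffAt ℝ 1 (fderiv ℝ (fun y => (u y : ℂ))) x := h1.fderiv_right (by norm_num)
  unfold dz
  fun_prop

lemma uzW (h : Sl Ω d p u) {x : ℂ} (hx : x ∈ Ω) :
    HasW (dz (fun y => (u y : ℂ))) (dz (dz (fun y => (u y : ℂ))) x) (-((|u x| ^ (p - 1) * u x : ℝ) : ℂ) / 4) x := by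
  have := hasW_of_differentiableAt ((h.uzC hx).differentiableAt (by norm_num))
  have e : db (dz (fun y => (u y : ℂ))) x = -((|u x| ^ (p - 1) * u x : ℝ) : ℂ) / 4 := by
    rw [← h.eq x hx]; ring
  rwa [e] at this

lemma Hpos (h : Sl Ω d p u) {x : ℂ} (hx : 0 < u x) : |u x| ^ (p - 1) * u x = hp' p u x := by
  unfold hp' fp
  rw [max_eq_left hx.le, abs_of_pos hx, ← Real.rpow_add_one hx.ne']; congr 1; ring

/-- truncation is C2 -/
lemma gC (h : Sl Ω d p u) {t : ℝ} (ht : 0 < t) : ContDiff ℝ 2 (fun y => PhiT t (u y)) := by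
  rw [contDiff_iff_contDiffAt]
  intro x
  by_cases hx : x ∈ Ω
  · exact (PhiT_contDiff t).contDiffAt.comp x (h.uC.contDiffAt (h.hΩ.mem_nhds hx))
  · have : (fun y => PhiT t (u y)) =ᶠ[𝓝 x] (fun _ => 0) := by
      have h1 : ∀ᶠ y in 𝓝 x, u y < t := (h.uc.continuousAt (x := x)).eventually_lt continuousAt_const (by rw [h.u0 x hx]; exact ht)
      filter_upwards [h1] with y hy
      exact PhiT_zero ht hy.le
    exact contDiffAt_const.congr_of_eventuallyEq this

lemma g_lap_in (h : Sl Ω d p u) {t : ℝ} (ht : 0 < t) {x : ℂ} (hx : x ∈ Ω) :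
    4 * db (dz (fun y => ((PhiT t (u y) : ℝ) : ℂ))) x =
      ((4 * deriv (psiT t) (u x) * ‖dz (fun y => (u y : ℂ)) x‖ ^ 2 - psiT t (u x) * hp' p u x : ℝ) : ℂ) := by
  have e1 : dz (fun y => ((PhiT t (u y) : ℝ) : ℂ)) =ᶠ[𝓝 x] fun y => (psiT t (u y) : ℂ) * dz (fun y => (u y : ℂ)) y := by
    filter_upwards [h.hΩ.mem_nhds hx] with y hy
    exact HasW.dz_eq ((h.uR hy).comp (PhiT_deriv t (u y)))
  have h1 := (h.uR hx).comp (((psiT_contDiff t).differentiable (by norm_num)) (u x)).hasDerivAt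
  have h2 := HasW.mul h1 (h.uzW hx)
  have h3 := (h2.congr_ev e1).db_eq
  rw [h3]
  have e2 : (psiT t (u x) : ℂ) * ((|u x| ^ (p - 1) * u x : ℝ) : ℂ) = (psiT t (u x) * hp' p u x : ℝ) := by
    by_cases hu : 0 < u x
    · rw [h.Hpos hu]; push_cast; ring
    · rw [psiT_zero ht (by linarith)]; simp
  have e3 : ((‖dz (fun y => (u y : ℂ)) x‖ ^ 2 : ℝ) : ℂ) = (starRingEnd ℂ) (dz (fun y => (u y : ℂ)) x) * dz (fun y => (u y : ℂ)) x := by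
    rw [← Complex.normSq_eq_norm_sq, Complex.normSq_eq_conj_mul_self]
  rw [Complex.ofReal_sub, ← e2, Complex.ofReal_mul (4 * deriv (psiT t) (u x)), e3]
  simp only [map_mul, Complex.conj_ofReal]
  push_cast
  ring

lemma g_lap_out (h : Sl Ω d p u) {t : ℝ} (ht : 0 < t) {x : ℂ} (hx : x ∉ Ω) :
    4 * db (dz (fun y => ((PhiT t (u y) : ℝ) : ℂ))) x = 0 := by
  have h1 : ∀ᶠ y in 𝓝 x, u y < t := (h.uc.continuousAt (x := x)).eventually_lt continuousAt_const (by rw [h.u0 x hx]; exact ht)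
  have e1 : dz (fun y => ((PhiT t (u y) : ℝ) : ℂ)) =ᶠ[𝓝 x] fun _ => 0 := by
    filter_upwards [h1.eventually_nhds] with y hy
    refine ((hasW_const 0 y).congr_ev ?_).dz_eq
    filter_upwards [hy] with w hw
    rw [PhiT_zero ht hw.le]; simp
  rw [((hasW_const 0 x).congr_ev e1).db_eq]; simp

lemma Lnn (h : Sl Ω d p u) {x y : ℂ} (hx : x ∈ Ω) (hy : y ∈ Ω) : Real.log ‖x - y‖ ≤ Real.log d := by
  have h1 := h.hd hx; have h2 := h.hd hy
  rw [mem_ball_zero_iff] at h1 h2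
  have h3 := norm_sub_le x y
  rcases (norm_nonneg (x - y)).eq_or_lt with h0 | h0
  · rw [← h0, Real.log_zero]; exact Real.log_nonneg h.d1
  · exact Real.log_le_log h0 (by linarith)

/-- the logarithmic potential bound -/
lemma green (h : Sl Ω d p u) {x : ℂ} (hx : x ∈ Ω) :
    2 * π * fp u x ≤ ∫ y, hp' p u y * (Real.log d - Real.log ‖x - y‖) := by
  have hLi : ∀ ρ : ℂ → ℝ, Continuous ρ → HasCompactSupport ρ → Integrable (fun y => ρ y * (Real.log d - Real.log ‖x - y‖)) := by
    intro ρ h1 h2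
    have := ((h1.integrable_of_hasCompactSupport h2).mul_const (Real.log d)).sub (logker_integrable h1 h2 x)
    refine this.congr (ae_of_all _ (fun y => ?_))
    simp only [Pi.sub_apply]; ring
  have key : ∀ t > 0, 2 * π * (u x - 2 * t) ≤ ∫ y, hp' p u y * (Real.log d - Real.log ‖x - y‖) := by
    intro t ht
    have hg := h.gC ht
    have hgc : HasCompactSupport (fun y => PhiT t (u y)) := h.out_cs (fun y hy => by rw [h.u0 y hy]; exact PhiT_zero ht ht.le)
    have hgC : ContDiff ℝ 2 (fun y => ((PhiT t (u y) : ℝ) : ℂ)) := Complex.ofRealCLM.contDiff.comp hg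
    have hgcC : HasCompactSupport (fun y => ((PhiT t (u y) : ℝ) : ℂ)) := hgc.mono (fun y hy h => hy (by simp only [h]; simp))
    have hz1 : ContDiff ℝ 1 (dz (fun y => ((PhiT t (u y) : ℝ) : ℂ))) := dz_contDiff (n := 1) (by norm_num; exact hgC)
    have hb0 : ContDiff ℝ 0 (db (dz (fun y => ((PhiT t (u y) : ℝ) : ℂ)))) := db_contDiff (n := 0) (by norm_num; exact hz1)
    set Λ := fun y => (4 * db (dz (fun y => ((PhiT t (u y) : ℝ) : ℂ))) y).re with hΛ
    have hΛr : ∀ z, 4 * db (dz (fun y => ((PhiT t (u y) : ℝ) : ℂ))) z = (Λ z : ℂ) := by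
      intro z
      by_cases hz : z ∈ Ω
      · simp only [hΛ]; rw [h.g_lap_in ht hz, Complex.ofReal_re]
      · simp only [hΛ]; rw [h.g_lap_out ht hz]; simp
    have hΛc : Continuous Λ := Complex.continuous_re.comp (continuous_const.mul hb0.continuous)
    have hΛ0 : ∀ y, y ∉ Ω → Λ y = 0 := fun y hy => by simp only [hΛ]; rw [h.g_lap_out ht hy]; simp
    have hΛcs : HasCompactSupport Λ := h.out_cs hΛ0
    have r1 := log_rep hg hgc hΛc hΛcs hΛr x
    have r2 : ∫ y, Λ y = 0 := by
      have := integral_db_zero _ hz1 (dz_compact hgcC)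
      have h2 : ∫ y, (Λ y : ℂ) = 0 := by
        simp_rw [← hΛr]; rw [integral_const_mul, this]; simp
      rw [integral_complex_ofReal] at h2
      exact_mod_cast h2
    have r3 : 2 * π * PhiT t (u x) = ∫ y, -(Λ y * (Real.log d - Real.log ‖x - y‖)) := by
      rw [r1, integral_neg]
      have i1 : Integrable (fun y => Λ y * Real.log d) := (hΛc.integrable_of_hasCompactSupport hΛcs).mul_const _
      have i2 := logker_integrable hΛc hΛcs x
      simp_rw [mul_sub]
      rw [integral_sub i1 i2, integral_mul_const, r2]; ring
    calc 2 * π * (u x - 2 * t) ≤ 2 * π * PhiT t (u x) := by gcongr; exact PhiT_ge ht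
      _ = ∫ y, -(Λ y * (Real.log d - Real.log ‖x - y‖)) := r3
      _ ≤ _ := by
        refine integral_mono (hLi Λ hΛc hΛcs).neg (hLi _ h.hpc h.hpcs) (fun y => ?_)
        simp only
        by_cases hy : y ∈ Ω
        · have h1 := h.Lnn hx hy
          have h2 : Λ y = 4 * deriv (psiT t) (u y) * ‖dz (fun y => (u y : ℂ)) y‖ ^ 2 - psiT t (u y) * hp' p u y := by
            have := hΛr y; rw [h.g_lap_in ht hy] at this; exact_mod_cast this.symm
          have h3 : - Λ y ≤ hp' p u y := by
            have a1 := psiT_deriv_nonneg ht (u y)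
            have a2 := psiT_le_one t (u y)
            have a3 := hp0 p u y
            have a4 : 0 ≤ 4 * deriv (psiT t) (u y) * ‖dz (fun y => (u y : ℂ)) y‖ ^ 2 := by positivity
            rw [h2]; nlinarith
          rw [← neg_mul]
          exact mul_le_mul_of_nonneg_right h3 (by linarith)
        · rw [hΛ0 y hy, h.hp_out hy]; simp
  have lim : 2 * π * u x ≤ ∫ y, hp' p u y * (Real.log d - Real.log ‖x - y‖) := by
    apply le_of_forall_pos_le_add
    intro e he
    have := key (e / (4 * π)) (by positivity)
    have e2 : 2 * π * (u x - 2 * (e / (4 * π))) = 2 * π * u x - e := by field_simp; ring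
    linarith
  have n0 : 0 ≤ ∫ y, hp' p u y * (Real.log d - Real.log ‖x - y‖) := by
    apply integral_nonneg
    intro y
    simp only [Pi.zero_apply]
    by_cases hy : y ∈ Ω
    · exact mul_nonneg (hp0 p u y) (by linarith [h.Lnn hx hy])
    · rw [h.hp_out hy]; simp
  unfold fp
  rcases le_total (u x) 0 with hu | hu
  · rw [max_eq_right hu]; simpa using n0
  · rw [max_eq_left hu]; exact lim

end Sl

end

noncomputable section

/-- truncated Riesz kernel -/
def kap (d b : ℝ) (w : ℂ) : ℝ := (Set.Iio d).indicator (fun r => r ^ (-b)) ‖w‖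

lemma kap_nonneg (d b : ℝ) (w : ℂ) : 0 ≤ kap d b w := by
  unfold kap; apply Set.indicator_apply_nonneg; intro _; positivity

lemma kap_aux (d b : ℝ) : Set.EqOn (fun r => r * (Set.Iio d).indicator (fun r => r ^ (-b)) r)
    ((Set.Iio d).indicator (fun r => r ^ (1 - b))) (Set.Ioi 0) := by
  intro r hr
  have hr : 0 < r := hr
  by_cases h : r < d
  · simp only [Set.indicator, Set.mem_Iio, h, if_true]
    rw [sub_eq_add_neg, Real.rpow_add hr, Real.rpow_one]
  · simp [Set.indicator, h]

lemma kap_integrable {d b : ℝ} (hd : 0 ≤ d) (hb : b < 2) : Integrable (kap d b) := by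
  unfold kap
  rw [radial_integrable, integrableOn_congr_fun (kap_aux d b) measurableSet_Ioi,
    IntegrableOn, integrable_indicator_iff measurableSet_Iio, IntegrableOn, Measure.restrict_restrict measurableSet_Iio,
    Set.inter_comm, Set.Ioi_inter_Iio]
  have := (intervalIntegral.intervalIntegrable_rpow' (a := 0) (b := d) (r := 1 - b) (by linarith)).1
  exact this.mono_set Set.Ioo_subset_Ioc_self

lemma kap_integral {d b : ℝ} (hd : 0 ≤ d) (hb : b < 2) : ∫ w, kap d b w = 2 * π * (d ^ (2 - b) / (2 - b)) := by
  unfold kap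
  rw [radial_integral, setIntegral_congr_fun measurableSet_Ioi (kap_aux d b),
    setIntegral_indicator measurableSet_Iio, Set.Ioi_inter_Iio, ← integral_Ioc_eq_integral_Ioo,
    ← intervalIntegral.integral_of_le hd, integral_rpow (Or.inl (by linarith))]
  rw [show 1 - b + 1 = 2 - b by ring, Real.zero_rpow (by linarith), sub_zero]

lemma amgm {p q a b X Q s f g : ℝ} (hp : 20 ≤ p) (hq : q = p + 1) (ha : a = 4 * p / q ^ 2) (hb : b = 2 - 2 / q)
    (hX : 0 < X) (hQ : 0 < Q) (hs : 0 < s) (hf : 0 ≤ f) (hg : 0 ≤ g) :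
    f ^ p * g ^ p * s ^ (-a) ≤ X ^ (2 - 2 / q) * Q ^ (2 / q) *
      ((1 - 2 / q) * (f ^ q * g ^ q / X ^ 2) + 1 / q * (f ^ q * s ^ (-b) / (X * Q)) + 1 / q * (g ^ q * s ^ (-b) / (X * Q))) := by
  have hq0 : 0 < q := by linarith
  have hw : 0 ≤ 1 - 2 / q := by rw [sub_nonneg, div_le_one hq0]; linarith
  rcases hf.eq_or_lt with h0 | hf0
  · rw [← h0, Real.zero_rpow (by linarith)]; simp only [zero_mul]; positivity
  rcases hg.eq_or_lt with h0 | hg0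
  · rw [← h0, Real.zero_rpow (by linarith)]; simp only [mul_zero, zero_mul]; positivity
  have h1 := Real.geom_mean_le_arith_mean3_weighted (w₁ := 1 - 2 / q) (w₂ := 1 / q) (w₃ := 1 / q)
    (p₁ := f ^ q * g ^ q / X ^ 2) (p₂ := f ^ q * s ^ (-b) / (X * Q)) (p₃ := g ^ q * s ^ (-b) / (X * Q))
    hw (by positivity) (by positivity) (by positivity) (by positivity) (by positivity) (by ring)
  refine le_trans (le_of_eq ?_) (mul_le_mul_of_nonneg_left h1 (by positivity))
  have e1 : f ^ q * g ^ q / X ^ 2 = Real.exp (q * Real.log f + q * Real.log g - 2 * Real.log X) := by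
    rw [Real.exp_sub, Real.exp_add, Real.rpow_def_of_pos hf0, Real.rpow_def_of_pos hg0, mul_comm q, mul_comm q,
      ← Real.exp_log hX, ← Real.exp_nat_mul, Real.exp_log hX]; norm_num
  have e2 : ∀ f : ℝ, 0 < f → f ^ q * s ^ (-b) / (X * Q) = Real.exp (q * Real.log f - b * Real.log s - Real.log X - Real.log Q) := by
    intro f hf0
    rw [Real.exp_sub, Real.exp_sub, Real.exp_sub, Real.rpow_def_of_pos hf0, Real.rpow_def_of_pos hs, Real.exp_log hX, Real.exp_log hQ,
      div_div, mul_neg, Real.exp_neg, mul_comm q, mul_comm b]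
    field_simp
  rw [e1, e2 f hf0, e2 g hg0, ← Real.exp_mul, ← Real.exp_mul, ← Real.exp_mul, Real.rpow_def_of_pos hf0, Real.rpow_def_of_pos hg0,
    Real.rpow_def_of_pos hs, Real.rpow_def_of_pos hX, Real.rpow_def_of_pos hQ]
  simp only [← Real.exp_add]
  congr 1
  subst ha hb hq
  field_simp
  ring

def Lk (d : ℝ) (w : ℂ × ℂ) : ℝ := Real.log d - Real.log ‖w.1 - w.2‖
def KK (p : ℝ) (u : ℂ → ℝ) (w : ℂ × ℂ) : ℝ := hp' p u w.1 * hp' p u w.2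

namespace Sl
variable {Ω : Set ℂ} {d p : ℝ} {u : ℂ → ℝ}

lemma KK0 (w : ℂ × ℂ) : 0 ≤ KK p u w := mul_nonneg (hp0 p u _) (hp0 p u _)
lemma KKi (h : Sl Ω d p u) : Integrable (KK p u) (volume.prod volume) := h.hpi.mul_prod h.hpi
lemma KKout (h : Sl Ω d p u) {w : ℂ × ℂ} (hw : ¬ (w.1 ∈ Ω ∧ w.2 ∈ Ω)) : KK p u w = 0 := by
  unfold KK
  by_cases h1 : w.1 ∈ Ω
  · rw [h.hp_out (fun h2 => hw ⟨h1, h2⟩), mul_zero]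
  · rw [h.hp_out h1, zero_mul]
lemma Lk_meas : Measurable (Lk d) := by unfold Lk; fun_prop
lemma Lk0 (h : Sl Ω d p u) {w : ℂ × ℂ} (h1 : w.1 ∈ Ω) (h2 : w.2 ∈ Ω) : 0 ≤ Lk d w := by
  unfold Lk; linarith [h.Lnn h1 h2]

lemma energy1 (h : Sl Ω d p u) {q a k X : ℝ} (hq : q = p + 1) (ha : a = 4 * p / q ^ 2) (hk : k = (π * q * d ^ (2 / q)) ^ (2 / q))
    (hX : X = ∫ x, fp u x ^ q) (hX0 : 0 < X) :
    Integrable (fun w => KK p u w * Real.exp (a * Lk d w)) (volume.prod volume) ∧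
    ∫ w, KK p u w * Real.exp (a * Lk d w) ∂(volume.prod volume) ≤ d ^ a * k * X ^ (2 - 2 / q) := by
  have hp := h.hp
  have hq0 : 0 < q := by linarith
  have hd : 0 < d := by linarith [h.d1]
  obtain ⟨b, hb⟩ : ∃ b, b = 2 - 2 / q := ⟨_, rfl⟩
  have h2q : 0 < 2 / q := by positivity
  have hb2 : b < 2 := by linarith
  obtain ⟨Q, hQ⟩ : ∃ Q, Q = π * q * d ^ (2 / q) := ⟨_, rfl⟩
  have hQ0 : 0 < Q := by rw [hQ]; positivity
  have hκi := kap_integrable hd.le hb2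
  have hκ : ∫ w, kap d b w = Q := by
    rw [kap_integral hd.le hb2, hQ, hb, show 2 - (2 - 2 / q) = 2 / q by ring]; field_simp
  have hFc : Continuous (fun x => fp u x ^ q) := h.fpc.rpow_const (fun _ => Or.inr hq0.le)
  have hFi : Integrable (fun x => fp u x ^ q) := hFc.integrable_of_hasCompactSupport
    (h.out_cs (fun x hx => by rw [h.fp_out hx]; exact Real.zero_rpow hq0.ne'))
  have i1 : Integrable (fun w : ℂ × ℂ => fp u w.1 ^ q * fp u w.2 ^ q) (volume.prod volume) := hFi.mul_prod hFi
  have i3 : Integrable (fun w : ℂ × ℂ => fp u w.2 ^ q * kap d b (w.1 - w.2)) (volume.prod volume) := by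
    have := Integrable.convolution_integrand (ContinuousLinearMap.mul ℝ ℝ) hFi hκi
    exact this
  have v3 : ∫ w : ℂ × ℂ, fp u w.2 ^ q * kap d b (w.1 - w.2) ∂(volume.prod volume) = X * Q := by
    rw [integral_prod_symm _ i3]
    simp only
    have : ∀ y : ℂ, ∫ x, fp u y ^ q * kap d b (x - y) = fp u y ^ q * Q := by
      intro y
      rw [integral_const_mul, integral_sub_right_eq_self (kap d b) y, hκ]
    simp_rw [this]
    rw [integral_mul_const, hX]
  have hsym : (fun w : ℂ × ℂ => fp u w.1 ^ q * kap d b (w.1 - w.2)) = (fun w : ℂ × ℂ => fp u w.2 ^ q * kap d b (w.1 - w.2)) ∘ Prod.swap := by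
    ext w
    simp only [Function.comp, Prod.swap, Prod.fst, Prod.snd]
    unfold kap; rw [norm_sub_rev]
  have i2 : Integrable (fun w : ℂ × ℂ => fp u w.1 ^ q * kap d b (w.1 - w.2)) (volume.prod volume) := by
    rw [hsym]; exact i3.swap
  have v2 : ∫ w : ℂ × ℂ, fp u w.1 ^ q * kap d b (w.1 - w.2) ∂(volume.prod volume) = X * Q := by
    rw [hsym, ← v3]
    exact integral_prod_swap (fun w : ℂ × ℂ => fp u w.2 ^ q * kap d b (w.1 - w.2))
  have v1 : ∫ w : ℂ × ℂ, fp u w.1 ^ q * fp u w.2 ^ q ∂(volume.prod volume) = X * X := by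
    rw [integral_prod_mul (fun x => fp u x ^ q) (fun x => fp u x ^ q), hX]
  set c := d ^ a * (X ^ (2 - 2 / q) * Q ^ (2 / q)) with hc
  have hc0 : 0 < c := by positivity
  set G := fun w : ℂ × ℂ => c * ((1 - 2 / q) / X ^ 2 * (fp u w.1 ^ q * fp u w.2 ^ q) + 1 / (q * (X * Q)) * (fp u w.1 ^ q * kap d b (w.1 - w.2))
    + 1 / (q * (X * Q)) * (fp u w.2 ^ q * kap d b (w.1 - w.2))) with hG
  have iG : Integrable G (volume.prod volume) :=
    (((i1.const_mul ((1 - 2 / q) / X ^ 2)).add (i2.const_mul (1 / (q * (X * Q))))).add (i3.const_mul (1 / (q * (X * Q))))).const_mul c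
  have vG : ∫ w, G w ∂(volume.prod volume) = c := by
    rw [hG, integral_const_mul]
    have j12 : Integrable (fun w : ℂ × ℂ => (1 - 2 / q) / X ^ 2 * (fp u w.1 ^ q * fp u w.2 ^ q) + 1 / (q * (X * Q)) * (fp u w.1 ^ q * kap d b (w.1 - w.2))) (volume.prod volume) :=
      (i1.const_mul ((1 - 2 / q) / X ^ 2)).add (i2.const_mul (1 / (q * (X * Q))))
    rw [integral_add j12 (i3.const_mul _), integral_add (i1.const_mul _) (i2.const_mul _), integral_const_mul, integral_const_mul, integral_const_mul,
      v1, v2, v3]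
    field_simp
    ring
  have hw : 0 ≤ 1 - 2 / q := by rw [sub_nonneg, div_le_one hq0]; linarith
  have hG0 : ∀ w, 0 ≤ G w := by
    intro w
    have a1 := kap_nonneg d b (w.1 - w.2)
    have a2 : 0 ≤ fp u w.1 ^ q := Real.rpow_nonneg (fp0 u _) _
    have a3 : 0 ≤ fp u w.2 ^ q := Real.rpow_nonneg (fp0 u _) _
    simp only [hG]; positivity
  have hle : ∀ᵐ w ∂(volume.prod volume), KK p u w * Real.exp (a * Lk d w) ≤ G w := by
    have dn := diag_null
    rw [Measure.volume_eq_prod] at dn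
    filter_upwards [dn] with w hw'
    by_cases hin : w.1 ∈ Ω ∧ w.2 ∈ Ω
    · have hs : 0 < ‖w.1 - w.2‖ := norm_pos_iff.mpr (sub_ne_zero.mpr hw')
      have hsd : ‖w.1 - w.2‖ < d := by
        have h1 := h.hd hin.1; have h2 := h.hd hin.2
        rw [mem_ball_zero_iff] at h1 h2
        have h3 := norm_sub_le w.1 w.2
        linarith
      have e1 : Real.exp (a * Lk d w) = d ^ a * ‖w.1 - w.2‖ ^ (-a) := by
        unfold Lk
        rw [Real.rpow_def_of_pos hd, Real.rpow_def_of_pos hs, ← Real.exp_add]; congr 1; ring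
      have e2 : kap d b (w.1 - w.2) = ‖w.1 - w.2‖ ^ (-b) := by
        unfold kap; simp [Set.indicator, hsd]
      have := amgm hp hq ha hb hX0 hQ0 hs (fp0 u w.1) (fp0 u w.2)
      rw [e1]; simp only [hG, e2]; unfold KK hp'
      calc _ = d ^ a * (fp u w.1 ^ p * fp u w.2 ^ p * ‖w.1 - w.2‖ ^ (-a)) := by ring
        _ ≤ d ^ a * _ := mul_le_mul_of_nonneg_left this (by positivity)
        _ = _ := by rw [hc]; field_simp
    · rw [h.KKout hin, zero_mul]; exact hG0 w
  have iK : Integrable (fun w => KK p u w * Real.exp (a * Lk d w)) (volume.prod volume) := by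
    refine iG.mono' ?_ ?_
    · have := Lk_meas (d := d)
      exact h.KKi.1.mul (Measurable.aestronglyMeasurable (by fun_prop))
    · filter_upwards [hle] with w hw
      rw [Real.norm_of_nonneg (mul_nonneg (KK0 w) (Real.exp_pos _).le)]; exact hw
  refine ⟨iK, ?_⟩
  calc _ ≤ ∫ w, G w ∂(volume.prod volume) := integral_mono_ae iK iG hle
    _ = c := vG
    _ = _ := by rw [hc, hk, hQ]; ring

lemma energy2 (h : Sl Ω d p u) {q a X : ℝ} (hq : q = p + 1) (ha : 0 < a) (hX : X = ∫ x, fp u x ^ q)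
    (iK : Integrable (fun w => KK p u w * Real.exp (a * Lk d w)) (volume.prod volume)) :
    Integrable (fun w => KK p u w * Lk d w) (volume.prod volume) ∧ 2 * π * X ≤ ∫ w, KK p u w * Lk d w ∂(volume.prod volume) := by
  have hp := h.hp
  have hq0 : 0 < q := by linarith
  have iL : Integrable (fun w => KK p u w * Lk d w) (volume.prod volume) := by
    refine (iK.const_mul (1 / a)).mono' ?_ (ae_of_all _ (fun w => ?_))
    · have := Lk_meas (d := d)
      exact h.KKi.1.mul (Measurable.aestronglyMeasurable (by fun_prop))
    · by_cases hin : w.1 ∈ Ω ∧ w.2 ∈ Ω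
      · have hL := h.Lk0 hin.1 hin.2
        have hK := KK0 (p := p) (u := u) w
        rw [Real.norm_of_nonneg (by positivity)]
        have : Lk d w ≤ 1 / a * Real.exp (a * Lk d w) := by
          have := Real.add_one_le_exp (a * Lk d w)
          rw [one_div, inv_mul_eq_div, le_div_iff₀ ha]; linarith
        calc _ ≤ KK p u w * (1 / a * Real.exp (a * Lk d w)) := by gcongr
          _ = _ := by ring
      · rw [h.KKout hin]; simp
  refine ⟨iL, ?_⟩
  have hFc : Continuous (fun x => fp u x ^ q) := h.fpc.rpow_const (fun _ => Or.inr hq0.le)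
  have hFi : Integrable (fun x => fp u x ^ q) := hFc.integrable_of_hasCompactSupport
    (h.out_cs (fun x hx => by rw [h.fp_out hx]; exact Real.zero_rpow hq0.ne'))
  rw [integral_prod _ iL, hX, ← integral_const_mul]
  refine integral_mono (hFi.const_mul _) iL.integral_prod_left (fun x => ?_)
  simp only
  have e : ∫ y, KK p u (x, y) * Lk d (x, y) = hp' p u x * ∫ y, hp' p u y * (Real.log d - Real.log ‖x - y‖) := by
    rw [← integral_const_mul]; congr 1; ext y; unfold KK Lk; ring
  rw [e]
  by_cases hx : x ∈ Ω
  · have := mul_le_mul_of_nonneg_left (h.green hx) (hp0 p u x)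
    refine le_trans (le_of_eq ?_) this
    unfold hp'
    rw [hq, Real.rpow_add' (fp0 u x) (by linarith), Real.rpow_one]; ring
  · rw [h.hp_out hx, h.fp_out hx, Real.zero_rpow hq0.ne']; simp

/-- deficit kernel -/
lemma phi_ge {τ : ℝ} (hτ : 0 ≤ τ) : (τ - 1) ^ 2 / 4 ≤ Real.exp (τ - 1) - τ := by
  have h1 := Real.add_one_le_exp ((τ - 1) / 2)
  have h2 : Real.exp (τ - 1) = Real.exp ((τ - 1) / 2) ^ 2 := by rw [← Real.exp_nat_mul]; congr 1; push_cast; ring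
  have h3 : ((τ - 1) / 2 + 1) ^ 2 ≤ Real.exp ((τ - 1) / 2) ^ 2 := by gcongr; linarith
  rw [h2]; nlinarith

def DD (d p a : ℝ) (u : ℂ → ℝ) (w : ℂ × ℂ) : ℝ := KK p u w * (Real.exp (a * Lk d w - 1) - a * Lk d w)

lemma DD0 (h : Sl Ω d p u) {a : ℝ} (ha : 0 < a) (w : ℂ × ℂ) : 0 ≤ DD d p a u w := by
  unfold DD
  by_cases hin : w.1 ∈ Ω ∧ w.2 ∈ Ω
  · have hL := h.Lk0 hin.1 hin.2
    apply mul_nonneg (KK0 w)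
    exact le_trans (by positivity) (phi_ge (mul_nonneg ha.le hL))
  · rw [h.KKout hin]; simp

lemma energy (h : Sl Ω d p u) {q a k X : ℝ} (hq : q = p + 1) (ha : a = 4 * p / q ^ 2) (hk : k = (π * q * d ^ (2 / q)) ^ (2 / q))
    (hX : X = ∫ x, fp u x ^ q) (hX0 : 0 < X) :
    Integrable (DD d p a u) (volume.prod volume) ∧
    ∫ w, DD d p a u w ∂(volume.prod volume) ≤ Real.exp (-1) * (d ^ a * k * X ^ (2 - 2 / q)) - 2 * π * a * X ∧
    ∀ c, 0 < c → (1 - c) * (∫ x, hp' p u x) ^ 2 ≤ Real.exp (-1) * (d ^ a * k * X ^ (2 - 2 / q)) + (∫ w, DD d p a u w ∂(volume.prod volume)) / c := by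
  have hp := h.hp
  have ha0 : 0 < a := by rw [ha, hq]; positivity
  obtain ⟨iK, bK⟩ := h.energy1 hq ha hk hX hX0
  obtain ⟨iL, bL⟩ := h.energy2 hq ha0 hX iK
  have eD : DD d p a u = fun w => Real.exp (-1) * (KK p u w * Real.exp (a * Lk d w)) - a * (KK p u w * Lk d w) := by
    ext w; unfold DD; rw [sub_eq_add_neg (a * Lk d w), Real.exp_add]; ring
  have iD : Integrable (DD d p a u) (volume.prod volume) := by
    rw [eD]; exact (iK.const_mul _).sub (iL.const_mul _)
  refine ⟨iD, ?_, ?_⟩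
  · rw [eD, integral_sub (iK.const_mul _) (iL.const_mul _), integral_const_mul, integral_const_mul]
    have e1 := Real.exp_pos (-1)
    have b1 := mul_le_mul_of_nonneg_left bK e1.le
    have b2 := mul_le_mul_of_nonneg_left bL ha0.le
    linarith
  · intro c hc
    have v : ∫ w, KK p u w ∂(volume.prod volume) = (∫ x, hp' p u x) ^ 2 := by
      unfold KK; rw [integral_prod_mul (hp' p u) (hp' p u), sq]
    rw [← v, ← integral_const_mul]
    have j1 : Integrable (fun w => Real.exp (-1) * (KK p u w * Real.exp (a * Lk d w))) (volume.prod volume) := iK.const_mul _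
    have j2 : Integrable (fun w => DD d p a u w / c) (volume.prod volume) := iD.div_const _
    calc _ ≤ ∫ w, (Real.exp (-1) * (KK p u w * Real.exp (a * Lk d w)) + DD d p a u w / c) ∂(volume.prod volume) := by
          refine integral_mono (h.KKi.const_mul _) (j1.add j2) (fun w => ?_)
          simp only
          by_cases hin : w.1 ∈ Ω ∧ w.2 ∈ Ω
          · have hτ := mul_nonneg ha0.le (h.Lk0 hin.1 hin.2)
            have h1 := phi_ge hτ
            have h2 : Real.exp (-1) * Real.exp (a * Lk d w) = Real.exp (a * Lk d w - 1) := by rw [← Real.exp_add]; congr 1; ring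
            have h3 := Real.add_one_le_exp (a * Lk d w - 1)
            have hK := KK0 (p := p) (u := u) w
            have h4 : 1 - c ≤ Real.exp (a * Lk d w - 1) + (Real.exp (a * Lk d w - 1) - a * Lk d w) / c := by
              have : 1 - a * Lk d w ≤ c + (a * Lk d w - 1) ^ 2 / 4 / c := by
                rw [← sub_nonneg]
                have : c + (a * Lk d w - 1) ^ 2 / 4 / c - (1 - a * Lk d w) = (c + (a * Lk d w - 1) / 2) ^ 2 / c := by field_simp; ring
                rw [this]; positivity
              have : (a * Lk d w - 1) ^ 2 / 4 / c ≤ (Real.exp (a * Lk d w - 1) - a * Lk d w) / c := by gcongr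
              linarith
            have h5 := mul_le_mul_of_nonneg_left h4 hK
            unfold DD
            calc _ = KK p u w * (1 - c) := by ring
              _ ≤ _ := h5
              _ = KK p u w * (Real.exp (-1) * Real.exp (a * Lk d w)) + KK p u w * (Real.exp (a * Lk d w - 1) - a * Lk d w) / c := by rw [h2]; ring
              _ = _ := by ring
          · have : DD d p a u w = 0 := by unfold DD; rw [h.KKout hin]; simp
            rw [this, h.KKout hin]; simp
      _ = Real.exp (-1) * (∫ w, KK p u w * Real.exp (a * Lk d w) ∂(volume.prod volume)) + (∫ w, DD d p a u w ∂(volume.prod volume)) / c := by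
          rw [integral_add j1 j2, integral_const_mul, integral_div]
      _ ≤ _ := by
          have e1 := Real.exp_pos (-1)
          have b1 := mul_le_mul_of_nonneg_left bK e1.le
          linarith

end Sl

end

noncomputable section

/-- the prefactor in the energy inequality -/
def gfac (d p : ℝ) : ℝ := Real.exp (-1) * (d ^ (4 * p / (p + 1) ^ 2) * (π * (p + 1) * d ^ (2 / (p + 1))) ^ (2 / (p + 1))) * p ^ (2 / (p + 1))

lemma lim_two_div : Tendsto (fun p : ℝ => 2 / (p + 1)) atTop (𝓝 0) :=
  Tendsto.div_atTop tendsto_const_nhds (tendsto_atTop_add_const_right _ _ tendsto_id)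

lemma lim_a : Tendsto (fun p : ℝ => 4 * p / (p + 1) ^ 2 * p) atTop (𝓝 4) := by
  have h1 : Tendsto (fun p : ℝ => 4 * (1 - 2 / (p + 1) / 2) ^ 2) atTop (𝓝 (4 * (1 - 0 / 2) ^ 2)) :=
    (((lim_two_div.div_const 2).const_sub 1).pow 2).const_mul 4
  refine Tendsto.congr' ?_ (by simpa using h1)
  filter_upwards [eventually_gt_atTop 0] with p hp
  have : p + 1 ≠ 0 := by positivity
  field_simp
  ring

lemma lim_a0 : Tendsto (fun p : ℝ => 4 * p / (p + 1) ^ 2) atTop (𝓝 0) := by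
  have h1 : Tendsto (fun p : ℝ => 4 * p / (p + 1) ^ 2 * p * p⁻¹) atTop (𝓝 (4 * 0)) := lim_a.mul tendsto_inv_atTop_zero
  refine Tendsto.congr' ?_ (by simpa using h1)
  filter_upwards [eventually_gt_atTop 0] with p hp
  field_simp

lemma lim_g {d : ℝ} (hd : 1 ≤ d) : Tendsto (gfac d) atTop (𝓝 (Real.exp (-1))) := by
  have hd0 : 0 < d := by linarith
  have h1 : Tendsto (fun p : ℝ => d ^ (4 * p / (p + 1) ^ 2)) atTop (𝓝 1) := by
    simpa using (tendsto_const_nhds (x := d)).rpow lim_a0 (Or.inl hd0.ne')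
  have h2 : Tendsto (fun p : ℝ => p ^ (2 / (p + 1))) atTop (𝓝 1) := by
    simpa using tendsto_rpow_div_mul_add 2 1 1 (by norm_num)
  have h3 : Tendsto (fun p : ℝ => (p + 1) ^ (2 / (p + 1))) atTop (𝓝 1) := by
    have h := (tendsto_rpow_div_mul_add 2 1 0 (by norm_num)).comp (tendsto_atTop_add_const_right atTop (1:ℝ) tendsto_id)
    simpa [Function.comp_def] using h
  have h4 : Tendsto (fun p : ℝ => π ^ (2 / (p + 1))) atTop (𝓝 1) := by
    simpa using (tendsto_const_nhds (x := π)).rpow lim_two_div (Or.inl pi_pos.ne')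
  have h5 : Tendsto (fun p : ℝ => (d ^ (2 / (p + 1))) ^ (2 / (p + 1))) atTop (𝓝 1) := by
    have h : Tendsto (fun p : ℝ => d ^ (2 / (p + 1))) atTop (𝓝 1) := by
      simpa using (tendsto_const_nhds (x := d)).rpow lim_two_div (Or.inl hd0.ne')
    simpa using h.rpow lim_two_div (Or.inl one_ne_zero)
  have h6 := (((h1.mul ((h4.mul h3).mul h5)).const_mul (Real.exp (-1))).mul h2)
  refine Tendsto.congr' ?_ (by simpa using h6)
  filter_upwards [eventually_gt_atTop 0] with p hp
  unfold gfac
  rw [Real.mul_rpow (by positivity) (by positivity), Real.mul_rpow pi_pos.le (by positivity)]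

lemma gfac_pos {d p : ℝ} (hd : 1 ≤ d) (hp : 0 < p) : 0 < gfac d p := by
  have : 0 < d := by linarith
  unfold gfac; positivity

/-- rescaled energy inequalities -/
lemma Sl.energyE {Ω : Set ℂ} {d p : ℝ} {u : ℂ → ℝ} (h : Sl Ω d p u) {X : ℝ} (hX : X = ∫ x, fp u x ^ (p + 1)) (hX0 : 0 < X) :
    p ^ 2 * ∫ w, Sl.DD d p (4 * p / (p + 1) ^ 2) u w ∂(volume.prod volume) ≤
      gfac d p * (p * X) ^ (2 - 2 / (p + 1)) - 2 * π * (4 * p / (p + 1) ^ 2 * p) * (p * X) ∧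
    ∀ c > 0, (1 - c) * (p * ∫ x, hp' p u x) ^ 2 ≤ gfac d p * (p * X) ^ (2 - 2 / (p + 1)) +
      (p ^ 2 * ∫ w, Sl.DD d p (4 * p / (p + 1) ^ 2) u w ∂(volume.prod volume)) / c := by
  have hp := h.p0
  obtain ⟨-, h1, h2⟩ := h.energy (q := p + 1) rfl rfl rfl hX hX0
  have key : gfac d p * (p * X) ^ (2 - 2 / (p + 1)) = p ^ 2 * (Real.exp (-1) * (d ^ (4 * p / (p + 1) ^ 2) * (π * (p + 1) * d ^ (2 / (p + 1))) ^ (2 / (p + 1)) * X ^ (2 - 2 / (p + 1)))) := by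
    have : p ^ 2 = p ^ (2 / (p + 1)) * p ^ (2 - 2 / (p + 1)) := by
      rw [← Real.rpow_add hp, ← Real.rpow_natCast]; congr 1; push_cast; ring
    rw [this, Real.mul_rpow hp.le hX0.le]
    unfold gfac; ring
  rw [key]
  set D := ∫ w, Sl.DD d p (4 * p / (p + 1) ^ 2) u w ∂(volume.prod volume)
  have hp2 : 0 < p ^ 2 := by positivity
  constructor
  · have := mul_le_mul_of_nonneg_left h1 hp2.le
    linarith
  · intro c hc
    have := mul_le_mul_of_nonneg_left (h2 c hc) hp2.le
    calc _ = p ^ 2 * ((1 - c) * (∫ x, hp' p u x) ^ 2) := by ring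
      _ ≤ _ := this
      _ = _ := by ring

lemma Sl.DDint0 {Ω : Set ℂ} {d p : ℝ} {u : ℂ → ℝ} (h : Sl Ω d p u) : 0 ≤ ∫ w, Sl.DD d p (4 * p / (p + 1) ^ 2) u w ∂(volume.prod volume) :=
  integral_nonneg (fun w => h.DD0 (by have := h.p0; positivity) w)

lemma seqlow {Ω : Set ℂ} {d : ℝ} {p : ℕ → ℝ} {u : ℕ → ℂ → ℝ} (hd : 1 ≤ d) (hp : Tendsto p atTop atTop) (hS : ∀ᶠ n in atTop, Sl Ω d (p n) (u n))
    (hX : ∀ᶠ n in atTop, 0 < ∫ x, fp (u n) x ^ (p n + 1)) :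
    ∃ l : ℕ → ℝ, Tendsto l atTop (𝓝 (8 * π * Real.exp 1)) ∧ ∀ᶠ n in atTop, l n ≤ p n * ∫ x, fp (u n) x ^ (p n + 1) := by
  let L : ℝ → ℝ := fun p => (2 * π * (4 * p / (p + 1) ^ 2 * p) / gfac d p) ^ (1 / (1 - 2 / (p + 1)))
  refine ⟨fun n => L (p n), ?_, ?_⟩
  · suffices hL : Tendsto L atTop (𝓝 (8 * π * Real.exp 1)) from hL.comp hp
    have h1 : Tendsto (fun p : ℝ => 1 / (1 - 2 / (p + 1))) atTop (𝓝 1) := by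
      simpa using (lim_two_div.const_sub 1).inv₀ (by norm_num)
    have h2 := ((lim_a.const_mul (2 * π)).div (lim_g hd) (Real.exp_pos _).ne').rpow h1 (Or.inl (by positivity))
    refine h2.congr' (Eventually.of_forall fun _ => rfl) |>.trans (le_of_eq ?_)
    congr 1
    rw [Real.rpow_one, Real.exp_neg]
    field_simp; ring
  · filter_upwards [hS, hX] with n h hX0
    have hpn := h.p0
    obtain ⟨h1, -⟩ := h.energyE rfl hX0
    have h0 := mul_nonneg (sq_nonneg (p n)) h.DDint0
    set X := ∫ x, fp (u n) x ^ (p n + 1)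
    have hg := gfac_pos hd hpn
    have hE : 0 < p n * X := by positivity
    have ht : 0 < 1 - 2 / (p n + 1) := by
      rw [sub_pos, div_lt_one (by positivity)]; linarith [h.hp]
    have hq : (p n * X) ^ (2 - 2 / (p n + 1)) = (p n * X) ^ (1 - 2 / (p n + 1)) * (p n * X) := by
      rw [← Real.rpow_add_one hE.ne']; congr 1; ring
    rw [hq] at h1
    have h3 : 2 * π * (4 * p n / (p n + 1) ^ 2 * p n) / gfac d (p n) ≤ (p n * X) ^ (1 - 2 / (p n + 1)) := by
      rw [div_le_iff₀ hg]
      by_contra hc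
      push Not at hc
      have := mul_lt_mul_of_pos_right hc hE
      linarith
    calc L (p n) ≤ ((p n * X) ^ (1 - 2 / (p n + 1))) ^ (1 / (1 - 2 / (p n + 1))) :=
          Real.rpow_le_rpow (by positivity) h3 (by positivity)
      _ = p n * X := by
          rw [← Real.rpow_mul hE.le, mul_one_div_cancel ht.ne', Real.rpow_one]

lemma seqDA {Ω : Set ℂ} {d : ℝ} {p : ℕ → ℝ} {u : ℕ → ℂ → ℝ} (hd : 1 ≤ d) (hp : Tendsto p atTop atTop) (hS : ∀ᶠ n in atTop, Sl Ω d (p n) (u n))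
    (hE : Tendsto (fun n => p n * ∫ x, fp (u n) x ^ (p n + 1)) atTop (𝓝 (8 * π * Real.exp 1)))
    (hX : ∀ᶠ n in atTop, 0 < ∫ x, fp (u n) x ^ (p n + 1)) :
    Tendsto (fun n => (p n) ^ 2 * ∫ w, Sl.DD d (p n) (4 * p n / (p n + 1) ^ 2) (u n) w ∂(volume.prod volume)) atTop (𝓝 0) ∧
    ∀ η > 0, ∀ᶠ n in atTop, (p n * ∫ x, hp' (p n) (u n) x) ^ 2 ≤ 64 * π ^ 2 * Real.exp 1 + η := by
  have hG : Tendsto (fun n => gfac d (p n) * (p n * ∫ x, fp (u n) x ^ (p n + 1)) ^ (2 - 2 / (p n + 1))) atTop (𝓝 (64 * π ^ 2 * Real.exp 1)) := by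
    have h1 := ((lim_g hd).comp hp).mul (hE.rpow ((lim_two_div.comp hp).const_sub 2) (Or.inl (by positivity)))
    refine (h1.congr' (Eventually.of_forall fun _ => rfl)).trans (le_of_eq ?_)
    congr 1
    rw [sub_zero, show (2:ℝ) = ((2:ℕ):ℝ) by norm_num, Real.rpow_natCast, Real.exp_neg]
    push_cast
    field_simp; ring
  have hD : Tendsto (fun n => (p n) ^ 2 * ∫ w, Sl.DD d (p n) (4 * p n / (p n + 1) ^ 2) (u n) w ∂(volume.prod volume)) atTop (𝓝 0) := by
    have h2 := hG.sub (((lim_a.comp hp).const_mul (2 * π)).mul hE)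
    refine tendsto_of_tendsto_of_tendsto_of_le_of_le' tendsto_const_nhds (h2.trans (le_of_eq ?_)) ?_ ?_
    · congr 1; ring
    · filter_upwards [hS] with n h using mul_nonneg (sq_nonneg (p n)) h.DDint0
    · filter_upwards [hS, hX] with n h hX0 using (h.energyE rfl hX0).1
  refine ⟨hD, fun η hη => ?_⟩
  set S := 64 * π ^ 2 * Real.exp 1 with hSdef
  have hS0 : 0 < S := by positivity
  obtain ⟨c, hc0, hc1, hc⟩ : ∃ c : ℝ, 0 < c ∧ c < 1 ∧ S < (1 - c) * (S + η) := by
    refine ⟨η / (2 * (S + η)), by positivity, ?_, ?_⟩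
    · rw [div_lt_one (by positivity)]; linarith
    · have : (1 - η / (2 * (S + η))) * (S + η) = S + η / 2 := by field_simp; ring
      rw [this]; linarith
  have h3 := hG.add (hD.div_const c)
  have h4 : ∀ᶠ n in atTop, gfac d (p n) * (p n * ∫ x, fp (u n) x ^ (p n + 1)) ^ (2 - 2 / (p n + 1)) + (p n) ^ 2 * (∫ w, Sl.DD d (p n) (4 * p n / (p n + 1) ^ 2) (u n) w ∂(volume.prod volume)) / c < (1 - c) * (S + η) :=
    h3.eventually_lt_const (by simpa using hc)
  filter_upwards [h4, hS, hX] with n h4 h hX0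
  have h5 := (h.energyE rfl hX0).2 c hc0
  by_contra hcon
  push Not at hcon
  have := mul_lt_mul_of_pos_left hcon (sub_pos.2 hc1)
  linarith

lemma Sl.EMA {Ω : Set ℂ} {d p M : ℝ} {u : ℂ → ℝ} (h : Sl Ω d p u) (hM : ∀ x, u x ≤ M) (hM0 : 0 ≤ M) :
    ∫ x, fp u x ^ (p + 1) ≤ M * ∫ x, hp' p u x := by
  rw [← integral_const_mul]
  have hq : Continuous (fun x => fp u x ^ (p + 1)) := h.fpc.rpow_const (fun _ => Or.inr (by linarith [h.p0]))
  refine integral_mono (hq.integrable_of_hasCompactSupport (h.out_cs fun x hx => ?_)) (h.hpi.const_mul _) fun x => ?_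
  · rw [h.fp_out hx, Real.zero_rpow (by linarith [h.p0])]
  · have h1 : fp u x ^ (p + 1) = fp u x * fp u x ^ p := by
      rw [Real.rpow_add_one' (Sl.fp0 u x) (by linarith [h.p0])]; ring
    show fp u x ^ (p + 1) ≤ M * fp u x ^ p
    rw [h1]
    exact mul_le_mul_of_nonneg_right (max_le (hM x) hM0) (Real.rpow_nonneg (Sl.fp0 u x) _)

lemma seqM {Ω : Set ℂ} {d : ℝ} {p M : ℕ → ℝ} {u : ℕ → ℂ → ℝ} (hd : 1 ≤ d) (hp : Tendsto p atTop atTop) (hS : ∀ᶠ n in atTop, Sl Ω d (p n) (u n))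
    (hE : Tendsto (fun n => p n * ∫ x, fp (u n) x ^ (p n + 1)) atTop (𝓝 (8 * π * Real.exp 1)))
    (hX : ∀ᶠ n in atTop, 0 < ∫ x, fp (u n) x ^ (p n + 1))
    (hM : ∀ᶠ n in atTop, 0 < M n ∧ ∀ x, u n x ≤ M n) :
    ∀ᶠ n in atTop, 1.6 ≤ M n ∧ p n * (∫ x, hp' (p n) (u n) x) ≤ (8 * π + 1 / 10) * M n ∧ p n * (∫ x, hp' (p n) (u n) x) ≤ 100 := by
  have he1 := Real.exp_one_gt_d9
  have he2 := Real.exp_one_lt_d9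
  have hpi1 := Real.pi_gt_d6
  have hpi2 := Real.pi_lt_d6
  have hA := (seqDA hd hp hS hE hX).2 1 one_pos
  have hElo : ∀ᶠ n in atTop, 8 * π * Real.exp 1 - 1 / 100 < p n * ∫ x, fp (u n) x ^ (p n + 1) :=
    hE.eventually_const_lt (by linarith)
  filter_upwards [hA, hElo, hM, hS] with n hA hE1 hM hS
  have h1 := hS.EMA hM.2 hM.1.le
  have hA0 : 0 ≤ ∫ x, hp' (p n) (u n) x := integral_nonneg (Sl.hp0 _ _)
  have h2 := mul_le_mul_of_nonneg_left h1 hS.p0.le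
  obtain ⟨A, hAd⟩ : ∃ A, A = p n * ∫ x, hp' (p n) (u n) x := ⟨_, rfl⟩
  have h3 : 8 * π * Real.exp 1 - 1 / 100 < M n * A := by rw [hAd]; linarith
  have hA00 : 0 ≤ A := by rw [hAd]; exact mul_nonneg hS.p0.le hA0
  rw [← hAd] at hA ⊢
  have hpe : 68.317 < 8 * π * Real.exp 1 := by nlinarith
  have hpe2 : 64 * π ^ 2 * Real.exp 1 < 1717.1 := by nlinarith
  have hpe3 : 25.1327 < 8 * π := by linarith
  have hA1 : A ≤ 41.46 := by nlinarith
  have hM0 := hM.1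
  refine ⟨?_, ?_, by linarith⟩
  · by_contra hc
    push Not at hc
    have : M n * A ≤ 1.6 * 41.46 := mul_le_mul hc.le hA1 hA00 (by norm_num)
    linarith
  · by_contra hc
    push Not at hc
    have h5 : A * ((8 * π + 1 / 10) * M n) ≤ A * A := mul_le_mul_of_nonneg_left hc.le hA00
    have h6 : 25.2327 * 68.307 ≤ (8 * π + 1 / 10) * (M n * A) := mul_le_mul (by linarith) (by linarith) (by norm_num) (by linarith)
    nlinarith

end

noncomputable section

/-- smooth cutoff -/
structure Cut (x0 : ℂ) (r t : ℝ) (χ : ℂ → ℝ) : Prop where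
  r0 : 0 < r
  rt : r < t
  C : ContDiff ℝ 3 χ
  one : ∀ y ∈ ball x0 r, χ y = 1
  zero : ∀ y, y ∉ ball x0 t → χ y = 0
  n0 : ∀ y, 0 ≤ χ y
  n1 : ∀ y, χ y ≤ 1

lemma exists_cut (x0 : ℂ) {r t : ℝ} (hr : 0 < r) (hrt : r < t) : ∃ χ, Cut x0 r t χ := by
  let b : ContDiffBump x0 := ⟨r, t, hr, hrt⟩
  refine ⟨b, hr, hrt, b.contDiff, fun y hy => b.one_of_mem_closedBall (ball_subset_closedBall hy), fun y hy => ?_, fun y => b.nonneg, fun y => b.le_one⟩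
  have := b.support_eq
  by_contra hc
  exact hy (by rw [← show Function.support b = ball x0 t from this]; exact hc)

namespace Cut
variable {x0 : ℂ} {r t : ℝ} {χ : ℂ → ℝ}

lemma cC (h : Cut x0 r t χ) : ContDiff ℝ 3 (fun y => (χ y : ℂ)) := Complex.ofRealCLM.contDiff.comp h.C

lemma ev_zero (h : Cut x0 r t χ) {y : ℂ} (hy : y ∉ closedBall x0 t) : χ =ᶠ[𝓝 y] fun _ => 0 := by
  filter_upwards [isClosed_closedBall.isOpen_compl.mem_nhds hy] with w hw
  exact h.zero w (fun hc => hw (ball_subset_closedBall hc))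

lemma ev_one (h : Cut x0 r t χ) {y : ℂ} (hy : y ∈ ball x0 r) : χ =ᶠ[𝓝 y] fun _ => 1 := by
  filter_upwards [isOpen_ball.mem_nhds hy] with w hw using h.one w hw

lemma db_zero (h : Cut x0 r t χ) {y : ℂ} (hy : y ∉ closedBall x0 t) : db (fun y => (χ y : ℂ)) y = 0 := by
  have : HasW (fun y => (χ y : ℂ)) 0 0 y := (hasW_const 0 y).congr_ev ((h.ev_zero hy).mono fun w hw => by simp [hw])
  exact this.db_eq

lemma db_one (h : Cut x0 r t χ) {y : ℂ} (hy : y ∈ ball x0 r) : db (fun y => (χ y : ℂ)) y = 0 := by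
  have : HasW (fun y => (χ y : ℂ)) 0 0 y := (hasW_const 1 y).congr_ev ((h.ev_one hy).mono fun w hw => by simp [hw])
  exact this.db_eq

lemma cs (_h : Cut x0 r t χ) {E : Type*} [Zero E] {f : ℂ → E} (hf : ∀ y, y ∉ closedBall x0 t → f y = 0) : HasCompactSupport f :=
  HasCompactSupport.intro (isCompact_closedBall x0 t) (fun y hy => hf y hy)

/-- the constant -/
def K (χ : ℂ → ℝ) (m : ℝ) : ℝ := ∫ y, (‖dz (db (fun y => (χ y : ℂ))) y‖ / m + ‖db (fun y => (χ y : ℂ)) y‖ / m ^ 2)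

lemma dbC (h : Cut x0 r t χ) : ContDiff ℝ 2 (db (fun y => (χ y : ℂ))) := by
  have := db_contDiff (n := 2) (g := fun y => (χ y : ℂ)) (by exact_mod_cast h.cC)
  exact_mod_cast this

lemma dzdbC (h : Cut x0 r t χ) : Continuous (dz (db (fun y => (χ y : ℂ)))) := by
  have h2 : ContDiff ℝ ((0:ℕ)+1) (db (fun y => (χ y : ℂ))) := h.dbC.of_le (by norm_num)
  exact (dz_contDiff (n := 0) h2).continuous

lemma Kint (h : Cut x0 r t χ) (m : ℝ) : Integrable (fun y => (‖dz (db (fun y => (χ y : ℂ))) y‖ / m + ‖db (fun y => (χ y : ℂ)) y‖ / m ^ 2)) := by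
  have hc : HasCompactSupport (db (fun y => (χ y : ℂ))) := h.cs (fun y hy => h.db_zero hy)
  have i1 : Integrable (dz (db (fun y => (χ y : ℂ)))) := h.dzdbC.integrable_of_hasCompactSupport (dz_compact hc)
  have i2 : Integrable (db (fun y => (χ y : ℂ))) := h.dbC.continuous.integrable_of_hasCompactSupport hc
  exact (i1.norm.div_const _).add (i2.norm.div_const _)

/-- local representation of the gradient -/
lemma rep (h : Cut x0 r t χ) {s t' M : ℝ} (hs : s < r) (ht : t < t') {u g : ℂ → ℝ} {uz : ℂ → ℂ} {c : ℂ → ℂ}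
    (hu : ∀ y ∈ ball x0 t', HasR u (uz y) y) (huz : ∀ y ∈ ball x0 t', ContDiffAt ℝ 1 uz y)
    (hu1 : ∀ y ∈ ball x0 t', ContDiffAt ℝ 1 u y)
    (hW : ∀ y ∈ ball x0 t', HasW uz (c y) (-(g y : ℂ) / 4) y) (hM : ∀ y ∈ ball x0 t', |u y| ≤ M)
    (hg : Continuous (fun y => ((χ y * g y : ℝ) : ℂ))) {z : ℂ} (hz : z ∈ ball x0 s) :
    ‖uz z + 1 / (4 * π) * CT (fun y => ((χ y * g y : ℝ) : ℂ)) z‖ ≤ M * K χ (r - s) / π := by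
  have hm : 0 < r - s := by linarith
  have hcb : closedBall x0 t ⊆ ball x0 t' := closedBall_subset_ball ht
  have hzr : z ∈ ball x0 r := ball_subset_ball hs.le hz
  set b := db (fun y => (χ y : ℂ)) with hb
  have hsep : ∀ y, y ∉ ball x0 r → r - s ≤ ‖z - y‖ := by
    intro y hy
    rw [mem_ball, not_lt] at hy
    rw [mem_ball] at hz
    have := dist_triangle y z x0
    rw [← dist_eq_norm, dist_comm]; linarith
  -- general smoothness helper
  have smooth : ∀ (F : ℂ → ℂ), (∀ y ∈ ball x0 t', ContDiffAt ℝ 1 F y) → ContDiff ℝ 1 (fun y => b y / (z - y) * F y) := by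
    intro F hF
    rw [contDiff_iff_contDiffAt]
    intro y
    by_cases h1 : y ∈ ball x0 r
    · refine (contDiffAt_const (c := (0:ℂ))).congr_of_eventuallyEq ?_
      filter_upwards [isOpen_ball.mem_nhds h1] with w hw
      rw [hb, h.db_one hw]; simp
    by_cases h2 : y ∈ closedBall x0 t
    · have hne : z - y ≠ 0 := fun hc => by have := hsep y h1; rw [hc] at this; simp at this; linarith
      have e1 : ContDiffAt ℝ 1 (fun y => (z - y)⁻¹) y := ContDiffAt.inv (by fun_prop) hne
      have e2 : ContDiffAt ℝ 1 b y := h.dbC.contDiffAt.of_le (by norm_num)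
      simp only [div_eq_mul_inv]
      exact (e2.mul e1).mul (hF y (hcb h2))
    · refine (contDiffAt_const (c := (0:ℂ))).congr_of_eventuallyEq ?_
      filter_upwards [isClosed_closedBall.isOpen_compl.mem_nhds h2] with w hw
      rw [hb, h.db_zero hw]; simp
  have csF : ∀ (F : ℂ → ℂ), HasCompactSupport (fun y => b y / (z - y) * F y) := fun F =>
    h.cs (fun y hy => by rw [hb, h.db_zero hy]; simp)
  -- Pompeiu for χ uz
  have hχu : ContDiff ℝ 1 (fun y => (χ y : ℂ) * uz y) := by
    rw [contDiff_iff_contDiffAt]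
    intro y
    by_cases h2 : y ∈ closedBall x0 t
    · exact (h.cC.contDiffAt.of_le (by norm_num)).mul (huz y (hcb h2))
    · refine (contDiffAt_const (c := (0:ℂ))).congr_of_eventuallyEq ?_
      filter_upwards [h.ev_zero h2] with w hw
      simp [hw]
  have hP := pompeiu _ hχu (h.cs (fun y hy => by rw [h.zero y (fun hc => hy (ball_subset_closedBall hc))]; simp)) z
  have hdb : ∀ y, db (fun y => (χ y : ℂ) * uz y) y / (z - y) = b y / (z - y) * uz y - 1 / 4 * (((χ y * g y : ℝ) : ℂ) / (z - y)) := by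
    intro y
    by_cases h2 : y ∈ closedBall x0 t
    · have h3 := (hasW_of_differentiableAt (h.cC.contDiffAt (x := y) |>.differentiableAt (by norm_num))).mul (hW y (hcb h2))
      rw [h3.db_eq, ← hb]; push_cast; ring
    · have h3 : HasW (fun y => (χ y : ℂ) * uz y) 0 0 y := (hasW_const 0 y).congr_ev ((h.ev_zero h2).mono fun w hw => by simp [hw])
      rw [h3.db_eq, hb, h.db_zero h2, h.zero y (fun hc => h2 (ball_subset_closedBall hc))]; simp
  have i1 : Integrable (fun y => b y / (z - y) * uz y) := (smooth uz huz).continuous.integrable_of_hasCompactSupport (csF uz)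
  have hgc : HasCompactSupport (fun y => ((χ y * g y : ℝ) : ℂ)) := h.cs (fun y hy => by
    rw [h.zero y (fun hc => hy (ball_subset_closedBall hc))]; simp)
  have i2 := CT_integrable _ hg hgc z
  rw [integral_congr_ae (Eventually.of_forall hdb), integral_sub i1 (i2.const_mul _), integral_const_mul, h.one z hzr] at hP
  -- integrate by parts
  have hu' : ∀ y ∈ ball x0 t', ContDiffAt ℝ 1 (fun y => (u y : ℂ)) y := fun y hy =>
    Complex.ofRealCLM.contDiff.contDiffAt.comp y (hu1 y hy)
  have hS := smooth _ hu'
  have hI := integral_dz_zero _ hS (csF _)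
  let k : ℂ → ℂ := fun y => (dz b y / (z - y) + b y / (z - y) ^ 2) * u y
  have hdz : ∀ y, dz (fun y => b y / (z - y) * (u y : ℂ)) y = k y + b y / (z - y) * uz y := by
    intro y
    have hz0 : (∀ᶠ w in 𝓝 y, b w = 0) → dz (fun y => b y / (z - y) * (u y : ℂ)) y = k y + b y / (z - y) * uz y := by
      intro he
      have e1 : HasW b 0 0 y := (hasW_const 0 y).congr_ev (he.mono fun w hw => by simp [hw])
      have e2 : HasW (fun y => b y / (z - y) * (u y : ℂ)) 0 0 y := (hasW_const 0 y).congr_ev (he.mono fun w hw => by simp [hw])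
      simp only [k]
      rw [e1.dz_eq, e2.dz_eq, he.self_of_nhds]; simp
    by_cases h1 : y ∈ ball x0 r
    · exact hz0 (by filter_upwards [isOpen_ball.mem_nhds h1] with w hw using h.db_one hw)
    by_cases h2 : y ∈ closedBall x0 t
    · have hne : z - y ≠ 0 := fun hc => by have := hsep y h1; rw [hc] at this; simp at this; linarith
      have e1 : HasW b (dz b y) (db b y) y := hasW_of_differentiableAt (h.dbC.contDiffAt.differentiableAt (by norm_num))
      have e2 : HasDerivAt (fun y => (z - y)⁻¹) (1 / (z - y) ^ 2) y := by
        have := ((hasDerivAt_id y).const_sub z).inv hne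
        refine this.congr_deriv ?_
        simp
      have e3 := (e1.mul (hasW_of_hasDerivAt e2)).mul (hu y (hcb h2))
      have e4 : (fun y => b y / (z - y) * (u y : ℂ)) = fun y => b y * (z - y)⁻¹ * (u y : ℂ) := by
        funext w; rw [div_eq_mul_inv]
      rw [e4, HasW.dz_eq e3]
      simp only [k]
      ring
    · exact hz0 (by filter_upwards [isClosed_closedBall.isOpen_compl.mem_nhds h2] with w hw using h.db_zero hw)
  have hkb : ∀ y, ‖k y‖ ≤ M * (‖dz b y‖ / (r - s) + ‖b y‖ / (r - s) ^ 2) := by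
    intro y
    have hM0 : 0 ≤ M := (abs_nonneg _).trans (hM z (ball_subset_ball (by linarith [h.rt]) hz))
    have hz0 : (∀ᶠ w in 𝓝 y, b w = 0) → ‖k y‖ ≤ M * (‖dz b y‖ / (r - s) + ‖b y‖ / (r - s) ^ 2) := by
      intro he
      have e1 : HasW b 0 0 y := (hasW_const 0 y).congr_ev (he.mono fun w hw => by simp [hw])
      simp only [k]
      rw [e1.dz_eq, he.self_of_nhds]; simp
    by_cases h1 : y ∈ ball x0 r
    · exact hz0 (by filter_upwards [isOpen_ball.mem_nhds h1] with w hw using h.db_one hw)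
    by_cases h2 : y ∈ closedBall x0 t
    · have hs' := hsep y h1
      have e1 : ‖dz b y / (z - y) + b y / (z - y) ^ 2‖ ≤ ‖dz b y‖ / (r - s) + ‖b y‖ / (r - s) ^ 2 := by
        refine (norm_add_le _ _).trans ?_
        rw [norm_div, norm_div, norm_pow]
        gcongr
      simp only [k]
      rw [norm_mul, mul_comm, Complex.norm_real, Real.norm_eq_abs]
      exact mul_le_mul (hM y (hcb h2)) e1 (norm_nonneg _) hM0
    · exact hz0 (by filter_upwards [isClosed_closedBall.isOpen_compl.mem_nhds h2] with w hw using h.db_zero hw)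
  have hkm : Integrable k := by
    have hd : Continuous (dz (fun y => b y / (z - y) * (u y : ℂ))) := by
      have h2 : ContDiff ℝ ((0:ℕ)+1) (fun y => b y / (z - y) * (u y : ℂ)) := hS.of_le (by norm_num)
      exact (dz_contDiff (n := 0) h2).continuous
    have i3 := (hd.integrable_of_hasCompactSupport (dz_compact (csF _))).sub i1
    refine i3.congr (Eventually.of_forall fun y => ?_)
    show dz (fun y => b y / (z - y) * (u y : ℂ)) y - b y / (z - y) * uz y = k y
    rw [hdz]; ring
  rw [integral_congr_ae (Eventually.of_forall hdz), integral_add hkm i1] at hI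
  have hfin : uz z + 1 / (4 * π) * CT (fun y => ((χ y * g y : ℝ) : ℂ)) z = -(∫ y, k y) / π := by
    have hpi : (π : ℂ) ≠ 0 := by exact_mod_cast pi_pos.ne'
    have : CT (fun y => ((χ y * g y : ℝ) : ℂ)) z = ∫ y, ((χ y * g y : ℝ) : ℂ) / (z - y) := rfl
    rw [this]
    field_simp
    push_cast at hP ⊢
    linear_combination (-4) * hP + 4 * hI
  rw [hfin, norm_div, norm_neg, Complex.norm_real, Real.norm_of_nonneg pi_pos.le]
  gcongr
  unfold K
  rw [← integral_const_mul]
  exact norm_integral_le_of_norm_le ((h.Kint _).const_mul M) (Eventually.of_forall hkb)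

/-- holomorphy of the remainder -/
lemma rep_hol (h : Cut x0 r t χ) {g : ℂ → ℝ} {uz c : ℂ → ℂ} (hW : ∀ y ∈ ball x0 r, HasW uz (c y) (-(g y : ℂ) / 4) y)
    (hg : ContDiff ℝ 1 (fun y => ((χ y * g y : ℝ) : ℂ))) {z : ℂ} (hz : z ∈ ball x0 r) :
    DifferentiableAt ℂ (fun z => uz z + 1 / (4 * π) * CT (fun y => ((χ y * g y : ℝ) : ℂ)) z) z := by
  have hgc : HasCompactSupport (fun y => ((χ y * g y : ℝ) : ℂ)) := h.cs (fun y hy => by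
    rw [h.zero y (fun hc => hy (ball_subset_closedBall hc))]; simp)
  have h1 := (hW z hz).add ((CT_hasW _ hg hgc z).const_mul (1 / (4 * π)))
  have h2 : -(g z : ℂ) / 4 + 1 / (4 * π) * (π * ((χ z * g z : ℝ) : ℂ)) = 0 := by
    rw [h.one z hz]
    have hpi : (π : ℂ) ≠ 0 := by exact_mod_cast pi_pos.ne'
    field_simp; ring
  rw [h2] at h1
  exact h1.hasDerivAt.differentiableAt

end Cut

end

noncomputable section

lemma integral_affine {E : Type*} [NormedAddCommGroup E] [NormedSpace ℝ E] (F : ℂ → E) (x : ℂ) {e : ℝ} (he : 0 < e) :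
    ∫ w : ℂ, F (x + e * w) = (e ^ 2)⁻¹ • ∫ y, F y := by
  have h1 := Measure.integral_comp_smul (volume : Measure ℂ) (fun y => F (x + y)) e
  simp only [Complex.real_smul, Complex.finrank_real_complex] at h1
  rw [h1, integral_add_left_eq_self, abs_of_pos (by positivity)]

lemma CT_scale (F : ℂ → ℂ) (x z : ℂ) {e : ℝ} (he : 0 < e) : CT F (x + e * z) = e * CT (fun w => F (x + e * w)) z := by
  have h1 := integral_affine (fun y => F y / (x + e * z - y)) x he
  unfold CT
  have he' : (e : ℂ) ≠ 0 := by exact_mod_cast he.ne'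
  have h2 : ∀ w : ℂ, F (x + e * w) / (x + e * z - (x + e * w)) = (e : ℂ)⁻¹ * (F (x + e * w) / (z - w)) := by
    intro w
    rw [show x + e * z - (x + e * w) = e * (z - w) by ring, ← div_div]
    rw [div_eq_mul_inv, div_eq_mul_inv, div_eq_mul_inv]; ring
  simp only [h2] at h1
  rw [integral_const_mul] at h1
  have h3 : (e : ℂ) * ∫ w, F (x + e * w) / (z - w) = e ^ 2 * ((e:ℂ)⁻¹ * ∫ w, F (x + e * w) / (z - w)) := by
    field_simp
  rw [h3, h1, Complex.real_smul]
  push_cast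
  field_simp

/-- local data around a concentration point -/
structure Lc (Ω : Set ℂ) (d p : ℝ) (u : ℂ → ℝ) (x0 : ℂ) (σ : ℝ) (xp : ℂ) (M ε : ℝ) : Prop where
  sl : Sl Ω d p u
  σ0 : 0 < σ
  hb : ball x0 (2 * σ) ⊆ Ω
  pos : ∀ y ∈ ball x0 (2 * σ), 0 < u y
  hxp : xp ∈ ball x0 (σ / 10)
  uM : u xp = M
  leM : ∀ x, u x ≤ M
  M1 : 1.6 ≤ M
  A1 : p * (∫ x, hp' p u x) ≤ 100
  A2 : p * (∫ x, hp' p u x) ≤ (8 * π + 1 / 10) * M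
  ε0 : 0 < ε
  εd : ε ^ 2 * (p * M ^ (p - 1)) = 1

/-- scaled functions -/
def vv (p : ℝ) (u : ℂ → ℝ) (xp : ℂ) (M ε : ℝ) (w : ℂ) : ℝ := p / M * (u (xp + ε * w) - M)
def vvz (p : ℝ) (u : ℂ → ℝ) (xp : ℂ) (M ε : ℝ) (w : ℂ) : ℂ := ((p * ε / M : ℝ) : ℂ) * dz (fun y => (u y : ℂ)) (xp + ε * w)
def rr (p : ℝ) (u : ℂ → ℝ) (xp : ℂ) (M ε : ℝ) (χ : ℂ → ℝ) (w : ℂ) : ℝ := χ (xp + ε * w) * (fp u (xp + ε * w) / M) ^ p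
def hhh (p : ℝ) (u : ℂ → ℝ) (xp : ℂ) (M ε : ℝ) (χ : ℂ → ℝ) (w : ℂ) : ℂ :=
  vvz p u xp M ε w + 1 / (4 * π) * CT (fun y => (rr p u xp M ε χ y : ℂ)) w

namespace Lc
variable {Ω : Set ℂ} {d p : ℝ} {u : ℂ → ℝ} {x0 : ℂ} {σ : ℝ} {xp : ℂ} {M ε : ℝ} {χ : ℂ → ℝ} {r t : ℝ}

lemma M0 (h : Lc Ω d p u x0 σ xp M ε) : 0 < M := by linarith [h.M1]
lemma p0 (h : Lc Ω d p u x0 σ xp M ε) : 0 < p := h.sl.p0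

lemma fpM (h : Lc Ω d p u x0 σ xp M ε) (x : ℂ) : fp u x ≤ M := max_le (h.leM x) h.M0.le
lemma fpeq (h : Lc Ω d p u x0 σ xp M ε) {x : ℂ} (hx : x ∈ ball x0 (2 * σ)) : fp u x = u x := max_eq_left (h.pos x hx).le

lemma rr0 (h : Lc Ω d p u x0 σ xp M ε) (hc : Cut x0 r t χ) (w : ℂ) : 0 ≤ rr p u xp M ε χ w :=
  mul_nonneg (hc.n0 _) (Real.rpow_nonneg (div_nonneg (Sl.fp0 u _) h.M0.le) _)
lemma fpow_le (h : Lc Ω d p u x0 σ xp M ε) (x : ℂ) : (fp u x / M) ^ p ≤ 1 :=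
  Real.rpow_le_one (div_nonneg (Sl.fp0 u _) h.M0.le) ((div_le_one h.M0).2 (h.fpM _)) h.p0.le
lemma rr1 (h : Lc Ω d p u x0 σ xp M ε) (hc : Cut x0 r t χ) (w : ℂ) : rr p u xp M ε χ w ≤ 1 :=
  mul_le_one₀ (hc.n1 _) (Real.rpow_nonneg (div_nonneg (Sl.fp0 u _) h.M0.le) _) (h.fpow_le _)

lemma rr_eq (h : Lc Ω d p u x0 σ xp M ε) (w : ℂ) :
    rr p u xp M ε χ w = (M ^ p)⁻¹ * (χ (xp + ε * w) * hp' p u (xp + ε * w)) := by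
  unfold rr hp'
  rw [Real.div_rpow (Sl.fp0 u _) h.M0.le]; ring

/-- `χ h` is `C²` -/
lemma gC (h : Lc Ω d p u x0 σ xp M ε) (hc : Cut x0 r t χ) (ht : t < 2 * σ) : ContDiff ℝ 2 (fun y => χ y * hp' p u y) := by
  rw [contDiff_iff_contDiffAt]
  intro y
  by_cases h2 : y ∈ closedBall x0 t
  · have hy : y ∈ ball x0 (2 * σ) := closedBall_subset_ball ht h2
    have hu : ContDiffAt ℝ 2 u y := h.sl.uC.contDiffAt (h.sl.hΩ.mem_nhds (h.hb hy))
    have h3 : ContDiffAt ℝ 2 (fun y => u y ^ p) y := hu.rpow_const_of_ne (h.pos y hy).ne'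
    refine ((hc.C.contDiffAt.of_le (by norm_num)).mul h3).congr_of_eventuallyEq ?_
    filter_upwards [isOpen_ball.mem_nhds hy] with w hw
    unfold hp'
    rw [h.fpeq hw]
  · refine (contDiffAt_const (c := (0:ℝ))).congr_of_eventuallyEq ?_
    filter_upwards [hc.ev_zero h2] with w hw
    simp [hw]

lemma rrC (h : Lc Ω d p u x0 σ xp M ε) (hc : Cut x0 r t χ) (ht : t < 2 * σ) : ContDiff ℝ 2 (rr p u xp M ε χ) := by
  have : rr p u xp M ε χ = fun w => (M ^ p)⁻¹ * (fun y => χ y * hp' p u y) (xp + ε * w) := funext fun w => h.rr_eq w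
  rw [this]
  exact contDiff_const.mul ((h.gC hc ht).comp (by fun_prop))

lemma rr_supp (h : Lc Ω d p u x0 σ xp M ε) (ht : t < 2 * σ) {w : ℂ} (hw : 2 * σ + σ / 10 ≤ ε * ‖w‖) : xp + ε * w ∉ closedBall x0 t := by
  intro hm
  rw [mem_closedBall] at hm
  have h1 := h.hxp
  rw [mem_ball] at h1
  have h2 : ‖(ε * w : ℂ)‖ = ε * ‖w‖ := by rw [norm_mul, Complex.norm_real, Real.norm_of_nonneg h.ε0.le]
  have h3 := dist_triangle_right (xp + ε * w) xp x0
  have h4 : dist (xp + ε * w) xp = ε * ‖w‖ := by rw [dist_eq_norm, ← h2]; congr 1; ring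
  linarith

lemma rrcs (h : Lc Ω d p u x0 σ xp M ε) (hc : Cut x0 r t χ) (ht : t < 2 * σ) : HasCompactSupport (rr p u xp M ε χ) := by
  apply hasCompactSupport_of_norm (T := (2 * σ + σ / 10) / ε)
  intro w hw
  rw [div_le_iff₀ h.ε0] at hw
  have h1 := h.rr_supp ht (w := w) (by linarith)
  unfold rr
  rw [hc.zero _ (fun hh => h1 (ball_subset_closedBall hh)), zero_mul]

lemma rri (h : Lc Ω d p u x0 σ xp M ε) (hc : Cut x0 r t χ) (ht : t < 2 * σ) : Integrable (rr p u xp M ε χ) :=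
  (h.rrC hc ht).continuous.integrable_of_hasCompactSupport (h.rrcs hc ht)

lemma eM (h : Lc Ω d p u x0 σ xp M ε) : (ε ^ 2)⁻¹ * (M ^ p)⁻¹ = p / M := by
  have h1 := h.εd
  have hM := h.M0
  have h2 : M ^ p = M ^ (p - 1) * M := by rw [← Real.rpow_add_one hM.ne']; congr 1; ring
  have h3 : (ε ^ 2)⁻¹ = p * M ^ (p - 1) := by
    rw [inv_eq_iff_eq_inv]; exact eq_inv_of_mul_eq_one_left h1
  have : 0 < M ^ (p - 1) := by positivity
  rw [h3, h2]; field_simp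

lemma mass (h : Lc Ω d p u x0 σ xp M ε) (hc : Cut x0 r t χ) (ht : t < 2 * σ) : ∫ w, rr p u xp M ε χ w ≤ 8 * π + 1 / 10 := by
  have hM := h.M0
  have h1 : ∫ w, rr p u xp M ε χ w = p / M * ∫ y, χ y * hp' p u y := by
    rw [integral_congr_ae (Eventually.of_forall fun w => h.rr_eq w), integral_const_mul, integral_affine (fun y => χ y * hp' p u y) xp h.ε0, smul_eq_mul, ← mul_assoc, mul_comm (M ^ p)⁻¹, h.eM]
  have h2 : ∫ y, χ y * hp' p u y ≤ ∫ y, hp' p u y := by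
    refine integral_mono ((h.gC hc ht).continuous.integrable_of_hasCompactSupport (hc.cs fun y hy => ?_)) h.sl.hpi fun y => ?_
    · rw [hc.zero _ (fun hh => hy (ball_subset_closedBall hh)), zero_mul]
    · exact mul_le_of_le_one_left (Sl.hp0 p u y) (hc.n1 y)
  rw [h1, div_mul_eq_mul_div, div_le_iff₀ hM]
  exact (mul_le_mul_of_nonneg_left h2 h.p0.le).trans h.A2

lemma vR (h : Lc Ω d p u x0 σ xp M ε) {w : ℂ} (hw : xp + ε * w ∈ Ω) : HasR (vv p u xp M ε) (vvz p u xp M ε w) w := by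
  have h1 : HasFDerivAt (fun y => (u y : ℂ)) (wL _ _) (xp + ε * w) := h.sl.uR hw
  have hl : HasFDerivAt (fun w : ℂ => xp + ε * w) ((ε:ℂ) • ContinuousLinearMap.id ℝ ℂ) w :=
    ((hasFDerivAt_id (𝕜 := ℝ) w).const_mul (ε:ℂ)).const_add xp
  have h2 : HasW (fun w => ((u (xp + ε * w) : ℝ) : ℂ)) (ε * dz (fun y => (u y : ℂ)) (xp + ε * w)) ((starRingEnd ℂ) (ε * dz (fun y => (u y : ℂ)) (xp + ε * w))) w := by
    refine HasW.mk' (h1.comp w hl) fun e => ?_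
    simp; ring
  have h3 := (h2.sub (hasW_const (M:ℂ) w)).const_mul ((p / M : ℝ) : ℂ)
  unfold HasR
  have e1 : (fun y => (vv p u xp M ε y : ℂ)) = fun y => ((p / M : ℝ) : ℂ) * (((u (xp + ε * y) : ℝ) : ℂ) - (M:ℂ)) := by
    funext y; unfold vv; push_cast; ring
  rw [e1]
  have e2 : vvz p u xp M ε w = ((p / M : ℝ) : ℂ) * (ε * dz (fun y => (u y : ℂ)) (xp + ε * w) - 0) := by
    unfold vvz; push_cast; ring
  rw [e2, map_mul, map_sub, Complex.conj_ofReal, map_zero]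
  exact h3

/-- scaled remainder -/
lemma hh_eq (h : Lc Ω d p u x0 σ xp M ε) (w : ℂ) : hhh p u xp M ε χ w = ((p * ε / M : ℝ) : ℂ) *
    (dz (fun y => (u y : ℂ)) (xp + ε * w) + 1 / (4 * π) * CT (fun y => ((χ y * hp' p u y : ℝ) : ℂ)) (xp + ε * w)) := by
  unfold hhh vvz
  rw [CT_scale _ _ _ h.ε0]
  have h1 : CT (fun y => (rr p u xp M ε χ y : ℂ)) w = ((M ^ p)⁻¹ : ℝ) * CT (fun w => ((χ (xp + ε * w) * hp' p u (xp + ε * w) : ℝ) : ℂ)) w := by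
    unfold CT
    rw [← integral_const_mul]
    refine integral_congr_ae (Eventually.of_forall fun y => ?_)
    simp only []
    rw [h.rr_eq]; push_cast; ring
  rw [h1]
  have h2 : (((M ^ p)⁻¹ : ℝ) : ℂ) = ((p * ε / M : ℝ) : ℂ) * ε := by
    have h3 := h.eM
    have := h.ε0
    have h4 : (M ^ p)⁻¹ = p * ε / M * ε := by
      field_simp at h3 ⊢
      linarith
    rw [h4]; push_cast; ring
  rw [h2]; ring

lemma hW (h : Lc Ω d p u x0 σ xp M ε) {y : ℂ} (hy : y ∈ ball x0 (2 * σ)) :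
    HasW (dz (fun y => (u y : ℂ))) (dz (dz (fun y => (u y : ℂ))) y) (-((hp' p u y : ℝ) : ℂ) / 4) y := by
  have := h.sl.uzW (h.hb hy)
  rw [h.sl.Hpos (h.pos y hy)] at this
  exact this

lemma hh_le (h : Lc Ω d p u x0 σ xp M ε) (hc : Cut x0 r t χ) (ht : t < 2 * σ) {s : ℝ} (hs : s < r) {w : ℂ} (hw : xp + ε * w ∈ ball x0 s) :
    ‖hhh p u xp M ε χ w‖ ≤ p * ε * (Cut.K χ (r - s) / π) := by
  have hM := h.M0
  have hp := h.p0
  have he := h.ε0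
  have h1 := hc.rep (u := u) (g := hp' p u) (M := M) hs ht (fun y hy => h.sl.uR (h.hb hy)) (fun y hy => h.sl.uzC (h.hb hy))
    (fun y hy => (h.sl.uC.contDiffAt (h.sl.hΩ.mem_nhds (h.hb hy))).of_le (by norm_num)) (fun y hy => h.hW hy)
    (fun y hy => by rw [abs_of_pos (h.pos y hy)]; exact h.leM y)
    (Complex.continuous_ofReal.comp (h.gC hc ht).continuous) hw
  rw [h.hh_eq, norm_mul, Complex.norm_real, Real.norm_of_nonneg (by positivity)]
  refine (mul_le_mul_of_nonneg_left h1 (by positivity)).trans (le_of_eq ?_)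
  field_simp

lemma hh_hol (h : Lc Ω d p u x0 σ xp M ε) (hc : Cut x0 r t χ) (ht : t < 2 * σ) {w : ℂ} (hw : xp + ε * w ∈ ball x0 r) :
    DifferentiableAt ℂ (hhh p u xp M ε χ) w := by
  have h1 := hc.rep_hol (g := hp' p u) (fun y hy => h.hW (ball_subset_ball (by linarith [hc.rt]) hy))
    (Complex.ofRealCLM.contDiff.comp ((h.gC hc ht).of_le (by norm_num))) hw
  rw [show hhh p u xp M ε χ = _ from funext fun w => h.hh_eq w]
  refine DifferentiableAt.const_mul ?_ _
  exact h1.comp w (f := fun w : ℂ => xp + ε * w) (by fun_prop)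

lemma CT_rr (h : Lc Ω d p u x0 σ xp M ε) (hc : Cut x0 r t χ) (ht : t < 2 * σ) (w : ℂ) : ‖CT (fun y => (rr p u xp M ε χ y : ℂ)) w‖ ≤ 10 * π + 1 / 10 := by
  have := CT_le (h.rri hc ht) (h.rr0 hc) (h.rr1 hc) w
  linarith [h.mass hc ht, kern_le (h.rri hc ht) (h.rr0 hc) (h.rr1 hc) w]

lemma vz_le (h : Lc Ω d p u x0 σ xp M ε) (hc : Cut x0 r t χ) (ht : t < 2 * σ) {s : ℝ} (hs : s < r) (hK : p * ε * (Cut.K χ (r - s) / π) ≤ 1 / 10) {w : ℂ} (hw : xp + ε * w ∈ ball x0 s) :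
    ‖vvz p u xp M ε w‖ ≤ 3 := by
  have h1 := h.hh_le hc ht hs hw
  have h2 := h.CT_rr hc ht w
  have h3 : vvz p u xp M ε w = hhh p u xp M ε χ w - 1 / (4 * π) * CT (fun y => (rr p u xp M ε χ y : ℂ)) w := by
    unfold hhh; ring
  have h4 : ‖(1 / (4 * π) : ℂ) * CT (fun y => (rr p u xp M ε χ y : ℂ)) w‖ ≤ 1 / (4 * π) * (10 * π + 1 / 10) := by
    rw [norm_mul]
    have : ‖(1 / (4 * π) : ℂ)‖ = 1 / (4 * π) := by
      rw [show (1 / (4 * π) : ℂ) = ((1 / (4 * π) : ℝ) : ℂ) by push_cast; ring, Complex.norm_real, Real.norm_of_nonneg (by positivity)]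
    rw [this]; gcongr
  have h5 : 1 / (4 * π) * (10 * π + 1 / 10) ≤ 2.6 := by
    rw [div_mul_eq_mul_div, one_mul, div_le_iff₀ (by positivity)]
    linarith [Real.pi_gt_three]
  rw [h3]
  refine (norm_sub_le _ _).trans ?_
  linarith

end Lc

end

noncomputable section

namespace Lc
variable {Ω : Set ℂ} {d p : ℝ} {u : ℂ → ℝ} {x0 : ℂ} {σ : ℝ} {xp : ℂ} {M ε : ℝ} {χ : ℂ → ℝ} {r t : ℝ}

lemma v00 (h : Lc Ω d p u x0 σ xp M ε) : vv p u xp M ε 0 = 0 := by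
  unfold vv; simp [h.uM]

lemma v_low (h : Lc Ω d p u x0 σ xp M ε) (hvz : ∀ w, xp + ε * w ∈ ball x0 (1.4 * σ) → ‖vvz p u xp M ε w‖ ≤ 3) (hε : ε ≤ σ / 10)
    {w : ℂ} (hw : ‖w‖ ≤ 1) : -6 ≤ vv p u xp M ε w := by
  have hin : ∀ s ∈ Set.Icc (0:ℝ) 1, xp + ε * (0 + s * w) ∈ ball x0 (1.4 * σ) := by
    intro s hs
    have h1 := h.hxp
    rw [mem_ball] at h1 ⊢
    have h3 := dist_triangle_right (xp + ε * (0 + s * w)) xp x0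
    have h4 : dist (xp + ε * (0 + s * w)) xp ≤ ε := by
      rw [dist_eq_norm, add_sub_cancel_left, norm_mul, Complex.norm_real, Real.norm_of_nonneg h.ε0.le, zero_add, norm_mul, Complex.norm_real, Real.norm_of_nonneg hs.1]
      have : s * ‖w‖ ≤ 1 := mul_le_one₀ hs.2 (norm_nonneg _) hw
      nlinarith [h.ε0]
    have := h.σ0
    have h5 := dist_triangle (xp + ε * (0 + s * w)) xp x0
    linarith
  have hσ : ball x0 (1.4 * σ) ⊆ Ω := (ball_subset_ball (by linarith [h.σ0])).trans h.hb
  have hd : ∀ s ∈ Set.Icc (0:ℝ) 1, HasDerivAt (fun s : ℝ => vv p u xp M ε (0 + s * w)) (2 * (vvz p u xp M ε (0 + s * w) * w).re) s :=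
    fun s hs => (h.vR (hσ (hin s hs))).line
  obtain ⟨c, hc, hce⟩ := exists_hasDerivAt_eq_slope (fun s : ℝ => vv p u xp M ε (0 + s * w)) (fun s => 2 * (vvz p u xp M ε (0 + s * w) * w).re) zero_lt_one
    (fun s hs => (hd s hs).continuousAt.continuousWithinAt) (fun s hs => hd s ⟨hs.1.le, hs.2.le⟩)
  have h1 : |(vvz p u xp M ε (0 + c * w) * w).re| ≤ 3 := by
    refine (Complex.abs_re_le_norm _).trans ?_
    rw [norm_mul]
    have := hvz _ (hin c ⟨hc.1.le, hc.2.le⟩)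
    nlinarith [norm_nonneg w, norm_nonneg (vvz p u xp M ε (0 + c * w))]
  have h2 := (abs_le.1 h1).1
  simp only [Complex.ofReal_one, Complex.ofReal_zero, zero_mul, one_mul, zero_add, h.v00] at hce h2
  have : vv p u xp M ε w = 2 * (vvz p u xp M ε (c * w) * w).re := by rw [hce]; simp
  rw [this]; linarith

lemma hp_low (h : Lc Ω d p u x0 σ xp M ε) (hvz : ∀ w, xp + ε * w ∈ ball x0 (1.4 * σ) → ‖vvz p u xp M ε w‖ ≤ 3) (hε : ε ≤ σ / 10)
    {x : ℂ} (hx : x ∈ ball xp ε) : M ^ p * Real.exp (-12) ≤ hp' p u x := by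
  have hp := h.sl.hp
  have hM := h.M0
  have he := h.ε0
  have he' : (ε : ℂ) ≠ 0 := by exact_mod_cast he.ne'
  have h1 : -6 ≤ vv p u xp M ε ((x - xp) / ε) := by
    apply h.v_low hvz hε
    rw [norm_div, Complex.norm_real, Real.norm_of_nonneg he.le, div_le_one he]
    rw [mem_ball, dist_eq_norm] at hx; exact hx.le
  unfold vv at h1
  rw [mul_div_cancel₀ _ he', add_sub_cancel] at h1
  have h2 : M * (1 - 6 / p) ≤ u x := by
    have h3 : p / M * (u x - M) * (M / p) = u x - M := by field_simp
    have h4 : -6 * (M / p) ≤ p / M * (u x - M) * (M / p) := mul_le_mul_of_nonneg_right h1 (by positivity)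
    rw [h3] at h4
    have : M * (1 - 6 / p) = M + -6 * (M / p) := by ring
    linarith
  have h6 : 0 < 1 - 6 / p := by rw [sub_pos, div_lt_one (by linarith)]; linarith
  have h5 : Real.exp (-12) ≤ (1 - 6 / p) ^ p := by
    rw [Real.rpow_def_of_pos h6, Real.exp_le_exp]
    have h7 := Real.one_sub_inv_le_log_of_pos h6
    have h8 : -(12 / p) ≤ 1 - (1 - 6 / p)⁻¹ := by
      have h9 : 1 - (1 - 6 / p)⁻¹ = -(6 / (p - 6)) := by
        have : p - 6 ≠ 0 := by linarith
        have : p ≠ 0 := by linarith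
        field_simp; ring
      rw [h9, neg_le_neg_iff, div_le_div_iff₀ (by linarith) (by linarith)]
      linarith
    have h10 : -(12 / p) * p ≤ Real.log (1 - 6 / p) * p := mul_le_mul_of_nonneg_right (h8.trans h7) (by linarith)
    have h11 : -(12 / p) * p = -12 := by field_simp
    linarith
  calc M ^ p * Real.exp (-12) ≤ M ^ p * (1 - 6 / p) ^ p := by gcongr
    _ = (M * (1 - 6 / p)) ^ p := (Real.mul_rpow hM.le h6.le).symm
    _ ≤ hp' p u x := Real.rpow_le_rpow (by positivity) (h2.trans (le_max_left _ _)) (by linarith)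

lemma near_mass (h : Lc Ω d p u x0 σ xp M ε) (hvz : ∀ w, xp + ε * w ∈ ball x0 (1.4 * σ) → ‖vvz p u xp M ε w‖ ≤ 3) (hε : ε ≤ σ / 10) :
    M * Real.exp (-12) ≤ p * ∫ x in ball xp ε, hp' p u x := by
  have hM := h.M0
  have he := h.ε0
  have hp := h.p0
  have h1 : ∫ x in ball xp ε, M ^ p * Real.exp (-12) ≤ ∫ x in ball xp ε, hp' p u x := by
    refine setIntegral_mono_on ?_ h.sl.hpi.integrableOn measurableSet_ball (fun x hx => h.hp_low hvz hε hx)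
    exact integrableOn_const (measure_ball_lt_top.ne)
  rw [setIntegral_const, Measure.real, Complex.volume_ball] at h1
  have h2 : (ENNReal.ofReal ε ^ 2 * (NNReal.pi : ENNReal)).toReal = ε ^ 2 * π := by
    simp [he.le]
  rw [h2, smul_eq_mul] at h1
  have h3 := h.eM
  have h4 : p * (ε ^ 2 * π * (M ^ p * Real.exp (-12))) = π * (M * Real.exp (-12)) := by
    have hMp : 0 < M ^ p := by positivity
    field_simp at h3 ⊢
    linarith
  have h5 := mul_le_mul_of_nonneg_left h1 hp.le
  rw [h4] at h5
  refine le_trans ?_ h5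
  have : 0 < M * Real.exp (-12) := by positivity
  nlinarith [Real.pi_gt_three]

lemma M_le (h : Lc Ω d p u x0 σ xp M ε) (hvz : ∀ w, xp + ε * w ∈ ball x0 (1.4 * σ) → ‖vvz p u xp M ε w‖ ≤ 3) (hε : ε ≤ σ / 10) :
    M ≤ 100 * Real.exp 12 := by
  have h1 := h.near_mass hvz hε
  have h2 : ∫ x in ball xp ε, hp' p u x ≤ ∫ x, hp' p u x :=
    setIntegral_le_integral h.sl.hpi (Eventually.of_forall (Sl.hp0 p u))
  have h3 := (h1.trans (mul_le_mul_of_nonneg_left h2 h.p0.le)).trans h.A1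
  rw [Real.exp_neg, ← div_eq_mul_inv, div_le_iff₀ (Real.exp_pos _)] at h3
  exact h3

lemma far_mass (h : Lc Ω d p u x0 σ xp M ε) (hvz : ∀ w, xp + ε * w ∈ ball x0 (1.4 * σ) → ‖vvz p u xp M ε w‖ ≤ 3) (hε : ε ≤ σ / 10)
    (hX : 0 < ∫ x, fp u x ^ (p + 1)) (hpd : 40 * Real.log (2 * d) ≤ p) (hεδ : ε ≤ Real.exp (-(p / 8)) / 2) :
    p * (∫ x in (ball xp (Real.exp (-(p / 8))))ᶜ, hp' p u x) ≤
      25 * Real.exp 12 * (p ^ 2 * ∫ w, Sl.DD d p (4 * p / (p + 1) ^ 2) u w ∂(volume.prod volume)) := by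
  have hp := h.sl.hp
  have hd1 := h.sl.d1
  set δ := Real.exp (-(p / 8)) with hδ
  have hδ0 : 0 < δ := Real.exp_pos _
  set a := 4 * p / (p + 1) ^ 2 with ha
  have ha0 : 0 < a := by have := h.p0; positivity
  have hap : a ≤ 4 / p := by
    rw [ha, div_le_div_iff₀ (by positivity) (by linarith)]
    nlinarith
  have hDi := (h.sl.energy (q := p + 1) rfl rfl rfl rfl hX).1
  set S : Set (ℂ × ℂ) := ball xp ε ×ˢ (ball xp δ)ᶜ with hS
  have hSm : MeasurableSet S := measurableSet_ball.prod measurableSet_ball.compl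
  have h1 : ∫ w in S, 1 / 25 * KK p u w ∂(volume.prod volume) ≤ ∫ w in S, Sl.DD d p a u w ∂(volume.prod volume) := by
    refine setIntegral_mono_on (h.sl.KKi.const_mul _).integrableOn hDi.integrableOn hSm ?_
    rintro ⟨x, y⟩ ⟨hx, hy⟩
    by_cases hin : x ∈ Ω ∧ y ∈ Ω
    · have hL0 : 0 ≤ Lk d (x, y) := h.sl.Lk0 hin.1 hin.2
      have hsep : δ / 2 ≤ ‖x - y‖ := by
        simp only [mem_ball, Set.mem_compl_iff, not_lt] at hx hy
        have := dist_triangle y x xp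
        rw [← dist_eq_norm, dist_comm]; linarith
      have hL : Lk d (x, y) ≤ Real.log (2 * d) + p / 8 := by
        unfold Lk
        have h3 : Real.log (δ / 2) ≤ Real.log ‖x - y‖ := Real.log_le_log (by positivity) hsep
        rw [Real.log_div hδ0.ne' two_ne_zero, hδ, Real.log_exp] at h3
        rw [Real.log_mul two_ne_zero (by linarith)]
        simp only
        linarith
      have hτ : a * Lk d (x, y) ≤ 0.6 := by
        calc a * Lk d (x, y) ≤ 4 / p * (p / 40 + p / 8) := by
              apply mul_le_mul hap (by linarith) hL0 (by positivity)
          _ = 0.6 := by field_simp; norm_num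
      have hτ0 : 0 ≤ a * Lk d (x, y) := mul_nonneg ha0.le hL0
      have h5 := Sl.phi_ge hτ0
      have h6 : 1 / 25 ≤ Real.exp (a * Lk d (x, y) - 1) - a * Lk d (x, y) := by
        refine le_trans ?_ h5
        nlinarith
      unfold Sl.DD
      rw [mul_comm]
      exact mul_le_mul_of_nonneg_left h6 (Sl.KK0 _)
    · have := h.sl.KKout (w := (x, y)) hin
      unfold Sl.DD; rw [this]; simp
  have h2 : ∫ w in S, Sl.DD d p a u w ∂(volume.prod volume) ≤ ∫ w, Sl.DD d p a u w ∂(volume.prod volume) :=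
    setIntegral_le_integral hDi (Eventually.of_forall (h.sl.DD0 ha0))
  rw [integral_const_mul] at h1
  have h3 : ∫ w in S, KK p u w ∂(volume.prod volume) = (∫ x in ball xp ε, hp' p u x) * ∫ x in (ball xp δ)ᶜ, hp' p u x :=
    setIntegral_prod_mul (hp' p u) (hp' p u) _ _
  rw [h3] at h1
  have h4 := h.near_mass hvz hε
  set N := ∫ x in ball xp ε, hp' p u x
  set F := ∫ x in (ball xp δ)ᶜ, hp' p u x with hF
  set D := ∫ w, Sl.DD d p a u w ∂(volume.prod volume)
  have hF0 : 0 ≤ F := setIntegral_nonneg measurableSet_ball.compl (fun x _ => Sl.hp0 p u x)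
  have h5 : Real.exp (-12) ≤ p * N := le_trans (by nlinarith [h.M1, Real.exp_pos (-12)]) h4
  have h6 : Real.exp (-12) * (p * F) ≤ p * N * (p * F) := mul_le_mul_of_nonneg_right h5 (by positivity)
  have h7 : Real.exp (-12) * (p * F) ≤ 25 * (p ^ 2 * D) := by
    have h8 : p ^ 2 * (1 / 25 * (N * F)) ≤ p ^ 2 * D := mul_le_mul_of_nonneg_left (h1.trans h2) (by positivity)
    nlinarith
  rw [Real.exp_neg] at h7
  have h8 := mul_le_mul_of_nonneg_left h7 (Real.exp_pos 12).le
  rw [← mul_assoc, mul_inv_cancel₀ (Real.exp_pos 12).ne', one_mul] at h8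
  linarith

/-- pointwise smallness away from the concentration point -/
lemma u_far (h : Lc Ω d p u x0 σ xp M ε) {T F : ℝ} (hT : 0 ≤ T) (hpδ : 2 * p ≤ Real.exp (p / 8))
    (hF : p * (∫ x in (ball xp (Real.exp (-(p / 8))))ᶜ, hp' p u x) ≤ F)
    {x : ℂ} (hx : 1 / p ≤ ‖x - xp‖) :
    u x ≤ Real.log (2 * d * p) * (100 / p) + (Real.log d + T) * F + 7 * (M ^ p * Real.exp (-(p * T)) ^ 2) := by
  have hp := h.sl.hp
  have hp0 := h.p0
  have hd1 := h.sl.d1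
  have hM := h.M0
  set δ := Real.exp (-(p / 8)) with hδ
  have hδ0 : 0 < δ := Real.exp_pos _
  have hδp : δ ≤ 1 / (2 * p) := by
    rw [hδ, Real.exp_neg, ← one_div]; exact one_div_le_one_div_of_le (by linarith) hpδ
  set η := Real.exp (-(p * T)) with hη
  have hη0 : 0 < η := Real.exp_pos _
  have hld : 0 ≤ Real.log d := Real.log_nonneg hd1
  have hl2 : 0 ≤ Real.log (2 * d * p) := Real.log_nonneg (by nlinarith)
  have hFint0 : 0 ≤ ∫ x in (ball xp δ)ᶜ, hp' p u x := setIntegral_nonneg measurableSet_ball.compl (fun x _ => Sl.hp0 p u x)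
  have hF0 : 0 ≤ F := le_trans (by positivity) hF
  by_cases hxΩ : x ∈ Ω
  swap
  · rw [h.sl.u0 x hxΩ]; positivity
  have hg := h.sl.green hxΩ
  have hux : u x ≤ fp u x := le_max_left _ _
  let G : ℂ → ℝ := fun y => hp' p u y * Real.log (2 * d * p) + ((ball xp δ)ᶜ).indicator (hp' p u) y * (Real.log d + p * T) + M ^ p * η * kerT η (x - y)
  have iF : Integrable (((ball xp δ)ᶜ).indicator (hp' p u)) := h.sl.hpi.indicator measurableSet_ball.compl
  have i1 : Integrable (fun y => hp' p u y * Real.log (2 * d * p)) := h.sl.hpi.mul_const _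
  have i2 : Integrable (fun y => ((ball xp δ)ᶜ).indicator (hp' p u) y * (Real.log d + p * T)) := iF.mul_const _
  have i3 : Integrable (fun y => M ^ p * η * kerT η (x - y)) := ((kerT_integrable η).comp_sub_left x).const_mul _
  have i12 : Integrable (fun y => hp' p u y * Real.log (2 * d * p) + ((ball xp δ)ᶜ).indicator (hp' p u) y * (Real.log d + p * T)) := i1.add i2
  have hle : ∫ y, hp' p u y * (Real.log d - Real.log ‖x - y‖) ≤ ∫ y, G y := by
    refine integral_mono_of_nonneg (Eventually.of_forall fun y => ?_) (i12.add i3) (Eventually.of_forall fun y => ?_)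
    · by_cases hy : y ∈ Ω
      · exact mul_nonneg (Sl.hp0 p u y) (sub_nonneg.2 (h.sl.Lnn hxΩ hy))
      · simp [h.sl.hp_out hy]
    · simp only [G]
      have hk0 := kerT_nonneg η (x - y)
      have hh0 := Sl.hp0 p u y
      have hhM : hp' p u y ≤ M ^ p := Real.rpow_le_rpow (Sl.fp0 u y) (h.fpM y) hp0.le
      by_cases hy : y ∈ ball xp δ
      · have hn : y ∉ (ball xp δ)ᶜ := fun hc => hc hy
        rw [Set.indicator_of_notMem hn]
        have hs : 1 / (2 * p) ≤ ‖x - y‖ := by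
          rw [mem_ball] at hy
          have := dist_triangle x y xp
          rw [← dist_eq_norm] at hx ⊢
          have h2 : 1 / p = 1 / (2 * p) + 1 / (2 * p) := by field_simp; norm_num
          linarith
        have h3 : Real.log (1 / (2 * p)) ≤ Real.log ‖x - y‖ := Real.log_le_log (by positivity) hs
        rw [one_div, Real.log_inv] at h3
        have h4 : Real.log (2 * d * p) = Real.log d + Real.log (2 * p) := by
          rw [← Real.log_mul (by linarith) (by linarith)]; congr 1; ring
        have h5 : hp' p u y * (Real.log d - Real.log ‖x - y‖) ≤ hp' p u y * Real.log (2 * d * p) :=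
          mul_le_mul_of_nonneg_left (by linarith) hh0
        have : 0 ≤ M ^ p * η * kerT η (x - y) := by positivity
        linarith
      · rw [Set.indicator_of_mem (show y ∈ (ball xp δ)ᶜ from hy)]
        have h5 : -Real.log ‖x - y‖ ≤ p * T + η * kerT η (x - y) := by
          rw [kerT_eq]
          by_cases hlt : ‖x - y‖ < η
          · rw [Set.indicator_of_mem (show ‖x - y‖ ∈ Set.Iio η from hlt)]
            rcases eq_or_lt_of_le (norm_nonneg (x - y)) with h0 | h0
            · rw [← h0]; simp; positivity
            · have h6 := Real.log_le_sub_one_of_pos (show 0 < η / ‖x - y‖ by positivity)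
              rw [Real.log_div hη0.ne' h0.ne', hη, Real.log_exp, ← hη, div_eq_mul_inv] at h6
              linarith
          · rw [Set.indicator_of_notMem (show ‖x - y‖ ∉ Set.Iio η from hlt)]
            push Not at hlt
            have := Real.log_le_log hη0 hlt
            rw [hη, Real.log_exp] at this
            linarith
        have h6 : hp' p u y * (Real.log d - Real.log ‖x - y‖) ≤ hp' p u y * (Real.log d + p * T + η * kerT η (x - y)) :=
          mul_le_mul_of_nonneg_left (by linarith) hh0
        have h7 : hp' p u y * (η * kerT η (x - y)) ≤ M ^ p * (η * kerT η (x - y)) := mul_le_mul_of_nonneg_right hhM (by positivity)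
        have h8 : 0 ≤ hp' p u y * Real.log (2 * d * p) := by positivity
        linarith
  have hG : ∫ y, G y = (∫ y, hp' p u y) * Real.log (2 * d * p) + (∫ y in (ball xp δ)ᶜ, hp' p u y) * (Real.log d + p * T) + M ^ p * η * (2 * π * η) := by
    simp only [G]
    rw [integral_add i12 i3, integral_add i1 i2, integral_mul_const, integral_mul_const, integral_const_mul, integral_indicator measurableSet_ball.compl,
      integral_sub_left_eq_self (kerT η) volume x, kerT_integral hη0.le]
  rw [hG] at hle
  have hA : ∫ y, hp' p u y ≤ 100 / p := by rw [le_div_iff₀ hp0, mul_comm]; exact h.A1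
  have b1 : (∫ y, hp' p u y) * Real.log (2 * d * p) ≤ 100 / p * Real.log (2 * d * p) := mul_le_mul_of_nonneg_right hA hl2
  set I := ∫ y in (ball xp δ)ᶜ, hp' p u y
  have b2 : I * (Real.log d + p * T) ≤ (Real.log d + T) * F := by
    have : I * (Real.log d + p * T) ≤ (p * I) * (Real.log d + T) := by
      have : I * Real.log d ≤ p * I * Real.log d := by
        refine mul_le_mul_of_nonneg_right ?_ hld
        nlinarith
      linarith
    refine this.trans ?_
    rw [mul_comm]
    exact mul_le_mul_of_nonneg_left hF (by positivity)
  have b3 : M ^ p * η * (2 * π * η) ≤ 7 * (M ^ p * η ^ 2) := by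
    have h1 : M ^ p * η * (2 * π * η) = 2 * π * (M ^ p * η ^ 2) := by ring
    rw [h1]
    have : 2 * π ≤ 7 := by linarith [Real.pi_lt_d2]
    gcongr
  have hf0 := Sl.fp0 u x
  have : fp u x ≤ 2 * π * fp u x := by nlinarith [Real.pi_gt_three]
  linarith

end Lc

end

noncomputable section

namespace Lc
variable {Ω : Set ℂ} {d p : ℝ} {u : ℂ → ℝ} {x0 : ℂ} {σ : ℝ} {xp : ℂ} {M ε : ℝ} {χ : ℂ → ℝ} {r t : ℝ}

lemma dist_eq (h : Lc Ω d p u x0 σ xp M ε) (w : ℂ) : ‖xp + ε * w - xp‖ = ε * ‖w‖ := by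
  rw [add_sub_cancel_left, norm_mul, Complex.norm_real, Real.norm_of_nonneg h.ε0.le]

lemma mem_of (h : Lc Ω d p u x0 σ xp M ε) {w : ℂ} {b : ℝ} (hw : ε * ‖w‖ < b) : xp + ε * w ∈ ball x0 (b + σ / 10) := by
  have h1 := h.hxp
  rw [mem_ball] at h1 ⊢
  have h2 := dist_triangle (xp + ε * w) xp x0
  have h3 : dist (xp + ε * w) xp = ε * ‖w‖ := by rw [dist_eq_norm, h.dist_eq]
  linarith

lemma one_v (h : Lc Ω d p u x0 σ xp M ε) (w : ℂ) : 1 + vv p u xp M ε w / p = u (xp + ε * w) / M := by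
  have := h.p0
  have := h.M0
  unfold vv; field_simp; ring

/-- algebraic decay from exponential smallness -/
lemma dec (h : Lc Ω d p u x0 σ xp M ε) {κ L : ℝ} (hκ : 0 ≤ κ) (hκM : κ * M ^ 2 ≤ 1 / 2) (hL0 : 0 ≤ L) (hε1 : ε ≤ 1)
    (hL : L * ((1 + 3 * σ) ^ 6 * p ^ 3 * (1 / 2) ^ (p - 1)) ≤ 1) {y : ℂ} (hy : ε * ‖y‖ ≤ 3 * σ) :
    L * (κ / M) ^ (p - 1) ≤ (1 + ‖y‖) ^ (-(6:ℝ)) := by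
  have hM := h.M0
  have hp := h.sl.hp
  have he := h.ε0
  have hσ := h.σ0
  have hw : 1 + ‖y‖ ≤ (1 + 3 * σ) / ε := by
    rw [le_div_iff₀ he]; nlinarith
  have hw0 := w_pos y
  rw [Real.rpow_neg hw0.le, ← one_div, le_div_iff₀ (by positivity)]
  have h6 : (1 + ‖y‖) ^ (6:ℝ) ≤ (1 + 3 * σ) ^ 6 * (p ^ 3 * (M ^ (p - 1)) ^ 3) := by
    have h1 : (1 + ‖y‖) ^ (6:ℝ) ≤ ((1 + 3 * σ) / ε) ^ 6 := by
      rw [show (6:ℝ) = ((6:ℕ):ℝ) by norm_num, Real.rpow_natCast]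
      gcongr
    have h2 : (1 / ε) ^ 2 = p * M ^ (p - 1) := by
      have := h.εd
      field_simp; linarith
    calc _ ≤ _ := h1
      _ = (1 + 3 * σ) ^ 6 * ((1 / ε) ^ 2) ^ 3 := by ring
      _ = _ := by rw [h2]; ring
  have h3 : (κ / M) ^ (p - 1) * (M ^ (p - 1)) ^ 3 ≤ (1 / 2) ^ (p - 1) := by
    have h4 : (κ / M) ^ (p - 1) * (M ^ (p - 1)) ^ 3 = (κ * M ^ 2) ^ (p - 1) := by
      rw [show (M ^ (p - 1)) ^ 3 = (M ^ 3) ^ (p - 1) by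
        rw [← Real.rpow_natCast, ← Real.rpow_natCast, ← Real.rpow_mul hM.le, ← Real.rpow_mul hM.le, mul_comm], ← Real.mul_rpow (by positivity) (by positivity)]
      congr 1; field_simp
    rw [h4]
    exact Real.rpow_le_rpow (by positivity) hκM (by linarith)
  have hk0 : 0 ≤ (κ / M) ^ (p - 1) := by positivity
  calc L * (κ / M) ^ (p - 1) * (1 + ‖y‖) ^ (6:ℝ) ≤ L * (κ / M) ^ (p - 1) * ((1 + 3 * σ) ^ 6 * (p ^ 3 * (M ^ (p - 1)) ^ 3)) := by gcongr
    _ = L * ((1 + 3 * σ) ^ 6 * p ^ 3 * ((κ / M) ^ (p - 1) * (M ^ (p - 1)) ^ 3)) := by ring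
    _ ≤ L * ((1 + 3 * σ) ^ 6 * p ^ 3 * (1 / 2) ^ (p - 1)) := by gcongr
    _ ≤ 1 := hL

lemma pk (h : Lc Ω d p u x0 σ xp M ε) (hc : Cut x0 σ (1.3 * σ) χ) (hvz : ∀ w, xp + ε * w ∈ ball x0 (1.4 * σ) → ‖vvz p u xp M ε w‖ ≤ 3)
    (hps : 1 / p ≤ σ / 10) (hR : p ^ 10 ≤ 1 / (p * ε)) {B : ℝ} (hB : 1 ≤ B) (hKB : Cut.K χ (σ - 0.9 * σ) / π ≤ B)
    {κ L : ℝ} (hκ : 0 ≤ κ) (hκM : κ * M ^ 2 ≤ 1 / 2) (hu : ∀ x, 1 / p ≤ ‖x - xp‖ → u x ≤ κ) (hL0 : 0 ≤ L) (hε1 : ε ≤ 1)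
    (hLχ : ∀ x, ‖dz (fun y => (χ y : ℂ)) x‖ ≤ L) (hL : (L + 3) * ((1 + 3 * σ) ^ 6 * p ^ 3 * (1 / 2) ^ (p - 1)) ≤ 1) :
    Pk B p (1 / (p * ε)) (vv p u xp M ε) (vvz p u xp M ε) (hhh p u xp M ε χ) (rr p u xp M ε χ) ∧
    ∀ y, 1 / (p * ε) ≤ ‖y‖ → rr p u xp M ε χ y ≤ (1 + ‖y‖) ^ (-(6:ℝ)) := by
  have hM := h.M0
  have hp := h.sl.hp
  have hp0 := h.p0
  have he := h.ε0
  have hσ := h.σ0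
  have hM1 := h.M1
  have hpe : 0 < p * ε := by positivity
  have ht : 1.3 * σ < 2 * σ := by linarith
  have hin : ∀ w ∈ ball (0:ℂ) (1 / (p * ε)), xp + ε * w ∈ ball x0 (σ / 5) := by
    intro w hw
    rw [mem_ball_zero_iff] at hw
    have h1 : ε * ‖w‖ < 1 / p := by
      calc ε * ‖w‖ < ε * (1 / (p * ε)) := by gcongr
        _ = 1 / p := by field_simp
    have := h.mem_of h1
    exact ball_subset_ball (by linarith) this
  have hb2 : ball x0 (σ / 5) ⊆ ball x0 (2 * σ) := ball_subset_ball (by linarith)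
  have hbΩ : ball x0 (σ / 5) ⊆ Ω := hb2.trans h.hb
  -- far facts
  have hfar : ∀ y : ℂ, 1 / (p * ε) ≤ ‖y‖ → u (xp + ε * y) ≤ κ := by
    intro y hy
    apply hu
    rw [h.dist_eq]
    rw [div_le_iff₀ hpe] at hy
    rw [div_le_iff₀ hp0]; linarith
  have hκM1 : κ / M ≤ 1 := by
    rw [div_le_one hM]; nlinarith
  have hfpf : ∀ y : ℂ, 1 / (p * ε) ≤ ‖y‖ → fp u (xp + ε * y) / M ≤ κ / M := fun y hy => by
    have : fp u (xp + ε * y) ≤ κ := max_le (hfar y hy) hκ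
    gcongr
  have hpow : (κ / M) ^ p ≤ (κ / M) ^ (p - 1) := by
    rcases eq_or_lt_of_le (show 0 ≤ κ / M by positivity) with h0 | h0
    · rw [← h0, Real.zero_rpow (by linarith), Real.zero_rpow (by linarith)]
    · exact Real.rpow_le_rpow_of_exponent_ge h0 hκM1 (by linarith)
  have hk0 : 0 ≤ (κ / M) ^ (p - 1) := by positivity
  have hclose : ∀ y : ℂ, xp + ε * y ∈ closedBall x0 (1.3 * σ) → ε * ‖y‖ ≤ 3 * σ := by
    intro y hy
    by_contra hcon
    push Not at hcon
    exact h.rr_supp ht (w := y) (by linarith) hy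
  have hρ6 : ∀ y, 1 / (p * ε) ≤ ‖y‖ → rr p u xp M ε χ y ≤ (1 + ‖y‖) ^ (-(6:ℝ)) := by
    intro y hy
    by_cases hcl : xp + ε * y ∈ closedBall x0 (1.3 * σ)
    · have h1 := h.dec hκ hκM (by positivity) hε1 hL (hclose y hcl)
      have h2 : rr p u xp M ε χ y ≤ (κ / M) ^ p := by
        unfold rr
        have h3 : (fp u (xp + ε * y) / M) ^ p ≤ (κ / M) ^ p := Real.rpow_le_rpow (div_nonneg (Sl.fp0 u _) hM.le) (hfpf y hy) hp0.le
        exact (mul_le_of_le_one_left (Real.rpow_nonneg (div_nonneg (Sl.fp0 u _) hM.le) _) (hc.n1 _)).trans h3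
      have : (κ / M) ^ (p - 1) ≤ (L + 3) * (κ / M) ^ (p - 1) := le_mul_of_one_le_left hk0 (by linarith)
      linarith
    · unfold rr
      rw [hc.zero _ (fun hh => hcl (ball_subset_closedBall hh)), zero_mul]
      have := w_pos y
      positivity
  have hz6 : ∀ y, 1 / (p * ε) ≤ ‖y‖ → ‖dz (fun y => (rr p u xp M ε χ y : ℂ)) y‖ ≤ (1 + ‖y‖) ^ (-(6:ℝ)) := by
    intro y hy
    have hw0 := w_pos y
    by_cases hcl : xp + ε * y ∈ closedBall x0 (1.3 * σ)
    · have hb : xp + ε * y ∈ ball x0 (2 * σ) := closedBall_subset_ball ht hcl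
      have hupos := h.pos _ hb
      have h1 := h.dec hκ hκM (by positivity) hε1 hL (hclose y hcl)
      have hl : HasFDerivAt (fun w : ℂ => xp + ε * w) ((ε:ℂ) • ContinuousLinearMap.id ℝ ℂ) y :=
        ((hasFDerivAt_id (𝕜 := ℝ) y).const_mul (ε:ℂ)).const_add xp
      have hχ : HasFDerivAt (fun y => (χ y : ℂ)) (wL (dz (fun y => (χ y : ℂ)) (xp + ε * y)) (db (fun y => (χ y : ℂ)) (xp + ε * y))) (xp + ε * y) :=
        hasW_of_differentiableAt (hc.cC.contDiffAt.differentiableAt (by norm_num))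
      have e1 : HasW (fun w => (χ (xp + ε * w) : ℂ)) (ε * dz (fun y => (χ y : ℂ)) (xp + ε * y)) (ε * db (fun y => (χ y : ℂ)) (xp + ε * y)) y := by
        refine HasW.mk' (hχ.comp y hl) fun e => ?_
        simp; ring
      have hq : 0 < 1 + vv p u xp M ε y / p := by rw [h.one_v]; positivity
      have hφ : HasDerivAt (fun s : ℝ => (1 + s / p) ^ p) ((1 + vv p u xp M ε y / p) ^ (p - 1)) (vv p u xp M ε y) := by
        have h2 : HasDerivAt (fun s : ℝ => 1 + s / p) (1 / p) (vv p u xp M ε y) := ((hasDerivAt_id _).div_const p).const_add 1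
        refine (h2.rpow_const (p := p) (Or.inl hq.ne')).congr_deriv ?_
        field_simp
      have e2 := (h.vR (h.hb hb)).comp hφ
      have e3 := e1.mul e2
      have e4 : HasW (fun y => (rr p u xp M ε χ y : ℂ)) _ _ y := e3.congr_ev (by
        have hcont : ContinuousAt (fun w : ℂ => xp + ε * w) y := by fun_prop
        filter_upwards [hcont.eventually (isOpen_ball.mem_nhds hb)] with w hw
        unfold rr
        rw [h.one_v, h.fpeq hw]; push_cast; rfl)
      rw [e4.dz_eq]
      have hq1 : 1 + vv p u xp M ε y / p ≤ κ / M := by rw [h.one_v, ← h.fpeq hb]; exact hfpf y hy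
      have hqp : (1 + vv p u xp M ε y / p) ^ p ≤ (κ / M) ^ (p - 1) := (Real.rpow_le_rpow hq.le hq1 hp0.le).trans hpow
      have hqp1 : (1 + vv p u xp M ε y / p) ^ (p - 1) ≤ (κ / M) ^ (p - 1) := Real.rpow_le_rpow hq.le hq1 (by linarith)
      have hv3 : ‖vvz p u xp M ε y‖ ≤ 3 := hvz y (closedBall_subset_ball (by linarith) hcl)
      have n1 : ‖(ε * dz (fun y => (χ y : ℂ)) (xp + ε * y)) * (((1 + vv p u xp M ε y / p) ^ p : ℝ) : ℂ)‖ ≤ L * (κ / M) ^ (p - 1) := by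
        rw [norm_mul, norm_mul, Complex.norm_real, Complex.norm_real, Real.norm_of_nonneg he.le, Real.norm_of_nonneg (by positivity)]
        have : ε * ‖dz (fun y => (χ y : ℂ)) (xp + ε * y)‖ ≤ L := (mul_le_of_le_one_left (norm_nonneg _) hε1).trans (hLχ _)
        exact mul_le_mul this hqp (by positivity) hL0
      have n2 : ‖(χ (xp + ε * y) : ℂ) * ((((1 + vv p u xp M ε y / p) ^ (p - 1) : ℝ) : ℂ) * vvz p u xp M ε y)‖ ≤ 3 * (κ / M) ^ (p - 1) := by
        rw [norm_mul, norm_mul, Complex.norm_real, Complex.norm_real, Real.norm_of_nonneg (hc.n0 _), Real.norm_of_nonneg (by positivity)]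
        refine (mul_le_of_le_one_left (by positivity) (hc.n1 _)).trans ?_
        rw [mul_comm]
        exact mul_le_mul hv3 hqp1 (by positivity) (by norm_num)
      refine (norm_add_le _ _).trans ?_
      linarith
    · have : HasW (fun y => (rr p u xp M ε χ y : ℂ)) 0 0 y := (hasW_const 0 y).congr_ev (by
        have hcont : ContinuousAt (fun w : ℂ => xp + ε * w) y := by fun_prop
        filter_upwards [hcont.eventually (isClosed_closedBall.isOpen_compl.mem_nhds hcl)] with w hw
        unfold rr
        rw [hc.zero _ (fun hh => hw (ball_subset_closedBall hh))]; simp)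
      rw [this.dz_eq, norm_zero]; positivity
  refine ⟨⟨hB, hp, hR, fun w hw => h.vR (hbΩ (hin w hw)), ?_, h.v00, ?_, ?_, ?_, ?_, ?_, h.rrC hc ht, h.rrcs hc ht, h.rr0 hc, h.rr1 hc, ?_, ?_, ?_, h.mass hc ht⟩, hρ6⟩
  · intro w hw
    unfold vvz
    refine ContDiffAt.contDiffWithinAt ?_
    refine contDiffAt_const.mul ?_
    exact ContDiffAt.comp (f := fun w : ℂ => xp + ε * w) w (h.sl.uzC (hbΩ (hin w hw))) (by fun_prop)
  · intro w _
    unfold vv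
    exact mul_nonpos_of_nonneg_of_nonpos (by positivity) (by linarith [h.leM (xp + ε * w)])
  · intro w hw
    rw [h.one_v]
    exact div_pos (h.pos _ (hb2 (hin w hw))) hM
  · intro w _
    unfold hhh; ring
  · intro w hw
    exact (h.hh_hol hc ht (ball_subset_ball (by linarith) (hin w hw))).differentiableWithinAt
  · intro w hw
    have h1 := h.hh_le hc ht (s := 0.9 * σ) (by linarith) (ball_subset_ball (by linarith) (hin w hw))
    refine h1.trans ?_
    rw [div_div_eq_mul_div, div_one, mul_comm]
    gcongr
  · intro w hw
    unfold rr
    rw [hc.one _ (ball_subset_ball (by linarith) (hin w hw)), h.one_v, h.fpeq (hb2 (hin w hw)), one_mul]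
  · intro y hy
    exact (hρ6 y hy).trans (Real.rpow_le_rpow_of_exponent_le (w_one y) (by norm_num))
  · intro y hy
    exact (hz6 y hy).trans (Real.rpow_le_rpow_of_exponent_le (w_one y) (by norm_num))

end Lc

end

noncomputable section

def WW : ℝ := ∫ y : ℂ, (1 + ‖y‖) ^ (-(3:ℝ))

lemma WW0 : 0 ≤ WW := integral_nonneg fun y => (Real.rpow_pos_of_pos (w_pos y) _).le

lemma tail_int {f : ℂ → ℝ} {R S : ℝ} (hR : 0 < R) (hRS : R ≤ S) (hf : Integrable f)
    (h : ∀ y, R ≤ ‖y‖ → |f y| ≤ (1 + ‖y‖) ^ (-(5:ℝ))) : |(∫ y in ball (0:ℂ) S, f y) - ∫ y, f y| ≤ WW / R := by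
  have h1 := integral_add_compl (measurableSet_ball (x := (0:ℂ)) (ε := S)) hf
  rw [← h1, sub_add_cancel_left, abs_neg]
  have hi : Integrable (fun y : ℂ => (1 + ‖y‖) ^ (-(3:ℝ)) / R) := (int_w 3 (by norm_num)).div_const R
  calc |∫ y in (ball (0:ℂ) S)ᶜ, f y| ≤ ∫ y in (ball (0:ℂ) S)ᶜ, |f y| := abs_integral_le_integral_abs
    _ ≤ ∫ y in (ball (0:ℂ) S)ᶜ, (1 + ‖y‖) ^ (-(3:ℝ)) / R := by
      refine setIntegral_mono_on hf.abs.integrableOn hi.integrableOn measurableSet_ball.compl fun y hy => ?_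
      have hy' : R ≤ ‖y‖ := by
        simp only [Set.mem_compl_iff, mem_ball_zero_iff, not_lt] at hy; linarith
      refine (h y hy').trans ?_
      have hw := w_one y
      have hw0 := w_pos y
      rw [show (-(5:ℝ)) = -3 + -2 by norm_num, Real.rpow_add hw0, div_eq_mul_inv]
      gcongr
      calc (1 + ‖y‖) ^ (-2:ℝ) ≤ (1 + ‖y‖) ^ (-1:ℝ) := Real.rpow_le_rpow_of_exponent_le hw (by norm_num)
        _ = (1 + ‖y‖)⁻¹ := Real.rpow_neg_one _
        _ ≤ R⁻¹ := by gcongr; linarith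
    _ ≤ ∫ y : ℂ, (1 + ‖y‖) ^ (-(3:ℝ)) / R := setIntegral_le_integral hi (Eventually.of_forall fun y => by
        have := w_pos y; positivity)
    _ = WW / R := by rw [integral_div]; rfl

namespace Lc
variable {Ω : Set ℂ} {d p : ℝ} {u : ℂ → ℝ} {x0 : ℂ} {σ : ℝ} {xp : ℂ} {M ε : ℝ} {χ : ℂ → ℝ} {r t : ℝ}

lemma three (h : Lc Ω d p u x0 σ xp M ε) (hc : Cut x0 σ (1.3 * σ) χ) (hR : p ^ 10 ≤ 1 / (p * ε))
    (h6 : ∀ y, 1 / (p * ε) ≤ ‖y‖ → rr p u xp M ε χ y ≤ (1 + ‖y‖) ^ (-(6:ℝ))) {C a b c : ℝ}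
    (h1 : |(∫ y, rr p u xp M ε χ y) - a| ≤ C / p ^ 2) (h2 : |(∫ y, Real.log ‖y‖ * rr p u xp M ε χ y) - b| ≤ C / p)
    (h3 : |(∫ y, rr p u xp M ε χ y ^ (1 + 1 / p)) - c| ≤ C / p ^ 2) (hi : Integrable (fun y => Real.log ‖y‖ * rr p u xp M ε χ y))
    {ϱ : ℝ} (hϱ : ϱ ≤ σ / 2) (hpϱ : 1 / p ≤ ϱ) :
    |(∫ z in ball (0:ℂ) (ϱ / ε), |1 + vv p u xp M ε z / p| ^ p) - a| ≤ (C + WW) / p ^ 2 ∧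
    |(∫ z in ball (0:ℂ) (ϱ / ε), Real.log ‖z‖ * |1 + vv p u xp M ε z / p| ^ p) - b| ≤ (C + WW) / p ∧
    |(∫ z in ball (0:ℂ) (ϱ / ε), |1 + vv p u xp M ε z / p| ^ (p + 1)) - c| ≤ (C + WW) / p ^ 2 := by
  have hM := h.M0
  have hp := h.sl.hp
  have hp0 := h.p0
  have he := h.ε0
  have hσ := h.σ0
  have ht : 1.3 * σ < 2 * σ := by linarith
  have hR0 : 0 < 1 / (p * ε) := by positivity
  have hRS : 1 / (p * ε) ≤ ϱ / ε := by rw [← div_div]; gcongr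
  have hp10 : (1:ℝ) ≤ p ^ 10 := one_le_pow₀ (by linarith)
  have hq : ∀ z ∈ ball (0:ℂ) (ϱ / ε), 0 < u (xp + ε * z) / M ∧ rr p u xp M ε χ z = (u (xp + ε * z) / M) ^ p := by
    intro z hz
    rw [mem_ball_zero_iff, lt_div_iff₀ he] at hz
    have hm := h.mem_of (w := z) (b := σ / 2) (by linarith)
    have hm2 : xp + ε * z ∈ ball x0 (2 * σ) := ball_subset_ball (by linarith) hm
    refine ⟨div_pos (h.pos _ hm2) hM, ?_⟩
    unfold rr
    rw [hc.one _ (ball_subset_ball (by linarith) hm), h.fpeq hm2, one_mul]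
  have e1 : (∫ z in ball (0:ℂ) (ϱ / ε), |1 + vv p u xp M ε z / p| ^ p) = ∫ z in ball (0:ℂ) (ϱ / ε), rr p u xp M ε χ z :=
    setIntegral_congr_fun measurableSet_ball fun z hz => by
      rw [h.one_v, (hq z hz).2, abs_of_pos (hq z hz).1]
  have e2 : (∫ z in ball (0:ℂ) (ϱ / ε), Real.log ‖z‖ * |1 + vv p u xp M ε z / p| ^ p) = ∫ z in ball (0:ℂ) (ϱ / ε), Real.log ‖z‖ * rr p u xp M ε χ z :=
    setIntegral_congr_fun measurableSet_ball fun z hz => by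
      rw [h.one_v, (hq z hz).2, abs_of_pos (hq z hz).1]
  have e3 : (∫ z in ball (0:ℂ) (ϱ / ε), |1 + vv p u xp M ε z / p| ^ (p + 1)) = ∫ z in ball (0:ℂ) (ϱ / ε), rr p u xp M ε χ z ^ (1 + 1 / p) :=
    setIntegral_congr_fun measurableSet_ball fun z hz => by
      rw [h.one_v, (hq z hz).2, abs_of_pos (hq z hz).1, ← Real.rpow_mul (hq z hz).1.le]
      congr 1; field_simp
  have r0 := h.rr0 hc
  have r1 := h.rr1 hc
  have hcont := (h.rrC hc ht).continuous
  have h65 : ∀ y : ℂ, (1 + ‖y‖) ^ (-(6:ℝ)) ≤ (1 + ‖y‖) ^ (-(5:ℝ)) := fun y =>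
    Real.rpow_le_rpow_of_exponent_le (w_one y) (by norm_num)
  have t1 := tail_int hR0 hRS (f := rr p u xp M ε χ) (hcont.integrable_of_hasCompactSupport (h.rrcs hc ht)) fun y hy => by
    rw [abs_of_nonneg (r0 y)]
    exact (h6 y hy).trans (h65 y)
  have t2 := tail_int hR0 hRS hi fun y hy => by
    have hy1 : 1 ≤ ‖y‖ := by linarith
    have hl0 : 0 ≤ Real.log ‖y‖ := Real.log_nonneg hy1
    rw [abs_of_nonneg (mul_nonneg hl0 (r0 y))]
    have hw := w_pos y
    calc Real.log ‖y‖ * rr p u xp M ε χ y ≤ (1 + ‖y‖) * (1 + ‖y‖) ^ (-(6:ℝ)) := by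
          refine mul_le_mul ?_ (h6 y hy) (r0 y) hw.le
          have := Real.log_le_sub_one_of_pos (x := ‖y‖) (by linarith)
          linarith
      _ = _ := by
          nth_rw 1 [← Real.rpow_one (1 + ‖y‖)]
          rw [← Real.rpow_add hw]; norm_num
  have t3 := tail_int hR0 hRS (f := fun y => rr p u xp M ε χ y ^ (1 + 1 / p))
    ((hcont.rpow_const fun y => Or.inr (by positivity)).integrable_of_hasCompactSupport ((h.rrcs hc ht).comp_left (g := fun s : ℝ => s ^ (1 + 1 / p)) (Real.zero_rpow (by positivity)))) fun y hy => by
    rw [abs_of_nonneg (Real.rpow_nonneg (r0 y) _)]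
    refine le_trans ?_ ((h6 y hy).trans (h65 y))
    have := Real.rpow_le_rpow_of_exponent_ge' (r0 y) (r1 y) zero_le_one (show 1 ≤ 1 + 1 / p by linarith [show 0 < 1 / p by positivity])
    rwa [Real.rpow_one] at this
  have hW := WW0
  have w2 : WW / (1 / (p * ε)) ≤ WW / p ^ 2 := by
    gcongr
    exact le_trans (pow_le_pow_right₀ (by linarith) (by norm_num)) hR
  have w1 : WW / (1 / (p * ε)) ≤ WW / p := by
    gcongr
    exact le_trans (le_self_pow₀ (by linarith) (by norm_num)) hR
  rw [e1, e2, e3, add_div, add_div]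
  refine ⟨?_, ?_, ?_⟩
  · exact (abs_sub_le _ _ _).trans ((add_le_add (t1.trans w2) h1).trans (add_comm _ _).le)
  · exact (abs_sub_le _ _ _).trans ((add_le_add (t2.trans w1) h2).trans (add_comm _ _).le)
  · exact (abs_sub_le _ _ _).trans ((add_le_add (t3.trans w2) h3).trans (add_comm _ _).le)

lemma eps_exp (h : Lc Ω d p u x0 σ xp M ε) : ε ≤ Real.exp (-((p - 1) / 5)) := by
  have hM := h.M0
  have hp := h.sl.hp
  have he := h.ε0
  have h1 : Real.exp (2 / 5) ≤ M := by
    refine le_trans ?_ h.M1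
    have := Real.exp_bound' (x := 2 / 5) (by norm_num) (by norm_num) (n := 4) (by norm_num)
    norm_num [Finset.sum_range_succ, Nat.factorial] at this
    linarith
  have h2 : Real.exp ((p - 1) * (2 / 5)) ≤ p * M ^ (p - 1) := by
    rw [mul_comm, Real.exp_mul]
    have : Real.exp (2 / 5) ^ (p - 1) ≤ M ^ (p - 1) := Real.rpow_le_rpow (Real.exp_pos _).le h1 (by linarith)
    have h3 : 0 ≤ M ^ (p - 1) := by positivity
    nlinarith
  have h4 := h.εd
  have h5 : ε ^ 2 * Real.exp ((p - 1) * (2 / 5)) ≤ 1 := by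
    exact le_trans (by gcongr) h4.le
  have h6 : ε ^ 2 ≤ Real.exp (-((p - 1) / 5)) ^ 2 := by
    rw [← Real.exp_nat_mul, show ((2:ℕ):ℝ) * (-((p - 1) / 5)) = -((p - 1) * (2 / 5)) by push_cast; ring, Real.exp_neg, ← one_div, le_div_iff₀ (Real.exp_pos _)]
    exact h5
  exact (pow_le_pow_iff_left₀ he.le (Real.exp_pos _).le (by norm_num)).1 h6

end Lc

lemma lim_pe (m : ℕ) {b : ℝ} (hb : 0 < b) : Tendsto (fun p : ℝ => p ^ m * Real.exp (-(p * b))) atTop (𝓝 0) := by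
  have h1 := (Real.tendsto_pow_mul_exp_neg_atTop_nhds_zero m).comp (tendsto_id.atTop_mul_const hb : Tendsto (fun p : ℝ => p * b) atTop atTop)
  have h2 := h1.const_mul ((b ^ m)⁻¹)
  rw [mul_zero] at h2
  refine h2.congr fun p => ?_
  simp only [Function.comp]
  rw [mul_pow]
  field_simp

lemma lim_log_div (c : ℝ) : Tendsto (fun p : ℝ => (c + Real.log p) * (100 / p)) atTop (𝓝 0) := by
  have h1 : Tendsto (fun p : ℝ => Real.log p / p) atTop (𝓝 0) := by
    have := Real.isLittleO_log_id_atTop.tendsto_div_nhds_zero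
    simpa using this
  have h2 : Tendsto (fun p : ℝ => c * 100 / p) atTop (𝓝 0) := tendsto_const_nhds.div_atTop tendsto_id
  have := h2.add (h1.const_mul 100)
  simp only [mul_zero, add_zero] at this
  refine this.congr fun p => ?_
  ring

lemma Cut.dz_bdd {x0 : ℂ} {r t : ℝ} {χ : ℂ → ℝ} (h : Cut x0 r t χ) : ∃ L : ℝ, 0 ≤ L ∧ ∀ x, ‖dz (fun y => (χ y : ℂ)) x‖ ≤ L := by
  have hc : Continuous (dz (fun y => (χ y : ℂ))) := by
    have := h.cC.continuous_fderiv (by norm_num)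
    unfold dz
    fun_prop
  have hs : HasCompactSupport (dz (fun y => (χ y : ℂ))) := h.cs fun y hy => by
    have : (fun y => (χ y : ℂ)) =ᶠ[𝓝 y] fun _ => 0 := (h.ev_zero hy).mono fun z hz => by simp [hz]
    exact ((hasW_const 0 y).congr_ev this).dz_eq
  obtain ⟨L, hL⟩ := hs.exists_bound_of_continuous hc
  exact ⟨L, (norm_nonneg _).trans (hL 0), hL⟩

/-- conclusion on the complex plane -/
lemma seq_concl {Ω : Set ℂ} {d : ℝ} {p M ε : ℕ → ℝ} {u : ℕ → ℂ → ℝ} {xp : ℕ → ℂ} {x0 : ℂ} {σ ϱ : ℝ} (hd : 1 ≤ d) (hp : Tendsto p atTop atTop)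
    (hS : ∀ᶠ n in atTop, Sl Ω d (p n) (u n)) (hX : ∀ᶠ n in atTop, 0 < ∫ x, fp (u n) x ^ (p n + 1))
    (hE : Tendsto (fun n => p n * ∫ x, fp (u n) x ^ (p n + 1)) atTop (𝓝 (8 * π * Real.exp 1)))
    (hσ : 0 < σ) (hb : ball x0 (2 * σ) ⊆ Ω) (hpos : ∀ᶠ n in atTop, ∀ y ∈ ball x0 (2 * σ), 0 < u n y)
    (hxp : Tendsto xp atTop (𝓝 x0)) (hM : ∀ᶠ n in atTop, u n (xp n) = M n ∧ 0 < M n ∧ ∀ x, u n x ≤ M n)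
    (hε : ∀ᶠ n in atTop, 0 < ε n ∧ ε n ^ 2 * (p n * M n ^ (p n - 1)) = 1) (hϱ0 : 0 < ϱ) (hϱ : ϱ ≤ σ / 2) :
    ∃ C : ℝ, 1 ≤ C ∧ ∀ᶠ n in atTop,
    |(∫ z in ball (0:ℂ) (ϱ / ε n), |1 + vv (p n) (u n) (xp n) (M n) (ε n) z / p n| ^ p n) - (8 * π - 24 * π / p n)| ≤ C / p n ^ 2 ∧
    |(∫ z in ball (0:ℂ) (ϱ / ε n), Real.log ‖z‖ * |1 + vv (p n) (u n) (xp n) (M n) (ε n) z / p n| ^ p n) - 12 * π * Real.log 2| ≤ C / p n ∧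
    |(∫ z in ball (0:ℂ) (ϱ / ε n), |1 + vv (p n) (u n) (xp n) (M n) (ε n) z / p n| ^ (p n + 1)) - (8 * π - 40 * π / p n)| ≤ C / p n ^ 2 := by
  obtain ⟨χ1, hc1⟩ := exists_cut x0 (r := 1.5 * σ) (t := 1.9 * σ) (by linarith) (by linarith)
  obtain ⟨χ2, hc2⟩ := exists_cut x0 (r := σ) (t := 1.3 * σ) (by linarith) (by linarith)
  obtain ⟨L, hL0, hL⟩ := hc2.dz_bdd
  set K1 := Cut.K χ1 (1.5 * σ - 1.4 * σ) / π with hK1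
  set B := max 1 (Cut.K χ2 (σ - 0.9 * σ) / π) with hBd
  have hB : 1 ≤ B := le_max_left _ _
  obtain ⟨C, P0, hC, hP0, hcore⟩ := core B hB
  refine ⟨C + WW, by linarith [WW0], ?_⟩
  have hMM : ∀ᶠ n in atTop, 0 < M n ∧ ∀ x, u n x ≤ M n := hM.mono fun n h => h.2
  have q1 := seqM hd hp hS hE hX hMM
  have q2 := (seqDA hd hp hS hE hX).1
  set A : ℝ := 100 * Real.exp 12 with hA
  have hA1 : 1 < A := by
    have : 1 < Real.exp 12 := Real.one_lt_exp_iff.2 (by norm_num)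
    rw [hA]; linarith
  set T := Real.log A with hT
  have hT0 : 0 < T := Real.log_pos hA1
  set κ : ℝ := 1 / (2 * A ^ 2) with hκ
  have hκ0 : 0 < κ := by positivity
  -- largeness conditions
  have l1 : ∀ (m : ℕ) (c : ℝ), 0 < c → ∀ᶠ n in atTop, p n ^ m * Real.exp (-((p n - 1) / 5)) ≤ c := by
    intro m c hc
    have h1 := ((lim_pe m (b := 1 / 5) (by norm_num)).const_mul (Real.exp (1 / 5))).comp hp
    rw [mul_zero] at h1
    filter_upwards [h1.eventually (ge_mem_nhds hc)] with n hn
    refine le_trans (le_of_eq ?_) hn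
    simp only [Function.comp]
    rw [mul_left_comm, ← Real.exp_add]; ring_nf
  have l2 : ∀ᶠ n in atTop, Real.exp (-((p n - 1) / 5)) ≤ Real.exp (-(p n / 8)) / 2 := by
    filter_upwards [hp.eventually_ge_atTop 100] with n hn
    have h2 : Real.exp (-((p n - 1) / 5)) = Real.exp (-(p n / 8)) * Real.exp (p n / 8 - (p n - 1) / 5) := by
      rw [← Real.exp_add]; ring_nf
    rw [h2, div_eq_mul_inv]
    refine mul_le_mul_of_nonneg_left ?_ (Real.exp_pos _).le
    have h3 : p n / 8 - (p n - 1) / 5 ≤ -1 := by linarith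
    calc _ ≤ Real.exp (-1) := Real.exp_le_exp.2 h3
      _ ≤ 2⁻¹ := by
        rw [Real.exp_neg]
        gcongr
        linarith [Real.add_one_le_exp 1]
  have l3 : ∀ᶠ n in atTop, 2 * p n ≤ Real.exp (p n / 8) := by
    have h1 := (lim_pe 1 (b := 1 / 8) (by norm_num)).comp hp
    filter_upwards [h1.eventually (ge_mem_nhds (show (0:ℝ) < 1 / 2 by norm_num))] with n hn
    simp only [Function.comp, pow_one] at hn
    rw [Real.exp_neg, ← div_eq_mul_inv, div_le_iff₀ (Real.exp_pos _)] at hn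
    rw [show p n / 8 = p n * (1 / 8) by ring]; linarith
  have l4 : ∀ᶠ n in atTop, (L + 3) * ((1 + 3 * σ) ^ 6 * p n ^ 3 * (1 / 2) ^ (p n - 1)) ≤ 1 := by
    have h1 := ((lim_pe 3 (Real.log_pos one_lt_two)).const_mul ((L + 3) * (1 + 3 * σ) ^ 6 * 2)).comp hp
    rw [mul_zero] at h1
    filter_upwards [h1.eventually (ge_mem_nhds (show (0:ℝ) < 1 by norm_num))] with n hn
    refine le_trans (le_of_eq ?_) hn
    simp only [Function.comp]
    have : ((1:ℝ) / 2) ^ (p n - 1) = 2 * Real.exp (-(p n * Real.log 2)) := by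
      rw [Real.rpow_sub_one (by norm_num), one_div, Real.inv_rpow (by norm_num), Real.rpow_def_of_pos (by norm_num), Real.exp_neg, mul_comm (p n)]
      field_simp
    rw [this]; ring
  have l5 : ∀ᶠ n in atTop, Real.log (2 * d * p n) * (100 / p n) ≤ κ / 3 := by
    have h1 := (lim_log_div (Real.log (2 * d))).comp hp
    filter_upwards [h1.eventually (ge_mem_nhds (show (0:ℝ) < κ / 3 by positivity)), hp.eventually_gt_atTop 0] with n hn hn0
    rw [Real.log_mul (by positivity) hn0.ne']
    exact hn
  have l6 : ∀ᶠ n in atTop, (Real.log d + T) * (25 * Real.exp 12 * (p n ^ 2 * ∫ w, Sl.DD d (p n) (4 * p n / (p n + 1) ^ 2) (u n) w ∂(volume.prod volume))) ≤ κ / 3 := by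
    have h1 := (q2.const_mul (25 * Real.exp 12)).const_mul (Real.log d + T)
    simp only [mul_zero] at h1
    exact h1.eventually (ge_mem_nhds (show (0:ℝ) < κ / 3 by positivity))
  have l7 : ∀ᶠ n in atTop, 7 * Real.exp (-(p n * T)) ≤ κ / 3 := by
    have h1 := ((lim_pe 0 hT0).const_mul 7).comp hp
    rw [mul_zero] at h1
    filter_upwards [h1.eventually (ge_mem_nhds (show (0:ℝ) < κ / 3 by positivity))] with n hn
    simpa using hn
  have l8 := hxp.eventually (ball_mem_nhds x0 (show 0 < σ / 10 by positivity))
  filter_upwards [hS, hX, hpos, hM, hε, q1, l1 11 1 one_pos, l1 0 (σ / 10) (by positivity), l1 1 (1 / 10 / (|K1| + 1)) (by positivity), l2, l3, l4, l5, l6, l7, l8,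
    hp.eventually_ge_atTop P0, hp.eventually_ge_atTop (40 * Real.log (2 * d)), hp.eventually_ge_atTop (10 / σ), hp.eventually_ge_atTop (1 / ϱ), hp.eventually_ge_atTop 1] with n
    aS aX apos aM aε a1 b11 b0 b1 a2 a3 a4 a5 a6 a7 a8 aP ad aσ aϱ ap1
  have hL' : Lc Ω d (p n) (u n) x0 σ (xp n) (M n) (ε n) := ⟨aS, hσ, hb, apos, a8, aM.1, aM.2.2, a1.1, a1.2.2, a1.2.1, aε.1, aε.2⟩
  have he := hL'.eps_exp
  have he0 := aε.1
  have hp0 := hL'.p0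
  have hvz : ∀ w, xp n + ε n * w ∈ ball x0 (1.4 * σ) → ‖vvz (p n) (u n) (xp n) (M n) (ε n) w‖ ≤ 3 := by
    intro w hw
    refine hL'.vz_le hc1 (by linarith) (s := 1.4 * σ) (by linarith) ?_ hw
    rw [← hK1]
    have h1 : p n * ε n ≤ 1 / 10 / (|K1| + 1) := by
      refine le_trans ?_ b1
      rw [pow_one]; gcongr
    rw [le_div_iff₀ (by positivity)] at h1
    have h2 : p n * ε n * K1 ≤ p n * ε n * (|K1| + 1) := by
      gcongr
      linarith [le_abs_self K1]
    linarith
  rw [pow_zero, one_mul] at b0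
  have hMA := hL'.M_le hvz (he.trans b0)
  have hfm := hL'.far_mass hvz (he.trans b0) aX ad (he.trans a2)
  have hM0 := hL'.M0
  have hu : ∀ x, 1 / p n ≤ ‖x - xp n‖ → u n x ≤ κ := by
    intro x hx
    have h1 := hL'.u_far hT0.le a3 hfm hx
    have h2 : M n ^ p n * Real.exp (-(p n * T)) ^ 2 ≤ Real.exp (-(p n * T)) := by
      have h3 : M n ^ p n ≤ Real.exp (p n * T) := by
        rw [mul_comm, Real.exp_mul, hT, Real.exp_log (by positivity)]
        exact Real.rpow_le_rpow hM0.le hMA hp0.le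
      calc _ ≤ Real.exp (p n * T) * Real.exp (-(p n * T)) ^ 2 := by gcongr
        _ = _ := by rw [sq, ← mul_assoc, ← Real.exp_add]; simp
    linarith
  have hR : p n ^ 10 ≤ 1 / (p n * ε n) := by
    rw [le_div_iff₀ (by positivity)]
    calc p n ^ 10 * (p n * ε n) = p n ^ 11 * ε n := by ring
      _ ≤ p n ^ 11 * Real.exp (-((p n - 1) / 5)) := by gcongr
      _ ≤ 1 := b11
  have hps : 1 / p n ≤ σ / 10 := by
    rw [div_le_iff₀ hσ] at aσ
    rw [div_le_iff₀ hp0]; linarith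
  have hpϱ : 1 / p n ≤ ϱ := by
    rw [div_le_iff₀ hϱ0] at aϱ
    rw [div_le_iff₀ hp0]; linarith
  have he1 : ε n ≤ 1 := he.trans (Real.exp_le_one_iff.2 (by linarith))
  have hκM : κ * M n ^ 2 ≤ 1 / 2 := by
    calc κ * M n ^ 2 ≤ κ * A ^ 2 := by gcongr
      _ = 1 / 2 := by rw [hκ]; field_simp
  obtain ⟨hPk, h6⟩ := hL'.pk hc2 hvz hps hR hB (le_max_right _ _) hκ0.le hκM hu hL0 he1 hL a4
  obtain ⟨c1, c2, c3, c4⟩ := hcore _ _ _ _ _ _ hPk aP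
  exact hL'.three hc2 hR h6 c1 c2 c3 c4 hϱ hpϱ

end

noncomputable section

/-- the standard isometry of the complex plane with the Euclidean plane -/
def JJ : ℂ ≃ₗᵢ[ℝ] E2 := Complex.orthonormalBasisOneI.repr

lemma JJ_one : JJ 1 = EuclideanSpace.single 0 1 := by
  ext i; fin_cases i <;> simp [JJ]

lemma JJ_I : JJ Complex.I = EuclideanSpace.single 1 1 := by
  ext i; fin_cases i <;> simp [JJ]

def JLc : ℂ →L[ℝ] E2 := (JJ.toContinuousLinearEquiv : ℂ →L[ℝ] E2)
lemma JLc_apply (z : ℂ) : JLc z = JJ z := rfl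

lemma JJ_hfd (z : ℂ) : HasFDerivAt (fun w => JJ w) JLc z := JLc.hasFDerivAt

lemma JJ_mp : MeasurePreserving (fun z => JJ z) volume volume := JJ.measurePreserving
lemma JJ_me : MeasurableEmbedding (fun z => JJ z) := JJ.toHomeomorph.measurableEmbedding

lemma JJ_ball (r : ℝ) : (fun z => JJ z) ⁻¹' (ball (0:E2) r) = ball (0:ℂ) r := by
  ext z; simp

lemma JJ_set (r : ℝ) (F : E2 → ℝ) : ∫ z in ball (0:E2) r, F z = ∫ z in ball (0:ℂ) r, F (JJ z) := by
  rw [← JJ_mp.setIntegral_preimage_emb JJ_me, JJ_ball]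

/-- extension by zero -/
def ext0 (Ω : Set E2) (u : E2 → ℝ) (z : ℂ) : ℝ := Ω.indicator u (JJ z)

lemma lap_conv {u : E2 → ℝ} {x : ℂ} (h : ContDiffAt ℝ 2 u (JJ x)) :
    4 * db (dz (fun y => (u (JJ y) : ℂ))) x = (lap u (JJ x) : ℂ) := by
  set a : E2 → ℝ := fun y => fderiv ℝ u y (EuclideanSpace.single 0 1) with ha
  set b : E2 → ℝ := fun y => fderiv ℝ u y (EuclideanSpace.single 1 1) with hb
  have hd1 : DifferentiableAt ℝ (fderiv ℝ u) (JJ x) := (h.fderiv_right (m := 1) (by norm_num)).differentiableAt (by norm_num)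
  have had : DifferentiableAt ℝ a (JJ x) := hd1.clm_apply (differentiableAt_const _)
  have hbd : DifferentiableAt ℝ b (JJ x) := hd1.clm_apply (differentiableAt_const _)
  have hJc : Continuous (fun z : ℂ => JJ z) := JJ.continuous
  have ev : dz (fun y => (u (JJ y) : ℂ)) =ᶠ[𝓝 x] fun y => ((a (JJ y) : ℂ) - Complex.I * (b (JJ y) : ℂ)) / 2 := by
    have h1 : ∀ᶠ y in 𝓝 (JJ x), ContDiffAt ℝ 2 u y := h.eventually (by simp)
    filter_upwards [hJc.continuousAt.eventually h1] with y hy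
    have h2 : HasFDerivAt (fun y => (u (JJ y) : ℂ)) (Complex.ofRealCLM.comp ((fderiv ℝ u (JJ y)).comp JLc)) y :=
      Complex.ofRealCLM.hasFDerivAt.comp y ((hy.differentiableAt (by norm_num)).hasFDerivAt.comp y (JJ_hfd y))
    unfold dz
    rw [h2.fderiv]
    simp [JLc_apply, JJ_one, JJ_I, ha, hb]
  have h3 : HasFDerivAt (fun y => ((a (JJ y) : ℂ) - Complex.I * (b (JJ y) : ℂ)) / 2)
      ((2:ℂ)⁻¹ • (Complex.ofRealCLM.comp ((fderiv ℝ a (JJ x)).comp JLc) - Complex.I • Complex.ofRealCLM.comp ((fderiv ℝ b (JJ x)).comp JLc))) x := by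
    have e1 : HasFDerivAt (fun y => (a (JJ y) : ℂ)) (Complex.ofRealCLM.comp ((fderiv ℝ a (JJ x)).comp JLc)) x :=
      Complex.ofRealCLM.hasFDerivAt.comp x (had.hasFDerivAt.comp x (JJ_hfd x))
    have e2 : HasFDerivAt (fun y => (b (JJ y) : ℂ)) (Complex.ofRealCLM.comp ((fderiv ℝ b (JJ x)).comp JLc)) x :=
      Complex.ofRealCLM.hasFDerivAt.comp x (hbd.hasFDerivAt.comp x (JJ_hfd x))
    have e3 := (e1.sub (e2.const_mul Complex.I)).const_mul (2:ℂ)⁻¹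
    refine e3.congr_of_eventuallyEq (Eventually.of_forall fun y => ?_)
    simp only [Pi.sub_apply]
    ring
  have hsym : fderiv ℝ b (JJ x) (EuclideanSpace.single 0 1) = fderiv ℝ a (JJ x) (EuclideanSpace.single 1 1) := by
    have h4 := (h.isSymmSndFDerivAt (by simp)) (EuclideanSpace.single 0 1) (EuclideanSpace.single 1 1)
    have ea : fderiv ℝ a (JJ x) (EuclideanSpace.single 1 1) = fderiv ℝ (fderiv ℝ u) (JJ x) (EuclideanSpace.single 1 1) (EuclideanSpace.single 0 1) := by
      rw [ha, fderiv_clm_apply hd1 (differentiableAt_const _)]; simp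
    have eb : fderiv ℝ b (JJ x) (EuclideanSpace.single 0 1) = fderiv ℝ (fderiv ℝ u) (JJ x) (EuclideanSpace.single 0 1) (EuclideanSpace.single 1 1) := by
      rw [hb, fderiv_clm_apply hd1 (differentiableAt_const _)]; simp
    rw [ea, eb, h4]
  unfold db
  rw [(h3.congr_of_eventuallyEq ev).fderiv]
  unfold lap
  rw [Fin.sum_univ_two]
  simp only [smul_apply, sub_apply, ContinuousLinearMap.comp_apply, JLc_apply, JJ_one, JJ_I, Complex.ofRealCLM_apply, hsym, smul_eq_mul]
  rw [← ha, ← hb]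
  push_cast
  linear_combination (-(fderiv ℝ b (JJ x) (EuclideanSpace.single 1 1) : ℂ)) * Complex.I_sq

lemma sl_of {Ω : Set E2} {d p : ℝ} {u : E2 → ℝ} (hΩ : IsOpen Ω) (hd : Ω ⊆ ball 0 (d / 2)) (hd1 : 1 ≤ d) (hp : 20 ≤ p)
    (h : IsSolution Ω p u) : Sl ((fun z => JJ z) ⁻¹' Ω) d p (ext0 Ω u) := by
  obtain ⟨h1, h2, h3, h4⟩ := h
  have hJc : Continuous (fun z : ℂ => JJ z) := JJ.continuous
  have hopen := hΩ.preimage hJc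
  have heq : ∀ z ∈ (fun z => JJ z) ⁻¹' Ω, ext0 Ω u z = u (JJ z) := fun z hz => Set.indicator_of_mem (show JJ z ∈ Ω from hz) u
  refine ⟨hopen, ?_, hd1, hp, ?_, ?_, ?_, ?_⟩
  · intro z hz
    have := hd hz
    simpa using this
  · have : ContDiffOn ℝ 2 (fun z => u (JJ z)) ((fun z => JJ z) ⁻¹' Ω) :=
      h1.comp (JLc.contDiff.contDiffOn) fun z hz => hz
    exact this.congr heq
  · exact (continuous_indicator h4 h2).comp hJc
  · intro z hz
    exact Set.indicator_of_notMem (show JJ z ∉ Ω from hz) u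
  · intro z hz
    have hz' : JJ z ∈ Ω := hz
    have e : (fun y => (ext0 Ω u y : ℂ)) =ᶠ[𝓝 z] fun y => (u (JJ y) : ℂ) := by
      filter_upwards [hopen.mem_nhds hz] with y hy
      rw [heq y hy]
    have e2 : dz (fun y => (ext0 Ω u y : ℂ)) =ᶠ[𝓝 z] dz (fun y => (u (JJ y) : ℂ)) := by
      filter_upwards [e.eventuallyEq_nhds] with y hy
      unfold dz; rw [hy.fderiv_eq]
    have e3 : db (dz (fun y => (ext0 Ω u y : ℂ))) z = db (dz (fun y => (u (JJ y) : ℂ))) z := by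
      unfold db; rw [e2.fderiv_eq]
    rw [e3, lap_conv (h1.contDiffAt (hΩ.mem_nhds hz')), heq z hz, ← h3 _ hz']
    push_cast; ring

lemma sol_neg {Ω : Set E2} {p : ℝ} {u : E2 → ℝ} (h : IsSolution Ω p u) : IsSolution Ω p (fun y => -u y) := by
  obtain ⟨h1, h2, h3, h4⟩ := h
  refine ⟨h1.neg, h2.neg, fun x hx => ?_, fun x hx => by simp [h4 x hx]⟩
  have : lap (fun y => -u y) x = -lap u x := by
    unfold lap
    simp only [fderiv_fun_neg, neg_apply, Finset.sum_neg_distrib]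
  rw [this, abs_neg]
  have := h3 x hx
  linarith

lemma ext0_neg (Ω : Set E2) (u : E2 → ℝ) (z : ℂ) : ext0 Ω (fun y => -u y) z = -ext0 Ω u z := by
  unfold ext0
  by_cases h : JJ z ∈ Ω
  · rw [Set.indicator_of_mem h, Set.indicator_of_mem h]
  · rw [Set.indicator_of_notMem h, Set.indicator_of_notMem h, neg_zero]

lemma Sl.fpi1 {Ω : Set ℂ} {d p : ℝ} {u : ℂ → ℝ} (h : Sl Ω d p u) :
    Continuous (fun x => fp u x ^ (p + 1)) ∧ HasCompactSupport (fun x => fp u x ^ (p + 1)) := by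
  have hp := h.p0
  refine ⟨h.fpc.rpow_const (fun _ => Or.inr (by positivity)), h.out_cs fun x hx => ?_⟩
  rw [h.fp_out hx, Real.zero_rpow (by positivity)]

lemma Xpos {Ω : Set E2} {d p : ℝ} {u : E2 → ℝ} (h : Sl ((fun z => JJ z) ⁻¹' Ω) d p (ext0 Ω u)) (hn : ∃ x ∈ Ω, 0 < u x) :
    0 < ∫ x, fp (ext0 Ω u) x ^ (p + 1) := by
  obtain ⟨x, hx, hux⟩ := hn
  refine h.fpi1.1.integral_pos_of_hasCompactSupport_nonneg_nonzero h.fpi1.2 (fun z => Real.rpow_nonneg (Sl.fp0 _ _) _) (x := JJ.symm x) ?_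
  have : fp (ext0 Ω u) (JJ.symm x) = u x := by
    unfold fp ext0
    rw [JJ.apply_symm_apply, Set.indicator_of_mem hx, max_eq_left hux.le]
  rw [this]
  positivity

lemma energy_split {Ω : Set E2} {d p : ℝ} {u : E2 → ℝ} (hΩ : IsOpen Ω) (h : Sl ((fun z => JJ z) ⁻¹' Ω) d p (ext0 Ω u))
    (h' : Sl ((fun z => JJ z) ⁻¹' Ω) d p (ext0 Ω (fun y => -u y))) :
    ∫ x in Ω, |u x| ^ (p + 1) = (∫ x, fp (ext0 Ω u) x ^ (p + 1)) + ∫ x, fp (ext0 Ω (fun y => -u y)) x ^ (p + 1) := by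
  have hp := h.p0
  have i1 : Integrable (fun x => fp (ext0 Ω u) x ^ (p + 1)) := h.fpi1.1.integrable_of_hasCompactSupport h.fpi1.2
  have i2 : Integrable (fun x => fp (ext0 Ω (fun y => -u y)) x ^ (p + 1)) := h'.fpi1.1.integrable_of_hasCompactSupport h'.fpi1.2
  rw [← integral_add i1 i2, ← integral_indicator hΩ.measurableSet, ← JJ_mp.integral_comp JJ_me]
  congr 1
  ext z
  have hz0 : (0:ℝ) ^ (p + 1) = 0 := Real.zero_rpow (by positivity)
  unfold fp
  rw [ext0_neg]
  unfold ext0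
  by_cases hz : JJ z ∈ Ω
  · rw [Set.indicator_of_mem hz, Set.indicator_of_mem hz]
    rcases le_total 0 (u (JJ z)) with h0 | h0
    · rw [max_eq_left h0, max_eq_right (by linarith), abs_of_nonneg h0, hz0, add_zero]
    · rw [max_eq_right h0, max_eq_left (by linarith), abs_of_nonpos h0, hz0, zero_add]
  · rw [Set.indicator_of_notMem hz, Set.indicator_of_notMem hz]
    simp [hz0]

lemma ball_sub_dom {Ω : Set E2} (hΩ : IsOpen Ω) {u : E2 → ℝ} (hu : ∀ x ∈ frontier Ω, u x = 0) {x : E2} {r : ℝ} (hr : 0 < r) (hx : x ∈ Ω)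
    (h : ∀ y ∈ ball x r, u y ≠ 0) : ball x r ⊆ Ω := by
  refine IsPreconnected.subset_left_of_subset_union (v := (closure Ω)ᶜ) hΩ isClosed_closure.isOpen_compl ?_ ?_ ⟨x, mem_ball_self hr, hx⟩ (convex_ball x r).isPreconnected
  · rw [Set.disjoint_compl_right_iff_subset]; exact subset_closure
  · intro y hy
    by_cases hyc : y ∈ closure Ω
    · left
      by_contra hn
      exact h y hy (hu y (by rw [hΩ.frontier_eq]; exact ⟨hyc, hn⟩))
    · right; exact hyc

/-- one concentration point -/
lemma one_point {Ω : Set E2} {d : ℝ} {p ε : ℕ → ℝ} {u v : ℕ → E2 → ℝ} {xl : ℕ → E2} {x : E2} {σ ϱ : ℝ} (hd : 1 ≤ d) (hp : Tendsto p atTop atTop)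
    (hS : ∀ᶠ n in atTop, Sl ((fun z => JJ z) ⁻¹' Ω) d (p n) (ext0 Ω (u n)))
    (hX : ∀ᶠ n in atTop, 0 < ∫ x, fp (ext0 Ω (u n)) x ^ (p n + 1))
    (hE : Tendsto (fun n => p n * ∫ x, fp (ext0 Ω (u n)) x ^ (p n + 1)) atTop (𝓝 (8 * π * Real.exp 1)))
    (hσ : 0 < σ) (hb : ball x (2 * σ) ⊆ Ω) (hpos : ∀ᶠ n in atTop, ∀ y ∈ ball x (2 * σ), 0 < u n y)
    (hxp : Tendsto xl atTop (𝓝 x)) (hM : ∀ n, xl n ∈ Ω ∧ 0 < u n (xl n) ∧ ∀ y ∈ closure Ω, u n y ≤ u n (xl n))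
    (hε : ∀ n, 0 < ε n ∧ ε n ^ 2 * (p n * u n (xl n) ^ (p n - 1)) = 1)
    (hv : ∀ n z, v n z = (p n / u n (xl n)) * (u n (xl n + ε n • z) - u n (xl n))) (hϱ0 : 0 < ϱ) (hϱ : ϱ ≤ σ / 2) :
    ∃ C : ℝ, 1 ≤ C ∧ ∀ᶠ n in atTop,
    |(∫ z in ball (0:E2) (ϱ / ε n), |1 + v n z / p n| ^ p n) - (8 * π - 24 * π / p n)| ≤ C / p n ^ 2 ∧
    |(∫ z in ball (0:E2) (ϱ / ε n), Real.log ‖z‖ * |1 + v n z / p n| ^ p n) - 12 * π * Real.log 2| ≤ C / p n ∧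
    |(∫ z in ball (0:E2) (ϱ / ε n), |1 + v n z / p n| ^ (p n + 1)) - (8 * π - 40 * π / p n)| ≤ C / p n ^ 2 := by
  have hmem : ∀ z : ℂ, z ∈ ball (JJ.symm x) (2 * σ) ↔ JJ z ∈ ball x (2 * σ) := by
    intro z
    rw [mem_ball, mem_ball]
    nth_rw 2 [← JJ.apply_symm_apply x]
    rw [JJ.dist_map]
  have hin : ∀ n, ∀ y ∈ Ω, ext0 Ω (u n) (JJ.symm y) = u n y := by
    intro n y hy
    unfold ext0
    rw [JJ.apply_symm_apply, Set.indicator_of_mem hy]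
  have hin' : ∀ n (z : ℂ), JJ z ∈ Ω → ext0 Ω (u n) z = u n (JJ z) := fun n z hz => Set.indicator_of_mem hz _
  obtain ⟨C, hC, H⟩ := seq_concl (M := fun n => u n (xl n)) (ε := ε) (xp := fun n => JJ.symm (xl n)) (x0 := JJ.symm x) (ϱ := ϱ) hd hp hS hX hE hσ
    (fun z hz => hb ((hmem z).1 hz))
    (hpos.mono fun n hn y hy => by
      have hy' := (hmem y).1 hy
      rw [hin' n y (hb hy')]
      exact hn _ hy')
    ((JJ.symm.continuous.tendsto x).comp hxp)
    (Eventually.of_forall fun n => ⟨hin n _ (hM n).1, (hM n).2.1, fun y => by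
      by_cases hy : JJ y ∈ Ω
      · rw [hin' n y hy]; exact (hM n).2.2 _ (subset_closure hy)
      · unfold ext0; rw [Set.indicator_of_notMem hy]; exact (hM n).2.1.le⟩)
    (Eventually.of_forall hε) hϱ0 hϱ
  refine ⟨C, hC, ?_⟩
  filter_upwards [H, hxp.eventually (ball_mem_nhds x hσ)] with n hn hxn
  have hvv : ∀ z ∈ ball (0:ℂ) (ϱ / ε n), v n (JJ z) = vv (p n) (ext0 Ω (u n)) (JJ.symm (xl n)) (u n (xl n)) (ε n) z := by
    intro z hz
    have he := (hε n).1
    have e1 : JJ (JJ.symm (xl n) + (ε n : ℂ) * z) = xl n + ε n • JJ z := by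
      rw [map_add, JJ.apply_symm_apply, ← Complex.real_smul, map_smul]
    have e2 : xl n + ε n • JJ z ∈ Ω := by
      apply hb
      rw [mem_ball_zero_iff, lt_div_iff₀ he] at hz
      rw [mem_ball]
      have hxn' : dist (xl n) x < σ := hxn
      have := dist_triangle (xl n + ε n • JJ z) (xl n) x
      have e3 : dist (xl n + ε n • JJ z) (xl n) = ‖z‖ * ε n := by
        rw [dist_eq_norm, add_sub_cancel_left, norm_smul, JJ.norm_map, Real.norm_of_nonneg he.le, mul_comm]
      linarith
    unfold vv
    rw [hv, hin' n _ (by rw [e1]; exact e2), e1]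
  rw [JJ_set, JJ_set, JJ_set]
  have i1 : (∫ z in ball (0:ℂ) (ϱ / ε n), |1 + v n (JJ z) / p n| ^ p n) = ∫ z in ball (0:ℂ) (ϱ / ε n), |1 + vv (p n) (ext0 Ω (u n)) (JJ.symm (xl n)) (u n (xl n)) (ε n) z / p n| ^ p n :=
    setIntegral_congr_fun measurableSet_ball fun z hz => by
      simp only [hvv z hz]
  have i2 : (∫ z in ball (0:ℂ) (ϱ / ε n), Real.log ‖JJ z‖ * |1 + v n (JJ z) / p n| ^ p n) = ∫ z in ball (0:ℂ) (ϱ / ε n), Real.log ‖z‖ * |1 + vv (p n) (ext0 Ω (u n)) (JJ.symm (xl n)) (u n (xl n)) (ε n) z / p n| ^ p n :=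
    setIntegral_congr_fun measurableSet_ball fun z hz => by
      simp only [hvv z hz, JJ.norm_map]
  have i3 : (∫ z in ball (0:ℂ) (ϱ / ε n), |1 + v n (JJ z) / p n| ^ (p n + 1)) = ∫ z in ball (0:ℂ) (ϱ / ε n), |1 + vv (p n) (ext0 Ω (u n)) (JJ.symm (xl n)) (u n (xl n)) (ε n) z / p n| ^ (p n + 1) :=
    setIntegral_congr_fun measurableSet_ball fun z hz => by
      simp only [hvv z hz]
  rw [i1, i2, i3]
  exact hn

end

/-- Proposition 3.10: sharp expansions of the integrals of
`|1 + v_{i,p}/p|^p`, `log|z| |1 + v_{i,p}/p|^p` and `|1 + v_{i,p}/p|^{p+1}`. -/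
theorem sharp_integral_expansions
    (Ω : Set E2) (hΩo : IsOpen Ω) (hΩb : IsBounded Ω) (hΩne : Ω.Nonempty)
    (p : ℕ → ℝ) (hp1 : ∀ n, 1 < p n) (hptop : Tendsto p atTop atTop)
    (u : ℕ → E2 → ℝ)
    (hsol : ∀ n, IsSolution Ω (p n) (u n))
    (hnod : ∀ n, IsNodal Ω (u n))
    (hlow : Tendsto (fun n => p n * ∫ x in Ω, |u n x| ^ (p n + 1)) atTop
      (𝓝 (16 * π * Real.exp 1)))
    (xl : Fin 2 → ℕ → E2)
    (hmax : ∀ n, xl 0 n ∈ Ω ∧ ∀ y ∈ closure Ω, u n y ≤ u n (xl 0 n))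
    (hmin : ∀ n, xl 1 n ∈ Ω ∧ ∀ y ∈ closure Ω, u n (xl 1 n) ≤ u n y)
    (x : Fin 2 → E2) (hx : ∀ i, x i ∈ Ω) (hxne : x 0 ≠ x 1)
    (hxconv : ∀ i, Tendsto (fun n => xl i n) atTop (𝓝 (x i)))
    (ε : Fin 2 → ℕ → ℝ) (hεpos : ∀ i n, 0 < ε i n)
    (hεdef : ∀ i n, (ε i n) ^ 2 * (p n * |u n (xl i n)| ^ (p n - 1)) = 1)
    (v : Fin 2 → ℕ → E2 → ℝ)
    (hv : ∀ i n z, v i n z =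
      (p n / u n (xl i n)) * (u n (xl i n + ε i n • z) - u n (xl i n)))
    (r0 : ℝ) (hr0 : 0 < r0)
    (hdisj : Disjoint (ball (x 0) (2 * r0)) (ball (x 1) (2 * r0)))
    (ϱ0 : ℝ) (hϱ0 : ϱ0 ∈ Set.Ioo (0:ℝ) (r0 / 2)) (N0 : ℕ)
    (hsign : ∀ n ≥ N0,
      (∀ y ∈ ball (x 0) (2 * ϱ0), 1 / p n ≤ u n y) ∧
      (∀ y ∈ ball (x 1) (2 * ϱ0), u n y ≤ -(1 / p n)))
    (ϱ : ℝ) (hϱ : 0 < ϱ ∧ ϱ ≤ ϱ0 / 2) :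
    ∀ δ ∈ Set.Ioo (0:ℝ) 1, ∃ C > (0:ℝ), ∃ N : ℕ, ∀ n ≥ N, ∀ i : Fin 2,
      |(∫ z in ball (0:E2) (ϱ / ε i n), |1 + v i n z / p n| ^ (p n))
          - (8 * π - 24 * π / p n)| ≤ C / (p n) ^ ((2:ℝ) - δ) ∧
      |(∫ z in ball (0:E2) (ϱ / ε i n), Real.log ‖z‖ * |1 + v i n z / p n| ^ (p n))
          - 12 * π * Real.log 2| ≤ C / p n ∧
      |(∫ z in ball (0:E2) (ϱ / ε i n), |1 + v i n z / p n| ^ (p n + 1))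
          - (8 * π - 40 * π / p n)| ≤ C / (p n) ^ ((2:ℝ) - δ) := by
  intro δ hδ
  obtain ⟨hϱ00, -⟩ := hϱ0
  -- a common ball
  obtain ⟨r, hr⟩ := hΩb.subset_ball (0:E2)
  set d : ℝ := max 1 (2 * r) with hdd
  have hd : 1 ≤ d := le_max_left _ _
  have hΩd : Ω ⊆ ball 0 (d / 2) := hr.trans (ball_subset_ball (by have := le_max_right 1 (2 * r); linarith))
  have hp20 := hptop.eventually_ge_atTop 20
  have hS0 : ∀ᶠ n in atTop, Sl ((fun z => JJ z) ⁻¹' Ω) d (p n) (ext0 Ω (u n)) :=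
    hp20.mono fun n hn => sl_of hΩo hΩd hd hn (hsol n)
  have hS1 : ∀ᶠ n in atTop, Sl ((fun z => JJ z) ⁻¹' Ω) d (p n) (ext0 Ω (fun y => -u n y)) :=
    hp20.mono fun n hn => sl_of hΩo hΩd hd hn (sol_neg (hsol n))
  have hX0 : ∀ᶠ n in atTop, 0 < ∫ x, fp (ext0 Ω (u n)) x ^ (p n + 1) := hS0.mono fun n hn => Xpos hn (hnod n).1
  have hX1 : ∀ᶠ n in atTop, 0 < ∫ x, fp (ext0 Ω (fun y => -u n y)) x ^ (p n + 1) := hS1.mono fun n hn => Xpos hn (by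
    obtain ⟨y, hy, hy0⟩ := (hnod n).2
    exact ⟨y, hy, by linarith⟩)
  obtain ⟨l0, hl0, hl0'⟩ := seqlow hd hptop hS0 hX0
  obtain ⟨l1, hl1, hl1'⟩ := seqlow hd hptop hS1 hX1
  have hsplit : ∀ᶠ n in atTop, p n * ∫ x in Ω, |u n x| ^ (p n + 1) =
      p n * (∫ x, fp (ext0 Ω (u n)) x ^ (p n + 1)) + p n * ∫ x, fp (ext0 Ω (fun y => -u n y)) x ^ (p n + 1) := by
    filter_upwards [hS0, hS1] with n h0 h1
    rw [energy_split hΩo h0 h1, mul_add]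
  have hE0 : Tendsto (fun n => p n * ∫ x, fp (ext0 Ω (u n)) x ^ (p n + 1)) atTop (𝓝 (8 * π * Real.exp 1)) := by
    have hup := hlow.sub hl1
    rw [show 16 * π * Real.exp 1 - 8 * π * Real.exp 1 = 8 * π * Real.exp 1 by ring] at hup
    refine tendsto_of_tendsto_of_tendsto_of_le_of_le' hl0 hup hl0' ?_
    filter_upwards [hsplit, hl1'] with n h1 h2
    linarith
  have hE1 : Tendsto (fun n => p n * ∫ x, fp (ext0 Ω (fun y => -u n y)) x ^ (p n + 1)) atTop (𝓝 (8 * π * Real.exp 1)) := by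
    have hup := hlow.sub hl0
    rw [show 16 * π * Real.exp 1 - 8 * π * Real.exp 1 = 8 * π * Real.exp 1 by ring] at hup
    refine tendsto_of_tendsto_of_tendsto_of_le_of_le' hl1 hup hl1' ?_
    filter_upwards [hsplit, hl0'] with n h1 h2
    linarith
  have hip : ∀ n, 0 < 1 / p n := fun n => by
    have := hp1 n
    positivity
  have hb0 : ball (x 0) (2 * ϱ0) ⊆ Ω := ball_sub_dom hΩo (hsol N0).2.2.2 (by linarith) (hx 0) fun y hy => by
    have h1 := (hsign N0 le_rfl).1 y hy
    have h2 := hip N0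
    exact (by linarith : 0 < u N0 y).ne'
  have hb1 : ball (x 1) (2 * ϱ0) ⊆ Ω := ball_sub_dom hΩo (hsol N0).2.2.2 (by linarith) (hx 1) fun y hy => by
    have h1 := (hsign N0 le_rfl).2 y hy
    have h2 := hip N0
    exact (by linarith : u N0 y < 0).ne
  have hm0 : ∀ n, 0 < u n (xl 0 n) := fun n => by
    obtain ⟨y, hy, hy0⟩ := (hnod n).1
    have := (hmax n).2 y (subset_closure hy)
    linarith
  have hm1 : ∀ n, 0 < -u n (xl 1 n) := fun n => by
    obtain ⟨y, hy, hy0⟩ := (hnod n).2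
    have := (hmin n).2 y (subset_closure hy)
    linarith
  obtain ⟨C0, hC0, H0⟩ := one_point (v := v 0) (xl := xl 0) (x := x 0) (ε := ε 0) (ϱ := ϱ) hd hptop hS0 hX0 hE0 hϱ00 hb0
    (by
      filter_upwards [eventually_ge_atTop N0] with n hn y hy
      have := (hsign n hn).1 y hy
      linarith [hip n])
    (hxconv 0) (fun n => ⟨(hmax n).1, hm0 n, (hmax n).2⟩)
    (fun n => ⟨hεpos 0 n, by have := hεdef 0 n; rwa [abs_of_pos (hm0 n)] at this⟩) (hv 0) hϱ.1 hϱ.2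
  obtain ⟨C1, hC1, H1⟩ := one_point (v := v 1) (xl := xl 1) (x := x 1) (ε := ε 1) (ϱ := ϱ) (u := fun n y => -u n y) hd hptop hS1 hX1 hE1 hϱ00 hb1
    (by
      filter_upwards [eventually_ge_atTop N0] with n hn y hy
      have := (hsign n hn).2 y hy
      linarith [hip n])
    (hxconv 1) (fun n => ⟨(hmin n).1, hm1 n, fun y hy => by have := (hmin n).2 y hy; linarith⟩)
    (fun n => ⟨hεpos 1 n, by have := hεdef 1 n; rwa [abs_of_neg (by linarith [hm1 n])] at this⟩)
    (fun n z => by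
      rw [hv 1 n z, div_neg]; ring) hϱ.1 hϱ.2
  obtain ⟨N, hN⟩ := eventually_atTop.1 (H0.and H1)
  refine ⟨C0 + C1, by linarith, N, fun n hn i => ?_⟩
  have hpn := hp1 n
  have hp0 : 0 < p n := by linarith
  have hpow : p n ^ ((2:ℝ) - δ) ≤ p n ^ 2 := by
    rw [← Real.rpow_natCast]
    exact Real.rpow_le_rpow_of_exponent_le hpn.le (by push_cast; linarith [hδ.1])
  have hpw0 : 0 < p n ^ ((2:ℝ) - δ) := Real.rpow_pos_of_pos hp0 _
  have k2 : ∀ {a c : ℝ}, 0 ≤ c → c ≤ C0 + C1 → a ≤ c / p n ^ 2 → a ≤ (C0 + C1) / p n ^ ((2:ℝ) - δ) := by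
    intro a c hc hcc ha
    refine ha.trans ?_
    gcongr
  have k1 : ∀ {a c : ℝ}, c ≤ C0 + C1 → a ≤ c / p n → a ≤ (C0 + C1) / p n := by
    intro a c hcc ha
    refine ha.trans ?_
    gcongr
  obtain ⟨⟨a1, a2, a3⟩, ⟨b1, b2, b3⟩⟩ := hN n hn
  fin_cases i
  · exact ⟨k2 (by linarith) (by linarith) a1, k1 (by linarith) a2, k2 (by linarith) (by linarith) a3⟩
  · exact ⟨k2 (by linarith) (by linarith) b1, k1 (by linarith) b2, k2 (by linarith) (by linarith) b3⟩

end
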